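/- Let n ≥ 3, m ≥ 2, ζ > 2 and τ ∈ (0, π/4); set a = cot τ (so a > 1) and b = √(a² − 1). Let f : ℝⁿ → ℝ be continuous, C^m outside some compact set, with finite limit f(∞) = lim_{|x|→∞} f(x) and limsup_{|x|→∞} |x|^{ζ+k} |D^k(f(x) − f(∞))| < ∞ for every k = 0,1,…,m. Let u ∈ C²(ℝⁿ) satisfy (√(a²+1)/(2b)) Σᵢ ln((λᵢ(D²u(x))+a−b)/(λᵢ(D²u(x))+a+b)) = f(x) for all x ∈ ℝⁿ, and suppose u(x) ≤ C(1+|x|²) for all x ∈ ℝⁿ for some constant C, and D²u(x) − (−a+b)I is positive definite for every x. Then there exist c ∈ ℝ, β ∈ ℝⁿ and a symmetric n×n matrix A with A − (−a+b)I positive definite and (√(a²+1)/(2b)) Σᵢ ln((λᵢ(A)+a−b)/(λᵢ(A)+a+b)) = f(∞), such that u(x) − (½ xᵀA x + β·x + c) = O_{m+1}(|x|^{2−min{n,ζ}}) as |x| → ∞ if ζ ≠ n, and = O_{m+1}(|x|^{2−n} ln|x|) if ζ = n. -/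

import Mathlib

open Filter Real

/-- The Hessian matrix `(∂ᵢ∂ⱼ u(x))` of a function on Euclidean space. -/
noncomputable def hess {n : ℕ} (u : EuclideanSpace ℝ (Fin n) → ℝ)
    (x : EuclideanSpace ℝ (Fin n)) : Matrix (Fin n) (Fin n) ℝ :=
  Matrix.of fun i j =>
    iteratedFDeriv ℝ 2 u x ![EuclideanSpace.single i 1, EuclideanSpace.single j 1]

section
open MeasureTheory
open scoped RealInnerProductSpace Topology ENNReal
theorem aux_a_gt_one {τ a : ℝ} (h0 : 0 < τ) (h1 : τ < Real.pi / 4)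
    (ha : a = Real.cos τ / Real.sin τ) : 1 < a := by
  have hs : 0 < Real.sin τ := Real.sin_pos_of_pos_of_lt_pi h0 (by linarith [Real.pi_pos])
  have h2 : Real.sin τ < Real.cos τ := by
    rw [← Real.sin_pi_div_two_sub]
    exact Real.sin_lt_sin_of_lt_of_le_pi_div_two (by linarith [Real.pi_pos]) (by linarith)
      (by linarith)
  rw [ha, lt_div_iff₀ hs]; linarith
theorem aux_b_pos {a b : ℝ} (ha : 1 < a) (hb : b = Real.sqrt (a ^ 2 - 1)) : 0 < b := by
  rw [hb]; apply Real.sqrt_pos.2; nlinarith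
theorem aux_b_lt {a b : ℝ} (ha : 1 < a) (hb : b = Real.sqrt (a ^ 2 - 1)) : b < a := by
  rw [hb]; apply (Real.sqrt_lt' (by linarith)).2; linarith
theorem aux_det_shift {n : ℕ} {A : Matrix (Fin n) (Fin n) ℝ} (hA : A.IsHermitian) (t : ℝ) :
    (A + t • (1 : Matrix (Fin n) (Fin n) ℝ)).det = ∏ i, (hA.eigenvalues i + t) := by
  have h := hA.charpoly_eq
  have h2 := congrArg (Polynomial.eval (-t)) h
  rw [Matrix.eval_charpoly, Polynomial.eval_prod] at h2
  have h3 : A + t • (1 : Matrix (Fin n) (Fin n) ℝ) = -(Matrix.scalar (Fin n) (-t) - A) := by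
    ext i j; by_cases hij : i = j <;> simp [Matrix.scalar, hij, add_comm]
  rw [h3, Matrix.det_neg, h2]
  simp only [Polynomial.eval_sub, Polynomial.eval_X, Polynomial.eval_C, Fintype.card_fin]
  have h4 : (-1 : ℝ) ^ n = ∏ _i : Fin n, (-1 : ℝ) := by simp
  rw [h4, ← Finset.prod_mul_distrib]
  refine Finset.prod_congr rfl fun i _ => ?_
  simp
theorem aux_eig_pos {n : ℕ} {A : Matrix (Fin n) (Fin n) ℝ} (hA : A.IsHermitian) {s : ℝ}
    (h : (A - s • (1 : Matrix (Fin n) (Fin n) ℝ)).PosDef) (i : Fin n) :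
    s < hA.eigenvalues i := by
  have hv := hA.mulVec_eigenvectorBasis i
  set v : Fin n → ℝ := ⇑(hA.eigenvectorBasis i) with hvd
  have hne : v ≠ 0 := by
    intro h0
    apply hA.eigenvectorBasis.orthonormal.ne_zero i
    ext j; exact congrFun h0 j
  have hp := h.dotProduct_mulVec_pos hne
  have hvv : 0 < v ⬝ᵥ v := by
    have := Matrix.dotProduct_star_self_pos_iff (v := v) |>.2 hne
    simpa using this
  rw [Matrix.sub_mulVec, hv, Matrix.smul_mulVec, Matrix.one_mulVec] at hp
  simp only [star_trivial, dotProduct_sub, dotProduct_smul, smul_eq_mul] at hp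
  nlinarith
theorem aux_logdet {n : ℕ} {A : Matrix (Fin n) (Fin n) ℝ} (hA : A.IsHermitian) {a b : ℝ}
    (hb : 0 < b) (h : (A - (-a + b) • (1 : Matrix (Fin n) (Fin n) ℝ)).PosDef) :
    ∑ i, Real.log ((hA.eigenvalues i + a - b) / (hA.eigenvalues i + a + b)) =
      Real.log (A + (a - b) • (1 : Matrix (Fin n) (Fin n) ℝ)).det
        - Real.log (A + (a + b) • (1 : Matrix (Fin n) (Fin n) ℝ)).det := by
  have hp := aux_eig_pos hA h
  rw [aux_det_shift hA, aux_det_shift hA,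
    Real.log_prod (fun i _ => by have := hp i; intro h0; linarith),
    Real.log_prod (fun i _ => by have := hp i; intro h0; linarith), ← Finset.sum_sub_distrib]
  refine Finset.sum_congr rfl fun i _ => ?_
  have := hp i
  rw [Real.log_div (by intro h0; linarith) (by intro h0; linarith)]
  congr 2 <;> ring
abbrev EV (n : ℕ) := EuclideanSpace ℝ (Fin n)
noncomputable abbrev ee {n : ℕ} (i : Fin n) : EV n := EuclideanSpace.single i 1
def pr {n : ℕ} (a B : Matrix (Fin n) (Fin n) ℝ) : ℝ := ∑ i, ∑ j, a i j * B i j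
def Ell {n : ℕ} (l L : ℝ) (a : Matrix (Fin n) (Fin n) ℝ) : Prop :=
  ∀ P : Matrix (Fin n) (Fin n) ℝ, P.PosSemidef → l * P.trace ≤ pr a P ∧ pr a P ≤ L * P.trace
def SupS {n : ℕ} (l L k : ℝ) (w : EV n → ℝ) (x : EV n) : Prop :=
  ∃ a b, Ell l L a ∧ ‖b‖ ≤ 1 ∧ pr a (hess w x) + fderiv ℝ w x b ≤ k
section
variable {n : ℕ}
theorem pr_add (a B C : Matrix (Fin n) (Fin n) ℝ) : pr a (B + C) = pr a B + pr a C := by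
  simp [pr, mul_add, Finset.sum_add_distrib]
theorem pr_sub (a B C : Matrix (Fin n) (Fin n) ℝ) : pr a (B - C) = pr a B - pr a C := by
  simp [pr, mul_sub, Finset.sum_sub_distrib]
theorem pr_smul (a B : Matrix (Fin n) (Fin n) ℝ) (c : ℝ) : pr a (c • B) = c * pr a B := by
  simp only [pr, Finset.mul_sum, Matrix.smul_apply, smul_eq_mul]
  exact Finset.sum_congr rfl fun i _ => Finset.sum_congr rfl fun j _ => by ring
theorem hess_apply (u : EV n → ℝ) (x : EV n) (i j : Fin n) :
    hess u x i j = fderiv ℝ (fderiv ℝ u) x (ee i) (ee j) := by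
  simp [hess, iteratedFDeriv_two_apply]
theorem sum_ee (ξ : EV n) : ξ = ∑ i, ξ i • ee i := by
  ext j; simp [ee, Pi.single_apply]
theorem bil_sum (B : EV n →L[ℝ] EV n →L[ℝ] ℝ) (ξ η : EV n) :
    B ξ η = ∑ i, ∑ j, ξ i * η j * B (ee i) (ee j) := by
  conv_lhs => rw [sum_ee ξ, sum_ee η]
  simp only [map_sum, map_smul, sum_apply, smul_apply,
    smul_eq_mul]
  rw [Finset.sum_comm]
  refine Finset.sum_congr rfl fun i _ => ?_
  rw [Finset.mul_sum]
  refine Finset.sum_congr rfl fun j _ => by ring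
theorem hess_quad (u : EV n → ℝ) (x ξ η : EV n) :
    fderiv ℝ (fderiv ℝ u) x ξ η = ∑ i, ∑ j, ξ i * η j * hess u x i j := by
  simp only [hess_apply]; exact bil_sum _ _ _
theorem d2_of_localMin {φ : EV n → ℝ} {x : EV n} (h : IsLocalMin φ x) (hc : ContDiffAt ℝ 2 φ x)
    (ξ : EV n) : 0 ≤ fderiv ℝ (fderiv ℝ φ) x ξ ξ := by
  by_contra hneg
  push Not at hneg
  set c : ℝ → EV n := fun t => x + t • ξ with hcd
  have hc0 : c 0 = x := by simp [c]
  have hcder : ∀ t, HasDerivAt c ξ t := fun t => by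
    simpa [c] using ((hasDerivAt_id t).smul_const ξ).const_add x
  have hct : ContinuousAt c 0 := (hcder 0).continuousAt
  have hev : ∀ᶠ y in 𝓝 x, DifferentiableAt ℝ φ y := by
    filter_upwards [hc.eventually (by simp)] with y hy using hy.differentiableAt (by simp)
  have hd : ∀ᶠ t in 𝓝 (0:ℝ), HasDerivAt (φ ∘ c) (fderiv ℝ φ (c t) ξ) t := by
    have := hct.tendsto; rw [hc0] at this
    filter_upwards [this.eventually hev] with t ht
    exact ht.hasFDerivAt.comp_hasDerivAt t (hcder t)
  have hd' : deriv (φ ∘ c) =ᶠ[𝓝 0] fun t => fderiv ℝ φ (c t) ξ := by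
    filter_upwards [hd] with t ht using ht.deriv
  have hdd : DifferentiableAt ℝ (fderiv ℝ φ) x :=
    (hc.fderiv_right (m := 1) (by norm_num)).differentiableAt (by simp)
  have h2 : HasDerivAt (fun t => fderiv ℝ φ (c t) ξ) (fderiv ℝ (fderiv ℝ φ) x ξ ξ) 0 := by
    have h3 : HasFDerivAt (fderiv ℝ φ) (fderiv ℝ (fderiv ℝ φ) x) (c 0) := by
      rw [hc0]; exact hdd.hasFDerivAt
    exact (h3.comp_hasDerivAt 0 (hcder 0)).clm_apply (hasDerivAt_const 0 ξ) |>.congr_deriv (by simp)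
  have hdd0 : deriv (deriv (φ ∘ c)) 0 = fderiv ℝ (fderiv ℝ φ) x ξ ξ := by
    rw [hd'.deriv_eq, h2.deriv]
  have hmin : IsLocalMin (φ ∘ c) 0 := by
    have := hct.tendsto; rw [hc0] at this
    filter_upwards [this.eventually h] with t ht
    simpa [hc0] using ht
  have hmax : IsLocalMax (φ ∘ c) 0 :=
    isLocalMax_of_deriv_deriv_neg (by rw [hdd0]; exact hneg) hmin.deriv_eq_zero
      (hd.self_of_nhds.continuousAt)
  have hconst : (φ ∘ c) =ᶠ[𝓝 0] fun _ => (φ ∘ c) 0 := by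
    filter_upwards [hmin, hmax] with t h1 h2 using le_antisymm h2 h1
  have : deriv (deriv (φ ∘ c)) 0 = 0 := by
    have h5 := hconst.deriv
    rw [h5.deriv_eq]; simp
  rw [hdd0] at this; linarith
theorem hess_symm {φ : EV n → ℝ} {x : EV n} (hc : ContDiffAt ℝ 2 φ x) (i j : Fin n) :
    hess φ x i j = hess φ x j i := by
  rw [hess_apply, hess_apply]
  exact (hc.isSymmSndFDerivAt (by simp)) _ _
theorem psd_of_quad {B : Matrix (Fin n) (Fin n) ℝ} (hs : ∀ i j, B i j = B j i)
    (h : ∀ ξ : EV n, 0 ≤ ∑ i, ∑ j, ξ i * ξ j * B i j) : B.PosSemidef := by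
  refine Matrix.PosSemidef.of_dotProduct_mulVec_nonneg ?_ fun v => ?_
  · ext i j; simp [hs i j]
  · have h1 := h (WithLp.toLp 2 v)
    suffices star v ⬝ᵥ B.mulVec v = ∑ i, ∑ j, v i * v j * B i j by rw [this]; exact h1
    simp only [dotProduct, Matrix.mulVec, Finset.mul_sum]
    exact Finset.sum_congr rfl fun i _ => Finset.sum_congr rfl fun j _ => by simp; ring
theorem hess_psd_of_localMin {φ : EV n → ℝ} {x : EV n} (h : IsLocalMin φ x)
    (hc : ContDiffAt ℝ 2 φ x) : (hess φ x).PosSemidef :=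
  psd_of_quad (hess_symm hc) fun ξ => by rw [← hess_quad]; exact d2_of_localMin h hc ξ
theorem fderiv2_lin {w ψ : EV n → ℝ} {x : EV n} (hw : ContDiffAt ℝ 2 w x)
    (hψ : ContDiffAt ℝ 2 ψ x) (c : ℝ) : fderiv ℝ (fderiv ℝ fun y => w y + c * ψ y) x =
      fderiv ℝ (fderiv ℝ w) x + c • fderiv ℝ (fderiv ℝ ψ) x := by
  have h1 : fderiv ℝ (fun y => w y + c * ψ y) =ᶠ[𝓝 x]
      fun y => fderiv ℝ w y + c • fderiv ℝ ψ y := by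
    filter_upwards [hw.eventually (by simp), hψ.eventually (by simp)] with y h1 h2
    have h1 := h1.differentiableAt (by simp)
    have h2 := h2.differentiableAt (by simp)
    rw [fderiv_fun_add h1 (h2.const_mul c), fderiv_const_mul h2]
  have h2 := (hw.fderiv_right (m := 1) (by norm_num)).differentiableAt (by simp)
  have h3 := (hψ.fderiv_right (m := 1) (by norm_num)).differentiableAt (by simp)
  rw [h1.fderiv_eq, fderiv_fun_add h2 (h3.fun_const_smul c), fderiv_fun_const_smul h3]
theorem hess_lin {w ψ : EV n → ℝ} {x : EV n} (hw : ContDiffAt ℝ 2 w x)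
    (hψ : ContDiffAt ℝ 2 ψ x) (c : ℝ) :
    hess (fun y => w y + c * ψ y) x = hess w x + c • hess ψ x := by
  ext i j; simp only [hess_apply, fderiv2_lin hw hψ c]; simp [hess_apply]
theorem touch {w ψ : EV n → ℝ} {x : EV n} (hw : ContDiffAt ℝ 2 w x) (hψ : ContDiffAt ℝ 2 ψ x)
    (hm : IsLocalMin (fun y => w y + (-1) * ψ y) x) :
    fderiv ℝ w x = fderiv ℝ ψ x ∧ ∀ {l L : ℝ} {a}, 0 ≤ l → Ell l L a →
      pr a (hess ψ x) ≤ pr a (hess w x) := by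
  constructor
  · have := hm.fderiv_eq_zero
    rw [fderiv_fun_add (hw.differentiableAt (by simp))
      ((hψ.differentiableAt (by simp)).const_mul _), fderiv_const_mul
      (hψ.differentiableAt (by simp))] at this
    simpa [add_neg_eq_zero] using this
  · intro l L a hl ha
    have hp := hess_psd_of_localMin hm (hw.add (contDiffAt_const.mul hψ))
    have h1 := (ha _ hp).1
    rw [hess_lin hw hψ, pr_add, pr_smul] at h1
    rw [hess_lin hw hψ] at hp
    have h2 := mul_nonneg hl hp.trace_nonneg
    linarith
end
section
variable {n : ℕ}
theorem rad_fderiv {F : ℝ → ℝ} {z x : EV n} (hF : DifferentiableAt ℝ F (‖x - z‖ ^ 2)) :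
    fderiv ℝ (fun y : EV n => F (‖y - z‖ ^ 2)) x = (2 * deriv F (‖x - z‖ ^ 2)) • innerSL ℝ (x - z) := by
  have h1 : HasFDerivAt (fun y : EV n => ‖y - z‖ ^ 2) (2 • innerSL ℝ (x - z)) x := by
    simpa using ((hasFDerivAt_id x).sub_const z).norm_sq
  refine (hF.hasDerivAt.comp_hasFDerivAt x h1).fderiv.trans ?_
  ext v; simp; ring
theorem rad_d2 {F : ℝ → ℝ} {z x : EV n} (hF : ContDiffAt ℝ 2 F (‖x - z‖ ^ 2)) (ξ η : EV n) :
    fderiv ℝ (fderiv ℝ (fun y : EV n => F (‖y - z‖ ^ 2))) x ξ η =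
      2 * deriv F (‖x - z‖ ^ 2) * ⟪ξ, η⟫ +
        4 * deriv (deriv F) (‖x - z‖ ^ 2) * (⟪x - z, ξ⟫ * ⟪x - z, η⟫) := by
  have hs : HasFDerivAt (fun y : EV n => ‖y - z‖ ^ 2) (2 • innerSL ℝ (x - z)) x := by
    simpa using ((hasFDerivAt_id x).sub_const z).norm_sq
  have h1 : fderiv ℝ (fun y : EV n => F (‖y - z‖ ^ 2)) =ᶠ[𝓝 x]
      fun y => (2 * deriv F (‖y - z‖ ^ 2)) • innerSL ℝ (y - z) := by
    have := hs.continuousAt.tendsto.eventually (hF.eventually (by simp))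
    filter_upwards [this] with y hy using rad_fderiv (hy.differentiableAt (by simp))
  have hd : DifferentiableAt ℝ (deriv F) (‖x - z‖ ^ 2) :=
    ((hF.fderiv_right (m := 1) (by norm_num)).differentiableAt (by simp)).clm_apply
      (differentiableAt_const (1:ℝ))
  have h2 := ((hd.hasDerivAt.comp_hasFDerivAt x hs).const_mul 2).smul
    (((innerSL ℝ : EV n →L[ℝ] _).hasFDerivAt (x := x - z)).comp x ((hasFDerivAt_id x).sub_const z))
  rw [h1.fderiv_eq]
  refine (congrArg (fun T : EV n →L[ℝ] EV n →L[ℝ] ℝ => T ξ η) h2.fderiv).trans ?_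
  simp only [add_apply, smul_apply, ContinuousLinearMap.smulRight_apply, innerSL_apply_apply,
    ContinuousLinearMap.comp_apply, Function.comp, ContinuousLinearMap.id_apply, smul_eq_mul, id,
    nsmul_eq_mul]
  have e : ∀ p q : EV n, (innerSL ℝ p) q = ⟪p, q⟫ := fun _ _ => rfl
  push_cast; simp only [e]; ring
noncomputable def gmap : (EV n →L[ℝ] ℝ) →L[ℝ] EV n :=
  ∑ i, (ContinuousLinearMap.apply ℝ ℝ (ee i : EV n)).smulRight (ee i)
theorem gmap_coord (l : EV n →L[ℝ] ℝ) (i : Fin n) : gmap l i = l (ee i) := by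
  simp [gmap, sum_apply, Pi.single_apply]
theorem inner_gmap (l : EV n →L[ℝ] ℝ) (ξ : EV n) : ⟪gmap l, ξ⟫ = l ξ := by
  conv_rhs => rw [sum_ee ξ]
  simp [PiLp.inner_apply, gmap_coord]
theorem gmap_inner (v : EV n) : gmap (innerSL ℝ v) = v := by
  refine ext_inner_right ℝ fun ξ => by rw [inner_gmap]; simp
theorem det_le_trace {P : Matrix (Fin n) (Fin n) ℝ} (h : P.PosSemidef) :
    |P.det| ≤ P.trace ^ n := by
  rw [h.1.det_eq_prod_eigenvalues, h.1.trace_eq_sum_eigenvalues, Finset.abs_prod]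
  calc _ ≤ ∏ i : Fin n, ∑ j, h.1.eigenvalues j := by
        refine Finset.prod_le_prod (fun i _ => abs_nonneg _) fun i _ => ?_
        simp only [RCLike.ofReal_real_eq_id, id]
        rw [abs_of_nonneg (h.eigenvalues_nonneg i)]
        exact Finset.single_le_sum (fun j _ => h.eigenvalues_nonneg j) (Finset.mem_univ i)
    _ = _ := by simp
theorem clm_det (T : EV n →L[ℝ] EV n) : T.det = (Matrix.of fun i j => T (ee j) i).det := by
  rw [ContinuousLinearMap.det, ← LinearMap.det_toMatrix (EuclideanSpace.basisFun (Fin n) ℝ).toBasis]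
  congr 1
theorem contDiff_sq (y : EV n) : ContDiff ℝ 2 fun x : EV n => ‖x - y‖ ^ 2 :=
  (contDiff_id.sub contDiff_const).norm_sq ℝ
theorem hess_sq (c : ℝ) (y x : EV n) : hess (fun x => c * ‖x - y‖ ^ 2) x = (2 * c) • 1 := by
  ext i j
  have h := rad_d2 (F := fun s => c * s) (z := y) (x := x) (by fun_prop) (ee i) (ee j)
  have h1 : deriv (fun s : ℝ => c * s) = fun _ => c := by ext s; simp
  rw [hess_apply, h, h1]
  by_cases hij : i = j <;> simp [ee, PiLp.inner_apply, hij]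
theorem gl_abp {l L : ℝ} (hl : 0 < l) {w : EV n → ℝ} (hw : ContDiff ℝ 2 w) {z : EV n}
    {r : ℝ} (hr : 0 < r) (hr1 : r ≤ 1) (h0 : ∀ x ∈ Metric.closedBall z (4 * r), 0 ≤ w x)
    (hS : ∀ x ∈ Metric.closedBall z (4 * r), SupS l L 1 w x) {x0 : EV n}
    (hx0 : x0 ∈ Metric.closedBall z r) (hx1 : w x0 ≤ 1) :
    volume (Metric.ball z r) ≤ ENNReal.ofReal (((4 + n * L) / l) ^ n) *
      volume ({x | w x ≤ 3} ∩ Metric.ball z (4 * r)) := by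
  set C := (4 + n * L) / l
  set T : EV n → EV n := fun x => x + r ^ 2 • gmap (fderiv ℝ w x)
  set T' : EV n → EV n →L[ℝ] EV n := fun x =>
    ContinuousLinearMap.id ℝ _ + r ^ 2 • (gmap.comp (fderiv ℝ (fderiv ℝ w) x))
  have hw1 : ContDiff ℝ 1 (fderiv ℝ w) := hw.fderiv_right (by norm_num)
  have hT : ∀ x, HasFDerivAt T (T' x) x := fun x =>
    (hasFDerivAt_id x).add ((gmap.hasFDerivAt.comp x
      (hw1.differentiable (by simp) x).hasFDerivAt).const_smul (r ^ 2))
  have hT'c : Continuous T' := by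
    have := hw1.continuous_fderiv (by simp)
    fun_prop
  set S : Set (EV n) := ({x | w x ≤ 3} ∩ Metric.ball z (4 * r)) ∩ {x | |(T' x).det| ≤ C ^ n}
  have hSm : MeasurableSet S := by
    refine ((measurableSet_le hw.continuous.measurable measurable_const).inter
      measurableSet_ball).inter (measurableSet_le ?_ measurable_const)
    exact (ContinuousLinearMap.continuous_det.comp hT'c).abs.measurable
  have hcov : Metric.ball z r ⊆ T '' S := by
    intro y hy
    rw [Metric.mem_ball, dist_eq_norm] at hy
    set ψ : EV n → ℝ := fun x => -(1 / (2 * r ^ 2)) * ‖x - y‖ ^ 2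
    have hψ : ContDiff ℝ 2 ψ := contDiff_const.mul (contDiff_sq y)
    obtain ⟨x, hxm, hx⟩ := (isCompact_closedBall z (4 * r)).exists_isMinOn
      ⟨z, by simp; positivity⟩
      (hw.continuous.add (continuous_const.mul hψ.continuous)).continuousOn
        (f := fun x => w x + (-1) * ψ x)
    have hr2 : 0 < r ^ 2 := by positivity
    have hψe : ∀ x, (-1) * ψ x = ‖x - y‖ ^ 2 / (2 * r ^ 2) := fun x => by simp only [ψ]; ring
    have hle : w x + ‖x - y‖ ^ 2 / (2 * r ^ 2) ≤ 3 := by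
      rw [Metric.mem_closedBall, dist_eq_norm] at hx0
      have h1 := hx (show x0 ∈ Metric.closedBall z (4 * r) by
        rw [Metric.mem_closedBall, dist_eq_norm]; linarith)
      simp only [Set.mem_ofPred_eq, hψe] at h1
      have h2 : ‖x0 - y‖ ≤ 2 * r := by
        have := norm_sub_le (x0 - z) (y - z)
        rw [sub_sub_sub_cancel_right] at this; linarith
      have h3 : ‖x0 - y‖ ^ 2 / (2 * r ^ 2) ≤ 2 := by
        rw [div_le_iff₀ (by positivity)]; nlinarith [norm_nonneg (x0 - y)]
      linarith
    have hw0 := h0 x hxm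
    have hq : ‖x - y‖ ^ 2 ≤ 6 * r ^ 2 := by
      have : ‖x - y‖ ^ 2 / (2 * r ^ 2) ≤ 3 := by linarith
      rw [div_le_iff₀ (by positivity)] at this; linarith
    have hq3 : ‖x - y‖ < 3 * r := by nlinarith [norm_nonneg (x - y)]
    have hxb : x ∈ Metric.ball z (4 * r) := by
      rw [Metric.mem_ball, dist_eq_norm]
      have := norm_add_le (x - y) (y - z)
      rw [sub_add_sub_cancel] at this; linarith
    have hmin : IsLocalMin (fun x => w x + (-1) * ψ x) x :=
      hx.isLocalMin (Filter.mem_of_superset (Metric.isOpen_ball.mem_nhds hxb)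
        Metric.ball_subset_closedBall)
    obtain ⟨hd, -⟩ := touch hw.contDiffAt hψ.contDiffAt hmin
    have hP := hess_psd_of_localMin hmin (hw.add (contDiff_const.mul hψ)).contDiffAt
    have hdψ : fderiv ℝ ψ x = (-(1 / r ^ 2)) • innerSL ℝ (x - y) := by
      have := rad_fderiv (F := fun s => -(1 / (2 * r ^ 2)) * s) (z := y) (x := x) (by fun_prop)
      rw [this]; congr 1; simp; field_simp
    rw [hess_lin hw.contDiffAt hψ.contDiffAt, hess_sq, smul_smul] at hP
    set P := hess w x + (-1 * (2 * -(1 / (2 * r ^ 2)))) • (1 : Matrix (Fin n) (Fin n) ℝ) with hPd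
    obtain ⟨a, b, ha, hb, hab⟩ := hS x hxm
    have hPt : r ^ 2 * P.trace ≤ C := by
      have h1 := (ha P hP).1
      have h2 := (ha 1 Matrix.PosSemidef.one).2
      rw [hPd, pr_add, pr_smul, ← hPd] at h1
      rw [hd, hdψ] at hab
      have h3 : |⟪x - y, b⟫| ≤ 3 * r :=
        (abs_real_inner_le_norm _ _).trans (by nlinarith [norm_nonneg (x - y), norm_nonneg b])
      simp only [smul_apply, innerSL_apply_apply, smul_eq_mul] at hab
      rw [Matrix.trace_one, Fintype.card_fin] at h2
      rw [le_div_iff₀ hl]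
      have h4 : r ^ 2 * (-(1 / r ^ 2) * ⟪x - y, b⟫) = - ⟪x - y, b⟫ := by field_simp
      have h5 : r ^ 2 * ((-1 * (2 * -(1 / (2 * r ^ 2)))) * pr a 1) = pr a 1 := by field_simp
      have h6 := mul_le_mul_of_nonneg_left hab hr2.le
      have h7 := mul_le_mul_of_nonneg_left h1 hr2.le
      rw [mul_add] at h6 h7
      rw [h4] at h6; rw [h5] at h7
      nlinarith [le_abs_self ⟪x - y, b⟫]
    refine ⟨x, ⟨⟨?_, hxb⟩, ?_⟩, ?_⟩
    · have : 0 ≤ ‖x - y‖ ^ 2 / (2 * r ^ 2) := by positivity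
      show w x ≤ 3; linarith
    · have h1 : (T' x).det = (r ^ 2 • P).det := by
        rw [clm_det]; congr 1; ext i j
        simp only [T', hPd, Matrix.of_apply, add_apply, smul_apply, ContinuousLinearMap.comp_apply,
          ContinuousLinearMap.id_apply, PiLp.add_apply, PiLp.smul_apply, gmap_coord, smul_eq_mul,
          Matrix.smul_apply, Matrix.add_apply, ← hess_apply, hess_symm hw.contDiffAt j i, mul_add]
        rw [add_comm]; congr 1
        by_cases hij : i = j <;> simp [hij, Matrix.one_apply]
        field_simp
      show |(T' x).det| ≤ C ^ n
      rw [h1]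
      refine (det_le_trace (hP.smul hr2.le)).trans ?_
      rw [Matrix.trace_smul, smul_eq_mul]
      exact pow_le_pow_left₀ (mul_nonneg hr2.le hP.trace_nonneg) hPt n
    · simp only [T]
      rw [hd, hdψ, map_smul, gmap_inner, smul_smul]
      have : r ^ 2 * -(1 / r ^ 2) = -1 := by field_simp
      rw [this]; simp
  calc _ ≤ volume (T '' S) := measure_mono hcov
    _ ≤ ∫⁻ x in S, ENNReal.ofReal |(T' x).det| :=
      addHaar_image_le_lintegral_abs_det_fderiv _ hSm fun x _ => (hT x).hasFDerivWithinAt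
    _ ≤ ∫⁻ x in S, ENNReal.ofReal (C ^ n) := by
      refine setLIntegral_mono measurable_const fun x hx => ENNReal.ofReal_le_ofReal hx.2
    _ = ENNReal.ofReal (C ^ n) * volume S := by simp
    _ ≤ _ := by gcongr; exact Set.inter_subset_left
end
section
variable {n : ℕ}
theorem cmpP {l L : ℝ} (hl : 0 ≤ l) {K : Set (EV n)} (hK : IsCompact K) {w ψ : EV n → ℝ}
    (hw : ContinuousOn w K) (hψ : ContinuousOn ψ K)
    (h : ∀ x ∈ K, ψ x ≤ w x ∨ (K ∈ 𝓝 x ∧ ContDiffAt ℝ 2 w x ∧ ContDiffAt ℝ 2 ψ x ∧ ∃ a b,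
      Ell l L a ∧ pr a (hess w x) + fderiv ℝ w x b < pr a (hess ψ x) + fderiv ℝ ψ x b)) :
    ∀ x ∈ K, ψ x ≤ w x := by
  intro y hy
  obtain ⟨x, hx, hm⟩ := hK.exists_isMinOn ⟨y, hy⟩ (hw.add (continuousOn_const.mul hψ))
    (f := fun x => w x + (-1) * ψ x)
  have h1 := hm hy
  simp only [Set.mem_ofPred_eq] at h1
  rcases h x hx with h2 | ⟨h2, h3, h4, a, b, ha, h5⟩
  · linarith
  · obtain ⟨h6, h7⟩ := touch h3 h4 (hm.isLocalMin h2)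
    have := h7 hl ha
    rw [h6] at h5; linarith
def outer (v : EV n) : Matrix (Fin n) (Fin n) ℝ := Matrix.of fun i j => v i * v j
theorem outer_psd (v : EV n) : (outer v).PosSemidef :=
  psd_of_quad (fun i j => mul_comm _ _) fun ξ => by
    have : ∑ i, ∑ j, ξ i * ξ j * outer v i j = (∑ i, ξ i * v i) ^ 2 := by
      rw [sq, Finset.sum_mul_sum]
      exact Finset.sum_congr rfl fun i _ => Finset.sum_congr rfl fun j _ => by simp [outer]; ring
    rw [this]; positivity
theorem outer_trace (v : EV n) : (outer v).trace = ‖v‖ ^ 2 := by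
  rw [EuclideanSpace.real_norm_sq_eq]; simp [outer, Matrix.trace, sq]
theorem inner_ee (v : EV n) (i : Fin n) : ⟪v, ee i⟫ = v i := by simp [ee, PiLp.inner_apply]
theorem rad_hess {F : ℝ → ℝ} {z x : EV n} (hF : ContDiffAt ℝ 2 F (‖x - z‖ ^ 2)) :
    hess (fun y : EV n => F (‖y - z‖ ^ 2)) x = (2 * deriv F (‖x - z‖ ^ 2)) • 1 +
      (4 * deriv (deriv F) (‖x - z‖ ^ 2)) • outer (x - z) := by
  ext i j
  rw [hess_apply, rad_d2 hF, inner_ee, inner_ee]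
  by_cases hij : i = j <;> simp [hij, outer, inner_ee]
theorem deriv_rpow2 (p : ℝ) {s : ℝ} (hs : 0 < s) : ContDiffAt ℝ 2 (fun s : ℝ => s ^ p) s ∧
    deriv (fun s : ℝ => s ^ p) s = p * s ^ (p - 1) ∧
    deriv (deriv fun s : ℝ => s ^ p) s = p * (p - 1) * s ^ (p - 2) := by
  refine ⟨contDiffAt_id.rpow_const_of_ne hs.ne', by simp [hs.ne'], ?_⟩
  have : deriv (fun s : ℝ => s ^ p) =ᶠ[𝓝 s] fun s => p * s ^ (p - 1) := by
    filter_upwards [lt_mem_nhds hs] with t ht; simp [ht.ne']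
  rw [this.deriv_eq, deriv_const_mul _ (by fun_prop (disch := exact Or.inl hs.ne')), (Real.hasDerivAt_rpow_const (Or.inl hs.ne')).deriv]
  ring_nf
theorem contDiffAt_rad {F : ℝ → ℝ} {z x : EV n} (hF : ContDiffAt ℝ 2 F (‖x - z‖ ^ 2)) :
    ContDiffAt ℝ 2 (fun y : EV n => F (‖y - z‖ ^ 2)) x :=
  hF.comp x (contDiff_sq z).contDiffAt
theorem gl_bar (n : ℕ) {l L : ℝ} (hl : 0 < l) : ∃ c > 0, ∃ k > 0, c ≤ 1 ∧ k ≤ 1 ∧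
    ∀ {w : EV n → ℝ} {z : EV n} {r s : ℝ}, ContDiff ℝ 2 w → 0 < r → r ≤ 1 → 0 < s →
    (∀ x ∈ Metric.closedBall z (16 * r), 0 ≤ w x) →
    (∀ x ∈ Metric.closedBall z (16 * r), SupS l L (k * s) w x) →
    (∀ x ∈ Metric.closedBall z r, s ≤ w x) → ∀ x ∈ Metric.closedBall z (12 * r), c * s ≤ w x := by
  obtain ⟨q, hq0, hq⟩ : ∃ q : ℝ, 1 ≤ q ∧ n * L + 17 ≤ 2 * (q + 1) * l := by
    refine ⟨max 1 ((n * L + 17) / (2 * l)), le_max_left _ _, ?_⟩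
    have := le_max_right 1 ((n * L + 17) / (2 * l))
    rw [div_le_iff₀ (by positivity)] at this
    nlinarith
  have h256 : (0:ℝ) < 256 ^ (-q) := by positivity
  have h144 : (256:ℝ) ^ (-q) < 144 ^ (-q) :=
    Real.rpow_lt_rpow_of_neg (by norm_num) (by norm_num) (by linarith)
  refine ⟨144 ^ (-q) - 256 ^ (-q), by linarith, 256 ^ (-q - 1), by positivity, ?_, ?_, ?_⟩
  · have : (144:ℝ) ^ (-q) ≤ 1 := Real.rpow_le_one_of_one_le_of_nonpos (by norm_num) (by linarith)
    linarith
  · exact Real.rpow_le_one_of_one_le_of_nonpos (by norm_num) (by linarith)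
  intro w z r s hw hr hr1 hs h0 hS h1
  have hr2 : 0 < r ^ 2 := by positivity
  set A := s * (r ^ 2) ^ q with hA
  have hApos : 0 < A := by positivity
  set F : ℝ → ℝ := fun t => t ^ (-q)
  set ψ : EV n → ℝ := fun x => (-(s * 256 ^ (-q))) + A * F (‖x - z‖ ^ 2)
  have hAr : ∀ C : ℝ, 0 < C → ∀ t, t ≤ C * r ^ 2 → 0 < t → s * C ^ (-q) ≤ A * t ^ (-q) := by
    intro C hC t ht h0
    have : (C * r ^ 2) ^ (-q) ≤ t ^ (-q) := Real.rpow_le_rpow_of_nonpos h0 ht (by linarith)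
    rw [Real.mul_rpow hC.le hr2.le, Real.rpow_neg hr2.le] at this
    calc _ = A * (C ^ (-q) * ((r ^ 2) ^ q)⁻¹) := by rw [hA]; field_simp
      _ ≤ _ := by gcongr
  have hAr' : ∀ C : ℝ, 0 < C → ∀ t, C * r ^ 2 ≤ t → A * t ^ (-q) ≤ s * C ^ (-q) := by
    intro C hC t ht
    have : t ^ (-q) ≤ (C * r ^ 2) ^ (-q) := Real.rpow_le_rpow_of_nonpos (by positivity) ht (by linarith)
    rw [Real.mul_rpow hC.le hr2.le, Real.rpow_neg hr2.le] at this
    calc _ ≤ A * (C ^ (-q) * ((r ^ 2) ^ q)⁻¹) := by gcongr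
      _ = _ := by rw [hA]; field_simp
  set K := Metric.closedBall z (16 * r) \ Metric.ball z r
  have hKc : IsCompact K := (isCompact_closedBall _ _).diff Metric.isOpen_ball
  have hpos : ∀ x ∈ K, r ≤ ‖x - z‖ ∧ ‖x - z‖ ≤ 16 * r := fun x hx => by
    simpa [K, dist_eq_norm, and_comm] using hx
  have hF : ∀ x ∈ K, ContDiffAt ℝ 2 F (‖x - z‖ ^ 2) := fun x hx =>
    (deriv_rpow2 _ (pow_pos (hr.trans_le (hpos x hx).1) 2)).1
  have key : ∀ x ∈ K, ψ x ≤ w x := by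
    refine cmpP (L := L) hl.le hKc hw.continuous.continuousOn (fun x hx => ?_) fun x hx => ?_
    · exact ((contDiffAt_const.add (contDiffAt_const.mul (contDiffAt_rad (hF x hx)))).continuousAt).continuousWithinAt
    obtain ⟨hx1, hx2⟩ := hpos x hx
    by_cases e1 : ‖x - z‖ = r
    · left
      have h2 := hAr' 1 one_pos (‖x - z‖ ^ 2) (by rw [e1]; linarith)
      have h3 := h1 x (by simp [dist_eq_norm, e1])
      simp only [ψ, F]; simp at h2; nlinarith
    by_cases e2 : ‖x - z‖ = 16 * r
    · left
      have h2 := hAr' 256 (by norm_num) (‖x - z‖ ^ 2) (by rw [e2]; nlinarith)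
      have h3 := h0 x hx.1
      simp only [ψ, F]; linarith
    right
    have hxr : r < ‖x - z‖ := lt_of_le_of_ne hx1 (Ne.symm e1)
    have hxR : ‖x - z‖ < 16 * r := lt_of_le_of_ne hx2 e2
    have hcr := contDiffAt_rad (hF x hx)
    refine ⟨?_, hw.contDiffAt, contDiffAt_const.add (contDiffAt_const.mul hcr), ?_⟩
    · refine Filter.inter_mem (Metric.closedBall_mem_nhds_of_mem (by simpa [dist_eq_norm]))
        (Metric.isClosed_closedBall.isOpen_compl.mem_nhds (x := x) (s := (Metric.closedBall z r)ᶜ) (by simpa [dist_eq_norm]) |> fun h => Filter.mem_of_superset h ?_)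
      exact Set.compl_subset_compl.2 Metric.ball_subset_closedBall
    obtain ⟨a, b, ha, hb, hab⟩ := hS x hx.1
    refine ⟨a, b, ha, hab.trans_lt ?_⟩
    have ht : 0 < ‖x - z‖ ^ 2 := pow_pos (hr.trans hxr) 2
    obtain ⟨-, hd1, hd2⟩ := deriv_rpow2 (-q) ht
    rw [hess_lin contDiffAt_const hcr, pr_add, pr_smul, rad_hess (hF x hx), pr_add, pr_smul, pr_smul,
      fderiv_const_add, fderiv_const_mul (hcr.differentiableAt (by simp)),
      rad_fderiv ((hF x hx).differentiableAt (by simp)), hd1, hd2]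
    have hz : pr a (hess (fun _ : EV n => (-(s * 256 ^ (-q)))) x) = 0 := by
      simp [pr, hess_apply]
    have p1 := (ha 1 Matrix.PosSemidef.one).2
    have p2 := (ha _ (outer_psd (x - z))).1
    rw [outer_trace] at p2
    rw [Matrix.trace_one, Fintype.card_fin] at p1
    have h3 : |⟪x - z, b⟫| ≤ 16 :=
        (abs_real_inner_le_norm _ _).trans (by nlinarith [norm_nonneg (x - z), norm_nonneg b])
    have hp : (‖x - z‖ ^ 2) ^ (-q - 1) = (‖x - z‖ ^ 2) ^ (-q - 2) * ‖x - z‖ ^ 2 := by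
      rw [← Real.rpow_add_one ht.ne']; ring_nf
    simp only [smul_apply, innerSL_apply_apply, smul_eq_mul, hz]
    have hbig : s * 256 ^ (-q - 1) ≤ A * (‖x - z‖ ^ 2) ^ (-q - 1) := by
      have h4 := hAr 256 (by norm_num) (‖x - z‖ ^ 2) (by nlinarith) ht
      rw [Real.rpow_sub_one ht.ne', Real.rpow_sub_one (by norm_num)]
      calc s * (256 ^ (-q) / 256) = s * 256 ^ (-q) / 256 := by ring
        _ ≤ A * (‖x - z‖ ^ 2) ^ (-q) / 256 := by gcongr
        _ ≤ A * (‖x - z‖ ^ 2) ^ (-q) / (‖x - z‖ ^ 2) := by gcongr; nlinarith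
        _ = _ := by ring
    set T := (‖x - z‖ ^ 2) ^ (-q - 2) with hT
    have hT0 : 0 < T := by positivity
    have : 2 * q * (A * (T * ‖x - z‖ ^ 2)) ≤
        A * (2 * (-q * (T * ‖x - z‖ ^ 2)) * pr a 1 + 4 * (-q * (-q - 1) * T) * pr a (outer (x - z)))
        + A * (2 * (-q * (T * ‖x - z‖ ^ 2)) * ⟪x - z, b⟫) := by
      have e : A * (2 * (-q * (T * ‖x - z‖ ^ 2)) * pr a 1 + 4 * (-q * (-q - 1) * T) * pr a (outer (x - z)))
        + A * (2 * (-q * (T * ‖x - z‖ ^ 2)) * ⟪x - z, b⟫) = 2 * q * (A * T) *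
          (2 * (q + 1) * pr a (outer (x - z)) - ‖x - z‖ ^ 2 * (pr a 1 + ⟪x - z, b⟫)) := by ring
      rw [e, show 2 * q * (A * (T * ‖x - z‖ ^ 2)) = 2 * q * (A * T) * ‖x - z‖ ^ 2 by ring]
      refine mul_le_mul_of_nonneg_left ?_ (by positivity)
      have h5 := mul_le_mul_of_nonneg_left p2 (by positivity : 0 ≤ 2 * (q + 1))
      nlinarith [le_abs_self ⟪x - z, b⟫]
    rw [hp] at hbig ⊢
    have h6 : 0 < s * (256:ℝ) ^ (-q - 1) := by positivity
    nlinarith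
  intro x hx
  rw [Metric.mem_closedBall, dist_eq_norm] at hx
  by_cases hxr : ‖x - z‖ < r
  · have h2 := h1 x (by simp [dist_eq_norm]; linarith)
    have : (144:ℝ) ^ (-q) ≤ 1 := Real.rpow_le_one_of_one_le_of_nonpos (by norm_num) (by linarith)
    nlinarith
  · have h2 := key x ⟨by simp [dist_eq_norm]; linarith, by simpa [dist_eq_norm] using hxr⟩
    push Not at hxr
    have h3 := hAr 144 (by norm_num) (‖x - z‖ ^ 2) (by nlinarith [norm_nonneg (x - z)]) (pow_pos (hr.trans_le hxr) 2)
    simp only [ψ, F] at h2; linarith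
end
section
variable {n : ℕ}
theorem hess_cmul {w : EV n → ℝ} {x : EV n} (hw : ContDiffAt ℝ 2 w x) (c : ℝ) :
    hess (fun y => c * w y) x = c • hess w x := by
  have := hess_lin (w := fun _ => 0) (x := x) contDiffAt_const hw c
  have h0 : hess (fun _ : EV n => (0:ℝ)) x = 0 := by ext i j; simp [hess_apply]
  simpa [h0] using this
theorem SupS.cmul {l L k : ℝ} {w : EV n → ℝ} {x : EV n} (h : SupS l L k w x)
    (hw : ContDiff ℝ 2 w) {c : ℝ} (hc : 0 ≤ c) : SupS l L (c * k) (fun y => c * w y) x := by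
  obtain ⟨a, b, ha, hb, h⟩ := h
  refine ⟨a, b, ha, hb, ?_⟩
  rw [hess_cmul hw.contDiffAt, pr_smul, fderiv_const_mul (hw.differentiable (by simp) x)]
  simpa [mul_add] using mul_le_mul_of_nonneg_left h hc
theorem SupS.mono {l L k k' : ℝ} {w : EV n → ℝ} {x : EV n} (h : SupS l L k w x) (hk : k ≤ k') :
    SupS l L k' w x := by
  obtain ⟨a, b, ha, hb, h⟩ := h
  exact ⟨a, b, ha, hb, h.trans hk⟩
theorem gl_step (n : ℕ) {l L : ℝ} (hl : 0 < l) (hL : 0 ≤ L) : ∃ c > 0, ∃ k > 0, ∃ δ > 0, c < 1 ∧ k ≤ 1 ∧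
    δ ≤ 1 ∧ ∀ {w : EV n → ℝ} {z : EV n} {R s : ℝ}, ContDiff ℝ 2 w → 0 < R → R ≤ 1 → 0 < s →
    (∀ x ∈ Metric.closedBall z (4 * R), 0 ≤ w x) →
    (∀ x ∈ Metric.closedBall z (4 * R), SupS l L (k * s) w x) →
    volume ({x | w x ≤ s} ∩ Metric.closedBall z R) < ENNReal.ofReal δ * volume (Metric.closedBall z R)
    → ∀ x ∈ Metric.closedBall z (3 * R), c * s < w x := by
  obtain ⟨c, hc, k, hk, hc1, hk1, H⟩ := gl_bar n (l := l) (L := L) hl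
  set C := ((4 + n * L) / l) ^ n
  have hC : 0 < C := by positivity
  refine ⟨c / 6, by positivity, k / 3, by positivity, min 1 (C⁻¹ * (1 / 4) ^ n), by positivity,
    by linarith, by linarith, min_le_left _ _, ?_⟩
  intro w z R s hw hR hR1 hs h0 hS hv x hx
  have key : ∀ y ∈ Metric.closedBall z (R / 4), s / 3 ≤ w y := by
    by_contra hcon
    push Not at hcon
    obtain ⟨y, hy, hys⟩ := hcon
    have hw' : ContDiff ℝ 2 fun y => (3 / s) * w y := contDiff_const.mul hw
    have e4 : 4 * (R / 4) = R := by ring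
    have hsub : Metric.closedBall z (4 * (R / 4)) ⊆ Metric.closedBall z (4 * R) :=
      Metric.closedBall_subset_closedBall (by linarith)
    have h1 := gl_abp hl hw' (z := z) (r := R / 4) (by positivity) (by linarith)
      (fun x hx => mul_nonneg (by positivity) (h0 x (hsub hx)))
      (fun x hx => ((hS x (hsub hx)).cmul hw (by positivity)).mono (by field_simp; exact hk1)) hy
      (by rw [div_mul_eq_mul_div, div_le_one hs]; linarith)
    have h2 : {x | 3 / s * w x ≤ 3} = {x | w x ≤ s} := by
      ext x; simp only [Set.mem_ofPred_eq]; rw [div_mul_eq_mul_div, div_le_iff₀ hs]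
      constructor <;> intro <;> linarith
    rw [h2, e4] at h1
    have h3 : volume ({x | w x ≤ s} ∩ Metric.ball z R) <
        ENNReal.ofReal (C⁻¹ * (1 / 4) ^ n) * volume (Metric.closedBall z R) :=
      (measure_mono (Set.inter_subset_inter_right _ Metric.ball_subset_closedBall)).trans_lt
        (hv.trans_le (by gcongr; exact min_le_right _ _))
    have h4 := ENNReal.mul_lt_mul_right (a := ENNReal.ofReal C) (by simpa using hC) (by simp) h3
    refine absurd (h1.trans_lt h4) (not_lt.2 ?_)
    rw [← mul_assoc, ← ENNReal.ofReal_mul hC.le, ← mul_assoc, mul_inv_cancel₀ hC.ne', one_mul,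
      Measure.addHaar_ball_of_pos _ _ (by positivity), Measure.addHaar_closedBall _ _ hR.le, ← mul_assoc,
      ← ENNReal.ofReal_mul (by positivity)]
    gcongr; simp only [finrank_euclideanSpace, Fintype.card_fin]; rw [← mul_pow]
    exact le_of_eq (by congr 1; ring)
  have e : 16 * (R / 4) = 4 * R := by ring
  have := H hw (z := z) (r := R / 4) (s := s / 3) (by positivity) (by linarith) (by positivity)
    (by rwa [e]) (by rw [e]; exact fun x hx => (hS x hx).mono (by linarith)) key x
    (by convert hx using 2; ring)
  have h5 := mul_pos hc hs
  linarith
theorem gl_ink (n : ℕ) {l L : ℝ} (hl : 0 < l) (hL : 0 ≤ L) : ∃ c > 0, ∃ k > 0, ∃ η > 0, c < 1 ∧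
    ∀ {w : EV n → ℝ} {z : EV n} {s : ℝ}, ContDiff ℝ 2 w → 0 < s →
    (∀ x ∈ Metric.closedBall z 5, 0 ≤ w x) →
    (∀ x ∈ Metric.closedBall z 5, SupS l L (k * s) w x) →
    (∀ x ∈ Metric.closedBall z 3, c * s < w x) ∨
    (1 + η) * volume.real ({x | s < w x} ∩ Metric.closedBall z 1) ≤
      volume.real ({x | c * s < w x} ∩ Metric.closedBall z 1) := by
  obtain ⟨c, hc, k, hk, δ, hδ, hc1, hk1, hδ1, H⟩ := gl_step n hl hL
  refine ⟨c, hc, k, hk, δ / 5 ^ n, by positivity, hc1, ?_⟩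
  intro w z s hw hs h0 hS
  by_cases hd : volume ({x | w x ≤ s} ∩ Metric.closedBall z 1) <
    ENNReal.ofReal δ * volume (Metric.closedBall z 1)
  · left
    have hsub : Metric.closedBall z (4 * 1) ⊆ Metric.closedBall z 5 :=
      Metric.closedBall_subset_closedBall (by norm_num)
    simpa using H hw one_pos le_rfl hs (fun x hx => h0 x (hsub hx)) (fun x hx => hS x (hsub hx)) hd
  right
  set B := Metric.closedBall z 1
  set E := {x | s < w x} ∩ B with hE
  set G := {x | c * s < w x} ∩ B with hG
  have hEm : MeasurableSet E := (measurableSet_lt measurable_const hw.continuous.measurable).inter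
    measurableSet_closedBall
  have hEG : E ⊆ G := fun x hx => ⟨lt_trans (mul_lt_of_lt_one_left hs hc1) hx.1, hx.2⟩
  set Z : EV n → ℝ → EV n := fun x t => x + t • (z - x)
  have hZ : ∀ x ∈ B, ∀ t, 0 ≤ t → t ≤ 1 → dist x (Z x t) ≤ t ∧
      Metric.closedBall (Z x t) t ⊆ B := by
    intro x hx t ht ht1
    rw [Metric.mem_closedBall, dist_comm, dist_eq_norm] at hx
    refine ⟨?_, Metric.closedBall_subset_closedBall' ?_⟩
    · simp only [Z, dist_self_add_right, norm_smul, Real.norm_of_nonneg ht]; nlinarith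
    · have : Z x t - z = (t - 1) • (z - x) := by simp only [Z]; module
      rw [dist_eq_norm, this, norm_smul, Real.norm_of_nonpos (by linarith)]; nlinarith
  have hsel : ∀ᵐ x ∂(volume.restrict E), ∃ t, 0 < t ∧ t ≤ 1 ∧
      Metric.closedBall (Z x t) t ⊆ G ∧
      ENNReal.ofReal δ * volume (Metric.closedBall (Z x t) t) ≤
        volume (Metric.closedBall (Z x t) t \ E) := by
    filter_upwards [IsUnifLocDoublingMeasure.ae_tendsto_measure_inter_div volume E 1,
      ae_restrict_mem hEm] with x hx hxE
    have hlim := hx (fun j : ℕ => Z x ((1 / 2) ^ j)) (fun j : ℕ => (1 / 2 : ℝ) ^ j)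
      (tendsto_nhdsWithin_iff.2 ⟨tendsto_pow_atTop_nhds_zero_of_lt_one (by norm_num) (by norm_num),
        Eventually.of_forall fun j => by simp [Set.mem_Ioi]⟩)
      (Eventually.of_forall fun j => by
        rw [one_mul]; exact (hZ x hxE.2 _ (by positivity) (pow_le_one₀ (by norm_num) (by norm_num))).1)
    set P : ℕ → Prop := fun j => volume ({x | w x ≤ s} ∩ Metric.closedBall (Z x ((1/2)^j)) ((1/2)^j))
      < ENNReal.ofReal δ * volume (Metric.closedBall (Z x ((1/2)^j)) ((1/2)^j)) with hP
    have hdiff : ∀ t, 0 ≤ t → t ≤ 1 → Metric.closedBall (Z x t) t \ E =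
        {x | w x ≤ s} ∩ Metric.closedBall (Z x t) t := by
      intro t h1 h2
      ext y; simp only [hE, Set.mem_diff, Set.mem_inter_iff, Set.mem_ofPred_eq, not_and']
      constructor
      · rintro ⟨h3, h4⟩; exact ⟨not_lt.1 (h4 ((hZ x hxE.2 t h1 h2).2 h3)), h3⟩
      · rintro ⟨h3, h4⟩; exact ⟨h4, fun _ => not_lt.2 h3⟩
    have hex : ∃ j, P j := by
      have h1 : ENNReal.ofReal (1 - δ) < 1 := by rw [ENNReal.ofReal_lt_one]; linarith
      obtain ⟨j, hj⟩ := ((tendsto_order.1 hlim).1 _ h1).exists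
      refine ⟨j, ?_⟩
      have hr : (0:ℝ) < (1 / 2) ^ j := by positivity
      have hp := Metric.measure_closedBall_pos volume (Z x ((1/2)^j)) hr
      have hf := (measure_closedBall_lt_top (μ := volume) (x := Z x ((1/2)^j)) (r := (1/2)^j)).ne
      rw [ENNReal.lt_div_iff_mul_lt (Or.inl hp.ne') (Or.inl hf)] at hj
      show volume _ < _
      rw [← hdiff _ hr.le (pow_le_one₀ (by norm_num) (by norm_num))]
      have h2 := measure_inter_add_diff (μ := volume) (Metric.closedBall (Z x ((1/2)^j)) ((1/2)^j)) hEm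
      rw [Set.inter_comm] at h2
      by_contra h3
      rw [not_lt] at h3
      have h4 := ENNReal.add_lt_add_of_lt_of_le (ENNReal.mul_ne_top ENNReal.ofReal_ne_top hf) hj h3
      rw [← add_mul, ← ENNReal.ofReal_add (by linarith) hδ.le, h2] at h4
      simp at h4
    classical
    set j := Nat.find hex
    have hj : P j := Nat.find_spec hex
    have hj0 : j ≠ 0 := fun h => by rw [h] at hj; exact hd (by simpa [hP, Z] using hj)
    obtain ⟨i, hi⟩ := Nat.exists_eq_succ_of_ne_zero hj0
    have hni : ¬ P i := Nat.find_min hex (by omega)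
    set t := (1 / 2 : ℝ) ^ i
    have htp : 0 < t := by positivity
    have ht1 : t ≤ 1 := pow_le_one₀ (by norm_num) (by norm_num)
    have hjt : (1 / 2 : ℝ) ^ j = t / 2 := by rw [hi, pow_succ]; ring
    simp only [hP, hjt] at hj
    have hb := hZ x hxE.2 (t / 2) (by positivity) (by linarith)
    have hsub : Metric.closedBall (Z x (t / 2)) (4 * (t / 2)) ⊆ Metric.closedBall z 5 := by
      refine Metric.closedBall_subset_closedBall' ?_
      have := hb.2 (Metric.mem_closedBall_self (by positivity))
      rw [Metric.mem_closedBall] at this; linarith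
    have h3 := H hw (by positivity) (by linarith) hs (fun x hx => h0 x (hsub hx))
      (fun x hx => hS x (hsub hx)) hj
    refine ⟨t, htp, ht1, fun y hy => ⟨h3 y ?_, (hZ x hxE.2 t htp.le ht1).2 hy⟩, ?_⟩
    · refine Metric.closedBall_subset_closedBall' ?_ hy
      have e : Z x t - Z x (t / 2) = (t / 2) • (z - x) := by simp only [Z]; module
      have hx2 := hxE.2
      rw [Metric.mem_closedBall, dist_comm, dist_eq_norm] at hx2
      rw [dist_eq_norm, e, norm_smul, Real.norm_of_nonneg (by positivity)]; nlinarith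
    · rw [hdiff t htp.le ht1]; exact not_lt.1 hni
  have hmain : ENNReal.ofReal δ * volume E ≤ ENNReal.ofReal (5 ^ n) * volume (G \ E) := by
    rw [ae_restrict_iff' hEm] at hsel
    set S : Set (EV n) := {x | x ∈ E ∧ ∃ t, 0 < t ∧ t ≤ 1 ∧ Metric.closedBall (Z x t) t ⊆ G ∧
      ENNReal.ofReal δ * volume (Metric.closedBall (Z x t) t) ≤
        volume (Metric.closedBall (Z x t) t \ E)} with hSd
    have hES : volume E ≤ volume S := measure_mono_ae (by
      filter_upwards [hsel] with x hx hxE using ⟨hxE, hx hxE⟩)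
    have hS2 : ∀ x ∈ S, ∃ t, 0 < t ∧ t ≤ 1 ∧ Metric.closedBall (Z x t) t ⊆ G ∧
      ENNReal.ofReal δ * volume (Metric.closedBall (Z x t) t) ≤
        volume (Metric.closedBall (Z x t) t \ E) := fun x hx => hx.2
    choose! t ht0 ht1 htG htv using hS2
    obtain ⟨u, huS, hud, hucov⟩ := Vitali.exists_disjoint_subfamily_covering_enlargement_closedBall S
      (fun x => Z x (t x)) t 1 ht1 5 (by norm_num)
    have hcount : u.Countable := hud.countable_of_nonempty_interior fun x hx => by
      rw [interior_closedBall _ (ht0 x (huS hx)).ne']; exact Metric.nonempty_ball.2 (ht0 x (huS hx))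
    have : Countable u := hcount.to_subtype
    have hcov : S ⊆ ⋃ b : u, Metric.closedBall (Z b (t b)) (5 * t b) := by
      intro x hx
      obtain ⟨b, hb, hsub⟩ := hucov x hx
      refine Set.mem_iUnion.2 ⟨⟨b, hb⟩, hsub ?_⟩
      exact (hZ x hx.1.2 _ (ht0 x hx).le (ht1 x hx)).1
    calc ENNReal.ofReal δ * volume E ≤ ENNReal.ofReal δ * ∑' b : u, volume (Metric.closedBall (Z b (t b)) (5 * t b)) := by
          gcongr; exact hES.trans ((measure_mono hcov).trans (measure_iUnion_le _))
      _ = ENNReal.ofReal (5 ^ n) * ∑' b : u, ENNReal.ofReal δ * volume (Metric.closedBall (Z b (t b)) (t b)) := by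
          rw [ENNReal.tsum_mul_left, ← mul_assoc, mul_comm (ENNReal.ofReal (5 ^ n)), mul_assoc,
            ← ENNReal.tsum_mul_left (a := ENNReal.ofReal (5 ^ n))]
          congr 2; ext b
          have := ht0 b (huS b.2)
          rw [Measure.addHaar_closedBall _ _ this.le, Measure.addHaar_closedBall _ _ (by positivity),
            ← mul_assoc, ← ENNReal.ofReal_mul (by positivity)]
          simp [mul_pow]
      _ ≤ ENNReal.ofReal (5 ^ n) * ∑' b : u, volume (Metric.closedBall (Z b (t b)) (t b) \ E) := by
          gcongr with b; exact htv b (huS b.2)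
      _ = ENNReal.ofReal (5 ^ n) * volume (⋃ b : u, (Metric.closedBall (Z b (t b)) (t b) \ E)) := by
          rw [measure_iUnion _ fun b => measurableSet_closedBall.diff hEm]
          intro b b' hbb
          exact (hud b.2 b'.2 (fun h => hbb (Subtype.ext h))).mono Set.diff_subset Set.diff_subset
      _ ≤ _ := by
          gcongr
          exact Set.iUnion_subset fun b => Set.diff_subset_diff_left (htG b (huS b.2))
  have hfin : ∀ S : Set (EV n), S ⊆ B → volume S ≠ ∞ := fun S hS =>
    ((measure_mono hS).trans_lt measure_closedBall_lt_top).ne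
  have h1 : δ * volume.real E ≤ 5 ^ n * volume.real (G \ E) := by
    have := ENNReal.toReal_mono (ENNReal.mul_ne_top (by simp) (hfin (G \ E) (Set.diff_subset.trans Set.inter_subset_right))) hmain
    simpa [ENNReal.toReal_mul, hδ.le, Measure.real, ENNReal.toReal_ofReal hδ.le] using this
  have h2 : volume.real G = volume.real E + volume.real (G \ E) := by
    rw [measureReal_diff hEG hEm (hfin G Set.inter_subset_right)]; ring
  rw [h2, add_mul, one_mul, div_mul_eq_mul_div]
  gcongr
  rw [div_le_iff₀ (by positivity)]; linarith
end
section
variable {n : ℕ}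
theorem fderiv_aff {w : EV n → ℝ} (hw : ContDiff ℝ 2 w) (z : EV n) (T : EV n →L[ℝ] EV n) (x : EV n) :
    fderiv ℝ (fun y => w (z + T y)) x = (fderiv ℝ w (z + T x)).comp T :=
  (((hw.differentiable (by simp)) (z + T x)).hasFDerivAt.comp x (T.hasFDerivAt.const_add z)).fderiv
theorem d2_aff {w : EV n → ℝ} (hw : ContDiff ℝ 2 w) (z : EV n) (T : EV n →L[ℝ] EV n) (x ξ η : EV n) :
    fderiv ℝ (fderiv ℝ (fun y => w (z + T y))) x ξ η =
      fderiv ℝ (fderiv ℝ w) (z + T x) (T ξ) (T η) := by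
  have h1 : fderiv ℝ (fun y => w (z + T y)) = fun y => (fderiv ℝ w (z + T y)).comp T :=
    funext fun y => fderiv_aff hw z T y
  have h2 : DifferentiableAt ℝ (fderiv ℝ w) (z + T x) :=
    (hw.fderiv_right (m := 1) (by norm_num)).differentiable (by simp) _
  have h3 := h2.hasFDerivAt.comp x (T.hasFDerivAt.const_add z)
  have h4 := ((ContinuousLinearMap.compL ℝ (EV n) (EV n) ℝ).flip T).hasFDerivAt.comp x h3
  rw [h1]
  have := h4.fderiv
  simp only [Function.comp_def] at this
  erw [this]
  simp
theorem contDiff_aff {w : EV n → ℝ} (hw : ContDiff ℝ 2 w) (z : EV n) (T : EV n →L[ℝ] EV n) :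
    ContDiff ℝ 2 fun y => w (z + T y) := hw.comp (contDiff_const.add T.contDiff)
theorem hess_scale {w : EV n → ℝ} (hw : ContDiff ℝ 2 w) (z : EV n) (r : ℝ) (x : EV n) :
    hess (fun y => w (z + r • y)) x = r ^ 2 • hess w (z + r • x) := by
  ext i j
  have := d2_aff hw z (r • ContinuousLinearMap.id ℝ (EV n)) x (ee i) (ee j)
  simp only [smul_apply, ContinuousLinearMap.id_apply, map_smul, smul_eq_mul] at this
  simp only [hess_apply, Matrix.smul_apply, smul_eq_mul]; rw [this]; ring
theorem gl (n : ℕ) {l L μ : ℝ} (hl : 0 < l) (hL : 0 ≤ L) (hμ : 0 < μ) : ∃ c > 0, ∃ κ > 0, c < 1 ∧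
    ∀ {w : EV n → ℝ} {z : EV n} {ρ s : ℝ}, ContDiff ℝ 2 w → 0 < ρ → 0 < s →
    (∀ x ∈ Metric.closedBall z (5 * ρ), 0 ≤ w x) →
    (∀ x ∈ Metric.closedBall z (5 * ρ), ∃ a b, Ell l L a ∧ ‖b‖ * ρ ≤ 1 ∧
      ρ ^ 2 * (pr a (hess w x) + fderiv ℝ w x b) ≤ κ * s) →
    μ * volume.real (Metric.closedBall z ρ) ≤ volume.real ({x | s < w x} ∩ Metric.closedBall z ρ) →
    ∀ x ∈ Metric.closedBall z (3 * ρ), c * s < w x := by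
  obtain ⟨c, hc, k, hk, η, hη, hc1, H⟩ := gl_ink n hl hL
  obtain ⟨N, hN⟩ := pow_unbounded_of_one_lt (1 / μ) (by linarith : 1 < 1 + η)
  refine ⟨c ^ (N + 1), by positivity, k * c ^ (N + 1), by positivity,
    pow_lt_one₀ hc.le hc1 (by simp), ?_⟩
  intro w z ρ s hw hρ hs h0 hS hv
  set W : EV n → ℝ := fun y => s⁻¹ * w (z + ρ • y) with hWd
  have hwz : ContDiff ℝ 2 fun y => w (z + ρ • y) := contDiff_aff hw z (ρ • ContinuousLinearMap.id ℝ (EV n))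
  have hW : ContDiff ℝ 2 W := contDiff_const.mul hwz
  have hin : ∀ {t : ℝ} {y : EV n}, y ∈ Metric.closedBall (0 : EV n) t ↔ z + ρ • y ∈ Metric.closedBall z (t * ρ) := by
    intro t y
    rw [mem_closedBall_zero_iff, Metric.mem_closedBall, dist_self_add_left, norm_smul, Real.norm_of_nonneg hρ.le,
      mul_comm, mul_le_mul_iff_left₀ hρ]
  have hW0 : ∀ y ∈ Metric.closedBall (0 : EV n) 5, 0 ≤ W y := fun y hy =>
    mul_nonneg (by positivity) (h0 _ (hin.1 hy))
  have hWS : ∀ j ≤ N + 1, ∀ y ∈ Metric.closedBall (0 : EV n) 5, SupS l L (k * c ^ j) W y := by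
    intro j hj y hy
    obtain ⟨a, b, ha, hb, h⟩ := hS _ (hin.1 hy)
    refine ⟨a, ρ • b, ha, by rw [norm_smul, Real.norm_of_nonneg hρ.le]; linarith, ?_⟩
    have h1 := fderiv_aff hw z (ρ • ContinuousLinearMap.id ℝ (EV n)) y
    simp only [smul_apply, ContinuousLinearMap.id_apply] at h1
    rw [hWd, hess_cmul hwz.contDiffAt, hess_scale hw, pr_smul, pr_smul,
      fderiv_const_mul (hwz.differentiable (by simp) y), h1]
    have h2 : c ^ (N + 1) ≤ c ^ j := pow_le_pow_of_le_one hc.le hc1.le hj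
    simp only [smul_apply, ContinuousLinearMap.comp_apply, ContinuousLinearMap.id_apply, map_smul, smul_eq_mul]
    calc _ = s⁻¹ * (ρ ^ 2 * (pr a (hess w (z + ρ • y)) + fderiv ℝ w (z + ρ • y) b)) := by ring
      _ ≤ s⁻¹ * (k * c ^ (N + 1) * s) := by gcongr
      _ = k * c ^ (N + 1) := by field_simp
      _ ≤ _ := by gcongr
  set V := volume.real (Metric.closedBall (0 : EV n) 1)
  have hV : 0 < V := ENNReal.toReal_pos (Metric.measure_closedBall_pos volume _ one_pos).ne' measure_closedBall_lt_top.ne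
  have hsc : ∀ A : Set (EV n), volume.real ((fun y => z + ρ • y) ⁻¹' A) = (ρ ^ n)⁻¹ * volume.real A := by
    intro A
    have : (fun y => z + ρ • y) ⁻¹' A = (fun y => ρ • y) ⁻¹' ((fun y => z + y) ⁻¹' A) := rfl
    rw [Measure.real, Measure.real, this, Measure.addHaar_preimage_smul _ hρ.ne', measure_preimage_add,
      ENNReal.toReal_mul, ENNReal.toReal_ofReal (abs_nonneg _), abs_of_pos (by positivity)]
    simp
  have hstart : μ * V ≤ volume.real ({y | 1 < W y} ∩ Metric.closedBall 0 1) := by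
    have e1 : {y | 1 < W y} ∩ Metric.closedBall 0 1 = (fun y => z + ρ • y) ⁻¹'
        ({x | s < w x} ∩ Metric.closedBall z ρ) := by
      ext y; simp only [Set.mem_inter_iff, Set.mem_preimage, Set.mem_ofPred_eq, hin, one_mul, hWd]
      rw [inv_mul_eq_div, one_lt_div hs]
    have e2 : Metric.closedBall (0 : EV n) 1 = (fun y => z + ρ • y) ⁻¹' Metric.closedBall z ρ := by
      ext y; simp only [Set.mem_preimage, hin, one_mul]
    rw [e1, hsc, show V = _ from congrArg volume.real e2, hsc, mul_left_comm]
    gcongr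
  have main : ∀ j ≤ N + 1, (∀ y ∈ Metric.closedBall (0 : EV n) 3, c ^ j < W y) ∨
      (1 + η) ^ j * (μ * V) ≤ volume.real ({y | c ^ j < W y} ∩ Metric.closedBall 0 1) := by
    intro j
    induction j with
    | zero => intro _; right; simpa using hstart
    | succ j ih =>
      intro hj
      have hcj : c * c ^ j = c ^ (j + 1) := (pow_succ' c j).symm
      rcases ih (by omega) with h | h
      · left; intro y hy
        exact lt_trans (by rw [← hcj]; exact mul_lt_of_lt_one_left (by positivity) hc1) (h y hy)
      · rcases H hW (pow_pos hc j) hW0 (hWS j (by omega)) with h2 | h2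
        · left; rwa [hcj] at h2
        · right; rw [hcj] at h2
          refine le_trans ?_ h2
          rw [pow_succ', mul_assoc]; gcongr
  intro x hx
  have hy : ∀ y ∈ Metric.closedBall (0 : EV n) 3, c ^ (N + 1) < W y := by
    refine (main _ le_rfl).resolve_right (not_le.2 ?_)
    have h1 : volume.real ({y | c ^ (N+1) < W y} ∩ Metric.closedBall 0 1) ≤ V :=
      measureReal_mono Set.inter_subset_right (measure_closedBall_lt_top.ne)
    have h3 : (1 + η) ^ N ≤ (1 + η) ^ (N + 1) := pow_le_pow_right₀ (by linarith) (by simp)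
    rw [div_lt_iff₀ hμ] at hN
    refine h1.trans_lt ?_
    rw [← mul_assoc]
    refine lt_mul_of_one_lt_left hV (hN.trans_le ?_)
    gcongr
  have e : z + ρ • (ρ⁻¹ • (x - z)) = x := by rw [smul_smul, mul_inv_cancel₀ hρ.ne']; simp
  have h5 := hy (ρ⁻¹ • (x - z)) (hin.2 (by rwa [e]))
  simp only [hWd, e] at h5
  rwa [inv_mul_eq_div, lt_div_iff₀ hs] at h5
end
section
variable {n : ℕ}
open scoped MatrixOrder in
theorem pd_sqrt {M : Matrix (Fin n) (Fin n) ℝ} (h : M.PosDef) : ∃ Q : Matrix (Fin n) (Fin n) ℝ, Q.PosDef ∧ M = Q * Q := by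
  obtain ⟨Q, hQ, h2⟩ := CStarAlgebra.isStrictlyPositive_iff_exists_isStrictlyPositive_and_eq_mul_self.1
    h.isStrictlyPositive
  exact ⟨Q, Matrix.isStrictlyPositive_iff_posDef.1 hQ, h2⟩
theorem pr_tr (a B : Matrix (Fin n) (Fin n) ℝ) : pr a B = (a.transpose * B).trace := by
  simp only [pr, Matrix.trace, Matrix.diag, Matrix.mul_apply, Matrix.transpose_apply]
  exact Finset.sum_comm
theorem pr_comm (a B : Matrix (Fin n) (Fin n) ℝ) : pr a B = pr B a := by simp [pr, mul_comm]
theorem sym_t {M : Matrix (Fin n) (Fin n) ℝ} (h : M.IsHermitian) : M.transpose = M := by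
  rw [← Matrix.conjTranspose_eq_transpose_of_trivial]; exact h.eq
open scoped MatrixOrder in
theorem pr_psd {A P : Matrix (Fin n) (Fin n) ℝ} (hA : A.PosSemidef) (hP : P.PosSemidef) : 0 ≤ pr A P := by
  obtain ⟨B, rfl⟩ := CStarAlgebra.nonneg_iff_eq_star_mul_self.mp hP.nonneg
  rw [pr_tr, sym_t hA.1, Matrix.star_eq_conjTranspose, ← Matrix.mul_assoc, Matrix.trace_mul_comm, ← Matrix.mul_assoc]
  exact (hA.mul_mul_conjTranspose_same B).trace_nonneg
theorem logdet_le {M M' : Matrix (Fin n) (Fin n) ℝ} (h : M.PosDef) (h' : M'.PosDef) :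
    Real.log M'.det ≤ Real.log M.det + pr M⁻¹ (M' - M) := by
  obtain ⟨Q, hQ, hM⟩ := pd_sqrt h
  have hd := hQ.det_pos
  have hu : IsUnit Q.det := hd.ne'.isUnit
  have hN : (Q⁻¹ * M' * Q⁻¹).PosDef := by
    have := h'.mul_mul_conjTranspose_same (B := Q⁻¹) (Matrix.vecMul_injective_of_isUnit (by
      rw [Matrix.isUnit_nonsing_inv_iff]; exact hQ.isUnit))
    rwa [hQ.1.inv.eq] at this
  have e1 : (Q⁻¹ * M' * Q⁻¹).det = M'.det / M.det := by
    rw [hM, Matrix.det_mul, Matrix.det_mul, Matrix.det_mul, Matrix.det_nonsing_inv, Ring.inverse_eq_inv']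
    field_simp
  have e2 : (Q⁻¹ * M' * Q⁻¹).trace = pr M⁻¹ M' := by
    rw [pr_tr, sym_t h.1.inv, Matrix.trace_mul_comm, hM, Matrix.mul_inv_rev, Matrix.mul_assoc]
  have e3 : pr M⁻¹ M = n := by
    rw [pr_tr, sym_t h.1.inv, Matrix.nonsing_inv_mul _ h.det_pos.ne'.isUnit]; simp
  have h1 : Real.log (Q⁻¹ * M' * Q⁻¹).det ≤ (Q⁻¹ * M' * Q⁻¹).trace - n := by
    rw [hN.1.det_eq_prod_eigenvalues, hN.1.trace_eq_sum_eigenvalues]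
    simp only [RCLike.ofReal_real_eq_id, id]
    rw [Real.log_prod fun i _ => (hN.eigenvalues_pos i).ne']
    have : (n : ℝ) = ∑ i : Fin n, 1 := by simp
    rw [this, ← Finset.sum_sub_distrib]
    exact Finset.sum_le_sum fun i _ => Real.log_le_sub_one_of_pos (hN.eigenvalues_pos i)
  rw [e1, Real.log_div h'.det_pos.ne' h.det_pos.ne', e2] at h1
  rw [pr_sub, e3]; linarith
theorem pr_one (P : Matrix (Fin n) (Fin n) ℝ) : pr 1 P = P.trace := by rw [pr_tr]; simp
theorem pr_subl (a b P : Matrix (Fin n) (Fin n) ℝ) : pr (a - b) P = pr a P - pr b P := by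
  rw [pr_comm, pr_sub, pr_comm P, pr_comm P]
theorem pr_smull (c : ℝ) (a P : Matrix (Fin n) (Fin n) ℝ) : pr (c • a) P = c * pr a P := by
  rw [pr_comm, pr_smul, pr_comm P]
theorem ell_inv {M : Matrix (Fin n) (Fin n) ℝ} {δ : ℝ} (hδ : 0 < δ) (h : M.PosDef)
    (h1 : (M - δ • (1 : Matrix (Fin n) (Fin n) ℝ)).PosSemidef) (h2 : (1 - M).PosSemidef) : Ell 1 δ⁻¹ M⁻¹ := by
  obtain ⟨Q, hQ, hM⟩ := pd_sqrt h
  have hu : IsUnit Q.det := hQ.det_pos.ne'.isUnit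
  have c : ∀ {B : Matrix (Fin n) (Fin n) ℝ}, B.PosSemidef → (Q⁻¹ * B * Q⁻¹).PosSemidef := fun hB => by
    have := hB.mul_mul_conjTranspose_same Q⁻¹
    rwa [hQ.1.inv.eq] at this
  have e1 : Q⁻¹ * M * Q⁻¹ = 1 := by
    rw [hM, ← Matrix.mul_assoc, Matrix.nonsing_inv_mul _ hu, Matrix.one_mul, Matrix.mul_nonsing_inv _ hu]
  have e2 : Q⁻¹ * Q⁻¹ = M⁻¹ := by rw [hM, Matrix.mul_inv_rev]
  have k1 := c h1
  have k2 := c h2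
  simp only [Matrix.mul_sub, Matrix.sub_mul, e1, Matrix.mul_one, e2, Matrix.mul_smul, Matrix.smul_mul] at k1 k2
  intro P hP
  have g1 := pr_psd k1 hP
  have g2 := pr_psd k2 hP
  rw [pr_subl, pr_one] at g1 g2
  rw [pr_smull] at g1
  refine ⟨by linarith, ?_⟩
  rw [inv_mul_eq_div, le_div_iff₀ hδ]; linarith
theorem quad_le_trace {A : Matrix (Fin n) (Fin n) ℝ} (hA : A.PosSemidef) (ξ : EV n) :
    ∑ i, ∑ j, ξ i * ξ j * A i j ≤ A.trace * ‖ξ‖ ^ 2 := by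
  have h : (‖ξ‖ ^ 2 • (1 : Matrix (Fin n) (Fin n) ℝ) - outer ξ).PosSemidef := by
    refine psd_of_quad (fun i j => ?_) fun η => ?_
    · simp [outer, Matrix.one_apply, eq_comm, mul_comm]
    · have e : ∑ i, ∑ j, η i * η j * (‖ξ‖ ^ 2 • (1 : Matrix (Fin n) (Fin n) ℝ) - outer ξ) i j =
          ‖ξ‖ ^ 2 * ‖η‖ ^ 2 - ⟪ξ, η⟫ ^ 2 := by
        simp only [outer, Matrix.sub_apply, Matrix.smul_apply, Matrix.one_apply, Matrix.of_apply, mul_sub,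
          Finset.sum_sub_distrib, smul_eq_mul, mul_ite, mul_one, mul_zero, Finset.sum_ite_eq,
          Finset.mem_univ, if_true]
        congr 1
        · rw [EuclideanSpace.norm_sq_eq η, Finset.mul_sum]
          exact Finset.sum_congr rfl fun i _ => by simp; ring
        · rw [PiLp.inner_apply, sq, Finset.sum_mul_sum]
          exact Finset.sum_congr rfl fun i _ => Finset.sum_congr rfl fun j _ => by simp; ring
      rw [e]
      have := abs_real_inner_le_norm ξ η
      nlinarith [sq_abs ⟪ξ, η⟫, abs_nonneg ⟪ξ, η⟫]
  have := pr_psd h hA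
  rw [pr_subl, pr_smull, pr_one] at this
  have e : pr (outer ξ) A = ∑ i, ∑ j, ξ i * ξ j * A i j := rfl
  rw [← e]; linarith
theorem two_sided {l L t o : ℝ} (hl : 0 < l) (ht0 : 0 ≤ t) {a P : Matrix (Fin n) (Fin n) ℝ} (ha : Ell l L a)
    (hs : ∀ i j, P i j = P j i) (ht : ∀ ξ : EV n, ∑ i, ∑ j, ξ i * ξ j * P i j ≤ t * ‖ξ‖ ^ 2)
    (ho : -o ≤ pr a P) (ξ : EV n) :
    (t - (n * L * t + o) / l) * ‖ξ‖ ^ 2 ≤ ∑ i, ∑ j, ξ i * ξ j * P i j := by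
  have e : ∀ ξ : EV n, ∑ i, ∑ j, ξ i * ξ j * (t • (1 : Matrix (Fin n) (Fin n) ℝ) - P) i j =
      t * ‖ξ‖ ^ 2 - ∑ i, ∑ j, ξ i * ξ j * P i j := by
    intro ξ
    simp only [Matrix.sub_apply, Matrix.smul_apply, Matrix.one_apply, mul_sub,
          Finset.sum_sub_distrib, smul_eq_mul, mul_ite, mul_one, mul_zero, Finset.sum_ite_eq,
          Finset.mem_univ, if_true]
    rw [EuclideanSpace.norm_sq_eq ξ, Finset.mul_sum]
    congr 1
    exact Finset.sum_congr rfl fun i _ => by simp; ring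
  have hp : (t • (1 : Matrix (Fin n) (Fin n) ℝ) - P).PosSemidef := by
    refine psd_of_quad (fun i j => ?_) fun ξ => ?_
    · simp [Matrix.one_apply, eq_comm, hs i j]
    · rw [e]; linarith [ht ξ]
  have h1 := (ha _ hp).1
  have h2 := quad_le_trace hp ξ
  have h3 := (ha 1 Matrix.PosSemidef.one).2
  simp only [Matrix.trace_one, Fintype.card_fin] at h3
  rw [pr_sub, pr_smul] at h1
  have h4 := mul_le_mul_of_nonneg_left h3 ht0
  have h5 : (t • (1 : Matrix (Fin n) (Fin n) ℝ) - P).trace ≤ (n * L * t + o) / l := by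
    rw [le_div_iff₀ hl]; linarith
  have h6 := mul_le_mul_of_nonneg_right h5 (sq_nonneg ‖ξ‖)
  rw [e] at h2
  linarith
end
section
variable {n : ℕ}
theorem sm_inv {T : EV n → EV n} (hT : ContDiff ℝ 1 T) {c : ℝ} (hc : 0 < c)
    (h : ∀ x ξ, c * ‖ξ‖ ^ 2 ≤ ⟪fderiv ℝ T x ξ, ξ⟫) :
    (∀ x y, c * ‖x - y‖ ^ 2 ≤ ⟪T x - T y, x - y⟫) ∧ (∀ x y, c * ‖x - y‖ ≤ ‖T x - T y‖) ∧ ∃ X : EV n → EV n, (∀ y, T (X y) = y) ∧ (∀ x, X (T x) = x) ∧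
      ContDiff ℝ 1 X := by
  have hd : ∀ x, HasFDerivAt T (fderiv ℝ T x) x := fun x => (hT.differentiable (by simp) x).hasFDerivAt
  have mon : ∀ x y, c * ‖x - y‖ ^ 2 ≤ ⟪T x - T y, x - y⟫ := by
    intro x y
    set ξ := x - y
    have hg : ∀ t : ℝ, HasDerivAt (fun t : ℝ => ⟪T (y + t • ξ), ξ⟫ - t * (c * ‖ξ‖ ^ 2))
        (⟪fderiv ℝ T (y + t • ξ) ξ, ξ⟫ - c * ‖ξ‖ ^ 2) t := by
      intro t
      have h1 : HasDerivAt (fun t : ℝ => y + t • ξ) ξ t := by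
        simpa using ((hasDerivAt_id t).smul_const ξ).const_add y
      have h2 := ((hd _).comp_hasDerivAt t h1).inner ℝ (hasDerivAt_const t ξ)
      simpa using h2.fun_sub ((hasDerivAt_id t).mul_const (c * ‖ξ‖ ^ 2))
    have hm := monotone_of_hasDerivAt_nonneg hg (fun t => sub_nonneg.2 (h _ _)) (zero_le_one' ℝ)
    simp only [zero_smul, add_zero, one_smul, zero_mul, sub_zero, one_mul] at hm
    rw [show y + ξ = x by simp [ξ]] at hm
    rw [inner_sub_left]; linarith
  have mono : ∀ x y, c * ‖x - y‖ ≤ ‖T x - T y‖ := by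
    intro x y
    have h4 := (mon x y).trans (real_inner_le_norm _ _)
    set ξ := x - y
    rcases (norm_nonneg ξ).eq_or_lt with h0 | h0
    · rw [← h0]; simp
    · rw [sq, ← mul_assoc] at h4; exact le_of_mul_le_mul_right h4 h0
  refine ⟨mon, mono, ?_⟩
  have hinj : Function.Injective T := fun x y hxy => by
    have := mono x y
    rw [hxy, sub_self, norm_zero] at this
    exact sub_eq_zero.1 (norm_le_zero_iff.1 (nonpos_of_mul_nonpos_right this hc))
  have hL : ∀ x, ∃ e : EV n ≃L[ℝ] EV n, (e : EV n →L[ℝ] EV n) = fderiv ℝ T x := by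
    intro x
    have : Function.Injective (fderiv ℝ T x : EV n →ₗ[ℝ] EV n) := by
      refine (injective_iff_map_eq_zero _).2 fun ξ hξ => ?_
      have h1 := h x ξ
      rw [show fderiv ℝ T x ξ = 0 from hξ, inner_zero_left] at h1
      exact norm_eq_zero.1 (pow_eq_zero_iff (two_ne_zero) |>.1 (le_antisymm (nonpos_of_mul_nonpos_right h1 hc) (sq_nonneg _)))
    exact ⟨(LinearEquiv.ofInjectiveEndo _ this).toContinuousLinearEquiv, by ext; rfl⟩
  choose e he using hL
  have hopen : IsOpenMap T := isOpenMap_iff_nhds_le.2 fun x => by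
    have : HasStrictFDerivAt T (e x : EV n →L[ℝ] EV n) x := by
      rw [he]; exact hT.contDiffAt.hasStrictFDerivAt (by simp)
    exact (this.map_nhds_eq_of_equiv).ge
  have hanti : AntilipschitzWith (Real.toNNReal c⁻¹) T := AntilipschitzWith.of_le_mul_dist fun x y => by
    rw [dist_eq_norm, dist_eq_norm, Real.coe_toNNReal _ (by positivity), inv_mul_eq_div, le_div_iff₀ hc, mul_comm]
    exact mono x y
  have hcl : IsClosed (Set.range T) := by
    refine IsClosedMap.isClosed_range (f := T) (isProperMap_iff_isClosedMap_and_compact_fibers.1 ?_).2.1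
    refine isProperMap_iff_tendsto_cocompact.2 ⟨hT.continuous, ?_⟩
    refine hanti.tendsto_cobounded.mono_left ?_ |>.mono_right ?_
    · exact Metric.cobounded_eq_cocompact.ge
    · exact Metric.cobounded_eq_cocompact.le
  have hsurj : Function.Surjective T := by
    rw [← Set.range_eq_univ]
    exact IsClopen.eq_univ ⟨hcl, hopen.isOpen_range⟩ (Set.range_nonempty T)
  set H : EV n ≃ₜ EV n := (Equiv.ofBijective T ⟨hinj, hsurj⟩).toHomeomorphOfContinuousOpen hT.continuous hopen
  refine ⟨H.symm, fun y => H.apply_symm_apply y, fun x => H.symm_apply_apply x, ?_⟩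
  exact H.contDiff_symm (f₀' := e) (fun a => by rw [he]; exact hd a) hT
end
section
variable {n : ℕ}
theorem legendre {w : EV n → ℝ} (hw : ContDiff ℝ 2 w) {c : ℝ} (hc : 0 < c)
    (h : ∀ x ξ, ξ ≠ 0 → c * ‖ξ‖ ^ 2 < fderiv ℝ (fderiv ℝ w) x ξ ξ) :
    ∃ (X : EV n → EV n) (v : EV n → ℝ), ContDiff ℝ 2 v ∧ ContDiff ℝ 1 X ∧ (∀ y, gmap (fderiv ℝ w (X y)) = y) ∧
      (∀ x, X (gmap (fderiv ℝ w x)) = x) ∧ (∀ y y', c * ‖X y - X y'‖ ≤ ‖y - y'‖) ∧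
      (∀ y, gmap (fderiv ℝ v y) = y - c • X y) ∧
      (∀ y, hess v y = 1 - c • (hess w (X y))⁻¹ ∧ (hess v y).PosDef ∧ IsUnit (hess w (X y)).det) ∧
      (∀ y ξ, fderiv ℝ (fderiv ℝ v) y ξ ξ ≤ ‖ξ‖ ^ 2) ∧ ∀ x z, w x + fderiv ℝ w x (z - x) ≤ w z := by
  have hw1 : ContDiff ℝ 1 (fderiv ℝ w) := hw.fderiv_right (by norm_num)
  have hW : ContDiff ℝ 1 fun x => gmap (fderiv ℝ w x) := gmap.contDiff.comp hw1
  have hdw : ∀ x, HasFDerivAt w (fderiv ℝ w x) x := fun x => (hw.differentiable (by simp) x).hasFDerivAt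
  have hW' : ∀ x, HasFDerivAt (fun x => gmap (fderiv ℝ w x)) (gmap.comp (fderiv ℝ (fderiv ℝ w) x)) x := fun x =>
    gmap.hasFDerivAt.comp x (hw1.differentiable (by simp) x).hasFDerivAt
  have h' : ∀ x ξ, c * ‖ξ‖ ^ 2 ≤ fderiv ℝ (fderiv ℝ w) x ξ ξ := fun x ξ => by
    by_cases h0 : ξ = 0
    · simp [h0]
    · exact (h x ξ h0).le
  obtain ⟨m1, m2, X, hX1, hX2, hX⟩ := sm_inv hW hc (fun x ξ => by
    rw [(hW' x).fderiv, ContinuousLinearMap.comp_apply, inner_gmap]; exact h' x ξ)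
  have hX' : ∀ y, HasFDerivAt X (fderiv ℝ X y) y := fun y => (hX.differentiable (by simp) y).hasFDerivAt
  set v : EV n → ℝ := fun y => ‖y‖ ^ 2 / 2 - c * (⟪X y, y⟫ - w (X y)) with hv
  have hv1 : ∀ y, HasFDerivAt v (innerSL ℝ (y - c • X y)) y := by
    intro y
    have e1 : HasFDerivAt (fun y : EV n => ‖y‖ ^ 2 / 2) ((1/2 : ℝ) • (2 • innerSL ℝ y)) y := by
      have := ((hasFDerivAt_id y).norm_sq).const_smul (1/2:ℝ)
      refine this.congr_of_eventuallyEq (Eventually.of_forall fun z => ?_) |>.congr_fderiv ?_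
      · simp; ring
      · simp
    have e2 := (hX' y).inner ℝ (hasFDerivAt_id y)
    have e3 := (hdw (X y)).comp y (hX' y)
    refine (e1.fun_sub ((e2.fun_sub e3).const_mul c)).congr_fderiv ?_
    ext ξ
    have := inner_gmap (fderiv ℝ w (X y)) (fderiv ℝ X y ξ)
    rw [hX1 y] at this
    simp [inner_sub_left, inner_smul_left, ← this]
    left
    rw [real_inner_comm y]; ring
  have hv2 : fderiv ℝ v = fun y => innerSL ℝ (y - c • X y) := funext fun y => (hv1 y).fderiv
  have hvc : ContDiff ℝ 2 v := by
    rw [show (2 : WithTop ℕ∞) = 1 + 1 by norm_num, contDiff_succ_iff_fderiv]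
    refine ⟨fun y => (hv1 y).differentiableAt, by simp, ?_⟩
    rw [hv2]; exact (innerSL ℝ).contDiff.comp (contDiff_id.sub (hX.const_smul c))
  have hv3 : ∀ y ξ η, fderiv ℝ (fderiv ℝ v) y ξ η = ⟪ξ - c • fderiv ℝ X y ξ, η⟫ := by
    intro y ξ η
    have : HasFDerivAt (fderiv ℝ v) ((innerSL ℝ).comp (ContinuousLinearMap.id ℝ (EV n) - c • fderiv ℝ X y)) y := by
      rw [hv2]
      exact (innerSL ℝ).hasFDerivAt.comp y ((hasFDerivAt_id y).fun_sub ((hX' y).fun_const_smul c))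
    rw [this.fderiv]; rfl
  have hJ : ∀ y ξ η, fderiv ℝ (fderiv ℝ w) (X y) (fderiv ℝ X y ξ) η = ⟪ξ, η⟫ := by
    intro y ξ η
    have e1 := ((hW' (X y)).comp y (hX' y))
    have e2 : (fun x => gmap (fderiv ℝ w x)) ∘ X = id := funext hX1
    rw [e2] at e1
    have e3 := e1.unique (hasFDerivAt_id y)
    have e4 := congrArg (fun T : EV n →L[ℝ] EV n => ⟪T ξ, η⟫) e3
    simpa [inner_gmap] using e4
  refine ⟨X, v, hvc, hX, hX1, hX2, fun y y' => ?_, fun y => ?_, fun y => ?_, fun y ξ => ?_, fun x z => ?_⟩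
  · have := m2 (X y) (X y'); simpa only [hX1] using this
  · rw [hv2]; exact gmap_inner _
  · have hJH : (Matrix.of fun i j => fderiv ℝ X y (ee i) j) * hess w (X y) = 1 := by
      ext i j
      have e1 := hJ y (ee i) (ee j)
      rw [hess_quad] at e1
      simp only [Matrix.mul_apply, Matrix.of_apply]
      have e2 : ∀ k, ∑ l, (fderiv ℝ X y (ee i)) k * (ee j : EV n) l * hess w (X y) k l =
          (fderiv ℝ X y (ee i)) k * hess w (X y) k j := fun k => by
        rw [Finset.sum_eq_single j]
        · simp [ee]
        · intro l _ hl; simp [ee, hl]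
        · simp
      rw [← Finset.sum_congr rfl fun k _ => e2 k, e1]
      by_cases hij : i = j <;> simp [ee, PiLp.inner_apply, hij, Matrix.one_apply]
    have hH : hess v y = 1 - c • (hess w (X y))⁻¹ := by
      rw [Matrix.inv_eq_left_inv hJH]
      ext i j
      rw [hess_apply, hv3]
      simp [inner_sub_left, inner_smul_left, ee, Matrix.one_apply, EuclideanSpace.inner_single_right, Pi.single_apply, eq_comm]
    refine ⟨hH, ?_, Matrix.isUnit_det_of_left_inverse hJH⟩
    refine Matrix.PosDef.of_dotProduct_mulVec_pos ?_ fun η hη => ?_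
    · ext i j; simp [hess_symm hvc.contDiffAt i j]
    · set ξ : EV n := WithLp.toLp 2 η
      have e1 : star η ⬝ᵥ (hess v y).mulVec η = fderiv ℝ (fderiv ℝ v) y ξ ξ := by
        rw [hess_quad]; simp [dotProduct, Matrix.mulVec, Finset.mul_sum, ξ]
        refine Finset.sum_congr rfl fun i _ => Finset.sum_congr rfl fun j _ => by ring
      rw [e1, hv3]
      set θ := fderiv ℝ X y ξ
      have hξ : ξ ≠ 0 := fun h0 => hη (by simpa [ξ] using h0)
      have hθ : θ ≠ 0 := fun h0 => hξ (by
        have := hJ y ξ ξ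
        rw [show fderiv ℝ X y ξ = 0 from h0] at this
        simpa using this.symm)
      have e2 := h (X y) θ hθ
      rw [hJ] at e2
      have e3 : ⟪ξ - c • θ, ξ⟫ = ‖ξ - c • θ‖ ^ 2 + c * (⟪ξ, θ⟫ - c * ‖θ‖ ^ 2) := by
        rw [← real_inner_self_eq_norm_sq, ← real_inner_self_eq_norm_sq]
        simp only [inner_sub_left, inner_sub_right, inner_smul_left, inner_smul_right, RCLike.conj_to_real]
        rw [real_inner_comm θ ξ]; ring
      rw [e3]
      have := mul_pos hc (sub_pos.2 e2)
      positivity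
  · rw [hv3, inner_sub_left, real_inner_self_eq_norm_sq, inner_smul_left]
    have e1 := h' (X y) (fderiv ℝ X y ξ)
    rw [hJ, real_inner_comm] at e1
    have : 0 ≤ ⟪fderiv ℝ X y ξ, ξ⟫ := le_trans (by positivity) e1
    have := mul_nonneg hc.le this
    simp only [RCLike.conj_to_real]; linarith
  · set ξ := z - x
    have hg : ∀ t : ℝ, HasDerivAt (fun t : ℝ => w (x + t • ξ) - t * fderiv ℝ w x ξ)
        (fderiv ℝ w (x + t • ξ) ξ - fderiv ℝ w x ξ) t := by
      intro t
      have h1 : HasDerivAt (fun t : ℝ => x + t • ξ) ξ t := by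
        simpa using ((hasDerivAt_id t).smul_const ξ).const_add x
      simpa using ((hdw _).comp_hasDerivAt t h1).fun_sub ((hasDerivAt_id t).mul_const (fderiv ℝ w x ξ))
    have hm := monotoneOn_of_deriv_nonneg (convex_Icc (0:ℝ) 1) (fun t _ => (hg t).continuousAt.continuousWithinAt)
      (fun t _ => (hg t).differentiableAt.differentiableWithinAt) (fun t ht => by
        rw [(hg t).deriv]
        rw [interior_Icc] at ht
        have := m1 (x + t • ξ) x
        rw [add_sub_cancel_left, inner_smul_right, inner_sub_left, inner_gmap, inner_gmap] at this
        have := le_trans (by positivity) this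
        exact nonneg_of_mul_nonneg_right (by linarith) ht.1) (by simp : (0:ℝ) ∈ Set.Icc (0:ℝ) 1)
        (by simp : (1:ℝ) ∈ Set.Icc (0:ℝ) 1) zero_le_one
    simp only [zero_smul, add_zero, one_smul, zero_mul, sub_zero, one_mul] at hm
    rw [show x + ξ = z by simp [ξ]] at hm
    linarith
end
structure FP {n : ℕ} (f : EV n → ℝ) (finf ζ C R : ℝ) (m : ℕ) : Prop where
  C1 : 1 ≤ C
  R1 : 1 ≤ R
  bd : ∀ x, |f x| ≤ C
  cd : ∀ x, R ≤ ‖x‖ → ContDiffAt ℝ m f x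
  dec : ∀ x, R ≤ ‖x‖ → |f x - finf| ≤ C * ‖x‖ ^ (-ζ)
  itd : ∀ x, R ≤ ‖x‖ → ∀ k ≤ m, ‖iteratedFDeriv ℝ k (fun y => f y - finf) x‖ ≤ C * ‖x‖ ^ (-ζ - k)
  d1 : ∀ x, R ≤ ‖x‖ → ‖fderiv ℝ f x‖ ≤ C * ‖x‖ ^ (-ζ - 1)
  lip : ∀ x d, R ≤ ‖x‖ → ‖d‖ ≤ ‖x‖ / 2 → |f (x + d) - f x| ≤ C * ‖x‖ ^ (-ζ - 1) * ‖d‖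
  tay : ∀ x d, R ≤ ‖x‖ → ‖d‖ ≤ ‖x‖ / 2 → |f (x + d) - f x - fderiv ℝ f x d| ≤ C * ‖x‖ ^ (-ζ - 2) * ‖d‖ ^ 2
section
variable {n : ℕ}
theorem rpow_half {r s : ℝ} {ζ : ℝ} (hr : 0 < r) (hs : r / 2 ≤ s) (hz : 0 ≤ ζ) : s ^ (-ζ) ≤ 2 ^ ζ * r ^ (-ζ) := by
  refine (Real.rpow_le_rpow_of_nonpos (by positivity) hs (by linarith)).trans_eq ?_
  rw [Real.div_rpow hr.le (by norm_num), Real.rpow_neg (by norm_num : (0:ℝ) ≤ 2)]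
  field_simp
theorem fpack {m : ℕ} (hm : 2 ≤ m) {ζ : ℝ} (hζ : 2 < ζ) {f : EV n → ℝ} {finf : ℝ}
    (hf_cont : Continuous f)
    (hf_Cm : ∃ K : Set (EV n), IsCompact K ∧ ContDiffOn ℝ m f Kᶜ)
    (hf_lim : Tendsto f (cocompact _) (nhds finf))
    (hf_decay : ∀ k : ℕ, k ≤ m → ∃ C R : ℝ, 0 < C ∧ 0 < R ∧
      ∀ x : EV n, R ≤ ‖x‖ →
        ‖x‖ ^ (ζ + k) * ‖iteratedFDeriv ℝ k (fun y => f y - finf) x‖ ≤ C) : ∃ C R, FP f finf ζ C R m := by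
  obtain ⟨K, hK, hfK⟩ := hf_Cm
  obtain ⟨RK, hRK⟩ := hK.isBounded.subset_closedBall 0
  choose! Ck Rk hCk hRk hk using hf_decay
  obtain ⟨B, hB⟩ : ∃ B, ∀ x, |f x| ≤ B := by
    have h1 : ∀ᶠ x in cocompact (EV n), |f x - finf| < 1 := by
      have := hf_lim.eventually (Metric.ball_mem_nhds finf one_pos)
      filter_upwards [this] with x hx
      simpa [Real.dist_eq] using hx
    obtain ⟨K2, hK2, h2⟩ := mem_cocompact.1 h1
    obtain ⟨B, hB⟩ := hK2.exists_bound_of_continuousOn hf_cont.continuousOn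
    refine ⟨max B (|finf| + 1), fun x => ?_⟩
    by_cases hx : x ∈ K2
    · exact (hB x hx).trans (le_max_left _ _)
    · have := h2 hx
      simp only [Set.mem_setOf_eq] at this
      refine le_trans ?_ (le_max_right _ _)
      have := abs_sub_abs_le_abs_sub (f x) finf
      linarith
  set C0 := 1 + |B| + ∑ k ∈ Finset.range (m + 1), Ck k with hC0
  set R0 := 1 + |RK| + ∑ k ∈ Finset.range (m + 1), Rk k with hR0
  have hCle : ∀ k ≤ m, Ck k ≤ C0 := fun k hkm => by
    have := Finset.single_le_sum (f := Ck) (fun i hi => (hCk i (by simpa [Nat.lt_succ_iff] using hi)).le) (Finset.mem_range.2 (Nat.lt_succ_of_le hkm))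
    have := abs_nonneg B; linarith
  have hRle : ∀ k ≤ m, Rk k ≤ R0 := fun k hkm => by
    have := Finset.single_le_sum (f := Rk) (fun i hi => (hRk i (by simpa [Nat.lt_succ_iff] using hi)).le) (Finset.mem_range.2 (Nat.lt_succ_of_le hkm))
    have := abs_nonneg RK; linarith
  have hC1 : 1 ≤ C0 := by
    have := Finset.sum_nonneg (s := Finset.range (m+1)) (f := Ck) fun i hi => (hCk i (by simpa [Nat.lt_succ_iff] using hi)).le
    have := abs_nonneg B; linarith
  have hR1 : 1 ≤ R0 ∧ RK < R0 := by
    have := Finset.sum_nonneg (s := Finset.range (m+1)) (f := Rk) fun i hi => (hRk i (by simpa [Nat.lt_succ_iff] using hi)).le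
    have := abs_nonneg RK; have := le_abs_self RK; constructor <;> linarith
  have cd : ∀ x, R0 ≤ ‖x‖ → ContDiffAt ℝ m f x := fun x hx => by
    refine hfK.contDiffAt (hK.isClosed.isOpen_compl.mem_nhds fun hxK => ?_)
    have := hRK hxK; rw [mem_closedBall_zero_iff] at this; linarith [hR1.2]
  have itd : ∀ x, R0 ≤ ‖x‖ → ∀ k ≤ m, ‖iteratedFDeriv ℝ k (fun y => f y - finf) x‖ ≤ C0 * ‖x‖ ^ (-ζ - k) := by
    intro x hx k hkm
    have hx0 : 0 < ‖x‖ := by linarith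
    have h1 := (hk k hkm x ((hRle k hkm).trans hx)).trans (hCle k hkm)
    rw [show -ζ - (k:ℝ) = -(ζ + k) by ring, Real.rpow_neg hx0.le, ← div_eq_mul_inv, le_div_iff₀ (by positivity), mul_comm]
    exact h1
  have hfd : ∀ x, fderiv ℝ (fun y => f y - finf) x = fderiv ℝ f x := fun x => fderiv_sub_const _
  have d1 : ∀ x, R0 ≤ ‖x‖ → ‖fderiv ℝ f x‖ ≤ C0 * ‖x‖ ^ (-ζ - 1) := fun x hx => by
    have := itd x hx 1 (by omega)
    rw [← hfd, ← norm_iteratedFDeriv_one]; simpa using this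
  have d2 : ∀ x, R0 ≤ ‖x‖ → ‖fderiv ℝ (fderiv ℝ f) x‖ ≤ C0 * ‖x‖ ^ (-ζ - 2) := fun x hx => by
    have := itd x hx 2 hm
    rw [← norm_iteratedFDeriv_fderiv, norm_iteratedFDeriv_one, funext hfd] at this; simpa using this
  set D := C0 * 2 ^ (ζ + 2) with hD
  have hp : (1:ℝ) ≤ 2 ^ (ζ + 2) := Real.one_le_rpow (by norm_num) (by linarith)
  have hCD : C0 ≤ D := le_mul_of_one_le_right (by linarith) hp
  have seg : ∀ x : EV n, 2 * R0 ≤ ‖x‖ → ∀ y ∈ Metric.closedBall x (‖x‖ / 2), ‖x‖ / 2 ≤ ‖y‖ ∧ R0 ≤ ‖y‖ := fun x hx y hy => by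
    rw [mem_closedBall_iff_norm'] at hy
    have := norm_sub_norm_le x y
    constructor <;> linarith
  have d1' : ∀ x, 2 * R0 ≤ ‖x‖ → ∀ y ∈ Metric.closedBall x (‖x‖ / 2), ‖fderiv ℝ f y‖ ≤ D * ‖x‖ ^ (-ζ - 1) := fun x hx y hy => by
    obtain ⟨h1, h2⟩ := seg x hx y hy
    refine (d1 y h2).trans ?_
    rw [hD, mul_assoc, show -ζ - 1 = -(ζ + 1) by ring]
    refine mul_le_mul_of_nonneg_left ((rpow_half (by linarith) h1 (by linarith)).trans ?_) (by linarith)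
    gcongr <;> norm_num
  have d2' : ∀ x, 2 * R0 ≤ ‖x‖ → ∀ y ∈ Metric.closedBall x (‖x‖ / 2), ‖fderiv ℝ (fderiv ℝ f) y‖ ≤ D * ‖x‖ ^ (-ζ - 2) := fun x hx y hy => by
    obtain ⟨h1, h2⟩ := seg x hx y hy
    refine (d2 y h2).trans ?_
    rw [hD, mul_assoc, show -ζ - 2 = -(ζ + 2) by ring]
    exact mul_le_mul_of_nonneg_left (rpow_half (by linarith) h1 (by linarith)) (by linarith)
  have hm1 : (m : WithTop ℕ∞) ≠ 0 := by
    simp; omega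
  have hda : ∀ y, R0 ≤ ‖y‖ → DifferentiableAt ℝ f y := fun y hy => (cd y hy).differentiableAt hm1
  have hda2 : ∀ y, R0 ≤ ‖y‖ → DifferentiableAt ℝ (fderiv ℝ f) y := fun y hy =>
    ((cd y hy).fderiv_right (m := 1) (by exact_mod_cast hm)).differentiableAt (by simp)
  refine ⟨D, 2 * R0, ⟨hC1.trans hCD, by linarith [hR1.1], fun x => (hB x).trans ?_, fun x hx => cd x (by linarith [hR1.1]), fun x hx => ?_,
    fun x hx k hk => (itd x (by linarith [hR1.1]) k hk).trans (by gcongr), fun x hx => (d1 x (by linarith [hR1.1])).trans (by gcongr), fun x d hx hd => ?_, fun x d hx hd => ?_⟩⟩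
  · have := Finset.sum_nonneg (s := Finset.range (m+1)) (f := Ck) fun i hi => (hCk i (by simpa [Nat.lt_succ_iff] using hi)).le
    have := le_abs_self B; linarith
  · have := itd x (by linarith [hR1.1]) 0 (by omega)
    rw [norm_iteratedFDeriv_zero] at this
    simp only [Real.norm_eq_abs, Nat.cast_zero, sub_zero] at this
    exact this.trans (by gcongr)
  · have := (convex_closedBall x (‖x‖ / 2)).norm_image_sub_le_of_norm_fderiv_le (𝕜 := ℝ) (f := f)
      (fun y hy => hda y (seg x hx y hy).2) (d1' x hx) (x := x) (y := x + d) (Metric.mem_closedBall_self (by positivity)) (by simpa [mem_closedBall_iff_norm] using hd)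
    simpa using this
  · have hsub : Metric.closedBall x ‖d‖ ⊆ Metric.closedBall x (‖x‖ / 2) := Metric.closedBall_subset_closedBall hd
    have h2 : ∀ y ∈ Metric.closedBall x ‖d‖, ‖fderiv ℝ f y - fderiv ℝ f x‖ ≤ D * ‖x‖ ^ (-ζ - 2) * ‖d‖ := fun y hy => by
      have := (convex_closedBall x (‖x‖ / 2)).norm_image_sub_le_of_norm_fderiv_le (𝕜 := ℝ) (f := fderiv ℝ f)
        (fun y hy => hda2 y (seg x hx y hy).2) (d2' x hx) (x := x) (y := y) (Metric.mem_closedBall_self (by positivity)) (hsub hy)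
      refine this.trans ?_
      rw [mem_closedBall_iff_norm] at hy
      gcongr
    have := (convex_closedBall x ‖d‖).norm_image_sub_le_of_norm_fderiv_le' (𝕜 := ℝ) (f := f) (φ := fderiv ℝ f x)
      (fun y hy => hda y (seg x hx y (hsub hy)).2) h2 (x := x) (y := x + d) (by simp) (by simp)
    rw [add_sub_cancel_left, mul_assoc, ← sq] at this
    simpa using this
end
def qf {n : ℕ} (M : Matrix (Fin n) (Fin n) ℝ) (ξ : EV n) : ℝ := ∑ i, ∑ j, ξ i * ξ j * M i j
noncomputable def sd {n : ℕ} (v : EV n → ℝ) (h : ℝ) (e y : EV n) : ℝ := (h ^ 2)⁻¹ * (v (y + h • e) + v (y - h • e) - 2 * v y)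
section
variable {n : ℕ}
theorem qf_hess (u : EV n → ℝ) (x ξ : EV n) : qf (hess u x) ξ = fderiv ℝ (fderiv ℝ u) x ξ ξ := (hess_quad u x ξ ξ).symm
theorem qf_eq (M : Matrix (Fin n) (Fin n) ℝ) (ξ : EV n) : qf M ξ = pr M (outer ξ) := by
  simp only [qf, pr, outer, Matrix.of_apply]
  exact Finset.sum_congr rfl fun i _ => Finset.sum_congr rfl fun j _ => by ring
theorem qf_add (M N : Matrix (Fin n) (Fin n) ℝ) (ξ : EV n) : qf (M + N) ξ = qf M ξ + qf N ξ := by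
  simp only [qf_eq, pr_comm _ (outer ξ), pr_add]
theorem qf_sub (M N : Matrix (Fin n) (Fin n) ℝ) (ξ : EV n) : qf (M - N) ξ = qf M ξ - qf N ξ := by
  simp only [qf_eq, pr_comm _ (outer ξ), pr_sub]
theorem qf_smul (c : ℝ) (M : Matrix (Fin n) (Fin n) ℝ) (ξ : EV n) : qf (c • M) ξ = c * qf M ξ := by
  simp only [qf_eq, pr_comm _ (outer ξ), pr_smul]
theorem qf_one (ξ : EV n) : qf (1 : Matrix (Fin n) (Fin n) ℝ) ξ = ‖ξ‖ ^ 2 := by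
  rw [qf_eq, pr_one, outer_trace]
theorem qf_dot (M : Matrix (Fin n) (Fin n) ℝ) (v : Fin n → ℝ) : star v ⬝ᵥ M.mulVec v = qf M (WithLp.toLp 2 v) := by
  simp [qf, dotProduct, Matrix.mulVec, Finset.mul_sum]
  exact Finset.sum_congr rfl fun i _ => Finset.sum_congr rfl fun j _ => by ring
theorem qf_psd {M : Matrix (Fin n) (Fin n) ℝ} (h : M.PosSemidef) (ξ : EV n) : 0 ≤ qf M ξ := by
  have := h.dotProduct_mulVec_nonneg (WithLp.ofLp ξ); rwa [qf_dot] at this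
theorem qf_pd {M : Matrix (Fin n) (Fin n) ℝ} (h : M.PosDef) {ξ : EV n} (h0 : ξ ≠ 0) : 0 < qf M ξ := by
  have := h.dotProduct_mulVec_pos (x := WithLp.ofLp ξ) (fun h1 => h0 (by ext i; exact congrFun h1 i)); rwa [qf_dot] at this
theorem pd_of_qf {M : Matrix (Fin n) (Fin n) ℝ} (hs : ∀ i j, M i j = M j i) (h : ∀ ξ : EV n, ξ ≠ 0 → 0 < qf M ξ) : M.PosDef := by
  refine Matrix.PosDef.of_dotProduct_mulVec_pos ?_ fun v hv => ?_
  · ext i j; simp [hs i j]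
  · rw [qf_dot]; exact h _ fun h1 => hv (by simpa using h1)
theorem eig_lb {M : Matrix (Fin n) (Fin n) ℝ} (hM : M.PosDef) (h1 : (1 - M).PosSemidef) :
    (M - M.det • (1 : Matrix (Fin n) (Fin n) ℝ)).PosSemidef := by
  have hs : ∀ t : ℝ, (M - t • (1 : Matrix (Fin n) (Fin n) ℝ)).IsHermitian := fun t =>
    hM.1.sub (by rw [Matrix.IsHermitian, Matrix.conjTranspose_smul]; simp)
  have hle : ∀ i, hM.1.eigenvalues i ≤ 1 := fun i => by
    by_contra hc
    have h2 : hM.1.eigenvalues i ∈ spectrum ℝ M := by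
      rw [hM.1.spectrum_real_eq_range_eigenvalues]; exact ⟨i, rfl⟩
    have h3 : 1 - hM.1.eigenvalues i ∈ spectrum ℝ (1 - M) := by
      have := spectrum.singleton_sub_eq M (1:ℝ)
      rw [map_one] at this; rw [← this]
      exact Set.sub_mem_sub rfl h2
    rw [h1.1.spectrum_real_eq_range_eigenvalues] at h3
    obtain ⟨j, hj⟩ := h3
    have := h1.eigenvalues_nonneg j
    linarith
  refine (hs _).posSemidef_iff_eigenvalues_nonneg.2 fun i => ?_
  have h2 : (hs M.det).eigenvalues i ∈ spectrum ℝ (M - M.det • (1 : Matrix (Fin n) (Fin n) ℝ)) := by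
    rw [(hs _).spectrum_real_eq_range_eigenvalues]; exact ⟨i, rfl⟩
  replace h2 : (hs M.det).eigenvalues i ∈ spectrum ℝ (M - algebraMap ℝ (Matrix (Fin n) (Fin n) ℝ) M.det) := by
    rw [Algebra.algebraMap_eq_smul_one]; exact h2
  rw [← spectrum.sub_singleton_eq, hM.1.spectrum_real_eq_range_eigenvalues] at h2
  obtain ⟨_, ⟨j, rfl⟩, _, rfl, h4⟩ := h2
  have h5 : M.det ≤ hM.1.eigenvalues j := by
    rw [hM.1.det_eq_prod_eigenvalues]
    simp only [RCLike.ofReal_real_eq_id, id]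
    rw [← Finset.mul_prod_erase _ _ (Finset.mem_univ j)]
    exact mul_le_of_le_one_right (hM.eigenvalues_pos j).le (Finset.prod_le_one (fun i _ => (hM.eigenvalues_pos i).le) fun i _ => hle i)
  simp only [Pi.zero_apply]; rw [← h4]; simpa using h5
theorem hess_tr {v : EV n → ℝ} (hv : ContDiff ℝ 2 v) (c y : EV n) : hess (fun y => v (y + c)) y = hess v (y + c) := by
  have := hess_scale hv c 1 y
  simpa [add_comm c] using this
theorem sd_cd {v : EV n → ℝ} (hv : ContDiff ℝ 2 v) (h : ℝ) (e : EV n) : ContDiff ℝ 2 (sd v h e) := by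
  unfold sd; fun_prop
theorem sd_hess {v : EV n → ℝ} (hv : ContDiff ℝ 2 v) (h : ℝ) (e y : EV n) :
    hess (sd v h e) y = (h ^ 2)⁻¹ • (hess v (y + h • e) + hess v (y - h • e) - (2:ℝ) • hess v y) := by
  have h1 : ContDiff ℝ 2 fun y => v (y + h • e) := by fun_prop
  have h2 : ContDiff ℝ 2 fun y => v (y + -(h • e)) := by fun_prop
  have e1 : sd v h e = fun y => (h ^ 2)⁻¹ * ((v (y + h • e) + 1 * v (y + -(h • e))) + (-2) * v y) := by
    ext y; simp only [sd, sub_eq_add_neg]; ring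
  rw [e1, hess_cmul (by fun_prop), hess_lin (by fun_prop) hv.contDiffAt, hess_lin h1.contDiffAt h2.contDiffAt, hess_tr hv, hess_tr hv]
  simp [sub_eq_add_neg]
theorem sd_fderiv {v : EV n → ℝ} (hv : ContDiff ℝ 2 v) (h : ℝ) (e y : EV n) :
    fderiv ℝ (sd v h e) y = (h ^ 2)⁻¹ • (fderiv ℝ v (y + h • e) + fderiv ℝ v (y - h • e) - (2:ℝ) • fderiv ℝ v y) := by
  have hd : ∀ y, HasFDerivAt v (fderiv ℝ v y) y := fun y => (hv.differentiable (by simp) y).hasFDerivAt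
  have h1 : HasFDerivAt (fun y => v (y + h • e)) (fderiv ℝ v (y + h • e)) y :=
    (hasFDerivAt_comp_add_right _).2 (hd _)
  have h2 : HasFDerivAt (fun y => v (y - h • e)) (fderiv ℝ v (y - h • e)) y :=
    (hasFDerivAt_comp_sub _).2 (hd _)
  exact (((h1.fun_add h2).fun_sub ((hd y).const_mul 2)).const_mul _).fderiv
end
structure VS {n : ℕ} (v F : EV n → ℝ) (Fi δ C R ζ : ℝ) : Prop where
  C1 : 1 ≤ C
  R1 : 1 ≤ R
  z2 : 2 < ζ
  d0 : 0 < δ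
  cd : ContDiff ℝ 2 v
  Fc : Continuous F
  pd : ∀ y, (hess v y).PosDef
  ell : ∀ y, Ell 1 δ⁻¹ (hess v y)⁻¹
  lo : ∀ y ξ, δ * ‖ξ‖ ^ 2 ≤ qf (hess v y) ξ
  hi : ∀ y ξ, qf (hess v y) ξ ≤ ‖ξ‖ ^ 2
  eq : ∀ y, Real.log (hess v y).det = F y
  bd : ∀ y, |F y| ≤ C
  dec : ∀ y, R ≤ ‖y‖ → |F y - Fi| ≤ C * ‖y‖ ^ (-ζ)
  lip : ∀ y y', R ≤ ‖y‖ → ‖y' - y‖ ≤ ‖y‖ / 2 → |F y' - F y| ≤ C * ‖y‖ ^ (-ζ - 1) * ‖y' - y‖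
  sub : ∀ y, R ≤ ‖y‖ → ∃ b : EV n, ‖b‖ ≤ C * ‖y‖ ^ (-ζ - 1) ∧ ∀ e : EV n, ‖e‖ = 1 → ∀ h, 0 < h → h ≤ 1 →
    -(C * ‖y‖ ^ (-ζ - 2)) ≤ pr (hess v y)⁻¹ (hess (sd v h e) y) + fderiv ℝ (sd v h e) y b
section
variable {n : ℕ}
theorem grow {w : EV n → ℝ} {Cg : ℝ} (hC : 0 ≤ Cg) (h1 : ∀ x, w x ≤ Cg * (1 + ‖x‖ ^ 2))
    (h2 : ∀ x z, w x + fderiv ℝ w x (z - x) ≤ w z) : ∃ B, 1 ≤ B ∧ ∀ x, ‖gmap (fderiv ℝ w x)‖ ≤ B * (1 + ‖x‖) := by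
  refine ⟨1 + 5 * Cg + |w 0| + ‖fderiv ℝ w 0‖, by positivity |> fun (h : 0 ≤ 5 * Cg + |w 0| + ‖fderiv ℝ w 0‖) => by linarith, fun x => ?_⟩
  set y := gmap (fderiv ℝ w x)
  by_cases hy : y = 0
  · rw [hy, norm_zero]; positivity
  have hy0 : 0 < ‖y‖ := norm_pos_iff.2 hy
  set s := 1 + ‖x‖ with hs
  have hx := norm_nonneg x
  have e1 := h2 x (x + (s / ‖y‖) • y)
  rw [add_sub_cancel_left, map_smul, ← inner_gmap, real_inner_self_eq_norm_sq, smul_eq_mul] at e1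
  have e2 : s / ‖y‖ * ‖y‖ ^ 2 = s * ‖y‖ := by field_simp
  have e3 : ‖x + (s / ‖y‖) • y‖ ≤ 2 * s := by
    refine (norm_add_le _ _).trans ?_
    rw [norm_smul, Real.norm_of_nonneg (by positivity), div_mul_cancel₀ _ hy0.ne']; linarith
  have e4 := h1 (x + (s / ‖y‖) • y)
  have e5 : ‖x + (s / ‖y‖) • y‖ ^ 2 ≤ 4 * s ^ 2 := by
    calc _ ≤ (2 * s) ^ 2 := by gcongr
      _ = _ := by ring
  have e6 := h2 0 x
  rw [sub_zero] at e6
  have e7 := (fderiv ℝ w 0).le_opNorm x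
  rw [Real.norm_eq_abs] at e7
  have e8 := neg_abs_le (fderiv ℝ w 0 x)
  have e9 := neg_abs_le (w 0)
  have s1 : 1 ≤ s := by linarith
  have s2 : s ≤ s ^ 2 := by rw [sq]; exact le_mul_of_one_le_left (by linarith) s1
  have f1 : Cg * (1 + ‖x + (s / ‖y‖) • y‖ ^ 2) ≤ 5 * Cg * s ^ 2 := by
    have : Cg * (1 + ‖x + (s / ‖y‖) • y‖ ^ 2) ≤ Cg * (s ^ 2 + 4 * s ^ 2) := by gcongr; linarith
    linarith
  have f2 : |w 0| ≤ |w 0| * s ^ 2 := le_mul_of_one_le_right (abs_nonneg _) (by linarith)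
  have f3 : ‖fderiv ℝ w 0‖ * ‖x‖ ≤ ‖fderiv ℝ w 0‖ * s ^ 2 := by gcongr; linarith
  have f4 : s * ‖y‖ ≤ s * ((1 + 5 * Cg + |w 0| + ‖fderiv ℝ w 0‖) * s) := by
    have : s * ((1 + 5 * Cg + |w 0| + ‖fderiv ℝ w 0‖) * s) = s ^ 2 + 5 * Cg * s ^ 2 + |w 0| * s ^ 2 + ‖fderiv ℝ w 0‖ * s ^ 2 := by ring
    rw [this, ← e2]; linarith
  exact le_of_mul_le_mul_left f4 (by linarith)
theorem vs_exists {m : ℕ} {a b ζ K finf C R : ℝ} (hb : 0 < b) (hab : 0 < a + b) (hK : 0 < K) (hζ : 2 < ζ) {f u : EV n → ℝ}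
    (hf : FP f finf ζ C R m) (hfc : Continuous f) (hu : ContDiff ℝ 2 u)
    (hpd : ∀ x, (hess u x - (-a + b) • (1 : Matrix (Fin n) (Fin n) ℝ)).PosDef)
    (heq : ∀ x, Real.log (hess u x + (a - b) • (1 : Matrix (Fin n) (Fin n) ℝ)).det
        - Real.log (hess u x + (a + b) • (1 : Matrix (Fin n) (Fin n) ℝ)).det = K * f x)
    (hg : ∃ C : ℝ, ∀ x : EV n, u x ≤ C * (1 + ‖x‖ ^ 2)) :
    ∃ (X Y : EV n → EV n) (v : EV n → ℝ) (δ C' R' c0 : ℝ), VS v (fun y => K * f (X y)) (K * finf) δ C' R' ζ ∧ 0 < c0 ∧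
      (∀ y, Y (X y) = y) ∧ (∀ x, X (Y x) = x) ∧ ContDiff ℝ 1 X ∧ (∀ x, Y x = gmap (fderiv ℝ (fun x => u x + 1 * ((a + b) / 2 * ‖x - 0‖ ^ 2)) x)) ∧ (∀ y, gmap (fderiv ℝ v y) = y - (2 * b) • X y) ∧
      (∀ y, hess v y = 1 - (2 * b) • (hess u (X y) + (a + b) • (1 : Matrix (Fin n) (Fin n) ℝ))⁻¹ ∧
        IsUnit (hess u (X y) + (a + b) • (1 : Matrix (Fin n) (Fin n) ℝ)).det) ∧
      (∀ y, R' ≤ ‖y‖ → c0 * ‖y‖ ≤ ‖X y‖) ∧ ∀ y y', 2 * b * ‖X y - X y'‖ ≤ ‖y - y'‖ := by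
  set w : EV n → ℝ := fun x => u x + 1 * ((a + b) / 2 * ‖x - 0‖ ^ 2) with hwd
  have hsq : ContDiff ℝ 2 fun x : EV n => (a + b) / 2 * ‖x - 0‖ ^ 2 := contDiff_const.mul (contDiff_sq 0)
  have hw : ContDiff ℝ 2 w := hu.add (contDiff_const.mul hsq)
  have hwH : ∀ x, hess w x = hess u x + (a + b) • (1 : Matrix (Fin n) (Fin n) ℝ) := fun x => by
    rw [hess_lin hu.contDiffAt hsq.contDiffAt, hess_sq, one_smul]; congr 2; ring
  obtain ⟨X, v, hv, hX, hWX, hXW, hXl, hgv, hH, hhi, hcv⟩ := legendre hw (c := 2 * b) (by positivity) (fun x ξ h0 => by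
    have := qf_pd (hpd x) h0
    rw [← qf_hess, hwH, qf_add, qf_smul, qf_one]
    rw [qf_sub, qf_smul, qf_one] at this
    linarith)
  obtain ⟨Cu, hCu⟩ := hg
  obtain ⟨B, hB1, hB⟩ := grow (w := w) (Cg := |Cu| + (a + b)) (by positivity) (fun x => by
    have h1 := hCu x
    have h2 : Cu * (1 + ‖x‖ ^ 2) ≤ |Cu| * (1 + ‖x‖ ^ 2) := by gcongr; exact le_abs_self _
    have h3 : 0 ≤ (a + b) * (2 + ‖x‖ ^ 2) := by positivity
    simp only [hwd, sub_zero]; linarith) hcv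
  simp only [hwH] at hH
  set c0 := (2 * B)⁻¹ with hc0
  have hc00 : 0 < c0 := by positivity
  have hc01 : c0 ≤ 1 := inv_le_one_of_one_le₀ (by linarith)
  have hXg : ∀ y, 2 * B ≤ ‖y‖ → c0 * ‖y‖ ≤ ‖X y‖ := fun y hy => by
    have h1 := hB (X y)
    rw [hWX] at h1
    rw [hc0, inv_mul_le_iff₀ (by positivity)]; linarith
  set R' := 2 * (2 * B + c0⁻¹ * R + c0⁻¹ * b⁻¹) with hR'
  have hRp := hf.R1
  have q1 : 0 < c0⁻¹ * R := by positivity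
  have q2 : 0 < c0⁻¹ * b⁻¹ := by positivity
  have big : ∀ y, R' / 2 ≤ ‖y‖ → c0 * ‖y‖ ≤ ‖X y‖ ∧ R ≤ ‖X y‖ ∧ b⁻¹ ≤ ‖X y‖ ∧ 0 < ‖y‖ := fun y hy => by
    have h1 := hXg y (by linarith)
    have h2 : c0⁻¹ * R ≤ ‖y‖ := by linarith
    have h3 : c0⁻¹ * b⁻¹ ≤ ‖y‖ := by linarith
    rw [inv_mul_le_iff₀ hc00] at h2 h3
    exact ⟨h1, h2.trans h1, h3.trans h1, by linarith⟩
  set Q := c0 ^ (-(ζ + 2)) with hQ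
  have hQ0 : 0 < Q := by positivity
  have hC0 := hf.C1
  have pw : ∀ y, R' / 2 ≤ ‖y‖ → ∀ s, 0 ≤ s → s ≤ ζ + 2 → C * ‖X y‖ ^ (-s) ≤ C * Q * ‖y‖ ^ (-s) := fun y hy s h0 hs => by
    obtain ⟨h1, _, _, h4⟩ := big y hy
    rw [mul_assoc]
    refine mul_le_mul_of_nonneg_left ((Real.rpow_le_rpow_of_nonpos (by positivity) h1 (by linarith)).trans ?_) (by linarith)
    rw [Real.mul_rpow hc00.le h4.le]
    gcongr ?_ * _
    exact Real.rpow_le_rpow_of_exponent_ge hc00 hc01 (by linarith)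
  have pw1 : ∀ y, R' / 2 ≤ ‖y‖ → C * ‖X y‖ ^ (-ζ - 1) ≤ C * Q * ‖y‖ ^ (-ζ - 1) := fun y hy => by
    have := pw y hy (ζ + 1) (by linarith) (by linarith); rwa [neg_add'] at this
  have pw2 : ∀ y, R' / 2 ≤ ‖y‖ → C * ‖X y‖ ^ (-ζ - 2) ≤ C * Q * ‖y‖ ^ (-ζ - 2) := fun y hy => by
    have := pw y hy (ζ + 2) (by linarith) (by linarith); rwa [neg_add'] at this
  have hXl' : ∀ y y', ‖X y - X y'‖ ≤ ‖y - y'‖ / (2 * b) := fun y y' => by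
    rw [le_div_iff₀ (by positivity), mul_comm]; exact hXl y y'
  have hs : ∀ y, (1 - hess v y).PosSemidef := fun y => psd_of_quad (fun i j => by
      simp [hess_symm hv.contDiffAt i j, Matrix.one_apply, eq_comm]) fun ξ => by
    have := hhi y ξ
    change 0 ≤ qf _ ξ
    rw [qf_sub, qf_one, qf_hess]; linarith
  have heqv : ∀ y, Real.log (hess v y).det = K * f (X y) := fun y => by
    obtain ⟨h1, h2, h3⟩ := hH y
    rw [← heq]
    set H := hess u (X y) + (a + b) • (1 : Matrix (Fin n) (Fin n) ℝ)
    have h4 : hess v y = (hess u (X y) + (a - b) • (1 : Matrix (Fin n) (Fin n) ℝ)) * H⁻¹ := by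
      have : hess u (X y) + (a - b) • (1 : Matrix (Fin n) (Fin n) ℝ) = H - (2 * b) • (1 : Matrix (Fin n) (Fin n) ℝ) := by
        simp only [H, add_sub_assoc, ← sub_smul]; congr 2; ring
      rw [h1, this, Matrix.sub_mul, Matrix.mul_nonsing_inv _ h3]; simp
    have h5 : 0 < (hess u (X y) + (a - b) • (1 : Matrix (Fin n) (Fin n) ℝ)).det := by
      have := (hpd (X y)).det_pos
      rwa [sub_eq_add_neg, ← neg_smul, show -(-a + b) = a - b by ring] at this
    rw [h4, Matrix.det_mul, Matrix.det_nonsing_inv, Ring.inverse_eq_inv', ← div_eq_mul_inv, Real.log_div h5.ne' h3.ne_zero]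
  set δ := Real.exp (-(K * C)) with hδ
  have hbd : ∀ y, |K * f (X y)| ≤ K * C := fun y => by
    rw [abs_mul, abs_of_pos hK]; exact mul_le_mul_of_nonneg_left (hf.bd _) hK.le
  have hdet : ∀ y, δ ≤ (hess v y).det := fun y => by
    rw [← Real.exp_log (hH y).2.1.det_pos, heqv]
    exact Real.exp_le_exp.2 (neg_le_of_abs_le (hbd y))
  have hlo : ∀ y, (hess v y - δ • (1 : Matrix (Fin n) (Fin n) ℝ)).PosSemidef := fun y => by
    have h1 := eig_lb (hH y).2.1 (hs y)
    refine psd_of_quad (fun i j => by simp [hess_symm hv.contDiffAt i j, Matrix.one_apply, eq_comm]) fun ξ => ?_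
    have h2 := qf_psd h1 ξ
    change 0 ≤ qf _ ξ
    rw [qf_sub, qf_smul, qf_one] at h2 ⊢
    have := mul_le_mul_of_nonneg_right (hdet y) (sq_nonneg ‖ξ‖)
    linarith
  have hRR : R' / 2 ≤ R' := by linarith
  set A := K * (C * Q) with hA
  have hA0 : 0 < A := by positivity
  have hA1 : 0 ≤ A / (2 * b) := by positivity
  have hA2 : 0 ≤ A * (2 ^ ζ + 1) / (b * c0) := by positivity
  have hA3 : 0 ≤ A * (2 / (2 * b) ^ 2) := by positivity
  set C' := 1 + K * C + A + A / (2 * b) + A * (2 ^ ζ + 1) / (b * c0) + A * (2 / (2 * b) ^ 2) with hC'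
  have hKC : 0 ≤ K * C := by positivity
  have hdec : ∀ y, R' / 2 ≤ ‖y‖ → |K * f (X y) - K * finf| ≤ A * ‖y‖ ^ (-ζ) := fun y hy => by
    rw [← mul_sub, abs_mul, abs_of_pos hK, hA, mul_assoc]
    exact mul_le_mul_of_nonneg_left ((hf.dec _ (big y hy).2.1).trans (pw y hy ζ (by linarith) (by linarith))) hK.le
  refine ⟨X, fun x => gmap (fderiv ℝ w x), v, δ, C', R', c0, ⟨by linarith, by linarith, hζ, by positivity, hv,
    continuous_const.mul (hfc.comp hX.continuous), fun y => (hH y).2.1, fun y => ell_inv (by positivity) (hH y).2.1 (hlo y) (hs y), fun y ξ => ?_,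
    fun y ξ => by rw [qf_hess]; exact hhi y ξ, heqv, fun y => (hbd y).trans (by linarith), fun y hy => ?_, fun y y' hy hy' => ?_, fun y hy => ?_⟩,
    hc00, hWX, hXW, hX, fun _ => rfl, hgv, fun y => ⟨(hH y).1, (hH y).2.2⟩, fun y hy => (big y (by linarith)).1, hXl⟩
  · have := qf_psd (hlo y) ξ
    rw [qf_sub, qf_smul, qf_one] at this; linarith
  · exact (hdec y (by linarith)).trans (by gcongr; linarith)
  · obtain ⟨h1, h2, h3, h4⟩ := big y (by linarith)
    have hp : 0 ≤ ‖y‖ ^ (-ζ - 1) * ‖y' - y‖ := by positivity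
    rcases le_or_gt ‖y' - y‖ (b * c0 * ‖y‖) with hc | hc
    · have hd : ‖X y' - X y‖ ≤ ‖X y‖ / 2 := by
        refine (hXl' y' y).trans ?_
        rw [div_le_iff₀ (by positivity)]
        have := mul_le_mul_of_nonneg_left h1 hb.le
        linarith
      have h5 := hf.lip (X y) (X y' - X y) h2 hd
      rw [add_sub_cancel] at h5
      rw [← mul_sub, abs_mul, abs_of_pos hK]
      calc K * |f (X y') - f (X y)| ≤ K * (C * Q * ‖y‖ ^ (-ζ - 1) * (‖y' - y‖ / (2 * b))) := by
            refine mul_le_mul_of_nonneg_left (h5.trans ?_) hK.le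
            exact mul_le_mul (pw1 y (by linarith)) (hXl' _ _) (norm_nonneg _) (by positivity)
        _ = A / (2 * b) * (‖y‖ ^ (-ζ - 1) * ‖y' - y‖) := by rw [hA]; ring
        _ ≤ C' * (‖y‖ ^ (-ζ - 1) * ‖y' - y‖) := mul_le_mul_of_nonneg_right (by linarith) hp
        _ = _ := by ring
    · have h6 : ‖y‖ / 2 ≤ ‖y'‖ := by
        have := norm_sub_norm_le y y'; rw [norm_sub_rev] at this; linarith
      have h7 := hdec y' (by linarith)
      have h8 := hdec y (by linarith)
      have h9 := rpow_half h4 h6 (by linarith : (0:ℝ) ≤ ζ)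
      have h10 : ‖y‖ ^ (-ζ) = ‖y‖ ^ (-ζ - 1) * ‖y‖ := by
        rw [← Real.rpow_add_one h4.ne']; congr 1; ring
      calc |K * f (X y') - K * f (X y)| = |(K * f (X y') - K * finf) - (K * f (X y) - K * finf)| := by ring_nf
        _ ≤ A * ‖y'‖ ^ (-ζ) + A * ‖y‖ ^ (-ζ) := (abs_sub _ _).trans (add_le_add h7 h8)
        _ ≤ A * (2 ^ ζ * ‖y‖ ^ (-ζ)) + A * ‖y‖ ^ (-ζ) := by gcongr
        _ = A * (2 ^ ζ + 1) * ‖y‖ ^ (-ζ - 1) * ‖y‖ := by rw [h10]; ring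
        _ ≤ A * (2 ^ ζ + 1) * ‖y‖ ^ (-ζ - 1) * (‖y' - y‖ / (b * c0)) := by
            gcongr; rw [le_div_iff₀ (by positivity)]; linarith
        _ = A * (2 ^ ζ + 1) / (b * c0) * (‖y‖ ^ (-ζ - 1) * ‖y' - y‖) := by ring
        _ ≤ C' * (‖y‖ ^ (-ζ - 1) * ‖y' - y‖) := mul_le_mul_of_nonneg_right (by linarith) hp
        _ = _ := by ring
  · obtain ⟨h1, h2, h3, h4⟩ := big y (by linarith)
    refine ⟨(K / (2 * b)) • gmap (fderiv ℝ f (X y)), ?_, fun e he h h0 hh1 => ?_⟩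
    · have e1 : ‖gmap (fderiv ℝ f (X y))‖ ≤ ‖fderiv ℝ f (X y)‖ := by
        have := inner_gmap (fderiv ℝ f (X y)) (gmap (fderiv ℝ f (X y)))
        rw [real_inner_self_eq_norm_sq] at this
        have h5 := (le_abs_self _).trans ((fderiv ℝ f (X y)).le_opNorm (gmap (fderiv ℝ f (X y))))
        rw [← this, sq] at h5
        by_contra hc
        push Not at hc
        have h6 : 0 < ‖gmap (fderiv ℝ f (X y))‖ := (norm_nonneg _).trans_lt hc
        exact absurd (le_of_mul_le_mul_right h5 h6) (not_le.2 hc)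
      rw [norm_smul, Real.norm_of_nonneg (by positivity)]
      calc K / (2 * b) * ‖gmap (fderiv ℝ f (X y))‖ ≤ K / (2 * b) * (C * Q * ‖y‖ ^ (-ζ - 1)) := by
            gcongr; exact e1.trans ((hf.d1 _ h2).trans (pw1 y (by linarith)))
        _ = A / (2 * b) * ‖y‖ ^ (-ζ - 1) := by rw [hA]; ring
        _ ≤ _ := mul_le_mul_of_nonneg_right (by linarith) (by positivity)
    · have hdd : ∀ y', ‖y' - y‖ = h → -(C * Q * ‖y‖ ^ (-ζ - 2) * (h / (2 * b)) ^ 2) ≤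
          f (X y') - f (X y) - fderiv ℝ f (X y) (X y' - X y) := fun y' hy' => by
        have e0 := hXl' y' y
        rw [hy'] at e0
        have e1 : ‖X y' - X y‖ ≤ ‖X y‖ / 2 := by
          refine e0.trans ?_
          rw [div_le_iff₀ (by positivity)]
          have := mul_le_mul_of_nonneg_left h3 hb.le
          rw [mul_inv_cancel₀ hb.ne'] at this; linarith
        have e2 := neg_le_of_abs_le (hf.tay (X y) (X y' - X y) h2 e1)
        rw [add_sub_cancel] at e2
        refine le_trans (neg_le_neg ?_) e2
        have := pw2 y (by linarith)
        gcongr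
      have n1 : ‖y + h • e - y‖ = h := by rw [add_sub_cancel_left, norm_smul, he, Real.norm_of_nonneg h0.le, mul_one]
      have n2 : ‖y - h • e - y‖ = h := by rw [sub_sub_cancel_left, norm_neg, norm_smul, he, Real.norm_of_nonneg h0.le, mul_one]
      have d1 := hdd _ n1
      have d2 := hdd _ n2
      have l1 := logdet_le (hH y).2.1 (hH (y + h • e)).2.1
      have l2 := logdet_le (hH y).2.1 (hH (y - h • e)).2.1
      rw [heqv, heqv] at l1 l2
      have e3 : pr (hess v y)⁻¹ (hess (sd v h e) y) = (h ^ 2)⁻¹ * (pr (hess v y)⁻¹ (hess v (y + h • e) - hess v y) +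
          pr (hess v y)⁻¹ (hess v (y - h • e) - hess v y)) := by
        rw [sd_hess hv, pr_smul, ← pr_add]; congr 2; rw [two_smul]; abel
      have e4 : fderiv ℝ (sd v h e) y ((K / (2 * b)) • gmap (fderiv ℝ f (X y))) =
          -((h ^ 2)⁻¹ * (K * (fderiv ℝ f (X y) (X (y + h • e) - X y) + fderiv ℝ f (X y) (X (y - h • e) - X y)))) := by
        rw [map_smul, ← inner_gmap (fderiv ℝ (sd v h e) y), sd_fderiv hv, map_smul, map_sub, map_add, map_smul, hgv, hgv, hgv,
          real_inner_comm, inner_gmap, ← map_add, map_smul]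
        have : y + h • e - (2 * b) • X (y + h • e) + (y - h • e - (2 * b) • X (y - h • e)) - (2:ℝ) • (y - (2 * b) • X y) =
          (-(2 * b)) • (X (y + h • e) - X y + (X (y - h • e) - X y)) := by module
        rw [this, map_smul, smul_eq_mul, smul_eq_mul, smul_eq_mul]; field_simp
      rw [e3, e4]
      have hh : 0 < (h ^ 2)⁻¹ := by positivity
      have fin : -(K * (2 * (C * Q * ‖y‖ ^ (-ζ - 2) * (h / (2 * b)) ^ 2))) ≤
          (pr (hess v y)⁻¹ (hess v (y + h • e) - hess v y) + pr (hess v y)⁻¹ (hess v (y - h • e) - hess v y)) -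
          K * (fderiv ℝ f (X y) (X (y + h • e) - X y) + fderiv ℝ f (X y) (X (y - h • e) - X y)) := by
        have := mul_le_mul_of_nonneg_left (add_le_add d1 d2) hK.le
        linarith
      have fin2 := mul_le_mul_of_nonneg_left fin hh.le
      have e5 : (h ^ 2)⁻¹ * -(K * (2 * (C * Q * ‖y‖ ^ (-ζ - 2) * (h / (2 * b)) ^ 2))) = -(A * (2 / (2 * b) ^ 2) * ‖y‖ ^ (-ζ - 2)) := by
        rw [hA]; field_simp
      rw [e5] at fin2
      have e6 : A * (2 / (2 * b) ^ 2) * ‖y‖ ^ (-ζ - 2) ≤ C' * ‖y‖ ^ (-ζ - 2) := mul_le_mul_of_nonneg_right (by linarith) (by positivity)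
      linarith
end
section
variable {n : ℕ}
theorem hess_cs {ψ : EV n → ℝ} {x : EV n} (M c : ℝ) (h : ContDiffAt ℝ 2 ψ x) : hess (fun y => M + c * ψ y) x = c • hess ψ x := by
  rw [hess_lin contDiffAt_const h]
  have : hess (fun _ : EV n => M) x = 0 := by ext i j; simp [hess_apply]
  rw [this, zero_add]
theorem fderiv_cs {ψ : EV n → ℝ} {x : EV n} (M c : ℝ) (h : ContDiffAt ℝ 2 ψ x) : fderiv ℝ (fun y => M + c * ψ y) x = c • fderiv ℝ ψ x := by
  rw [fderiv_const_add, fderiv_const_mul (h.differentiableAt (by simp))]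
theorem line_d {v : EV n → ℝ} {y e : EV n} {t : ℝ} (h : ContDiffAt ℝ 2 v (y + t • e)) :
    HasDerivAt (fun t => v (y + t • e)) (fderiv ℝ v (y + t • e) e) t ∧
    HasDerivAt (fun t => fderiv ℝ v (y + t • e) e) (qf (hess v (y + t • e)) e) t := by
  have h1 : HasDerivAt (fun t : ℝ => y + t • e) e t := by
    simpa using ((hasDerivAt_id t).smul_const e).const_add y
  have h2 := (h.fderiv_right (m := 1) (by norm_num)).differentiableAt (by simp)
  have h3 : HasDerivAt (fderiv ℝ v ∘ fun t : ℝ => y + t • e) (fderiv ℝ (fderiv ℝ v) (y + t • e) e) t :=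
    h2.hasFDerivAt.comp_hasDerivAt t h1
  have h4 : HasDerivAt (v ∘ fun t : ℝ => y + t • e) (fderiv ℝ v (y + t • e) e) t :=
    (h.differentiableAt (by simp)).hasFDerivAt.comp_hasDerivAt t h1
  refine ⟨h4, ?_⟩
  rw [qf_hess]
  have h5 := h3.clm_apply (hasDerivAt_const t e)
  simp only [map_zero, add_zero] at h5
  exact h5
theorem sd_le {v : EV n → ℝ} {y e : EV n} {h M : ℝ} (hh : 0 < h)
    (H : ∀ t, |t| ≤ h → ContDiffAt ℝ 2 v (y + t • e) ∧ qf (hess v (y + t • e)) e ≤ M) : sd v h e y ≤ M := by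
  have hm : ∀ t, |t| ≤ h → |-t| ≤ h := fun t ht => by rwa [abs_neg]
  have d1 : ∀ t, |t| ≤ h → HasDerivAt (fun t => v (y + t • e) + v (y + (-t) • e) - M * t ^ 2)
      (fderiv ℝ v (y + t • e) e - fderiv ℝ v (y + (-t) • e) e - M * (2 * t)) t := fun t ht => by
    have h1 := (line_d (H t ht).1).1
    have h2 := (line_d (H _ (hm t ht)).1).1.scomp t (hasDerivAt_neg t)
    refine ((h1.add h2).sub ((hasDerivAt_pow 2 t).const_mul M)).congr_deriv ?_
    simp; ring
  have d2 : ∀ t, |t| ≤ h → HasDerivAt (fun t => fderiv ℝ v (y + t • e) e - fderiv ℝ v (y + (-t) • e) e - M * (2 * t))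
      (qf (hess v (y + t • e)) e + qf (hess v (y + (-t) • e)) e - 2 * M) t := fun t ht => by
    have h1 := (line_d (H t ht).1).2
    have h2 := (line_d (H _ (hm t ht)).1).2.scomp t (hasDerivAt_neg t)
    refine ((h1.sub h2).sub (((hasDerivAt_id t).const_mul 2).const_mul M)).congr_deriv ?_
    simp; ring
  have hI : ∀ t ∈ Set.Icc 0 h, |t| ≤ h := fun t ht => by rw [abs_of_nonneg ht.1]; exact ht.2
  have a1 : AntitoneOn (fun t => fderiv ℝ v (y + t • e) e - fderiv ℝ v (y + (-t) • e) e - M * (2 * t)) (Set.Icc 0 h) := by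
    refine antitoneOn_of_deriv_nonpos (convex_Icc 0 h) (fun t ht => (d2 t (hI t ht)).continuousAt.continuousWithinAt)
      (fun t ht => (d2 t (hI t (interior_subset ht))).differentiableAt.differentiableWithinAt) fun t ht => ?_
    have ht := hI t (interior_subset ht)
    rw [(d2 t ht).deriv]
    have := (H t ht).2; have := (H _ (hm t ht)).2; linarith
  have a2 : AntitoneOn (fun t => v (y + t • e) + v (y + (-t) • e) - M * t ^ 2) (Set.Icc 0 h) := by
    refine antitoneOn_of_deriv_nonpos (convex_Icc 0 h) (fun t ht => (d1 t (hI t ht)).continuousAt.continuousWithinAt)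
      (fun t ht => (d1 t (hI t (interior_subset ht))).differentiableAt.differentiableWithinAt) fun t ht => ?_
    have ht := interior_subset ht
    rw [(d1 t (hI t ht)).deriv]
    have := a1 ⟨le_rfl, hh.le⟩ ht ht.1
    simp only [zero_smul, neg_zero, mul_zero, sub_self] at this; linarith
  have := a2 ⟨le_rfl, hh.le⟩ ⟨hh.le, le_rfl⟩ hh.le
  simp only [zero_smul, neg_zero, add_zero, neg_smul, ← sub_eq_add_neg] at this
  rw [sd, inv_mul_le_iff₀ (by positivity)]; nlinarith
theorem le_sd {v : EV n → ℝ} {y e : EV n} {h M : ℝ} (hh : 0 < h)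
    (H : ∀ t, |t| ≤ h → ContDiffAt ℝ 2 v (y + t • e) ∧ M ≤ qf (hess v (y + t • e)) e) : M ≤ sd v h e y := by
  have := sd_le (v := fun y => -1 * v y) (y := y) (e := e) (M := -M) hh fun t ht => ⟨contDiffAt_const.mul (H t ht).1, by
    have h1 := hess_cs 0 (-1) (H t ht).1
    simp only [zero_add] at h1
    rw [h1, qf_smul]; linarith [(H t ht).2]⟩
  have h2 : sd (fun y => -1 * v y) h e y = -sd v h e y := by simp only [sd]; ring
  linarith
theorem qf_entry {P : Matrix (Fin n) (Fin n) ℝ} (hs : ∀ i j, P i j = P j i) {t : ℝ} (H : ∀ ξ : EV n, |qf P ξ| ≤ t * ‖ξ‖ ^ 2) (i j : Fin n) :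
    |P i j| ≤ 2 * t := by
  have h1 : ∀ ξ η : EV n, qf P ξ = ∑ i, ∑ j, ξ i * ξ j * P i j := fun _ _ => rfl
  have key : ∀ x y : EV n, qf P (x + y) - qf P (x - y) = 4 * ∑ i, ∑ j, x i * y j * P i j := by
    intro x y
    have e1 : ∑ i, ∑ j, x i * y j * P i j = ∑ i, ∑ j, y i * x j * P i j := by
      rw [Finset.sum_comm]; exact Finset.sum_congr rfl fun i _ => Finset.sum_congr rfl fun j _ => by rw [hs]; ring
    have e2 : qf P (x + y) - qf P (x - y) = 2 * (∑ i, ∑ j, x i * y j * P i j) + 2 * ∑ i, ∑ j, y i * x j * P i j := by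
      simp only [qf, Finset.mul_sum, ← Finset.sum_sub_distrib, ← Finset.sum_add_distrib]
      exact Finset.sum_congr rfl fun i _ => Finset.sum_congr rfl fun j _ => by simp; ring
    rw [e2, ← e1]; ring
  have k1 := key (ee i) (ee j)
  have k2 : ∑ k, ∑ l, (ee i : EV n) k * (ee j : EV n) l * P k l = P i j := by
    simp [ee, Pi.single_apply]
  rw [k2] at k1
  have h2 := H (ee i + ee j); have h3 := H (ee i - ee j)
  have h4 := parallelogram_law_with_norm ℝ (ee i : EV n) (ee j)
  simp only [EuclideanSpace.norm_single, norm_one] at h4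
  have h5 : ‖(ee i : EV n) + ee j‖ ^ 2 + ‖(ee i : EV n) - ee j‖ ^ 2 = 4 := by linarith
  have h6 : |4 * P i j| ≤ t * 4 := by
    rw [← k1]; refine (abs_sub _ _).trans ?_
    rw [← h5, mul_add]; exact add_le_add h2 h3
  rw [abs_mul, abs_of_pos (by norm_num : (0:ℝ) < 4)] at h6
  have := abs_nonneg (P i j)
  linarith
theorem qf_ent_le {P : Matrix (Fin n) (Fin n) ℝ} {t : ℝ} (ht : ∀ i j, |P i j| ≤ t) {e : EV n} (he : ‖e‖ = 1) : |qf P e| ≤ n ^ 2 * t := by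
  have hc : ∀ i, |e i| ≤ 1 := fun i => he ▸ PiLp.norm_apply_le e i
  calc |qf P e| ≤ ∑ i : Fin n, ∑ j : Fin n, t := (Finset.abs_sum_le_sum_abs _ _).trans (Finset.sum_le_sum fun i _ =>
        (Finset.abs_sum_le_sum_abs _ _).trans (Finset.sum_le_sum fun j _ => by
          rw [abs_mul, abs_mul]
          exact (mul_le_of_le_one_left (abs_nonneg _) (mul_le_one₀ (hc i) (abs_nonneg _) (hc j))).trans (ht i j)))
    _ = _ := by simp; ring
theorem qf_hom (P : Matrix (Fin n) (Fin n) ℝ) (c : ℝ) (ξ : EV n) : qf P (c • ξ) = c ^ 2 * qf P ξ := by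
  simp only [qf, Finset.mul_sum]
  exact Finset.sum_congr rfl fun i _ => Finset.sum_congr rfl fun j _ => by simp; ring
theorem net (n : ℕ) {L : ℝ} (hL : 0 ≤ L) : ∃ N : Finset (EV n), (∀ e ∈ N, ‖e‖ = 1) ∧ ∃ C, 1 ≤ C ∧
    (∀ (P a : Matrix (Fin n) (Fin n) ℝ) (s : ℝ), (∀ i j, P i j = P j i) → 0 ≤ s → Ell 1 L a → (∀ e ∈ N, qf P e ≤ s) → -s ≤ pr a P →
      ∀ i j, |P i j| ≤ C * s) ∧
    ∀ (P : Matrix (Fin n) (Fin n) ℝ) (s : ℝ), (∀ i j, P i j = P j i) → 0 ≤ s → (∀ e ∈ N, |qf P e| ≤ s) → ∀ i j, |P i j| ≤ C * s := by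
  set D : ℝ := n ^ 2 * (2 + n * L) with hD
  have hD0 : 0 ≤ D := by positivity
  set η : ℝ := 1 / (8 * (1 + D)) with hη
  have hη0 : 0 < η := by positivity
  have hηD : 8 * (D * η) ≤ 1 := by
    rw [hη, mul_one_div, ← mul_div_assoc, div_le_one (by positivity)]; linarith
  obtain ⟨N, hN, hc⟩ := (isCompact_sphere (0 : EV n) 1).elim_finite_subcover_image (b := Metric.sphere (0 : EV n) 1)
    (c := fun e => Metric.ball e η) (fun _ _ => Metric.isOpen_ball) (fun x hx => Set.mem_biUnion hx (Metric.mem_ball_self hη0))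
  obtain ⟨hf, hc⟩ := hc
  have up : ∀ (P : Matrix (Fin n) (Fin n) ℝ) (s : ℝ), (∀ e ∈ N, qf P e ≤ s) → ∀ ξ : EV n,
      qf P ξ ≤ (s + 2 * η * ∑ i, ∑ j, |P i j|) * ‖ξ‖ ^ 2 := by
    intro P s h ξ
    have hu : ∀ ξ : EV n, ‖ξ‖ = 1 → qf P ξ ≤ s + 2 * η * ∑ i, ∑ j, |P i j| := by
      intro ξ h1
      obtain ⟨e, he, hb⟩ := Set.mem_iUnion₂.1 (hc (mem_sphere_zero_iff_norm.2 h1))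
      have he1 : ‖e‖ = 1 := mem_sphere_zero_iff_norm.1 (hN he)
      have hd : ∀ i, |ξ i - e i| ≤ η := fun i => (PiLp.norm_apply_le (ξ - e) i).trans (mem_ball_iff_norm.1 hb).le
      have h3 : qf P ξ - qf P e ≤ 2 * η * ∑ i, ∑ j, |P i j| := by
        simp only [qf, Finset.mul_sum, ← Finset.sum_sub_distrib]
        refine Finset.sum_le_sum fun i _ => Finset.sum_le_sum fun j _ => ?_
        have e1 : ξ i * ξ j * P i j - e i * e j * P i j = ((ξ i - e i) * ξ j + e i * (ξ j - e j)) * P i j := by ring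
        rw [e1]
        refine (le_abs_self _).trans ?_
        rw [abs_mul]
        refine mul_le_mul_of_nonneg_right ((abs_add_le _ _).trans ?_) (abs_nonneg _)
        rw [abs_mul, abs_mul, two_mul]
        refine add_le_add ?_ ?_
        · exact (mul_le_of_le_one_right (abs_nonneg _) (h1 ▸ PiLp.norm_apply_le ξ j)).trans (hd i)
        · exact (mul_le_of_le_one_left (abs_nonneg _) (he1 ▸ PiLp.norm_apply_le e i)).trans (hd j)
      linarith [h e he]
    by_cases h0 : ξ = 0
    · subst h0; simp [qf]
    have hp : 0 < ‖ξ‖ := norm_pos_iff.2 h0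
    have := hu (‖ξ‖⁻¹ • ξ) (by rw [norm_smul, norm_inv, norm_norm, inv_mul_cancel₀ hp.ne'])
    rw [qf_hom, inv_pow, inv_mul_le_iff₀ (by positivity)] at this
    linarith
  have fin : ∀ (P : Matrix (Fin n) (Fin n) ℝ) (s : ℝ), (∀ i j, P i j = P j i) → 0 ≤ s → (∀ ξ : EV n,
      |qf P ξ| ≤ (2 + n * L) * (s + 2 * η * ∑ i, ∑ j, |P i j|) * ‖ξ‖ ^ 2) → ∀ i j, |P i j| ≤ (1 + 4 * D) * s := by
    intro P s hs h0 h
    set T := ∑ i, ∑ j, |P i j| with hT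
    have h1 := qf_entry hs h
    have h2 : T ≤ ∑ i : Fin n, ∑ j : Fin n, 2 * ((2 + n * L) * (s + 2 * η * T)) :=
      Finset.sum_le_sum fun i _ => Finset.sum_le_sum fun j _ => h1 i j
    have h3 : ∑ i : Fin n, ∑ j : Fin n, 2 * ((2 + n * L) * (s + 2 * η * T)) = 2 * D * s + 4 * (D * η) * T := by
      simp [hD]; ring
    have hT0 : 0 ≤ T := Finset.sum_nonneg fun i _ => Finset.sum_nonneg fun j _ => abs_nonneg _
    have h4 : T ≤ 4 * D * s := by
      have := mul_le_mul_of_nonneg_right hηD hT0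
      linarith
    intro i j
    have h5 : |P i j| ≤ T := (Finset.single_le_sum (f := fun j => |P i j|) (fun j _ => abs_nonneg _) (Finset.mem_univ j)).trans
      (Finset.single_le_sum (f := fun i => ∑ j, |P i j|) (fun i _ => Finset.sum_nonneg fun j _ => abs_nonneg _) (Finset.mem_univ i))
    linarith
  refine ⟨hf.toFinset, fun e he => mem_sphere_zero_iff_norm.1 (hN (hf.mem_toFinset.1 he)), 1 + 4 * D, by linarith, ?_, ?_⟩
  · intro P a s hs h0 ha h1 h2
    have h3 := up P s fun e he => h1 e (hf.mem_toFinset.2 he)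
    refine fin P s hs h0 fun ξ => ?_
    have ht : 0 ≤ s + 2 * η * ∑ i, ∑ j, |P i j| := by positivity
    set t := s + 2 * η * ∑ i, ∑ j, |P i j| with htd
    have h4 := two_sided (l := 1) (by norm_num) ht ha hs (fun ξ => h3 ξ) h2 ξ
    have hst : s ≤ t := by
      have : 0 ≤ 2 * η * ∑ i, ∑ j, |P i j| := by positivity
      linarith
    have hn : 0 ≤ n * L * t * ‖ξ‖ ^ 2 := by positivity
    have ht2 : 0 ≤ t * ‖ξ‖ ^ 2 := by positivity
    have hst2 := mul_le_mul_of_nonneg_right hst (sq_nonneg ‖ξ‖)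
    have h4' : (t - (n * L * t + s) / 1) * ‖ξ‖ ^ 2 ≤ qf P ξ := h4
    rw [abs_le]; constructor
    · have e1 : (t - (n * L * t + s) / 1) * ‖ξ‖ ^ 2 = t * ‖ξ‖ ^ 2 - n * L * t * ‖ξ‖ ^ 2 - s * ‖ξ‖ ^ 2 := by ring
      linarith
    · have := h3 ξ; linarith
  · intro P s hs h0 h1
    have h3 := up P s fun e he => (le_abs_self _).trans (h1 e (hf.mem_toFinset.2 he))
    have h4 := up (-P) s fun e he => by
      have : qf (-P) e = -qf P e := by simp [qf]
      rw [this]; exact (neg_le_abs _).trans (h1 e (hf.mem_toFinset.2 he))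
    refine fin P s hs h0 fun ξ => ?_
    have e1 : qf (-P) ξ = -qf P ξ := by simp [qf]
    have h4 := h4 ξ
    simp only [Matrix.neg_apply, abs_neg, e1] at h4
    set t := s + 2 * η * ∑ i, ∑ j, |P i j| with htd
    have ht : 0 ≤ t := by positivity
    have h5 : t * ‖ξ‖ ^ 2 ≤ (2 + n * L) * t * ‖ξ‖ ^ 2 := by
      have : 0 ≤ (1 + n * L) * (t * ‖ξ‖ ^ 2) := by positivity
      linarith
    rw [abs_le]; constructor
    · linarith
    · have := h3 ξ; linarith
end
section
variable {n : ℕ}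
theorem qf_cont {v : EV n → ℝ} (hv : ContDiff ℝ 2 v) (e : EV n) : Continuous fun y => qf (hess v y) e := by
  simp only [qf_hess]
  have := (hv.fderiv_right (m := 1) (by norm_num)).continuous_fderiv (by simp)
  fun_prop
theorem ek_P {v F : EV n → ℝ} {Fi δ C R ζ μ : ℝ} (V : VS v F Fi δ C R ζ) (hμ : 0 < μ) : ∃ c > 0, c < 1 ∧ ∃ K, 1 ≤ K ∧ ∃ R', R ≤ R' ∧
    ∀ (x e : EV n) (ρ s M : ℝ), 2 * R' ≤ ‖x‖ → 0 < ρ → 6 * ρ ≤ ‖x‖ / 4 → ‖e‖ = 1 → 0 < s → K * (ρ / ‖x‖) ≤ s →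
    (∀ y ∈ Metric.closedBall x (6 * ρ), qf (hess v y) e ≤ M) →
    μ * volume.real (Metric.closedBall x ρ) ≤ volume.real ({y | qf (hess v y) e < M - 2 * s} ∩ Metric.closedBall x ρ) →
    ∀ y ∈ Metric.closedBall x (3 * ρ), qf (hess v y) e ≤ M - c * s := by
  obtain ⟨c, hc, κ, hκ, hc1, G⟩ := gl n (l := 1) (L := δ⁻¹) one_pos (inv_nonneg.2 V.d0.le) hμ
  have hC := V.C1
  have hz := V.z2
  have hR1 := V.R1
  set D : ℝ := C * 2 ^ (ζ + 2) with hD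
  have h2z : (1:ℝ) ≤ 2 ^ (ζ + 2) := Real.one_le_rpow (by norm_num) (by linarith)
  have hD1 : 1 ≤ D := one_le_mul_of_one_le_of_one_le hC h2z
  refine ⟨c, hc, hc1, D / κ + 1, by linarith [show 0 ≤ D / κ by positivity], R + D, by linarith, ?_⟩
  intro x e ρ s M hx hρ hρx he hs hK hM hv
  have hx0 : 0 < ‖x‖ := by linarith
  have hx1 : 1 ≤ ‖x‖ := by linarith
  have hball : ∀ y ∈ Metric.closedBall x (6 * ρ), ‖x‖ / 2 ≤ ‖y‖ := fun y hy => by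
    have h1 := norm_sub_norm_le x y
    rw [← dist_eq_norm, dist_comm] at h1
    have := Metric.mem_closedBall.1 hy; linarith
  have hq := qf_cont V.cd e
  have key : ∀ ε, 0 < ε → ε ≤ s → ∀ y ∈ Metric.closedBall x (3 * ρ), qf (hess v y) e ≤ M - c * s + ε := by
    intro ε hε hεs y hy
    obtain ⟨d, hd, hu⟩ := Metric.uniformContinuousOn_iff.1
      ((isCompact_closedBall x (6 * ρ)).uniformContinuousOn_of_continuous hq.continuousOn) ε hε
    set h := min (min ρ 1) (d / 2) with hh
    have hh0 : 0 < h := by positivity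
    have hhρ : h ≤ ρ := (min_le_left _ _).trans (min_le_left _ _)
    have hh1 : h ≤ 1 := (min_le_left _ _).trans (min_le_right _ _)
    have hhd : h < d := lt_of_le_of_lt (min_le_right _ _) (by linarith)
    have hte : ∀ t, |t| ≤ h → ∀ y : EV n, dist (y + t • e) y ≤ h := fun t ht y => by
      rw [dist_eq_norm, add_sub_cancel_left, norm_smul, he, mul_one]; exact ht
    have hin : ∀ y ∈ Metric.closedBall x (5 * ρ), ∀ t, |t| ≤ h → y + t • e ∈ Metric.closedBall x (6 * ρ) := fun y hy t ht => by
      rw [Metric.mem_closedBall] at hy ⊢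
      linarith [dist_triangle (y + t • e) y x, hte t ht y]
    have hsub : ∀ {r}, r ≤ 5 → Metric.closedBall x (r * ρ) ⊆ Metric.closedBall x (5 * ρ) := fun hr =>
      Metric.closedBall_subset_closedBall (by gcongr)
    have hcl : ∀ y ∈ Metric.closedBall x (5 * ρ), ∀ t, |t| ≤ h → |qf (hess v (y + t • e)) e - qf (hess v y) e| < ε := fun y hy t ht =>
      hu _ (hin y hy t ht) _ (Metric.closedBall_subset_closedBall (by linarith) hy) (lt_of_le_of_lt (hte t ht y) hhd)
    have := G (w := fun y => M + (-1) * sd v h e y) (z := x) (ρ := ρ) (s := s) (by have := sd_cd V.cd h e; fun_prop) hρ hs ?_ ?_ ?_ y hy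
    · have h1 := le_sd (v := v) (y := y) (e := e) (M := qf (hess v y) e - ε) hh0 fun t ht => ⟨V.cd.contDiffAt, by
        have := abs_lt.1 (hcl y (hsub (by norm_num) hy) t ht); linarith⟩
      linarith
    · intro y hy
      have := sd_le (v := v) (y := y) (e := e) (M := M) hh0 fun t ht => ⟨V.cd.contDiffAt, hM _ (hin y hy t ht)⟩
      linarith
    · intro y hy
      have hy2 := hball y (Metric.closedBall_subset_closedBall (by linarith) hy)
      obtain ⟨b, hb, hS⟩ := V.sub y (by linarith)
      have hS := hS e he h hh0 hh1
      refine ⟨_, b, V.ell y, ?_, ?_⟩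
      · have h1 := rpow_half hx0 hy2 (ζ := ζ + 1) (by linarith)
        rw [show -(ζ + 1) = -ζ - 1 by ring] at h1
        have h2 : ‖x‖ ^ (-ζ - 1) ≤ ‖x‖ ^ (-2 : ℝ) := Real.rpow_le_rpow_of_exponent_le hx1 (by linarith)
        have h3 : (2:ℝ) ^ (ζ + 1) ≤ 2 ^ (ζ + 2) := Real.rpow_le_rpow_of_exponent_le (by norm_num) (by linarith)
        rw [Real.rpow_neg hx0.le, Real.rpow_two] at h2
        calc ‖b‖ * ρ ≤ (C * (2 ^ (ζ + 2) * (‖x‖ ^ 2)⁻¹)) * ‖x‖ := by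
              refine mul_le_mul (hb.trans ?_) (by linarith) hρ.le (by positivity)
              gcongr
              exact h1.trans (mul_le_mul h3 h2 (by positivity) (by positivity))
          _ = D / ‖x‖ := by rw [hD]; field_simp
          _ ≤ 1 := by rw [div_le_one hx0]; linarith
      · have hsd := (sd_cd V.cd h e).contDiffAt (x := y)
        rw [hess_cs _ _ hsd, fderiv_cs _ _ hsd, pr_smul]
        have h1 := rpow_half hx0 hy2 (ζ := ζ + 2) (by linarith)
        rw [show -(ζ + 2) = -ζ - 2 by ring] at h1
        have h2 : ‖x‖ ^ (-ζ - 2) ≤ ‖x‖ ^ (-2 : ℝ) := Real.rpow_le_rpow_of_exponent_le hx1 (by linarith)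
        rw [Real.rpow_neg hx0.le, Real.rpow_two] at h2
        have h3 : C * ‖y‖ ^ (-ζ - 2) ≤ D * (‖x‖ ^ 2)⁻¹ := by
          rw [hD, mul_assoc]; gcongr
          exact h1.trans (by gcongr)
        have h4 : ρ ^ 2 * (D * (‖x‖ ^ 2)⁻¹) = D * (ρ / ‖x‖) ^ 2 := by field_simp
        have h5 : (ρ / ‖x‖) ^ 2 ≤ ρ / ‖x‖ := by
          rw [sq]; exact mul_le_of_le_one_left (by positivity) (by rw [div_le_one hx0]; linarith)
        have h6 : D * (ρ / ‖x‖) ≤ κ * s := by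
          have : D / κ * (ρ / ‖x‖) ≤ s := le_trans (by gcongr; linarith) hK
          rw [div_mul_eq_mul_div, div_le_iff₀ hκ] at this; linarith
        calc _ = ρ ^ 2 * -(pr (hess v y)⁻¹ (hess (sd v h e) y) + fderiv ℝ (sd v h e) y b) := by simp; left; ring
          _ ≤ ρ ^ 2 * (D * (‖x‖ ^ 2)⁻¹) := by gcongr; linarith
          _ ≤ D * (ρ / ‖x‖) := by rw [h4]; gcongr
          _ ≤ _ := h6
    · refine hv.trans (measureReal_mono ?_ ((measure_mono Set.inter_subset_right).trans_lt measure_closedBall_lt_top).ne)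
      intro y ⟨h1, h2⟩
      refine ⟨?_, h2⟩
      have h3 := sd_le (v := v) (y := y) (e := e) (M := qf (hess v y) e + ε) hh0 fun t ht => ⟨V.cd.contDiffAt, by
        have := abs_lt.1 (hcl y (hsub (r := 1) (by norm_num) (by simpa using h2)) t ht); linarith⟩
      simp only [Set.mem_setOf_eq] at h1 ⊢
      linarith
  intro y hy
  refine le_of_forall_pos_le_add fun ε hε => ?_
  have := key (min ε s) (by positivity) (min_le_right _ _) y hy
  have := min_le_left ε s
  linarith
theorem ek_step {v F : EV n → ℝ} {Fi δ C R ζ : ℝ} (V : VS v F Fi δ C R ζ) : ∃ N : Finset (EV n), (∀ e ∈ N, ‖e‖ = 1) ∧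
    (∃ Cn, 1 ≤ Cn ∧ ∀ (P : Matrix (Fin n) (Fin n) ℝ) (s : ℝ), (∀ i j, P i j = P j i) → 0 ≤ s → (∀ e ∈ N, |qf P e| ≤ s) → ∀ i j, |P i j| ≤ Cn * s) ∧
    ∃ θ > 0, θ ≤ 1 / 2 ∧ ∃ K, 1 ≤ K ∧ ∃ R', R ≤ R' ∧ ∀ (x : EV n) (r Ω : ℝ) (M m : EV n → ℝ), R' ≤ ‖x‖ → 0 < r → r ≤ ‖x‖ / 4 →
    K * (r / ‖x‖) ≤ Ω → 0 < Ω → (∀ e ∈ N, ∀ y ∈ Metric.closedBall x r, m e ≤ qf (hess v y) e ∧ qf (hess v y) e ≤ M e) → ∑ e ∈ N, (M e - m e) ≤ Ω →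
    ∃ M' m' : EV n → ℝ, (∀ e ∈ N, ∀ y ∈ Metric.closedBall x (r / 2), m' e ≤ qf (hess v y) e ∧ qf (hess v y) e ≤ M' e) ∧
      ∑ e ∈ N, (M' e - m' e) ≤ (1 - θ) * Ω := by
  obtain ⟨N, hN, Cn, hCn, hA, hB⟩ := net n (inv_nonneg.2 V.d0.le : 0 ≤ δ⁻¹)
  have hC := V.C1
  have hz := V.z2
  have hR1 := V.R1
  refine ⟨N, hN, ⟨Cn, hCn, hB⟩, ?_⟩
  set μ : ℝ := 1 / (2 * (N.card + 1)) with hμ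
  have hμ0 : 0 < μ := by positivity
  obtain ⟨c, hc, hc1, K, hK1, R', hR', HP⟩ := ek_P V hμ0
  set κ : ℝ := 1 / (8 * (N.card + 1) * (n ^ 2 + 1) * Cn) with hκ
  have hκ0 : 0 < κ := by positivity
  have hκ1 : κ ≤ 1 / 8 := by
    rw [hκ]; gcongr
    have h1 : (1:ℝ) ≤ N.card + 1 := by linarith [(Nat.cast_nonneg N.card : (0:ℝ) ≤ _)]
    have h2 : (1:ℝ) ≤ n ^ 2 + 1 := by linarith [sq_nonneg (n:ℝ)]
    calc (8:ℝ) = 8 * 1 * 1 * 1 := by norm_num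
      _ ≤ _ := by gcongr
  refine ⟨c * κ, by positivity, by nlinarith, (K + 4 * C) / κ, by rw [le_div_iff₀ hκ0]; linarith, 2 * R', by linarith, ?_⟩
  intro x r Ω M m hx hr hrx hKΩ hΩ hMm hsum
  have hx0 : 0 < ‖x‖ := by linarith
  have hs0 : 0 < κ * Ω := by positivity
  have hKs : (K + 4 * C) * (r / ‖x‖) ≤ κ * Ω := by
    rw [div_mul_eq_mul_div, div_le_iff₀ hκ0] at hKΩ; linarith
  have hrx0 : 0 ≤ r / ‖x‖ := by positivity
  have hsub : Metric.closedBall x (r / 6) ⊆ Metric.closedBall x r := Metric.closedBall_subset_closedBall (by linarith)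
  have hsub2 : Metric.closedBall x (r / 2) ⊆ Metric.closedBall x r := Metric.closedBall_subset_closedBall (by linarith)
  by_cases hcase : ∃ e ∈ N, μ * volume.real (Metric.closedBall x (r / 6)) ≤
      volume.real ({y | qf (hess v y) e < M e - 2 * (κ * Ω)} ∩ Metric.closedBall x (r / 6))
  · obtain ⟨e, he, hv⟩ := hcase
    have h1 := HP x e (r / 6) (κ * Ω) (M e) hx (by linarith) (by linarith) (hN e he) hs0 (by
      refine le_trans ?_ hKs
      have h1 : r / 6 / ‖x‖ ≤ r / ‖x‖ := by gcongr; linarith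
      have h2 : 0 ≤ 4 * C * (r / ‖x‖) := by positivity
      calc K * (r / 6 / ‖x‖) ≤ K * (r / ‖x‖) := by gcongr
        _ ≤ _ := by linarith) (fun y hy => (hMm e he y (by rwa [show 6 * (r / 6) = r by ring] at hy)).2) hv
    classical
    refine ⟨fun e' => if e' = e then M e - c * (κ * Ω) else M e', m, fun e' he' y hy => ⟨(hMm e' he' y (hsub2 hy)).1, ?_⟩, ?_⟩
    · by_cases h2 : e' = e
      · subst h2; simp only [if_true]; exact h1 y (by rwa [show 3 * (r / 6) = r / 2 by ring])
      · simp only [h2, if_false]; exact (hMm e' he' y (hsub2 hy)).2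
    · have e1 : ∀ e' ∈ N, (if e' = e then M e - c * (κ * Ω) else M e') - m e' = (M e' - m e') - if e' = e then c * (κ * Ω) else 0 := by
        intro e' _; by_cases h2 : e' = e
        · subst h2; simp; ring
        · simp [h2]
      rw [Finset.sum_congr rfl e1, Finset.sum_sub_distrib, Finset.sum_ite_eq' N e, if_pos he]
      linarith
  · push Not at hcase
    have hx0 : ∃ x0 ∈ Metric.closedBall x (r / 6), ∀ e ∈ N, M e - 2 * (κ * Ω) ≤ qf (hess v x0) e := by
      by_contra hcon
      push Not at hcon
      have hcov : Metric.closedBall x (r / 6) ⊆ ⋃ e ∈ N, ({y | qf (hess v y) e < M e - 2 * (κ * Ω)} ∩ Metric.closedBall x (r / 6)) := by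
        intro y hy
        obtain ⟨e, he, h1⟩ := hcon y hy
        exact Set.mem_biUnion he ⟨h1, hy⟩
      have hp : 0 < volume.real (Metric.closedBall x (r / 6)) :=
        ENNReal.toReal_pos (Metric.measure_closedBall_pos _ _ (by linarith)).ne' measure_closedBall_lt_top.ne
      have h1 : volume.real (Metric.closedBall x (r / 6)) ≤ ∑ e ∈ N, volume.real ({y | qf (hess v y) e < M e - 2 * (κ * Ω)} ∩ Metric.closedBall x (r / 6)) :=
        (measureReal_mono hcov ((measure_mono (Set.iUnion₂_subset fun e _ => Set.inter_subset_right)).trans_lt measure_closedBall_lt_top).ne).trans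
          (measureReal_biUnion_finset_le _ _)
      have h2 : ∑ e ∈ N, volume.real ({y | qf (hess v y) e < M e - 2 * (κ * Ω)} ∩ Metric.closedBall x (r / 6)) ≤
          ∑ e ∈ N, μ * volume.real (Metric.closedBall x (r / 6)) := Finset.sum_le_sum fun e he => (hcase e he).le
      rw [Finset.sum_const, nsmul_eq_mul] at h2
      have h3 : N.card * μ ≤ 1 / 2 := by
        rw [hμ, mul_one_div, div_le_div_iff₀ (by positivity) (by norm_num)]; linarith
      have := mul_le_mul_of_nonneg_right h3 hp.le
      rw [mul_assoc] at this
      linarith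
    obtain ⟨x0, hx0b, hx0⟩ := hx0
    have hd : ∀ y ∈ Metric.closedBall x r, |F y - F x| ≤ C * (r / ‖x‖) := by
      intro y hy
      rw [mem_closedBall_iff_norm] at hy
      have h1 := V.lip x y (by linarith) (by linarith)
      have h2 : ‖x‖ ^ (-ζ - 1) ≤ ‖x‖ ^ (-1 : ℝ) := Real.rpow_le_rpow_of_exponent_le (by linarith) (by linarith)
      rw [Real.rpow_neg_one] at h2
      calc _ ≤ _ := h1
        _ ≤ C * ‖x‖⁻¹ * r := by gcongr
        _ = _ := by ring
    have hent : ∀ y ∈ Metric.closedBall x r, ∀ e ∈ N, |qf (hess v y) e - qf (hess v x0) e| ≤ n ^ 2 * (Cn * (2 * (κ * Ω))) := by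
      intro y hy e he
      rw [← qf_sub]
      refine qf_ent_le (hA _ (hess v x0)⁻¹ _ ?_ (by positivity) (V.ell x0) ?_ ?_) (hN e he)
      · intro i j; simp only [Matrix.sub_apply, hess_symm V.cd.contDiffAt i j]
      · intro e he; rw [qf_sub]; linarith [(hMm e he y hy).2, hx0 e he]
      · have h1 := logdet_le (V.pd x0) (V.pd y)
        rw [V.eq, V.eq] at h1
        have h2 := abs_le.1 (hd y hy)
        have h3 := abs_le.1 (hd x0 (hsub hx0b))
        have h4 : 0 ≤ K * (r / ‖x‖) := by positivity
        have h5 : 0 ≤ C * (r / ‖x‖) := by positivity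
        linarith
    refine ⟨fun e => qf (hess v x0) e + n ^ 2 * (Cn * (2 * (κ * Ω))), fun e => qf (hess v x0) e - n ^ 2 * (Cn * (2 * (κ * Ω))), fun e he y hy => ?_, ?_⟩
    · have := abs_le.1 (hent y (hsub2 hy) e he)
      constructor <;> simp only <;> linarith
    · have e1 : ∀ e ∈ N, (qf (hess v x0) e + n ^ 2 * (Cn * (2 * (κ * Ω)))) - (qf (hess v x0) e - n ^ 2 * (Cn * (2 * (κ * Ω)))) = 4 * (n ^ 2 * Cn * κ) * Ω := fun _ _ => by ring
      rw [Finset.sum_congr rfl e1, Finset.sum_const, nsmul_eq_mul, ← mul_assoc]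
      gcongr
      have h1 : N.card * (4 * (n ^ 2 * Cn * κ)) ≤ 1 / 2 := by
        have : N.card * (4 * (n ^ 2 * Cn * κ)) = N.card * (4 * (n ^ 2 * Cn)) / (8 * (N.card + 1) * (n ^ 2 + 1) * Cn) := by rw [hκ]; ring
        rw [this, div_le_div_iff₀ (by positivity) (by norm_num)]
        have : 0 ≤ Cn * (8 * (N.card + n ^ 2 + 1)) := by positivity
        linarith
      have h2 : c * κ ≤ 1 / 2 := by nlinarith
      linarith
theorem ek {v F : EV n → ℝ} {Fi δ C R ζ : ℝ} (V : VS v F Fi δ C R ζ) : ∃ α : ℝ, 0 < α ∧ α ≤ 1 ∧ ∃ K, 1 ≤ K ∧ ∃ R', R ≤ R' ∧ ∀ x y : EV n, R' ≤ ‖x‖ →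
    ‖y - x‖ ≤ ‖x‖ / 4 → ∀ i j, |hess v y i j - hess v x i j| ≤ K * (‖y - x‖ / ‖x‖) ^ α := by
  obtain ⟨N, hN, ⟨Cn, hCn, hB⟩, θ, hθ, hθ1, K, hK, R', hR', H⟩ := ek_step V
  have hR1 := V.R1
  set q : ℝ := 1 - θ with hq
  have hq0 : 0 < q := by linarith
  set Ω : ℝ := N.card + K with hΩ
  have hΩK : K ≤ Ω := by linarith [(Nat.cast_nonneg N.card : (0:ℝ) ≤ _)]
  have it : ∀ (k : ℕ) (x : EV n), R' ≤ ‖x‖ → ∃ M m : EV n → ℝ, (∀ e ∈ N, ∀ y ∈ Metric.closedBall x (‖x‖ / 4 * (1/2) ^ k), m e ≤ qf (hess v y) e ∧ qf (hess v y) e ≤ M e) ∧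
      ∑ e ∈ N, (M e - m e) ≤ Ω * q ^ k := by
    intro k x hx
    have hx0 : 0 < ‖x‖ := by linarith
    induction k with
    | zero =>
      refine ⟨fun _ => 1, fun _ => 0, fun e he y _ => ⟨?_, ?_⟩, ?_⟩
      · have := V.lo y e; have := V.d0; have : 0 ≤ δ * ‖e‖ ^ 2 := by positivity
        simp only; linarith
      · have := V.hi y e; rw [hN e he] at this; simpa using this
      · simp; linarith
    | succ k ih =>
      obtain ⟨M, m, h1, h2⟩ := ih
      have hle : (1/2 : ℝ) ^ k ≤ 1 := pow_le_one₀ (by norm_num) (by norm_num)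
      obtain ⟨M', m', h3, h4⟩ := H x (‖x‖ / 4 * (1/2) ^ k) (Ω * q ^ k) M m hx (by positivity) (mul_le_of_le_one_right (by positivity) hle)
        (by
          have : ‖x‖ / 4 * (1/2) ^ k / ‖x‖ ≤ 1 * q ^ k := by
            rw [div_mul_eq_mul_div, div_div, div_le_iff₀ (by positivity)]
            have h5 : (1/2:ℝ) ^ k ≤ q ^ k := by gcongr; linarith
            have h6 : ‖x‖ * (1/2:ℝ) ^ k ≤ ‖x‖ * q ^ k := by gcongr
            have : 0 ≤ ‖x‖ * q ^ k := by positivity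
            linarith
          calc _ ≤ K * (1 * q ^ k) := by gcongr
            _ ≤ _ := by rw [one_mul]; gcongr) (by positivity) h1 h2
      exact ⟨M', m', by rw [pow_succ]; convert h3 using 5; ring, by rw [pow_succ]; linarith⟩
  set α : ℝ := Real.logb (1/2) q with hα
  have hqα : ((1:ℝ)/2) ^ α = q := Real.rpow_logb (by norm_num) (by norm_num) hq0
  have hα0 : 0 < α := Real.logb_pos_of_base_lt_one (by norm_num) (by norm_num) hq0 (by linarith)
  have hα1 : α ≤ 1 := by
    by_contra hcon
    push Not at hcon
    have := Real.rpow_lt_rpow_of_exponent_gt (by norm_num : (0:ℝ) < 1/2) (by norm_num) hcon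
    rw [hqα, Real.rpow_one] at this; linarith
  refine ⟨α, hα0, hα1, Cn * (Ω * (8 ^ α)), ?_, R', hR', fun x y hx hy i j => ?_⟩
  · have : (1:ℝ) ≤ 8 ^ α := Real.one_le_rpow (by norm_num) hα0.le
    exact one_le_mul_of_one_le_of_one_le hCn (one_le_mul_of_one_le_of_one_le (by linarith) this)
  have hx0 : 0 < ‖x‖ := by linarith
  by_cases hxy : y = x
  · subst hxy; simp [Real.zero_rpow hα0.ne']
  have hd0 : 0 < ‖y - x‖ := norm_pos_iff.2 (sub_ne_zero.2 hxy)
  have ht0 : 0 < 4 * ‖y - x‖ / ‖x‖ := by positivity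
  obtain ⟨k, hk1, hk2⟩ := exists_nat_pow_near_of_lt_one ht0 (by rw [div_le_one hx0]; linarith) (by norm_num : (0:ℝ) < 1/2) (by norm_num)
  obtain ⟨M, m, h1, h2⟩ := it k x hx
  have hyb : y ∈ Metric.closedBall x (‖x‖ / 4 * (1/2) ^ k) := by
    rw [mem_closedBall_iff_norm]; rw [div_le_iff₀ hx0] at hk2; linarith
  have hpos : ∀ e ∈ N, 0 ≤ M e - m e := fun e he => by have := h1 e he y hyb; linarith
  have h3 := hB (hess v y - hess v x) (Ω * q ^ k) (fun i j => by simp only [Matrix.sub_apply, hess_symm V.cd.contDiffAt i j]) (by positivity) (fun e he => by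
    rw [qf_sub]
    have h4 := h1 e he y hyb
    have h5 := h1 e he x (Metric.mem_closedBall_self (by positivity))
    have h6 := (Finset.single_le_sum hpos he).trans h2
    rw [abs_le]; constructor <;> linarith) i j
  rw [Matrix.sub_apply] at h3
  refine h3.trans ?_
  rw [mul_assoc, mul_assoc]
  gcongr
  have h7 : q ^ (k+1) ≤ (4 * ‖y - x‖ / ‖x‖) ^ α := by
    rw [← hqα, ← Real.rpow_natCast, ← Real.rpow_mul (by norm_num), mul_comm, Real.rpow_mul (by norm_num), Real.rpow_natCast]
    exact Real.rpow_le_rpow (by positivity) hk1.le hα0.le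
  have h8 : (8:ℝ) ^ α = 2 ^ α * 4 ^ α := by rw [← Real.mul_rpow (by norm_num) (by norm_num)]; norm_num
  have h9 : (2:ℝ) ^ α = q⁻¹ := by rw [← hqα, one_div, Real.inv_rpow (by norm_num), inv_inv]
  rw [show 4 * ‖y - x‖ / ‖x‖ = 4 * (‖y - x‖ / ‖x‖) by ring, Real.mul_rpow (by norm_num) (by positivity)] at h7
  rw [h8, h9, mul_assoc, le_inv_mul_iff₀ hq0, mul_comm, ← pow_succ]
  exact h7
end
section
variable {n : ℕ}
noncomputable def pz {n : ℕ} (σ : ℝ) (y : EV n) : ℝ := (1 + ‖y - 0‖ ^ 2) ^ (σ / 2)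
theorem pz_cd (σ : ℝ) : ContDiff ℝ 2 (pz σ : EV n → ℝ) := contDiff_iff_contDiffAt.2 fun y =>
  ((contDiff_const.add (contDiff_sq 0)).contDiffAt).rpow_const_of_ne (by positivity)
theorem pz_le {σ : ℝ} (h0 : 0 < σ) (h1 : σ ≤ 1) (y : EV n) : 0 < pz σ y ∧ pz σ y ≤ (1 + ‖y‖) ^ σ := by
  refine ⟨by unfold pz; positivity, ?_⟩
  unfold pz
  rw [sub_zero, show σ / 2 = 2⁻¹ * σ by ring, Real.rpow_mul (by positivity)]
  gcongr
  rw [← one_div, ← Real.sqrt_eq_rpow]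
  exact Real.sqrt_le_iff.2 ⟨by positivity, by have := norm_nonneg y; ring_nf; linarith⟩
theorem pz_ell (hn : 3 ≤ n) {σ L : ℝ} (h0 : 0 < σ) (hσ : L * (1 - σ) ≤ 1) (h1 : σ ≤ 1) {a : Matrix (Fin n) (Fin n) ℝ} (ha : Ell 1 L a) (y : EV n) :
    σ * (1 + ‖y‖ ^ 2)⁻¹ ≤ pr a (hess (pz σ) y) := by
  have hp : 0 < 1 + ‖y - 0‖ ^ 2 := by positivity
  obtain ⟨c1, c2, c3⟩ := deriv_rpow2 (σ / 2) hp
  have hF : ContDiffAt ℝ 2 (fun s : ℝ => (1 + s) ^ (σ / 2)) (‖y - 0‖ ^ 2) :=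
    ContDiffAt.comp (g := fun s : ℝ => s ^ (σ / 2)) (‖y - 0‖ ^ 2) c1 (contDiffAt_const.add contDiffAt_id)
  have d1 : deriv (fun s : ℝ => (1 + s) ^ (σ / 2)) = fun s => deriv (fun s : ℝ => s ^ (σ / 2)) (1 + s) := by
    ext s; exact deriv_comp_const_add (fun s : ℝ => s ^ (σ / 2)) 1 s
  have d2 : deriv (deriv fun s : ℝ => (1 + s) ^ (σ / 2)) (‖y - 0‖ ^ 2) = deriv (deriv fun s : ℝ => s ^ (σ / 2)) (1 + ‖y - 0‖ ^ 2) := by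
    rw [d1]; exact deriv_comp_const_add (deriv fun s : ℝ => s ^ (σ / 2)) 1 _
  have hH : hess (pz σ) y = (2 * (σ / 2 * (1 + ‖y‖ ^ 2) ^ (σ / 2 - 1))) • 1 + (4 * (σ / 2 * (σ / 2 - 1) * (1 + ‖y‖ ^ 2) ^ (σ / 2 - 2))) • outer y := by
    have h1 := rad_hess hF
    rw [d2, c3, d1] at h1
    beta_reduce at h1
    rw [c2] at h1
    simp only [sub_zero] at h1
    rw [← h1]; unfold pz; simp only [sub_zero]
  rw [hH]
  rw [sub_zero] at hp
  clear hH hF d1 d2 c1 c2 c3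
  set t := ‖y‖ ^ 2 with ht
  have ht0 : 0 ≤ t := by positivity
  have e1 : (1 + t) ^ (σ / 2 - 1) = (1 + t) ^ (σ / 2) * (1 + t)⁻¹ := by rw [Real.rpow_sub_one hp.ne']; rfl
  have e2 : (1 + t) ^ (σ / 2 - 2) = (1 + t) ^ (σ / 2) * (1 + t)⁻¹ * (1 + t)⁻¹ := by
    rw [Real.rpow_sub hp, Real.rpow_two]; field_simp
  have hr : 1 ≤ (1 + t) ^ (σ / 2) := Real.one_le_rpow (by linarith) (by positivity)
  rw [pr_add, pr_smul, pr_smul, e1, e2]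
  have hn' : (3:ℝ) ≤ n := by exact_mod_cast hn
  have p1 : (n:ℝ) ≤ pr a 1 := by have := (ha 1 Matrix.PosSemidef.one).1; simpa using this
  have p2 := (ha _ (outer_psd y)).2
  have p3 : (n - 1) * t ≤ t * pr a 1 - pr a (outer y) := by
    have h := (ha (t • (1 : Matrix (Fin n) (Fin n) ℝ) - outer y) ?_).1
    · rw [pr_sub, pr_smul, Matrix.trace_sub, Matrix.trace_smul, outer_trace, ← ht] at h
      simp at h; linarith
    · refine psd_of_quad (fun i j => by simp [outer, Matrix.one_apply, eq_comm, mul_comm]) fun ξ => ?_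
      change 0 ≤ qf _ ξ
      rw [qf_sub, qf_smul, qf_one]
      have := quad_le_trace (outer_psd y) ξ
      rw [outer_trace] at this
      exact sub_nonneg.2 this
  rw [outer_trace, ← ht] at p2
  have p4 : (1 - σ) * pr a (outer y) ≤ t := by
    calc _ ≤ (1 - σ) * (L * t) := mul_le_mul_of_nonneg_left p2 (by linarith)
      _ = L * (1 - σ) * t := by ring
      _ ≤ 1 * t := by gcongr
      _ = t := one_mul t
  have key : 1 + t ≤ (1 + t) * pr a 1 - (2 - σ) * pr a (outer y) := by
    have : 2 * t ≤ (n - 1) * t := by gcongr; linarith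
    linarith
  have hi : 0 < (1 + t)⁻¹ := by positivity
  have : 2 * (σ / 2 * ((1 + t) ^ (σ / 2) * (1 + t)⁻¹)) * pr a 1 + 4 * (σ / 2 * (σ / 2 - 1) * ((1 + t) ^ (σ / 2) * (1 + t)⁻¹ * (1 + t)⁻¹)) * pr a (outer y)
      = σ * (1 + t) ^ (σ / 2) * (1 + t)⁻¹ * (1 + t)⁻¹ * ((1 + t) * pr a 1 - (2 - σ) * pr a (outer y)) := by
    field_simp; ring
  rw [this]
  calc σ * (1 + t)⁻¹ = σ * 1 * (1 + t)⁻¹ * (1 + t)⁻¹ * (1 + t) := by field_simp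
    _ ≤ _ := by gcongr
theorem vs_psi (hn : 3 ≤ n) {v F : EV n → ℝ} {Fi δ C R ζ : ℝ} (V : VS v F Fi δ C R ζ) : ∃ σ : ℝ, 0 < σ ∧ σ < 1 ∧ ∃ D, 1 ≤ D ∧ ∀ (h : ℝ) (e : EV n),
    0 < h → ‖e‖ = 1 → ∃ Ψ : EV n → ℝ, ContDiff ℝ 2 Ψ ∧ (∀ y, 0 ≤ Ψ y ∧ Ψ y ≤ D * (h ^ 2)⁻¹ * (1 + ‖y‖ + h) ^ σ) ∧
      ContDiff ℝ 2 (fun y => sd v h e y + 1 * Ψ y) ∧ ∀ y, 0 < pr (hess v y)⁻¹ (hess (fun y => sd v h e y + 1 * Ψ y) y) := by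
  have hδ := V.d0
  have hC := V.C1
  set L := δ⁻¹ with hL
  have hL0 : 0 < L := inv_pos.2 hδ
  set σ := 1 - (L + 1)⁻¹ with hσ
  have hi : (L + 1)⁻¹ < 1 := inv_lt_one_of_one_lt₀ (by linarith)
  have hi0 : 0 < (L + 1)⁻¹ := by positivity
  have hσ0 : 0 < σ := by linarith
  have hLσ : L * (1 - σ) ≤ 1 := by
    rw [hσ, sub_sub_cancel, ← div_eq_mul_inv, div_le_one (by linarith)]; linarith
  have hR := V.R1
  obtain ⟨C2, hC2, hg⟩ : ∃ C2, 1 ≤ C2 ∧ ∀ y, |F y - Fi| ≤ C2 * (1 + ‖y‖ ^ 2)⁻¹ := by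
    refine ⟨(2 * C + |Fi|) * (1 + R ^ 2), ?_, fun y => ?_⟩
    · have : 1 ≤ 2 * C + |Fi| := by have := abs_nonneg Fi; linarith
      exact one_le_mul_of_one_le_of_one_le this (by have := sq_nonneg R; linarith)
    have hp : 0 < 1 + ‖y‖ ^ 2 := by positivity
    rw [← div_eq_mul_inv, le_div_iff₀ hp]
    rcases le_total R ‖y‖ with hy | hy
    · have h1 := V.dec y hy
      have h2 : ‖y‖ ^ (-ζ) ≤ (‖y‖ ^ 2)⁻¹ := by
        rw [← Real.rpow_two, ← Real.rpow_neg (norm_nonneg y)]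
        exact Real.rpow_le_rpow_of_exponent_le (by linarith) (by linarith [V.z2])
      have hy2 : 1 ≤ ‖y‖ ^ 2 := one_le_pow₀ (by linarith)
      calc |F y - Fi| * (1 + ‖y‖ ^ 2) ≤ (C * (‖y‖ ^ 2)⁻¹) * (‖y‖ ^ 2 + ‖y‖ ^ 2) := by
            gcongr; exact h1.trans (by gcongr)
        _ = 2 * C := by linear_combination 2 * C * (inv_mul_cancel₀ (by linarith : ‖y‖ ^ 2 ≠ 0))
        _ ≤ (2 * C + |Fi|) * 1 := by linarith [abs_nonneg Fi]
        _ ≤ _ := by gcongr; linarith [sq_nonneg R]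
    · have h1 : |F y - Fi| ≤ 2 * C + |Fi| := (abs_sub _ _).trans (by linarith [V.bd y])
      gcongr
  refine ⟨σ, hσ0, by linarith, 8 * (C2 / σ), ?_, fun h e hh he => ?_⟩
  · have : 1 ≤ C2 / σ := by rw [le_div_iff₀ hσ0]; linarith
    linarith
  set D := 2 * (C2 / σ) with hD
  have hD0 : 0 < D := by positivity
  have hcd := pz_cd σ (n := n)
  have hsd := sd_cd hcd h e
  set k := 4 * D * (h ^ 2)⁻¹ with hk
  have hik : 0 < (h ^ 2)⁻¹ := by positivity
  have hΨ : ContDiff ℝ 2 (fun y => D * sd (pz σ) h e y + k * pz σ y) := (contDiff_const.mul hsd).add (contDiff_const.mul hcd)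
  refine ⟨fun y => D * sd (pz σ) h e y + k * pz σ y, hΨ, fun y => ?_, (sd_cd V.cd h e).add (contDiff_const.mul hΨ), fun y => ?_⟩
  · have q1 := pz_le hσ0 (by linarith) y
    have q2 := pz_le hσ0 (by linarith) (y + h • e)
    have q3 := pz_le hσ0 (by linarith) (y - h • e)
    have hne : ‖h • e‖ = h := by rw [norm_smul, he, mul_one, Real.norm_of_nonneg hh.le]
    have b2 : (1 + ‖y + h • e‖) ^ σ ≤ (1 + ‖y‖ + h) ^ σ := by have := norm_add_le y (h • e); exact Real.rpow_le_rpow (by positivity) (by linarith) hσ0.le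
    have b3 : (1 + ‖y - h • e‖) ^ σ ≤ (1 + ‖y‖ + h) ^ σ := by have := norm_sub_le y (h • e); exact Real.rpow_le_rpow (by positivity) (by linarith) hσ0.le
    have b1 : (1 + ‖y‖) ^ σ ≤ (1 + ‖y‖ + h) ^ σ := Real.rpow_le_rpow (by positivity) (by linarith) hσ0.le
    have e1 : D * sd (pz σ) h e y + k * pz σ y = D * (h ^ 2)⁻¹ * (pz σ (y + h • e) + pz σ (y - h • e) + 2 * pz σ y) := by
      simp only [sd, hk]; ring
    beta_reduce
    rw [e1]
    refine ⟨by have := q1.1; have := q2.1; have := q3.1; positivity, ?_⟩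
    rw [show 8 * (C2 / σ) * (h ^ 2)⁻¹ * (1 + ‖y‖ + h) ^ σ = D * (h ^ 2)⁻¹ * (4 * (1 + ‖y‖ + h) ^ σ) by rw [hD]; ring]
    gcongr
    linarith [q1.2, q2.2, q3.2]
  · have e1 : (fun y => sd v h e y + 1 * (D * sd (pz σ) h e y + k * pz σ y)) = fun y => (sd v h e y + D * sd (pz σ) h e y) + k * pz σ y := by
      ext y; ring
    rw [e1, hess_lin ((sd_cd V.cd h e).contDiffAt.add (contDiffAt_const.mul hsd.contDiffAt)) hcd.contDiffAt,
      hess_lin (sd_cd V.cd h e).contDiffAt hsd.contDiffAt, sd_hess hcd, sd_hess V.cd]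
    simp only [pr_add, pr_sub, pr_smul]
    have l1 := logdet_le (V.pd y) (V.pd (y + h • e))
    have l2 := logdet_le (V.pd y) (V.pd (y - h • e))
    rw [V.eq, V.eq, pr_sub] at l1 l2
    have s1 := pz_ell hn hσ0 hLσ (by linarith) (V.ell y) y
    have tr : ∀ y', σ * (1 + ‖y'‖ ^ 2)⁻¹ ≤ pr (hess v y)⁻¹ (hess (pz σ) y') := pz_ell hn hσ0 hLσ (by linarith) (V.ell y)
    have s2 := tr (y + h • e)
    have s3 := tr (y - h • e)
    have g1 := abs_le.1 (hg y)
    have g2 := abs_le.1 (hg (y + h • e))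
    have g3 := abs_le.1 (hg (y - h • e))
    have i1 : 0 < (1 + ‖y‖ ^ 2)⁻¹ := by positivity
    have i2 : 0 < (1 + ‖y + h • e‖ ^ 2)⁻¹ := by positivity
    have i3 : 0 < (1 + ‖y - h • e‖ ^ 2)⁻¹ := by positivity
    generalize (1 + ‖y‖ ^ 2)⁻¹ = x1 at *
    generalize (1 + ‖y + h • e‖ ^ 2)⁻¹ = x2 at *
    generalize (1 + ‖y - h • e‖ ^ 2)⁻¹ = x3 at *
    have hDσ : D * σ = 2 * C2 := by rw [hD]; field_simp
    have m1 := mul_le_mul_of_nonneg_left s1 hD0.le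
    have m2 := mul_le_mul_of_nonneg_left s2 hD0.le
    have m3 := mul_le_mul_of_nonneg_left s3 hD0.le
    rw [← mul_assoc, hDσ] at m1 m2 m3
    have c1 : 0 < C2 * x1 := by positivity
    have c2 : 0 < C2 * x2 := by positivity
    have c3 : 0 < C2 * x3 := by positivity
    rw [hk, show ∀ A B E G H : ℝ, (h ^ 2)⁻¹ * A + D * ((h ^ 2)⁻¹ * (B + E - 2 * G)) + 4 * D * (h ^ 2)⁻¹ * G
      = (h ^ 2)⁻¹ * (A + (D * B + D * E + 2 * (D * G))) from fun A B E G H => by ring]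
    · apply mul_pos hik; linarith
    · exact 0
end
section
variable {n : ℕ}
theorem vs_max {L T r : ℝ} {g : EV n → ℝ} (hg : ContDiff ℝ 2 g) (H : ∀ y, ∃ a, Ell 1 L a ∧ 0 < pr a (hess g y))
    (hb : ∀ y, ‖y‖ = r → g y ≤ T) : ∀ y, ‖y‖ ≤ r → g y ≤ T := by
  intro y hy
  refine cmpP (l := 1) (L := L) zero_le_one (isCompact_closedBall (0 : EV n) r) (w := fun _ => T) (ψ := g) continuousOn_const hg.continuous.continuousOn
    (fun x hx => ?_) y (by simpa using hy)
  rw [mem_closedBall_zero_iff] at hx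
  rcases hx.eq_or_lt with h | h
  · exact Or.inl (hb x h)
  · obtain ⟨a, ha, h1⟩ := H x
    refine Or.inr ⟨Metric.closedBall_mem_nhds_of_mem (by simpa using h), contDiffAt_const, hg.contDiffAt, a, 0, ha, ?_⟩
    have : hess (fun _ : EV n => T) x = 0 := by ext i j; simp [hess_apply]
    rw [this]; simpa [pr] using h1
theorem ek_qf {v : EV n → ℝ} {α K R' : ℝ} (hα : 0 < α) (hK : 0 ≤ K)
    (ek : ∀ x y : EV n, R' ≤ ‖x‖ → ‖y - x‖ ≤ ‖x‖ / 4 → ∀ i j, |hess v y i j - hess v x i j| ≤ K * (‖y - x‖ / ‖x‖) ^ α)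
    {e : EV n} (he : ‖e‖ = 1) {x y : EV n} {ε : ℝ} (hR : 0 < R') (hx : R' ≤ ‖x‖) (hy : ‖y - x‖ ≤ ε * ‖x‖) (hε : ε ≤ 1 / 4) :
    |qf (hess v y) e - qf (hess v x) e| ≤ n ^ 2 * (K * ε ^ α) := by
  rw [← qf_sub]
  refine qf_ent_le (fun i j => ?_) he
  have hx0 : 0 < ‖x‖ := by linarith
  refine (ek x y hx (hy.trans ?_) i j).trans ?_
  · have := mul_le_mul_of_nonneg_right hε hx0.le; linarith
  · gcongr
    rwa [div_le_iff₀ hx0]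
theorem near_mono (hn : 3 ≤ n) {v F : EV n → ℝ} {Fi δ C R ζ : ℝ} (V : VS v F Fi δ C R ζ) : ∃ q : ℝ, 0 < q ∧ ∃ D, 1 ≤ D ∧ ∃ R1, 1 ≤ R1 ∧
    ∀ (e : EV n) (r r' t : ℝ), ‖e‖ = 1 → R1 ≤ r → r ≤ r' → r' ≤ 2 * r → (∀ z : EV n, ‖z‖ = r' → qf (hess v z) e ≤ t) →
      ∀ y : EV n, ‖y‖ = r → qf (hess v y) e ≤ t + D * r ^ (-q) := by
  obtain ⟨α, hα, hα1, K, hK, R', hR', hek⟩ := ek V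
  obtain ⟨σ, hσ0, hσ1, D, hD, hΨ⟩ := vs_psi hn V
  have hR := V.R1
  set p := (2 - σ) / 4 with hp
  have hp0 : 0 < p := by linarith
  refine ⟨p * α, by positivity, 2 * (n ^ 2 * K) + 4 * D, ?_, max R' (4 ^ (1 / p) + 4), ?_, ?_⟩
  · have : 0 ≤ (n:ℝ) ^ 2 * K := by positivity
    linarith
  · exact le_max_of_le_left (by linarith)
  intro e r r' t he hr hrr hr2 ht y hy
  have hr1 : R' ≤ r := (le_max_left _ _).trans hr
  have hr3 := (le_max_right _ _).trans hr
  have h4p : 0 < (4:ℝ) ^ (1 / p) := by positivity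
  have hr0 : 0 < r := by linarith
  set ε := r ^ (-p) with hε
  have hε0 : 0 < ε := by positivity
  have hε4 : ε ≤ 1 / 4 := by
    calc ε ≤ ((4:ℝ) ^ (1 / p)) ^ (-p) := Real.rpow_le_rpow_of_nonpos h4p (by linarith) (by linarith)
      _ = 1 / 4 := by rw [← Real.rpow_mul (by norm_num)]; rw [show 1 / p * -p = -1 by field_simp]; norm_num [Real.rpow_neg]
  have hεα : ε ^ α = r ^ (-(p * α)) := by rw [hε, ← Real.rpow_mul hr0.le]; ring_nf
  set q := r ^ (-(p * α)) with hq
  set h := ε * r with hh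
  have hh0 : 0 < h := by positivity
  have hhr : h ≤ r / 4 := by have := mul_le_mul_of_nonneg_right hε4 hr0.le; linarith
  obtain ⟨Ψ, _, hΨb, hcd, hL⟩ := hΨ h e hh0 he
  have hΨ4 : ∀ z : EV n, ‖z‖ ≤ 2 * r → Ψ z ≤ 4 * D * q := fun z hz => by
    refine (hΨb z).2.trans ?_
    have h1 : (1 + ‖z‖ + h) ^ σ ≤ 4 * r ^ σ := by
      calc _ ≤ (4 * r) ^ σ := Real.rpow_le_rpow (by positivity) (by linarith) hσ0.le
        _ = 4 ^ σ * r ^ σ := Real.mul_rpow (by norm_num) hr0.le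
        _ ≤ 4 ^ (1:ℝ) * r ^ σ := by gcongr; norm_num
        _ = _ := by norm_num
    have h2 : (h ^ 2)⁻¹ * r ^ σ ≤ q := by
      have : (h ^ 2)⁻¹ = r ^ (2 * p - 2) := by
        rw [hh, hε, ← Real.rpow_add_one hr0.ne', ← Real.rpow_natCast, ← Real.rpow_mul hr0.le, ← Real.rpow_neg hr0.le]
        congr 1; push_cast; ring
      rw [this, ← Real.rpow_add hr0]
      refine Real.rpow_le_rpow_of_exponent_le (by linarith) ?_
      have : p * α ≤ p * 1 := by gcongr
      linarith
    calc D * (h ^ 2)⁻¹ * (1 + ‖z‖ + h) ^ σ ≤ D * (h ^ 2)⁻¹ * (4 * r ^ σ) := by gcongr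
      _ = 4 * D * ((h ^ 2)⁻¹ * r ^ σ) := by ring
      _ ≤ _ := by gcongr
  have hE : ∀ z : EV n, r ≤ ‖z‖ → ∀ s, |s| ≤ h → |qf (hess v (z + s • e)) e - qf (hess v z) e| ≤ n ^ 2 * (K * q) := fun z hz s hs => by
    rw [← hεα]
    refine ek_qf hα (by linarith) hek he (by linarith) (by linarith) ?_ hε4
    rw [add_sub_cancel_left, norm_smul, he, mul_one]
    exact hs.trans (by rw [hh]; gcongr)
  have hM := vs_max hcd (fun y => ⟨_, V.ell y, hL y⟩) (T := t + n ^ 2 * (K * q) + 4 * D * q) (r := r') (fun z hz => by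
    have h1 := sd_le (v := v) (y := z) (e := e) (M := t + n ^ 2 * (K * q)) hh0 fun s hs => ⟨V.cd.contDiffAt, by
      have := (abs_le.1 (hE z (by linarith) s hs)).2; linarith [ht z hz]⟩
    have h2 := hΨ4 z (by linarith)
    linarith) y (by linarith)
  have h1 := le_sd (v := v) (y := y) (e := e) (M := qf (hess v y) e - n ^ 2 * (K * q)) hh0 fun s hs => ⟨V.cd.contDiffAt, by
      have := (abs_le.1 (hE y (by linarith) s hs)).1; linarith⟩
  have h2 := (hΨb y).1
  linarith
theorem near_mono' (hn : 3 ≤ n) {v F : EV n → ℝ} {Fi δ C R ζ : ℝ} (V : VS v F Fi δ C R ζ) : ∃ q : ℝ, 0 < q ∧ ∃ D, 1 ≤ D ∧ ∃ R1, 1 ≤ R1 ∧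
    ∀ (e : EV n) (r r' t : ℝ), ‖e‖ = 1 → R1 ≤ r → r ≤ r' → (∀ z : EV n, ‖z‖ = r' → qf (hess v z) e ≤ t) →
      ∀ y : EV n, ‖y‖ = r → qf (hess v y) e ≤ t + D * r ^ (-q) := by
  obtain ⟨q, hq, D, hD, R1, hR1, H⟩ := near_mono hn V
  have h2 : (2:ℝ) ^ (-q) < 1 := Real.rpow_lt_one_of_one_lt_of_neg (by norm_num) (by linarith)
  have h20 : 0 < (2:ℝ) ^ (-q) := by positivity
  have hs : 0 < 1 - (2:ℝ) ^ (-q) := by linarith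
  set D' := D / (1 - 2 ^ (-q)) with hD'
  have hDD : D ≤ D' := by rw [le_div_iff₀ hs]; exact mul_le_of_le_one_right (by linarith) (by linarith)
  refine ⟨q, hq, D', hD.trans hDD, R1, hR1, ?_⟩
  intro e r r' t he hr hrr ht
  obtain ⟨k, hk⟩ := pow_unbounded_of_one_lt (r' / r) (by norm_num : (1:ℝ) < 2)
  rw [div_lt_iff₀ (by linarith)] at hk
  induction k generalizing r with
  | zero => linarith
  | succ k ih =>
    intro y hy
    have hr0 : 0 < r := by linarith
    rcases le_or_gt r' (2 * r) with h | h
    · refine (H e r r' t he hr hrr h ht y hy).trans (by gcongr)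
    · have h1 := H e r (2 * r) _ he hr (by linarith) le_rfl (ih (2 * r) (by linarith) h.le (by rw [pow_succ] at hk; linarith)) y hy
      rw [Real.mul_rpow (by norm_num) hr0.le] at h1
      have : D' * 2 ^ (-q) + D = D' := by rw [hD']; field_simp; ring
      have h3 : D' * (2 ^ (-q) * r ^ (-q)) + D * r ^ (-q) = D' * r ^ (-q) := by linear_combination r ^ (-q) * this
      linarith
end
section
variable {n : ℕ}
theorem far (hn : 3 ≤ n) (r : ℝ) : ∃ z : EV n, r ≤ ‖z‖ := by
  refine ⟨|r| • ee ⟨0, by omega⟩, ?_⟩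
  rw [norm_smul]; simp [ee]; exact le_abs_self r
theorem vs_harn (hn : 3 ≤ n) {v F : EV n → ℝ} {Fi δ C R ζ : ℝ} (V : VS v F Fi δ C R ζ) {e : EV n} (he : ‖e‖ = 1) {M s : ℝ} (hs : 0 < s)
    (hM : ∀ η > 0, ∃ R0, ∀ z : EV n, R0 ≤ ‖z‖ → qf (hess v z) e ≤ M + η) :
    ∃ c > 0, ∃ R0, ∀ z : EV n, R0 ≤ ‖z‖ → qf (hess v z) e < M - s → ∀ y : EV n, ‖y‖ = ‖z‖ → qf (hess v y) e ≤ M - c := by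
  obtain ⟨α, hα, hα1, K, hK, R', hR', hek⟩ := ek V
  obtain ⟨σ, hσ0, hσ1, D, hD, hΨ⟩ := vs_psi hn V
  have hR := V.R1
  have small : ∀ s > 0, ∃ θ : ℝ, 0 < θ ∧ θ ≤ 1 / 4 ∧ n ^ 2 * (K * θ ^ α) ≤ s := fun s hs => by
    have h0 : 0 < (n:ℝ) ^ 2 * K := by have : 0 < n := by omega
                                      positivity
    refine ⟨min (1/4) ((s / (n ^ 2 * K)) ^ (1 / α)), by positivity, min_le_left _ _, ?_⟩
    have : (min (1/4) ((s / (n ^ 2 * K)) ^ (1 / α))) ^ α ≤ s / (n ^ 2 * K) := by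
      calc _ ≤ ((s / (n ^ 2 * K)) ^ (1 / α)) ^ α := Real.rpow_le_rpow (by positivity) (min_le_right _ _) hα.le
        _ = _ := by rw [← Real.rpow_mul (by positivity), one_div_mul_cancel hα.ne', Real.rpow_one]
    rw [← mul_assoc]
    rw [le_div_iff₀ h0] at this; linarith
  obtain ⟨θ, hθ, hθ4, hθs⟩ := small (s / 2) (by linarith)
  obtain ⟨c, hc, κ, hκ, hc1, G⟩ := gl n (l := 1) (L := δ⁻¹) (μ := (θ / 4) ^ n) one_pos (inv_nonneg.2 V.d0.le) (by positivity)
  obtain ⟨ε', hε'0, hε'4, hε's⟩ := small (c * s / 16) (by positivity)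
  set ε := min ε' (θ / 2) with hε
  have hε0 : 0 < ε := lt_min hε'0 (by linarith)
  have hεθ : ε ≤ θ / 2 := min_le_right _ _
  have hεs : n ^ 2 * (K * ε ^ α) ≤ c * s / 16 := le_trans (by gcongr; exact min_le_left _ _) hε's
  have hcs : 0 < c * s := by positivity
  have hcs1 : c * s < s := mul_lt_of_lt_one_left hs hc1
  set η := c * s / 32 with hη
  obtain ⟨R0, hR0⟩ := hM η (by positivity)
  have lim : Tendsto (fun r : ℝ => D * (ε ^ 2)⁻¹ * 12 * r ^ (-(2 - σ))) atTop (𝓝 0) := by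
    have := (tendsto_rpow_neg_atTop (show 0 < 2 - σ by linarith)).const_mul (D * (ε ^ 2)⁻¹ * 12)
    rwa [mul_zero] at this
  obtain ⟨R2, hR2⟩ := (lim.eventually (gt_mem_nhds (show (0:ℝ) < η by positivity))).exists_forall_of_atTop
  refine ⟨c * s / 8, by positivity, max (max R0 R2) (max R' 1), fun z hz hzs => ?_⟩
  set r := ‖z‖ with hr
  have hr1 : R' ≤ r := (le_max_left _ _).trans ((le_max_right _ _).trans hz)
  have hr2 : R0 ≤ r := (le_max_left _ _).trans ((le_max_left _ _).trans hz)
  have hr3 := hR2 r ((le_max_right _ _).trans ((le_max_left _ _).trans hz))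
  have hr0 : 1 ≤ r := by linarith
  set h := ε * r with hh
  have hh0 : 0 < h := by positivity
  have hhr : h ≤ θ / 2 * r := by rw [hh]; gcongr
  have hθr : θ * r ≤ 1 / 4 * r := by gcongr
  obtain ⟨Ψ, _, hΨb, hcd, hL⟩ := hΨ h e hh0 he
  have hΨ4 : ∀ y : EV n, ‖y‖ ≤ 10 * r → Ψ y ≤ η := fun y hy => by
    refine (hΨb y).2.trans (le_trans ?_ hr3.le)
    have h1 : (1 + ‖y‖ + h) ^ σ ≤ 12 * r ^ σ := by
      calc _ ≤ (12 * r) ^ σ := Real.rpow_le_rpow (by positivity) (by linarith) hσ0.le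
        _ = 12 ^ σ * r ^ σ := Real.mul_rpow (by norm_num) (by linarith)
        _ ≤ 12 ^ (1:ℝ) * r ^ σ := by gcongr; norm_num
        _ = _ := by norm_num
    have h2 : r ^ (-(2 - σ)) = (r ^ 2)⁻¹ * r ^ σ := by
      rw [show -(2 - σ) = -2 + σ by ring, Real.rpow_add (by linarith), Real.rpow_neg (by linarith), Real.rpow_two]
    calc D * (h ^ 2)⁻¹ * (1 + ‖y‖ + h) ^ σ ≤ D * (h ^ 2)⁻¹ * (12 * r ^ σ) := by gcongr
      _ = _ := by rw [hh, h2, mul_pow, mul_inv]; ring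
  have hne : ∀ t, |t| ≤ h → ‖t • e‖ ≤ h := fun t ht => by rwa [norm_smul, he, mul_one]
  have hT := vs_max hcd (fun y => ⟨_, V.ell y, hL y⟩) (T := M + 2 * η) (r := 10 * r) (fun y hy => by
    have h1 := sd_le (v := v) (y := y) (e := e) (M := M + η) hh0 fun t ht => ⟨V.cd.contDiffAt, hR0 _ (by
      have := hne t ht
      have h3 := norm_sub_norm_le y (-(t • e))
      rw [norm_neg, sub_neg_eq_add] at h3
      linarith)⟩
    have h2 := hΨ4 y hy.le
    linarith)
  have hw : ContDiff ℝ 2 (fun y => (M + 2 * η) + (-1) * (sd v h e y + 1 * Ψ y)) := contDiff_const.add (contDiff_const.mul hcd)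
  have hG := G hw (z := 0) (ρ := 2 * r) (s := s / 4) (by linarith) (by linarith) (fun y hy => by
      have := hT y (by rw [mem_closedBall_zero_iff] at hy; linarith); linarith) (fun y hy => ⟨_, 0, V.ell y, by simp, by
      rw [hess_cs _ _ hcd.contDiffAt, pr_smul, map_zero, add_zero]
      have := hL y
      have h1 : 0 ≤ κ * (s / 4) := by positivity
      have h2 : 0 ≤ (2 * r) ^ 2 * pr (hess v y)⁻¹ (hess (fun y => sd v h e y + 1 * Ψ y) y) := by positivity
      linarith⟩) (by
    have hnn : n ≠ 0 := by omega
    haveI : Nonempty (Fin n) := ⟨⟨0, by omega⟩⟩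
    have e1 : (θ / 4) ^ n * volume.real (Metric.closedBall (0 : EV n) (2 * r)) = volume.real (Metric.closedBall z (θ / 2 * r)) := by
      simp only [measureReal_def]
      rw [Measure.addHaar_closedBall _ _ (by positivity), Measure.addHaar_closedBall _ _ (by positivity), ENNReal.toReal_mul, ENNReal.toReal_mul,
        ENNReal.toReal_ofReal (by positivity), ENNReal.toReal_ofReal (by positivity), finrank_euclideanSpace_fin, ← mul_assoc, ← mul_pow]
      congr 2; ring
    rw [e1]
    refine measureReal_mono (fun y hy => ?_) ((measure_mono Set.inter_subset_right).trans_lt measure_closedBall_lt_top).ne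
    rw [mem_closedBall_iff_norm] at hy
    have hyz : ‖y‖ ≤ 2 * r := by
      have := norm_le_norm_add_norm_sub' y z; linarith
    refine ⟨?_, by simpa using hyz⟩
    have h1 := sd_le (v := v) (y := y) (e := e) (M := M - s / 2) hh0 fun t ht => ⟨V.cd.contDiffAt, by
      have := (abs_le.1 (ek_qf hα (by linarith) hek he (by linarith) hr1 (y := y + t • e) (ε := θ) (by
        rw [add_sub_right_comm]
        refine (norm_add_le _ _).trans ?_
        have := hne t ht
        linarith) hθ4)).2
      linarith⟩
    have h2 := hΨ4 y (by linarith)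
    change s / 4 < _
    linarith)
  intro y hy
  have h1 := hG y (by rw [mem_closedBall_zero_iff]; linarith)
  have h2 := le_sd (v := v) (y := y) (e := e) (M := qf (hess v y) e - c * s / 16) hh0 fun t ht => ⟨V.cd.contDiffAt, by
    have := (abs_le.1 (ek_qf hα (by linarith) hek he (by linarith) (by linarith) (x := y) (y := y + t • e) (ε := ε) (by
        rw [add_sub_cancel_left, hy]; exact hne t ht) (by linarith))).1
    linarith⟩
  have h3 := (hΨb y).1
  linarith
theorem vs_conv (hn : 3 ≤ n) {v F : EV n → ℝ} {Fi δ C R ζ : ℝ} (V : VS v F Fi δ C R ζ) {e : EV n} (he : ‖e‖ = 1) :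
    ∃ M, ∀ s > 0, ∃ R0, ∀ z : EV n, R0 ≤ ‖z‖ → |qf (hess v z) e - M| ≤ s := by
  set S := {m : ℝ | ∃ R0, ∀ z : EV n, R0 ≤ ‖z‖ → qf (hess v z) e ≤ m} with hS
  have hne : S.Nonempty := ⟨1, 0, fun z _ => by have := V.hi z e; rwa [he, one_pow] at this⟩
  have hbb : BddBelow S := ⟨0, fun m ⟨R0, hm⟩ => by
    obtain ⟨z, hz⟩ := far hn R0
    have := V.lo z e
    rw [he] at this
    linarith [hm z hz, V.d0]⟩
  set M := sInf S with hM
  have ha : ∀ η > 0, ∃ R0, ∀ z : EV n, R0 ≤ ‖z‖ → qf (hess v z) e ≤ M + η := fun η hη => by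
    obtain ⟨m, ⟨R0, hm⟩, h1⟩ := exists_lt_of_csInf_lt hne (show sInf S < M + η by linarith)
    exact ⟨R0, fun z hz => (hm z hz).trans h1.le⟩
  refine ⟨M, fun s hs => ?_⟩
  obtain ⟨R0, hR0⟩ := ha s hs
  by_contra hcon
  push Not at hcon
  obtain ⟨c, hc, R2, hR2⟩ := vs_harn hn V he hs ha
  obtain ⟨q, hq, D, hD, R1, hR1, H⟩ := near_mono' hn V
  have lim : Tendsto (fun r : ℝ => D * r ^ (-q)) atTop (𝓝 0) := by
    have := (tendsto_rpow_neg_atTop hq).const_mul D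
    rwa [mul_zero] at this
  obtain ⟨R3, hR3⟩ := (lim.eventually (gt_mem_nhds (show (0:ℝ) < c / 2 by positivity))).exists_forall_of_atTop
  have : M - c / 2 ∈ S := ⟨max R1 R3, fun y hy => by
    obtain ⟨z, hz, hzs⟩ := hcon (max (max R0 R2) ‖y‖)
    have hz0 : R0 ≤ ‖z‖ := (le_max_left _ _).trans ((le_max_left _ _).trans hz)
    have hz2 : R2 ≤ ‖z‖ := (le_max_right _ _).trans ((le_max_left _ _).trans hz)
    have h1 : qf (hess v z) e < M - s := by
      rcases lt_abs.1 hzs with h | h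
      · linarith [hR0 z hz0]
      · linarith
    have h2 := H e ‖y‖ ‖z‖ (M - c) he ((le_max_left _ _).trans hy) ((le_max_right _ _).trans hz) (hR2 z hz2 h1) y rfl
    have h3 := hR3 ‖y‖ ((le_max_right _ _).trans hy)
    linarith⟩
  linarith [csInf_le hbb this]
theorem vs_lim (hn : 3 ≤ n) {v F : EV n → ℝ} {Fi δ C R ζ : ℝ} (V : VS v F Fi δ C R ζ) :
    ∃ A : Matrix (Fin n) (Fin n) ℝ, (∀ i j, A i j = A j i) ∧ ∀ s > 0, ∃ R0, ∀ z : EV n, R0 ≤ ‖z‖ → ∀ i j, |hess v z i j - A i j| ≤ s := by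
  have h0 : ∀ ξ : EV n, ∃ M, ∀ s > 0, ∃ R0, ∀ z : EV n, R0 ≤ ‖z‖ → |qf (hess v z) ξ - M| ≤ s := fun ξ => by
    by_cases hξ : ξ = 0
    · exact ⟨0, fun s hs => ⟨0, fun z _ => by subst hξ; simpa [qf] using hs.le⟩⟩
    have hx : 0 < ‖ξ‖ := norm_pos_iff.2 hξ
    obtain ⟨M, hM⟩ := vs_conv hn V (e := ‖ξ‖⁻¹ • ξ) (by rw [norm_smul, norm_inv, norm_norm, inv_mul_cancel₀ hx.ne'])
    refine ⟨‖ξ‖ ^ 2 * M, fun s hs => ?_⟩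
    obtain ⟨R0, h⟩ := hM (s / ‖ξ‖ ^ 2) (by positivity)
    refine ⟨R0, fun z hz => ?_⟩
    have h1 := h z hz
    rw [qf_hom, le_div_iff₀ (by positivity)] at h1
    rw [show qf (hess v z) ξ - ‖ξ‖ ^ 2 * M = ((‖ξ‖⁻¹) ^ 2 * qf (hess v z) ξ - M) * ‖ξ‖ ^ 2 by field_simp, abs_mul, abs_of_pos (by positivity : 0 < ‖ξ‖ ^ 2)]
    exact h1
  choose M hM using h0
  have key : ∀ z i j, hess v z i j = (qf (hess v z) (ee i + ee j) - qf (hess v z) (ee i) - qf (hess v z) (ee j)) / 2 := fun z i j => by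
    have := (hess_symm V.cd.contDiffAt i j : hess v z i j = _)
    simp only [qf_hess, map_add, add_apply]
    rw [hess_apply, hess_apply] at *
    linarith
  refine ⟨Matrix.of fun i j => (M (ee i + ee j) - M (ee i) - M (ee j)) / 2, fun i j => by simp only [Matrix.of_apply]; rw [add_comm (ee i)]; ring, fun s hs => ?_⟩
  choose r hr using fun ξ => hM ξ (s / 2) (by linarith)
  refine ⟨∑ i, |r (ee i)| + ∑ i, ∑ j, |r (ee i + ee j)|, fun z hz i j => ?_⟩
  have p1 : ∀ i, |r (ee i)| ≤ ∑ i, |r (ee i)| := fun i => Finset.single_le_sum (f := fun i => |r (ee i)|) (fun i _ => abs_nonneg _) (Finset.mem_univ i)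
  have p2 : |r (ee i + ee j)| ≤ ∑ i, ∑ j, |r (ee i + ee j)| :=
    (Finset.single_le_sum (f := fun j => |r (ee i + ee j)|) (fun j _ => abs_nonneg _) (Finset.mem_univ j)).trans
      (Finset.single_le_sum (f := fun i => ∑ j, |r (ee i + ee j)|) (fun i _ => Finset.sum_nonneg fun j _ => abs_nonneg _) (Finset.mem_univ i))
  have p3 := abs_nonneg (r (ee i + ee j))
  have p4 := abs_nonneg (r (ee i))
  have a1 := abs_le.1 (hr (ee i) z (by linarith [p1 i, le_abs_self (r (ee i))]))
  have a2 := abs_le.1 (hr (ee j) z (by linarith [p1 j, le_abs_self (r (ee j))]))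
  have a3 := abs_le.1 (hr (ee i + ee j) z (by linarith [p1 i, le_abs_self (r (ee i + ee j))]))
  rw [key, Matrix.of_apply, abs_le]
  constructor <;> linarith
end
noncomputable def nf (n : ℕ) : Filter (EV n) := comap norm atTop
section
variable {n : ℕ}
theorem evi {p : EV n → Prop} : (∀ᶠ z in nf n, p z) ↔ ∃ R0, ∀ z : EV n, R0 ≤ ‖z‖ → p z := by
  rw [nf, ((atTop_basis (α := ℝ)).comap norm).eventually_iff]; simp
theorem ev_ge (R : ℝ) : ∀ᶠ z in nf n, R ≤ ‖z‖ := evi.2 ⟨R, fun _ h => h⟩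
theorem nf_norm : Tendsto (fun z : EV n => ‖z‖) (nf n) atTop := tendsto_comap
theorem nf_ne (hn : 3 ≤ n) : (nf n).NeBot := by
  rw [neBot_iff]; intro h
  have : ∀ᶠ z in nf n, False := by rw [h]; exact eventually_bot
  obtain ⟨R, hR⟩ := evi.1 this
  obtain ⟨z, hz⟩ := far hn R
  exact hR z hz
noncomputable def mc {n : ℕ} (T : Matrix (Fin n) (Fin n) ℝ) : EV n →L[ℝ] EV n := Matrix.toEuclideanCLM (𝕜 := ℝ) T
theorem mc_apply (T : Matrix (Fin n) (Fin n) ℝ) (x : EV n) (i : Fin n) : mc T x i = ∑ j, T i j * x j := by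
  rw [mc, Matrix.ofLp_toEuclideanCLM]; rfl
theorem mc_ee (T : Matrix (Fin n) (Fin n) ℝ) (i k : Fin n) : mc T (ee i) k = T k i := by
  rw [mc_apply]; simp [ee]
theorem mc_mul (S T : Matrix (Fin n) (Fin n) ℝ) (x : EV n) : mc S (mc T x) = mc (S * T) x := by
  simp [mc, map_mul]
theorem mc_one (x : EV n) : mc 1 x = x := by simp [mc]
theorem d2_comp {w : EV n → ℝ} {B : EV n →L[ℝ] EV n} {x : EV n} (hw : ContDiffAt ℝ 2 w (B x)) (ξ η : EV n) :
    fderiv ℝ (fderiv ℝ fun y => w (B y)) x ξ η = fderiv ℝ (fderiv ℝ w) (B x) (B ξ) (B η) := by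
  have h1 : fderiv ℝ (fun y => w (B y)) =ᶠ[𝓝 x] fun y => (fderiv ℝ w (B y)).comp B := by
    have : ∀ᶠ y in 𝓝 x, DifferentiableAt ℝ w (B y) := B.continuous.continuousAt.eventually
      ((hw.eventually (by simp)).mono fun z hz => hz.differentiableAt (by simp))
    filter_upwards [this] with y hy
    exact (hy.hasFDerivAt.comp y B.hasFDerivAt).fderiv
  have h2 : DifferentiableAt ℝ (fderiv ℝ w) (B x) := (hw.fderiv_right (m := 1) (by norm_num)).differentiableAt (by simp)
  have h3 : HasFDerivAt (fun y => fderiv ℝ w (B y)) ((fderiv ℝ (fderiv ℝ w) (B x)).comp B) x := h2.hasFDerivAt.comp x B.hasFDerivAt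
  rw [h1.fderiv_eq, (h3.clm_comp (hasFDerivAt_const B x)).fderiv]
  simp
theorem hess_comp {w : EV n → ℝ} {T : Matrix (Fin n) (Fin n) ℝ} {x : EV n} (hw : ContDiffAt ℝ 2 w (mc T x)) :
    hess (fun y => w (mc T y)) x = T.transpose * hess w (mc T x) * T := by
  ext i j
  rw [hess_apply, d2_comp hw, hess_quad]
  simp only [mc_ee, Matrix.mul_apply, Matrix.transpose_apply, Finset.sum_mul]
  rw [Finset.sum_comm]
  exact Finset.sum_congr rfl fun k _ => Finset.sum_congr rfl fun l _ => by ring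
theorem pr_conj (a T H : Matrix (Fin n) (Fin n) ℝ) : pr a (T.transpose * H * T) = pr (T * a * T.transpose) H := by
  rw [pr_tr, pr_tr, Matrix.transpose_mul, Matrix.transpose_mul, Matrix.transpose_transpose]
  rw [show T * (a.transpose * T.transpose) * H = T * (a.transpose * (T.transpose * H)) by simp [Matrix.mul_assoc], Matrix.trace_mul_comm T]
  simp [Matrix.mul_assoc]
theorem pr_ent {c H : Matrix (Fin n) (Fin n) ℝ} {ε m : ℝ} (hc : ∀ i j, |c i j| ≤ ε) (hH : ∀ i j, |H i j| ≤ m) :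
    |pr c H| ≤ n ^ 2 * (ε * m) := by
  calc |pr c H| ≤ ∑ i : Fin n, ∑ j : Fin n, ε * m := (Finset.abs_sum_le_sum_abs _ _).trans (Finset.sum_le_sum fun i _ =>
        (Finset.abs_sum_le_sum_abs _ _).trans (Finset.sum_le_sum fun j _ => by
          rw [abs_mul]
          exact mul_le_mul (hc i j) (hH i j) (abs_nonneg _) ((abs_nonneg _).trans (hc i j))))
    _ = _ := by simp; ring
theorem rad_pr {G : ℝ → ℝ} {x : EV n} (hF : ContDiffAt ℝ 2 G (‖x - 0‖ ^ 2)) {b : Matrix (Fin n) (Fin n) ℝ} {ε : ℝ}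
    (hb : ∀ i j, |b i j - (1 : Matrix (Fin n) (Fin n) ℝ) i j| ≤ ε) {g1 g2 : ℝ} (h1 : deriv G (‖x - 0‖ ^ 2) = g1) (h2 : deriv (deriv G) (‖x - 0‖ ^ 2) = g2) :
    pr b (hess (fun y : EV n => G (‖y - 0‖ ^ 2)) x) ≤ 2 * n * g1 + 4 * g2 * ‖x‖ ^ 2 + n ^ 2 * (ε * (2 * |g1| + 4 * |g2| * ‖x‖ ^ 2)) := by
  have hb' : b = (b - 1) + 1 := by simp
  have hm : ∀ i j, |((2 * g1) • (1 : Matrix (Fin n) (Fin n) ℝ) + (4 * g2) • outer x) i j| ≤ 2 * |g1| + 4 * |g2| * ‖x‖ ^ 2 := fun i j => by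
    have c1 : |(1 : Matrix (Fin n) (Fin n) ℝ) i j| ≤ 1 := by by_cases h : i = j <;> simp [h, Matrix.one_apply]
    have c2 : |outer x i j| ≤ ‖x‖ ^ 2 := by
      simp only [outer, Matrix.of_apply, abs_mul, sq]
      exact mul_le_mul (PiLp.norm_apply_le x i) (PiLp.norm_apply_le x j) (abs_nonneg _) (norm_nonneg _)
    simp only [Matrix.add_apply, Matrix.smul_apply, smul_eq_mul]
    refine (abs_add_le _ _).trans ?_
    rw [abs_mul, abs_mul, abs_mul, abs_mul, abs_two, show |(4:ℝ)| = 4 by norm_num]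
    have := mul_le_mul_of_nonneg_left c1 (by positivity : 0 ≤ 2 * |g1|)
    have := mul_le_mul_of_nonneg_left c2 (by positivity : 0 ≤ 4 * |g2|)
    linarith
  have h3 := (abs_le.1 (pr_ent (c := b - 1) hb hm)).2
  rw [rad_hess hF, h1, h2, sub_zero, hb', pr_comm, pr_add, pr_comm _ (b - 1), pr_comm _ 1, pr_one, Matrix.trace_add, Matrix.trace_smul, Matrix.trace_smul, outer_trace, Matrix.trace_one]
  simp only [Fintype.card_fin, smul_eq_mul]
  linarith
theorem inv_tendsto {ι : Type*} {l : Filter ι} {f : ι → Matrix (Fin n) (Fin n) ℝ} {A : Matrix (Fin n) (Fin n) ℝ} (h : Tendsto f l (𝓝 A)) (hA : A.det ≠ 0) :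
    Tendsto (fun x => (f x)⁻¹) l (𝓝 A⁻¹) := by
  simp only [Matrix.inv_def, Ring.inverse_eq_inv']
  have h1 : Tendsto (fun x => (f x).det) l (𝓝 A.det) := (Continuous.matrix_det continuous_id).continuousAt.tendsto.comp h
  have h2 : Tendsto (fun x => (f x).adjugate) l (𝓝 A.adjugate) := (Continuous.matrix_adjugate continuous_id).continuousAt.tendsto.comp h
  exact (h1.inv₀ hA).smul h2
theorem ent_tendsto {ι : Type*} {l : Filter ι} {f : ι → Matrix (Fin n) (Fin n) ℝ} {A : Matrix (Fin n) (Fin n) ℝ} :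
    Tendsto f l (𝓝 A) ↔ ∀ ε > 0, ∀ᶠ x in l, ∀ i j, |f x i j - A i j| ≤ ε := by
  constructor
  · intro h ε hε
    have h1 : ∀ i j, Tendsto (fun x => f x i j) l (𝓝 (A i j)) := fun i j => tendsto_pi_nhds.1 (tendsto_pi_nhds.1 h i) j
    rw [eventually_all]; intro i; rw [eventually_all]; intro j
    filter_upwards [Metric.tendsto_nhds.1 (h1 i j) ε hε] with x hx
    exact hx.le
  · intro h
    refine tendsto_pi_nhds.2 fun i => tendsto_pi_nhds.2 fun j => Metric.tendsto_nhds.2 fun ε hε => ?_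
    filter_upwards [h (ε / 2) (by linarith)] with x hx
    have := hx i j
    rw [Real.dist_eq]; linarith
end
abbrev Mx (n : ℕ) := Matrix (Fin n) (Fin n) ℝ
section
variable {n : ℕ}
theorem ann_c (r ρ : ℝ) : IsCompact {x : EV n | r ≤ ‖x‖ ∧ ‖x‖ ≤ ρ} :=
  (isCompact_closedBall (0 : EV n) ρ).of_isClosed_subset (by
    rw [Set.setOf_and]; exact (isClosed_le continuous_const continuous_norm).inter (isClosed_le continuous_norm continuous_const))
    fun x hx => by simpa using hx.2
theorem ann_n {r ρ : ℝ} {x : EV n} (h1 : r < ‖x‖) (h2 : ‖x‖ < ρ) : {x : EV n | r ≤ ‖x‖ ∧ ‖x‖ ≤ ρ} ∈ 𝓝 x :=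
  (((continuous_norm.tendsto x).eventually (lt_mem_nhds h1)).and ((continuous_norm.tendsto x).eventually (gt_mem_nhds h2))).mono
    fun _ h => ⟨h.1.le, h.2.le⟩
theorem ext_cmp {l L R1 : ℝ} (hl : 0 ≤ l) {g ψ : EV n → ℝ} (hd : ∀ x : EV n, R1 ≤ ‖x‖ → ContDiffAt ℝ 2 g x ∧ ContDiffAt ℝ 2 ψ x)
    (hb : ∀ x : EV n, ‖x‖ = R1 → g x ≤ ψ x) (hi : ∀ ε > 0, ∀ᶠ x in nf n, g x ≤ ε + ψ x)
    (he : ∀ x : EV n, R1 < ‖x‖ → ∃ a b, Ell l L a ∧ pr a (hess ψ x) + fderiv ℝ ψ x b < pr a (hess g x) + fderiv ℝ g x b) :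
    ∀ x : EV n, R1 ≤ ‖x‖ → g x ≤ ψ x := by
  intro y hy
  refine le_of_forall_pos_le_add fun ε hε => ?_
  obtain ⟨ρ0, hρ⟩ := evi.1 (hi ε hε)
  have hd' : ∀ x : EV n, R1 ≤ ‖x‖ → ContDiffAt ℝ 2 (fun y => ε + 1 * ψ y) x := fun x hx => contDiffAt_const.add (contDiffAt_const.mul (hd x hx).2)
  have := cmpP (L := L) hl (ann_c R1 (max ρ0 ‖y‖)) (w := fun y => ε + 1 * ψ y) (ψ := g) (fun x hx => (hd' x hx.1).continuousAt.continuousWithinAt)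
    (fun x hx => (hd x hx.1).1.continuousAt.continuousWithinAt) (fun x hx => ?_) y ⟨hy, le_max_right _ _⟩
  · linarith
  rcases hx.1.eq_or_lt with h | h
  · left; have := hb x h.symm; linarith
  rcases hx.2.eq_or_lt with h2 | h2
  · left; have := hρ x (h2 ▸ le_max_left _ _); linarith
  right
  obtain ⟨a, b, h3, h4⟩ := he x h
  refine ⟨ann_n h h2, hd' x hx.1, (hd x hx.1).1, a, b, h3, ?_⟩
  rw [hess_cs _ _ (hd x hx.1).2, fderiv_cs _ _ (hd x hx.1).2, one_smul, one_smul]; exact h4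
theorem rbar {k : ℝ} (hk : 0 < k) {x : EV n} (hx : x ≠ 0) : ContDiffAt ℝ 2 (fun y : EV n => (‖y - 0‖ ^ 2) ^ (-k / 2)) x ∧
    (‖x - 0‖ ^ 2) ^ (-k / 2) = ‖x‖ ^ (-k) ∧ (∀ b, fderiv ℝ (fun y : EV n => (‖y - 0‖ ^ 2) ^ (-k / 2)) x b ≤ k * ‖x‖ ^ (-k - 1) * ‖b‖) ∧
    ∀ (b : Mx n) (ε : ℝ), (∀ i j, |b i j - (1 : Mx n) i j| ≤ ε) →
      pr b (hess (fun y : EV n => (‖y - 0‖ ^ 2) ^ (-k / 2)) x) ≤ (n ^ 2 * (ε * (k * (k + 3))) - k * (n - 2 - k)) * ‖x‖ ^ (-k - 2) := by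
  have hr : 0 < ‖x‖ := norm_pos_iff.2 hx
  have hs : 0 < ‖x - 0‖ ^ 2 := by rw [sub_zero]; positivity
  obtain ⟨c1, c2, c3⟩ := deriv_rpow2 (-k / 2) hs
  have hp : ∀ p : ℝ, (‖x - 0‖ ^ 2) ^ p = ‖x‖ ^ (2 * p) := fun p => by rw [sub_zero, ← Real.rpow_natCast, ← Real.rpow_mul hr.le]; norm_num
  have e1 : ‖x‖ ^ (-k - 1) = ‖x‖ ^ (-k - 2) * ‖x‖ := by rw [← Real.rpow_add_one hr.ne']; ring_nf
  have e2 : ‖x‖ ^ (-k - 4) * ‖x‖ ^ 2 = ‖x‖ ^ (-k - 2) := by rw [← Real.rpow_natCast, ← Real.rpow_add hr]; norm_num; ring_nf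
  rw [hp, show 2 * (-k / 2 - 1) = -k - 2 by ring] at c2
  rw [hp, show 2 * (-k / 2 - 2) = -k - 4 by ring] at c3
  set t := ‖x‖ ^ (-k - 2)
  have ht : 0 < t := by positivity
  refine ⟨contDiffAt_rad c1, by rw [hp]; ring_nf, fun b => ?_, fun b ε hb => ?_⟩
  · rw [rad_fderiv (c1.differentiableAt (by simp)), c2, smul_apply, innerSL_apply_apply, e1, sub_zero, smul_eq_mul]
    have h1 : -(‖x‖ * ‖b‖) ≤ ⟪x, b⟫ := (abs_le.1 (abs_real_inner_le_norm x b)).1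
    have := mul_le_mul_of_nonneg_left h1 (by positivity : 0 ≤ k * t)
    linarith
  · have h1 := rad_pr c1 hb c2 c3
    refine h1.trans (le_of_eq ?_)
    rw [abs_of_nonpos (by have : 0 ≤ k * t := by positivity
                          linarith), abs_of_nonneg (by have : 0 ≤ k / 2 * (k / 2 + 1) * ‖x‖ ^ (-k - 4) := by positivity
                                                       linarith)]
    linear_combination (k * (k + 2) + n ^ 2 * ε * (k * (k + 2))) * e2
theorem vs_rate (hn : 3 ≤ n) {v F : EV n → ℝ} {Fi δ C R ζ : ℝ} (V : VS v F Fi δ C R ζ) :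
    ∃ A : Mx n, (∀ i j, A i j = A j i) ∧ Tendsto (hess v) (nf n) (𝓝 A) ∧ ∃ C1, ∀ᶠ y in nf n, ∀ i j, |hess v y i j - A i j| ≤ C1 * ‖y‖ ^ (-(3/4) : ℝ) := by
  obtain ⟨A, hAs, hA⟩ := vs_lim hn V
  have hne := nf_ne hn
  have hT : Tendsto (hess v) (nf n) (𝓝 A) := ent_tendsto.2 fun ε hε => evi.2 (hA ε hε)
  have hq : ∀ ξ, Tendsto (fun y => qf (hess v y) ξ) (nf n) (𝓝 (qf A ξ)) := fun ξ => by
    simp only [qf]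
    exact tendsto_finsetSum _ fun i _ => tendsto_finsetSum _ fun j _ => tendsto_const_nhds.mul (tendsto_pi_nhds.1 (tendsto_pi_nhds.1 hT i) j)
  have hδ := V.d0
  have hC := V.C1
  have lo : ∀ ξ, δ * ‖ξ‖ ^ 2 ≤ qf A ξ := fun ξ => ge_of_tendsto (hq ξ) (Eventually.of_forall fun y => V.lo y ξ)
  have hi : ∀ ξ, qf A ξ ≤ ‖ξ‖ ^ 2 := fun ξ => le_of_tendsto (hq ξ) (Eventually.of_forall fun y => V.hi y ξ)
  have hpd : A.PosDef := pd_of_qf hAs fun ξ h => lt_of_lt_of_le (by have := norm_pos_iff.2 h; positivity) (lo ξ)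
  have hps : ∀ {M : Mx n}, (∀ i j, M i j = M j i) → (∀ ξ, 0 ≤ qf M ξ) → M.PosSemidef := fun hs h =>
    Matrix.PosSemidef.of_dotProduct_mulVec_nonneg (by ext i j; simp [hs i j]) fun w => by rw [qf_dot]; exact h _
  have hell : Ell 1 δ⁻¹ A⁻¹ := by
    refine ell_inv hδ hpd (hps (fun i j => ?_) fun ξ => ?_) (hps (fun i j => ?_) fun ξ => ?_)
    · simp [hAs i j, Matrix.one_apply, eq_comm]
    · rw [qf_sub, qf_smul, qf_one]; linarith [lo ξ]
    · simp [hAs i j, Matrix.one_apply, eq_comm]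
    · rw [qf_sub, qf_one]; linarith [hi ξ]
  have hdet : A.det ≠ 0 := hpd.det_pos.ne'
  have hld : Tendsto (fun y => Real.log (hess v y).det) (nf n) (𝓝 (Real.log A.det)) :=
    ((Continuous.matrix_det continuous_id).continuousAt.tendsto.comp hT).log hdet
  have hFi : Real.log A.det = Fi := by
    refine tendsto_nhds_unique hld ?_
    simp only [V.eq]
    rw [tendsto_iff_norm_sub_tendsto_zero]
    refine squeeze_zero' (Eventually.of_forall fun _ => norm_nonneg _) ((ev_ge R).mono fun y hy => V.dec y hy) ?_
    simpa using ((tendsto_rpow_neg_atTop (by linarith [V.z2])).comp nf_norm).const_mul C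
  obtain ⟨T, hTp, hTA⟩ := pd_sqrt hpd
  have hTt : T.transpose = T := by have := hTp.1.eq; simpa using this
  have hTu : IsUnit T.det := hTp.det_pos.ne'.isUnit
  have hTA1 : T * A⁻¹ * T.transpose = 1 := by
    rw [hTt, hTA, Matrix.mul_inv_rev, ← Matrix.mul_assoc, Matrix.mul_nonsing_inv T hTu, Matrix.one_mul, Matrix.nonsing_inv_mul T hTu]
  have hTn : ∀ y, ‖mc T y‖ ^ 2 = qf A y := fun y => by
    rw [EuclideanSpace.real_norm_sq_eq, hTA, qf]
    simp only [mc_apply, sq, Finset.sum_mul_sum]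
    simp only [Matrix.mul_apply, Finset.mul_sum]
    rw [Finset.sum_comm]
    refine Finset.sum_congr rfl fun i _ => ?_
    rw [Finset.sum_comm]
    refine Finset.sum_congr rfl fun j _ => Finset.sum_congr rfl fun k _ => ?_
    rw [show T k i = T i k from congrFun (congrFun hTt i) k]; ring
  have hTle : ∀ y, ‖mc T y‖ ≤ ‖y‖ := fun y => (pow_le_pow_iff_left₀ (norm_nonneg _) (norm_nonneg _) two_ne_zero).1 (by rw [hTn]; exact hi y)
  have hT0 : ∀ y, y ≠ 0 → mc T y ≠ 0 := fun y hy h => by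
    have := hTn y
    rw [h, norm_zero] at this
    have := qf_pd hpd hy
    norm_num at *; linarith
  set k : ℝ := 3 / 4 with hk
  have hk0 : 0 < k := by norm_num [hk]
  have hk1 : k < 1 := by norm_num [hk]
  clear_value k
  have hn0 : (3 : ℝ) ≤ n := by exact_mod_cast hn
  have hinv : Tendsto (fun y => T * (hess v y)⁻¹ * T.transpose) (nf n) (𝓝 1) := by
    rw [← hTA1]
    exact (tendsto_const_nhds.mul (inv_tendsto hT hdet)).mul tendsto_const_nhds
  obtain ⟨R1, hR1⟩ := evi.1 ((ent_tendsto.1 hinv (1 / (45 * n ^ 2)) (by positivity)).and ((ev_ge R).and (ev_ge (12 * C))))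
  set R2 := max R1 1
  have hR2 : 1 ≤ R2 := le_max_right _ _
  set ψ0 : EV n → ℝ := fun y => (‖y - 0‖ ^ 2) ^ (-k / 2) with hψ0
  set K := 16 * C + 1 + R2 ^ k with hK
  have hR2k : 0 < R2 ^ k := by positivity
  have hK0 : 0 < K := by positivity
  have hψd : ∀ x : EV n, x ≠ 0 → ContDiffAt ℝ 2 (fun y => ψ0 (mc T y)) x := fun x hx =>
    (rbar hk0 (hT0 x hx)).1.comp x (mc T).contDiff.contDiffAt
  have hx0 : ∀ x : EV n, R2 ≤ ‖x‖ → x ≠ 0 := fun x hx => norm_pos_iff.1 (by linarith)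
  have up : ∀ e : EV n, ‖e‖ = 1 → ∀ h, 0 < h → h ≤ 1 → ∀ y : EV n, R2 ≤ ‖y‖ → sd v h e y ≤ qf A e + K * ψ0 (mc T y) := by
    intro e he h hh hh1
    refine ext_cmp (l := 1) (L := δ⁻¹) zero_le_one (fun x hx => ⟨(sd_cd V.cd h e).contDiffAt, contDiffAt_const.add (contDiffAt_const.mul (hψd x (hx0 x hx)))⟩)
      (fun x hx => ?_) (fun ε hε => ?_) fun x hx => ?_
    · have h1 : sd v h e x ≤ 1 := sd_le hh fun t _ => ⟨V.cd.contDiffAt, by have := V.hi (x + t • e) e; rwa [he, one_pow] at this⟩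
      have h2 : 0 ≤ qf A e := le_trans (by positivity) (lo e)
      have h3 : R2 ^ (-k) ≤ ψ0 (mc T x) := by
        simp only [hψ0]; rw [(rbar hk0 (hT0 x (hx0 x hx.ge))).2.1]
        exact Real.rpow_le_rpow_of_nonpos (norm_pos_iff.2 (hT0 x (hx0 x hx.ge))) (hx ▸ hTle x) (by linarith)
      have h4 : 1 ≤ K * R2 ^ (-k) := by
        rw [Real.rpow_neg (by linarith), ← div_eq_mul_inv, le_div_iff₀ hR2k]; linarith
      have := mul_le_mul_of_nonneg_left h3 hK0.le
      linarith
    · obtain ⟨ρ, hρ⟩ := hA (ε / n ^ 2) (by positivity)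
      filter_upwards [ev_ge (ρ + 1), ev_ge 1] with x hx hx1
      have h1 : sd v h e x ≤ qf A e + ε := sd_le hh fun t ht => ⟨V.cd.contDiffAt, by
        have h2 : ρ ≤ ‖x + t • e‖ := by
          have h3 := norm_sub_norm_le x (-(t • e))
          rw [norm_neg, norm_smul, he, mul_one, sub_neg_eq_add, Real.norm_eq_abs] at h3
          linarith
        have h4 := (abs_le.1 (qf_ent_le (P := hess v (x + t • e) - A) (fun i j => hρ _ h2 i j) he)).2
        rw [qf_sub, mul_div_cancel₀ _ (by positivity)] at h4; linarith⟩
      have h3 : 0 ≤ K * ψ0 (mc T x) := by simp only [hψ0]; positivity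
      linarith
    · have hx' := hx0 x hx.le
      have hm := hT0 x hx'
      obtain ⟨r1, r2, r3, r4⟩ := rbar hk0 hm
      obtain ⟨q1, q2, q3⟩ := hR1 x ((le_max_left _ _).trans hx.le)
      obtain ⟨b, hb, hsub⟩ := V.sub x q2
      refine ⟨(hess v x)⁻¹, b, V.ell x, lt_of_lt_of_le ?_ (hsub e he h hh hh1)⟩
      have hxp : 0 < ‖x‖ := norm_pos_iff.2 hx'
      have hmp : 0 < ‖mc T x‖ := norm_pos_iff.2 hm
      rw [hess_cs _ _ (hψd x hx'), fderiv_cs _ _ (hψd x hx'), pr_smul, hess_comp (w := ψ0) r1, pr_conj]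
      have h1 : pr (T * (hess v x)⁻¹ * T.transpose) (hess ψ0 (mc T x)) ≤ _ := r4 _ _ q1
      have h2 : fderiv ℝ (fun y => ψ0 (mc T y)) x b = fderiv ℝ ψ0 (mc T x) (mc T b) := by
        have := ((r1.differentiableAt (by simp)).hasFDerivAt.comp x (mc T).hasFDerivAt).fderiv
        exact congrArg (fun L => L b) this
      have h3 : fderiv ℝ ψ0 (mc T x) (mc T b) ≤ _ := r3 (mc T b)
      rw [smul_apply, h2, smul_eq_mul]
      set t := ‖mc T x‖ ^ (-k - 2) with ht
      have e1 : ‖mc T x‖ ^ (-k - 1) = t * ‖mc T x‖ := by rw [ht, ← Real.rpow_add_one hmp.ne']; ring_nf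
      have ht0 : 0 < t := by positivity
      have h4 : ‖mc T x‖ * ‖mc T b‖ ≤ 1 / 12 := by
        have c1 : ‖mc T x‖ * ‖mc T b‖ ≤ ‖x‖ * (C * ‖x‖ ^ (-ζ - 1)) := mul_le_mul (hTle x) ((hTle b).trans hb) (norm_nonneg _) hxp.le
        have c2 : ‖x‖ ^ (-ζ - 1) ≤ ‖x‖ ^ (-3 + 1 - 0 : ℝ) * ‖x‖⁻¹ := by
          rw [← Real.rpow_neg_one ‖x‖, ← Real.rpow_add hxp]
          exact Real.rpow_le_rpow_of_exponent_le (by linarith) (by linarith [V.z2])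
        have c3 : ‖x‖ ^ (-3 + 1 - 0 : ℝ) ≤ ‖x‖⁻¹ := by
          rw [← Real.rpow_neg_one ‖x‖]; exact Real.rpow_le_rpow_of_exponent_le (by linarith) (by norm_num)
        have c4 : C * ‖x‖⁻¹ ≤ 1 / 12 := by rw [← div_eq_mul_inv, div_le_div_iff₀ hxp (by norm_num)]; linarith
        calc _ ≤ _ := c1
          _ ≤ ‖x‖ * (C * (‖x‖⁻¹ * ‖x‖⁻¹)) := by gcongr; exact c2.trans (by gcongr)
          _ = C * ‖x‖⁻¹ := by field_simp
          _ ≤ _ := c4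
      have h5 : ‖x‖ ^ (-ζ - 2) ≤ t := by
        refine le_trans (Real.rpow_le_rpow_of_exponent_le (by linarith) (sub_le_sub_right (neg_le_neg (hk1.le.trans (one_le_two.trans V.z2.le))) 2) : ‖x‖ ^ (-ζ - 2) ≤ ‖x‖ ^ (-k - 2)) ?_
        exact Real.rpow_le_rpow_of_nonpos hmp (hTle x) (by linarith)
      have h6 : (n ^ 2 * (1 / (45 * n ^ 2) * (k * (k + 3))) - k * (n - 2 - k)) * t ≤ -(1 / 8) * t := by
        refine mul_le_mul_of_nonneg_right ?_ ht0.le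
        have : (n : ℝ) ^ 2 * (1 / (45 * n ^ 2) * (k * (k + 3))) = 1 / 16 := by rw [hk]; field_simp; norm_num
        rw [this, hk]; linarith
      have h7 : k * ‖mc T x‖ ^ (-k - 1) * ‖mc T b‖ ≤ (1 / 16) * t := by
        rw [e1]; have := mul_le_mul_of_nonneg_left h4 (by positivity : 0 ≤ k * t)
        rw [hk] at this ⊢; linarith
      have h8 : pr (T * (hess v x)⁻¹ * T.transpose) (hess ψ0 (mc T x)) + fderiv ℝ ψ0 (mc T x) (mc T b) ≤ -(1 / 16) * t := by
        have c1 := h1.trans h6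
        have c2 := h3.trans h7
        linarith
      have h9 := mul_le_mul_of_nonneg_left h8 hK0.le
      have h10 := mul_le_mul_of_nonneg_left h5 (by linarith : 0 ≤ C)
      have h11 : 0 < (1 + R2 ^ k) * t := by positivity
      rw [hK] at h9 ⊢
      linarith
  obtain ⟨N, hN, C0, hC0, hnet, -⟩ := net n (L := δ⁻¹) (by positivity)
  have hsq : ∀ y, Real.sqrt δ * ‖y‖ ≤ ‖mc T y‖ := fun y => by
    rw [← Real.sqrt_sq (norm_nonneg y), ← Real.sqrt_mul hδ.le]
    exact Real.sqrt_le_iff.2 ⟨norm_nonneg _, by rw [hTn]; exact lo y⟩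
  have hsδ : 0 < Real.sqrt δ := Real.sqrt_pos.2 hδ
  set K2 := K * Real.sqrt δ ^ (-k) + C with hK2
  refine ⟨A, hAs, hT, C0 * K2, evi.2 ⟨max R R2, fun y hy => ?_⟩⟩
  have hyR : R ≤ ‖y‖ := (le_max_left _ _).trans hy
  have hy2 : R2 ≤ ‖y‖ := (le_max_right _ _).trans hy
  have hy0 := hx0 y hy2
  have hyp : 0 < ‖y‖ := norm_pos_iff.2 hy0
  have hψy : K * ψ0 (mc T y) ≤ K2 * ‖y‖ ^ (-k) := by
    have h1 : ψ0 (mc T y) ≤ Real.sqrt δ ^ (-k) * ‖y‖ ^ (-k) := by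
      simp only [hψ0]; rw [(rbar hk0 (hT0 y hy0)).2.1, ← Real.mul_rpow hsδ.le hyp.le]
      exact Real.rpow_le_rpow_of_nonpos (by positivity) (hsq y) (by linarith)
    have h2 := mul_le_mul_of_nonneg_left h1 hK0.le
    have h3 : 0 ≤ C * ‖y‖ ^ (-k) := by positivity
    rw [hK2]; linarith
  have := hnet (hess v y - A) A⁻¹ (K2 * ‖y‖ ^ (-k)) (fun i j => by
    have := hess_symm V.cd.contDiffAt (x := y) i j
    simp [this, hAs i j]) (by positivity) hell (fun e he => ?_) ?_
  · intro i j; have h1 := this i j; rw [Matrix.sub_apply] at h1; rw [mul_assoc]; exact h1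
  · by_contra hlt
    push Not at hlt
    rw [qf_sub] at hlt
    have hB : K2 * ‖y‖ ^ (-k) + qf A e < qf (hess v y) e := by linarith
    obtain ⟨M, hM1, hM2⟩ := exists_between hB
    have hc : Continuous fun t : ℝ => qf (hess v (y + t • e)) e := (qf_cont V.cd e).comp (by fun_prop)
    have h0 := hc.continuousAt (x := 0)
    obtain ⟨d, hd0, hd⟩ := Metric.eventually_nhds_iff.1 (h0.eventually (lt_mem_nhds (a := M) (by simpa using hM2)))
    have h1 := le_sd (v := v) (y := y) (e := e) (h := min (d / 2) 1) (M := M) (by positivity) fun t ht => ⟨V.cd.contDiffAt, (hd (by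
      rw [Real.dist_eq, sub_zero]; have := ht.trans (min_le_left _ _); linarith)).le⟩
    have h2 := up e (hN e he) _ (by positivity : 0 < min (d / 2) 1) (min_le_right _ _) y hy2
    linarith
  · have h1 := logdet_le hpd (V.pd y)
    rw [V.eq, hFi] at h1
    have h2 := (abs_le.1 (V.dec y hyR)).1
    have h3 : C * ‖y‖ ^ (-ζ) ≤ K2 * ‖y‖ ^ (-k) := by
      have h4 : ‖y‖ ^ (-ζ) ≤ ‖y‖ ^ (-k) := Real.rpow_le_rpow_of_exponent_le (by linarith) (by rw [hk]; linarith [V.z2])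
      have h5 : C ≤ K2 := by have : 0 ≤ K * Real.sqrt δ ^ (-k) := by positivity
                             linarith
      exact mul_le_mul h5 h4 (by positivity) (by linarith)
    linarith
end
def Hd {n : ℕ} (α : ℝ) (W : ℝ → ℝ) (w : EV n → ℝ) : Prop :=
  ∃ C, ∀ᶠ x in nf n, |w x| ≤ C * W ‖x‖ ∧ ∀ y, ‖y - x‖ ≤ ‖x‖ / 4 → |w y - w x| ≤ C * W ‖x‖ * (‖y - x‖ / ‖x‖) ^ α
section
variable {n : ℕ}
theorem nrm_le (x : EV n) : ‖x‖ ≤ ∑ i, |x i| := by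
  conv_lhs => rw [sum_ee x]
  exact (norm_sum_le _ _).trans (Finset.sum_le_sum fun i _ => by simp [norm_smul, ee])
theorem mc_le {M : Mx n} {ε : ℝ} (h : ∀ i j, |M i j| ≤ ε) (ξ : EV n) : ‖mc M ξ‖ ≤ n ^ 2 * ε * ‖ξ‖ := by
  refine (nrm_le _).trans ?_
  calc _ ≤ ∑ i : Fin n, ∑ j : Fin n, ε * ‖ξ‖ := Finset.sum_le_sum fun i _ => by
        rw [mc_apply]
        refine (Finset.abs_sum_le_sum_abs _ _).trans (Finset.sum_le_sum fun j _ => ?_)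
        rw [abs_mul]
        exact mul_le_mul (h i j) (PiLp.norm_apply_le ξ j) (abs_nonneg _) ((abs_nonneg _).trans (h i j))
    _ = _ := by simp; ring
theorem gmd {w : EV n → ℝ} {x : EV n} (hw : ContDiffAt ℝ 2 w x) :
    HasFDerivAt (fun x => gmap (fderiv ℝ w x)) (mc (hess w x)) x := by
  have h2 : DifferentiableAt ℝ (fderiv ℝ w) x := (hw.fderiv_right (m := 1) (by norm_num)).differentiableAt (by simp)
  have h3 := (gmap (n := n)).hasFDerivAt.comp x h2.hasFDerivAt
  suffices e : mc (hess w x) = (gmap (n := n)).comp (fderiv ℝ (fderiv ℝ w) x) by rw [e]; exact h3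
  refine ContinuousLinearMap.ext fun ξ => ?_
  ext i
  rw [mc_apply]
  simp only [ContinuousLinearMap.comp_apply, gmap_coord, hess_quad, ee]
  rw [Finset.sum_comm]
  simp [Pi.single_apply, hess_symm hw i, mul_comm]
theorem inv_diff {M M' : Mx n} {B s : ℝ} (h : IsUnit M.det) (h' : IsUnit M'.det) (hB : ∀ i j, |M⁻¹ i j| ≤ B) (hB' : ∀ i j, |M'⁻¹ i j| ≤ B)
    (hs : ∀ i j, |M' i j - M i j| ≤ s) (i j : Fin n) : |M⁻¹ i j - M'⁻¹ i j| ≤ n ^ 2 * (B * B) * s := by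
  have e : M⁻¹ - M'⁻¹ = M⁻¹ * (M' - M) * M'⁻¹ := by
    rw [mul_sub, sub_mul, Matrix.mul_assoc, Matrix.mul_nonsing_inv _ h', Matrix.nonsing_inv_mul _ h]; simp
  rw [← Matrix.sub_apply, e, Matrix.mul_apply]
  calc _ ≤ ∑ k : Fin n, ∑ l : Fin n, B * s * B := (Finset.abs_sum_le_sum_abs _ _).trans (Finset.sum_le_sum fun k _ => by
        rw [abs_mul, Matrix.mul_apply, ← Finset.sum_mul]
        have b0 := (abs_nonneg _).trans (hB i j)
        refine mul_le_mul ?_ (hB' _ _) (abs_nonneg _) (Finset.sum_nonneg fun _ _ => mul_nonneg b0 ((abs_nonneg _).trans (hs i j)))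
        refine (Finset.abs_sum_le_sum_abs _ _).trans (Finset.sum_le_sum fun l _ => ?_)
        rw [abs_mul]
        exact mul_le_mul (hB _ _) (hs _ _) (abs_nonneg _) b0)
    _ = _ := by simp; ring
theorem nondeg {v : EV n → ℝ} {X : EV n → EV n} {b c0 R : ℝ} {A : Mx n} (hb : 0 < b) (hc : 0 < c0) (hv : ContDiff ℝ 2 v)
    (hg : ∀ y, gmap (fderiv ℝ v y) = y - (2 * b) • X y) (hgr : ∀ y, R ≤ ‖y‖ → c0 * ‖y‖ ≤ ‖X y‖)
    (hA : Tendsto (hess v) (nf n) (𝓝 A)) : (1 - A).det ≠ 0 := by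
  intro h0
  obtain ⟨q, hq0, hq⟩ := Matrix.exists_mulVec_eq_zero_iff.2 h0
  set ξ : EV n := WithLp.toLp 2 q with hξd
  have hξ : mc (1 - A) ξ = 0 := by
    ext i; rw [mc_apply]; exact congrFun hq i
  have hξ0 : 0 < ‖ξ‖ := norm_pos_iff.2 fun h => hq0 (by simpa [ξ] using h)
  obtain ⟨R0, hR0⟩ := evi.1 (ent_tendsto.1 hA (b * c0 / (n ^ 2 + 1)) (by positivity))
  set t0 := (|R0| + |R|) / ‖ξ‖ with ht0
  have hX : ∀ y, X y = (2 * b)⁻¹ • (y - gmap (fderiv ℝ v y)) := fun y => by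
    rw [hg, sub_sub_cancel, smul_smul, inv_mul_cancel₀ (by positivity), one_smul]
  have hd : ∀ t, HasDerivAt (fun t : ℝ => X (t • ξ)) ((2 * b)⁻¹ • (ξ - mc (hess v (t • ξ)) ξ)) t := fun t => by
    simp only [hX]
    have h1 : HasDerivAt (fun t : ℝ => t • ξ) ξ t := by simpa using (hasDerivAt_id t).smul_const ξ
    exact (h1.sub ((gmd hv.contDiffAt).comp_hasDerivAt t h1)).const_smul (2 * b)⁻¹
  have hbd : ∀ t ∈ Set.Ici t0, ‖(2 * b)⁻¹ • (ξ - mc (hess v (t • ξ)) ξ)‖ ≤ c0 / 2 * ‖ξ‖ := fun t ht => by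
    have ht' : |R0| + |R| ≤ t * ‖ξ‖ := by rwa [Set.mem_Ici, ht0, div_le_iff₀ hξ0] at ht
    have h2 : |R0| ≤ ‖t • ξ‖ := by
      rw [norm_smul]; have := mul_le_mul_of_nonneg_right (le_abs_self t) hξ0.le; have := abs_nonneg R
      rw [Real.norm_eq_abs]; linarith
    have h3 := mc_le (M := hess v (t • ξ) - A) (hR0 _ ((le_abs_self _).trans h2)) ξ
    have h4 : ξ - mc (hess v (t • ξ)) ξ = - mc (hess v (t • ξ) - A) ξ := by
      have : mc (hess v (t • ξ) - A) ξ = mc (hess v (t • ξ)) ξ - ξ + mc (1 - A) ξ := by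
        ext i; simp only [PiLp.add_apply, PiLp.sub_apply]
        conv_rhs => rw [← mc_one ξ]
        simp only [mc_apply, Matrix.sub_apply, ← Finset.sum_sub_distrib, ← Finset.sum_add_distrib]
        simp only [sub_mul, Finset.sum_sub_distrib, Finset.sum_add_distrib, ← mc_apply, mc_one]; ring
      rw [this, hξ]; abel
    rw [h4, smul_neg, norm_neg, norm_smul, Real.norm_of_nonneg (by positivity)]
    refine (mul_le_mul_of_nonneg_left h3 (by positivity)).trans ?_
    have h5 : (n:ℝ) ^ 2 * (b * c0 / (n ^ 2 + 1)) ≤ b * c0 := by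
      rw [mul_div_assoc', div_le_iff₀ (by positivity)]; have : 0 ≤ b * c0 := by positivity
      linarith
    calc (2 * b)⁻¹ * (n ^ 2 * (b * c0 / (n ^ 2 + 1)) * ‖ξ‖) ≤ (2 * b)⁻¹ * (b * c0 * ‖ξ‖) := by gcongr
      _ = _ := by field_simp
  have key : ∀ t, t0 ≤ t → c0 * (t * ‖ξ‖) ≤ ‖X (t0 • ξ)‖ + c0 / 2 * ‖ξ‖ * (t - t0) := fun t ht => by
    have h1 := (convex_Ici t0).norm_image_sub_le_of_norm_hasDerivWithin_le (fun t _ => (hd t).hasDerivWithinAt) hbd (Set.self_mem_Ici) ht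
    have t0n : 0 ≤ t0 := by positivity
    rw [Real.norm_of_nonneg (by linarith)] at h1
    have h2 : ‖t • ξ‖ = t * ‖ξ‖ := by rw [norm_smul, Real.norm_of_nonneg (by linarith)]
    have h3 : |R0| + |R| ≤ t * ‖ξ‖ := by rwa [ht0, div_le_iff₀ hξ0] at ht
    have h4 := hgr (t • ξ) (by rw [h2]; have := le_abs_self R; have := abs_nonneg R0; linarith)
    rw [h2] at h4
    have := norm_sub_norm_le (X (t • ξ)) (X (t0 • ξ))
    linarith
  have t0n : 0 ≤ t0 := by positivity
  set D := ‖X (t0 • ξ)‖ with hD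
  have hD0 : 0 ≤ D := norm_nonneg _
  have hk : 0 < c0 * ‖ξ‖ := by positivity
  have := key (t0 + 2 * (D + 1) / (c0 * ‖ξ‖)) (by have : 0 ≤ 2 * (D + 1) / (c0 * ‖ξ‖) := by positivity
                                                  linarith)
  have e : 2 * (D + 1) / (c0 * ‖ξ‖) * (c0 * ‖ξ‖) = 2 * (D + 1) := by field_simp
  have : 0 ≤ c0 * ‖ξ‖ * t0 := by positivity
  linarith
end
section
variable {n : ℕ}
theorem interp {d A1 A2 : ℝ} (hd : 0 ≤ d) (h1 : d ≤ A1) (h2 : d ≤ A2) : d ≤ A1 ^ (1/9:ℝ) * A2 ^ (8/9:ℝ) := by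
  rcases hd.eq_or_lt with h | h
  · rw [← h]; have := hd.trans h1; have := hd.trans h2; positivity
  calc d = d ^ (1/9:ℝ) * d ^ (8/9:ℝ) := by rw [← Real.rpow_add h]; norm_num
    _ ≤ _ := mul_le_mul (Real.rpow_le_rpow hd h1 (by norm_num)) (Real.rpow_le_rpow hd h2 (by norm_num)) (by positivity) (by have := hd.trans h1; positivity)
theorem xfer (hn : 3 ≤ n) {m : ℕ} {a b ζ K finf C R : ℝ} (hb : 0 < b) (hab : 0 < a + b) (hK : 0 < K) (hζ : 2 < ζ) {f u : EV n → ℝ}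
    (hf : FP f finf ζ C R m) (hfc : Continuous f) (hu : ContDiff ℝ 2 u)
    (hpd : ∀ x, (hess u x - (-a + b) • (1 : Mx n)).PosDef)
    (heq : ∀ x, Real.log (hess u x + (a - b) • (1 : Mx n)).det - Real.log (hess u x + (a + b) • (1 : Mx n)).det = K * f x)
    (hg : ∃ C : ℝ, ∀ x : EV n, u x ≤ C * (1 + ‖x‖ ^ 2)) :
    ∃ A : Mx n, (∀ i j, A i j = A j i) ∧ Tendsto (hess u) (nf n) (𝓝 A) ∧ (A + (a + b) • (1 : Mx n)).det ≠ 0 ∧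
      ∃ α : ℝ, 0 < α ∧ α < 1 ∧ ∀ i j, Hd α (fun r => r ^ (-(2/3) : ℝ)) (fun x => hess u x i j - A i j) := by
  obtain ⟨X, Y, v, δ, C', R', c0, V, hc0, hYX, hXY, hX1, hYf, hgv, hH, hgr, hXl⟩ := vs_exists hb hab hK hζ hf hfc hu hpd heq hg
  obtain ⟨Av, hAs, hAt, C1, hC1⟩ := vs_rate hn V
  have hdet := nondeg hb hc0 V.cd hgv hgr hAt
  obtain ⟨α, hα, hα1, Ke, hKe, Re, hRe, hek⟩ := ek V
  have hnf := nf_ne hn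
  set A : Mx n := (2 * b) • (1 - Av)⁻¹ - (a + b) • (1 : Mx n) with hAd
  have hHx : ∀ x, hess u x = (2 * b) • (1 - hess v (Y x))⁻¹ - (a + b) • (1 : Mx n) ∧ IsUnit (1 - hess v (Y x)).det := fun x => by
    obtain ⟨h1, h2⟩ := hH (Y x)
    rw [hXY] at h1 h2
    have h3 : 1 - hess v (Y x) = (2 * b) • (hess u x + (a + b) • (1 : Mx n))⁻¹ := by rw [h1, sub_sub_cancel]
    have h4 : ((2 * b) • (hess u x + (a + b) • (1 : Mx n))⁻¹) * ((2 * b)⁻¹ • (hess u x + (a + b) • (1 : Mx n))) = 1 := by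
      rw [Matrix.smul_mul, Matrix.mul_smul, smul_smul, Matrix.nonsing_inv_mul _ h2, mul_inv_cancel₀ (by positivity), one_smul]
    rw [h3, Matrix.inv_eq_right_inv h4, smul_smul, mul_inv_cancel₀ (by positivity), one_smul]
    exact ⟨by simp, Matrix.isUnit_det_of_right_inverse h4⟩
  have hYn : ∀ x, 2 * ‖X 0‖ ≤ ‖x‖ → b * ‖x‖ ≤ ‖Y x‖ := fun x hx => by
    have h1 := hXl (Y x) 0
    rw [hXY, sub_zero] at h1
    have h2 := norm_sub_norm_le x (X 0)
    have := mul_le_mul_of_nonneg_left h2 (by positivity : 0 ≤ 2 * b)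
    have := mul_le_mul_of_nonneg_left hx hb.le
    linarith
  have hYt : Tendsto Y (nf n) (nf n) := by
    rw [nf, tendsto_comap_iff]
    refine tendsto_atTop_mono' _ ?_ (nf_norm.const_mul_atTop hb)
    filter_upwards [ev_ge (2 * ‖X 0‖)] with x hx using hYn x hx
  have hNt : Tendsto (fun x => (1 - hess v (Y x))⁻¹) (nf n) (𝓝 (1 - Av)⁻¹) := inv_tendsto (tendsto_const_nhds.sub (hAt.comp hYt)) hdet
  have hAt' : Tendsto (hess u) (nf n) (𝓝 A) := by
    have := (hNt.const_smul (2 * b)).sub_const ((a + b) • (1 : Mx n))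
    exact this.congr fun x => ((hHx x).1).symm
  have hAsym : ∀ i j, A i j = A j i := fun i j => tendsto_nhds_unique (tendsto_pi_nhds.1 (tendsto_pi_nhds.1 hAt' i) j)
    ((tendsto_pi_nhds.1 (tendsto_pi_nhds.1 hAt' j) i).congr fun x => hess_symm hu.contDiffAt j i)
  refine ⟨A, hAsym, hAt', ?_, α / 9, by linarith, by linarith, ?_⟩
  · rw [hAd, sub_add_cancel, Matrix.det_smul]
    exact mul_ne_zero (pow_ne_zero _ (by positivity)) (Matrix.isUnit_nonsing_inv_det _ (isUnit_iff_ne_zero.2 hdet)).ne_zero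
  obtain ⟨Bm, hBm1, hBm⟩ : ∃ B : ℝ, 1 ≤ B ∧ ∀ i j, |(1 - Av)⁻¹ i j| + 1 ≤ B := by
    refine ⟨(∑ i, ∑ j, |(1 - Av)⁻¹ i j|) + 1, le_add_of_nonneg_left (by positivity), fun i j => ?_⟩
    have h1 := Finset.single_le_sum (f := fun j => |(1 - Av)⁻¹ i j|) (fun _ _ => abs_nonneg _) (Finset.mem_univ j)
    have h2 := Finset.single_le_sum (f := fun i => ∑ j, |(1 - Av)⁻¹ i j|) (fun _ _ => by positivity) (Finset.mem_univ i)
    linarith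
  obtain ⟨S1, hS1⟩ := evi.1 (ent_tendsto.1 hNt 1 one_pos)
  have hN : ∀ x, S1 ≤ ‖x‖ → ∀ i j, |(1 - hess v (Y x))⁻¹ i j| ≤ Bm := fun x hx i j => by
    have := hS1 x hx i j; have := hBm i j
    have := abs_sub_abs_le_abs_sub ((1 - hess v (Y x))⁻¹ i j) ((1 - Av)⁻¹ i j); linarith
  set Q := 2 * b * (n ^ 2 * (Bm * Bm)) with hQ
  have hQ0 : 0 ≤ Q := by positivity
  have hdif : ∀ x x' s, S1 ≤ ‖x‖ → S1 ≤ ‖x'‖ → (∀ i j, |hess v (Y x') i j - hess v (Y x) i j| ≤ s) → ∀ i j, |hess u x' i j - hess u x i j| ≤ Q * s :=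
    fun x x' s hx hx' hs i j => by
    have := inv_diff (hHx x').2 (hHx x).2 (hN x' hx') (hN x hx) (s := s) (fun i j => by simp only [Matrix.sub_apply]; rw [sub_sub_sub_cancel_left]; exact hs i j) i j
    rw [(hHx x).1, (hHx x').1, Matrix.sub_apply, Matrix.sub_apply, sub_sub_sub_cancel_right, Matrix.smul_apply, Matrix.smul_apply, ← smul_sub, smul_eq_mul, abs_mul, abs_of_pos (by positivity), hQ, mul_assoc (2 * b)]
    gcongr
  obtain ⟨S2, hS2⟩ := evi.1 hC1
  set T : ℝ := 1 + |S1| + (|S2| + |Re| + |R'|) / b + 2 * ‖X 0‖ with hT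
  have hT1 : ∀ r, T ≤ r → 1 ≤ r ∧ S1 ≤ r ∧ S2 ≤ b * r ∧ Re ≤ b * r ∧ 2 * ‖X 0‖ ≤ r := fun r hr => by
    have := abs_nonneg S1; have := le_abs_self S1; have := le_abs_self S2; have := le_abs_self Re; have := abs_nonneg S2; have := abs_nonneg Re; have := abs_nonneg R'; have := norm_nonneg (X 0)
    have h0 : 0 ≤ (|S2| + |Re| + |R'|) / b := by positivity
    have h1 : (|S2| + |Re| + |R'|) / b ≤ r := by linarith
    rw [div_le_iff₀ hb] at h1
    refine ⟨?_, ?_, ?_, ?_, ?_⟩ <;> linarith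
  have hT0 : 1 ≤ T := by
    have : 0 ≤ |S1| + (|S2| + |Re| + |R'|) / b + 2 * ‖X 0‖ := by positivity
    linarith
  set P := Q * (|C1| * b ^ (-(3/4) : ℝ)) with hP
  have hP0 : 0 ≤ P := by positivity
  have hrate : ∀ x, T ≤ ‖x‖ → ∀ i j, |hess u x i j - A i j| ≤ P * ‖x‖ ^ (-(3/4) : ℝ) := fun x hx i j => by
    obtain ⟨h1, h2, h3, h4, h5⟩ := hT1 _ hx
    have h6 := hYn x h5
    have h7 : ∀ i j, |Av i j - hess v (Y x) i j| ≤ |C1| * (b ^ (-(3/4) : ℝ) * ‖x‖ ^ (-(3/4) : ℝ)) := fun i j => by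
      rw [abs_sub_comm]
      refine (hS2 (Y x) (by linarith) i j).trans ?_
      rw [← Real.mul_rpow hb.le (norm_nonneg _)]
      exact mul_le_mul (le_abs_self _) (Real.rpow_le_rpow_of_nonpos (by positivity) h6 (by norm_num)) (by positivity) (abs_nonneg _)
    have := inv_diff (hHx x).2 (isUnit_iff_ne_zero.2 hdet) (hN x h2) (fun i j => by have := hBm i j; linarith) (s := |C1| * (b ^ (-(3/4) : ℝ) * ‖x‖ ^ (-(3/4) : ℝ)))
      (fun i j => by simp only [Matrix.sub_apply]; rw [sub_sub_sub_cancel_left, abs_sub_comm]; exact h7 i j) i j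
    rw [(hHx x).1, Matrix.sub_apply, hAd, Matrix.sub_apply, sub_sub_sub_cancel_right, Matrix.smul_apply, Matrix.smul_apply, ← smul_sub, smul_eq_mul, abs_mul, abs_of_pos (by positivity : 0 < 2 * b)]
    refine (mul_le_mul_of_nonneg_left this (by positivity)).trans (le_of_eq ?_)
    rw [hP, hQ]; ring
  set L := 1 + n ^ 2 * (2 * b * Bm) with hL
  have hL1 : 0 < L := by positivity
  have hYL : ∀ x x', 2 * T ≤ ‖x‖ → ‖x' - x‖ ≤ ‖x‖ / 4 → ‖Y x' - Y x‖ ≤ L * ‖x' - x‖ := fun x x' hx hx' => by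
    have hsq : ContDiff ℝ 2 fun x : EV n => (a + b) / 2 * ‖x - 0‖ ^ 2 := contDiff_const.mul (contDiff_sq 0)
    have hw : ContDiff ℝ 2 fun x : EV n => u x + 1 * ((a + b) / 2 * ‖x - 0‖ ^ 2) := hu.add (contDiff_const.mul hsq)
    have hY' : Y = fun x => gmap (fderiv ℝ (fun x => u x + 1 * ((a + b) / 2 * ‖x - 0‖ ^ 2)) x) := funext hYf
    refine (convex_closedBall x (‖x‖ / 4)).norm_image_sub_le_of_norm_hasFDerivWithin_le (f := Y)
      (f' := fun z => mc (hess (fun x : EV n => u x + 1 * ((a + b) / 2 * ‖x - 0‖ ^ 2)) z)) (fun z _ => ?_) (fun z hz => ?_) (Metric.mem_closedBall_self (by positivity)) (mem_closedBall_iff_norm.2 hx')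
    · rw [hY']; exact (gmd hw.contDiffAt).hasFDerivWithinAt
    · refine ContinuousLinearMap.opNorm_le_bound _ hL1.le fun ξ => ?_
      have hz2 : T ≤ ‖z‖ := by
        have := mem_closedBall_iff_norm.1 hz; have := norm_sub_norm_le x z; rw [norm_sub_rev] at this; linarith
      have e : hess (fun x : EV n => u x + 1 * ((a + b) / 2 * ‖x - 0‖ ^ 2)) z = (2 * b) • (1 - hess v (Y z))⁻¹ := by
        rw [hess_lin hu.contDiffAt hsq.contDiffAt, hess_sq, one_smul, (hHx z).1, show 2 * ((a + b) / 2) = a + b by ring, sub_add_cancel]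
      rw [e]
      refine (mc_le (ε := 2 * b * Bm) (fun i j => ?_) ξ).trans ?_
      · rw [Matrix.smul_apply, smul_eq_mul, abs_mul, abs_of_pos (by positivity)]
        exact mul_le_mul_of_nonneg_left (hN z (hT1 _ hz2).2.1 i j) (by positivity)
      · rw [hL]; have := norm_nonneg ξ; linarith
  set P1 := Q * (Ke * (L / b) ^ α) + 2 * P * (2 ^ (3/4:ℝ)) * (4 * L / b) ^ α with hP1
  have hP10 : 0 ≤ P1 := by positivity
  have hhol : ∀ x x', 2 * T ≤ ‖x‖ → ‖x' - x‖ ≤ ‖x‖ / 4 → ∀ i j, |hess u x' i j - hess u x i j| ≤ P1 * (‖x' - x‖ / ‖x‖) ^ α ∧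
      |hess u x' i j - hess u x i j| ≤ 2 * P * 2 ^ (3/4:ℝ) * ‖x‖ ^ (-(3/4) : ℝ) := fun x x' hx hx' i j => by
    have hx0 : 0 < ‖x‖ := by linarith
    have hz2 : ‖x‖ / 2 ≤ ‖x'‖ := by
      have := norm_sub_norm_le x x'; rw [norm_sub_rev] at this; linarith
    obtain ⟨h1, h2, h3, h4, h5⟩ := hT1 ‖x‖ (by linarith)
    have r1 := hrate x (by linarith) i j
    have r2 := (hrate x' (by linarith) i j).trans (mul_le_mul_of_nonneg_left (rpow_half hx0 hz2 (by norm_num : (0:ℝ) ≤ 3/4)) hP0)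
    have two : (1:ℝ) ≤ 2 ^ (3/4:ℝ) := Real.one_le_rpow (by norm_num) (by norm_num)
    have hr0 : 0 ≤ P * ‖x‖ ^ (-(3/4) : ℝ) := by positivity
    have dec : |hess u x' i j - hess u x i j| ≤ 2 * P * 2 ^ (3/4:ℝ) * ‖x‖ ^ (-(3/4) : ℝ) := by
      have e := abs_sub_le (hess u x' i j) (A i j) (hess u x i j)
      rw [abs_sub_comm (A i j)] at e
      have := mul_le_mul_of_nonneg_right two hr0
      linarith
    refine ⟨?_, dec⟩
    rcases le_or_gt ‖x' - x‖ (b / (4 * L) * ‖x‖) with hc | hc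
    · have y1 := hYL x x' hx hx'
      have y2 := hYn x h5
      have y3 : ‖Y x' - Y x‖ ≤ ‖Y x‖ / 4 := by
        have := mul_le_mul_of_nonneg_left hc hL1.le
        rw [show L * (b / (4 * L) * ‖x‖) = b * ‖x‖ / 4 by field_simp] at this; linarith
      have := hdif x x' _ h2 (hT1 ‖x'‖ (by linarith)).2.1 (hek (Y x) (Y x') (by linarith) y3) i j
      refine this.trans ?_
      have y4 : ‖Y x' - Y x‖ / ‖Y x‖ ≤ L / b * (‖x' - x‖ / ‖x‖) := by
        rw [div_mul_div_comm]
        exact div_le_div₀ (by positivity) y1 (by positivity) y2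
      have y5 := Real.rpow_le_rpow (by positivity) y4 hα.le
      rw [Real.mul_rpow (by positivity) (by positivity)] at y5
      have : 0 ≤ 2 * P * (2 ^ (3/4:ℝ)) * (4 * L / b) ^ α * (‖x' - x‖ / ‖x‖) ^ α := by positivity
      calc _ ≤ Q * (Ke * ((L / b) ^ α * (‖x' - x‖ / ‖x‖) ^ α)) := by gcongr
        _ ≤ _ := by rw [hP1]; linarith
    · have y4 : 1 ≤ 4 * L / b * (‖x' - x‖ / ‖x‖) := by
        rw [div_mul_div_comm, le_div_iff₀ (by positivity), one_mul]
        rw [div_mul_eq_mul_div, div_lt_iff₀ (by positivity)] at hc; linarith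
      have y5 := Real.one_le_rpow y4 hα.le
      rw [Real.mul_rpow (by positivity) (by positivity)] at y5
      have y6 : ‖x‖ ^ (-(3/4) : ℝ) ≤ 1 := Real.rpow_le_one_of_one_le_of_nonpos h1 (by norm_num)
      have q0 : 0 ≤ 2 * P * 2 ^ (3/4:ℝ) := by positivity
      have y7 := mul_le_mul_of_nonneg_left (y6.trans y5) q0
      have : 0 ≤ Q * (Ke * (L / b) ^ α) * (‖x' - x‖ / ‖x‖) ^ α := by positivity
      refine dec.trans ?_
      rw [hP1]; linarith
  intro i j
  set P2 := 2 * P * 2 ^ (3/4:ℝ) with hP2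
  have hP20 : 0 ≤ P2 := by positivity
  refine ⟨P + P1 ^ (1/9:ℝ) * P2 ^ (8/9:ℝ), evi.2 ⟨max (2 * T) (max T 1), fun x hx => ?_⟩⟩
  have hxT : 2 * T ≤ ‖x‖ := (le_max_left _ _).trans hx
  have hxT1 : T ≤ ‖x‖ := ((le_max_left _ _).trans (le_max_right _ _)).trans hx
  have hx1 : 1 ≤ ‖x‖ := (hT1 _ hxT1).1
  have hx0 : 0 < ‖x‖ := by linarith
  have q : 0 ≤ P1 ^ (1/9:ℝ) * P2 ^ (8/9:ℝ) := by positivity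
  have w0 : 0 ≤ ‖x‖ ^ (-(2/3) : ℝ) := by positivity
  refine ⟨?_, fun y hy => ?_⟩
  · refine (hrate x hxT1 i j).trans ?_
    exact mul_le_mul (by linarith) (Real.rpow_le_rpow_of_exponent_le hx1 (by norm_num)) (by positivity) (by positivity)
  · obtain ⟨h1, h2⟩ := hhol x y hxT hy i j
    rw [sub_sub_sub_cancel_right]
    refine (interp (abs_nonneg _) h1 h2).trans ?_
    rw [Real.mul_rpow hP10 (by positivity), Real.mul_rpow hP20 (by positivity), ← Real.rpow_mul (by positivity), ← Real.rpow_mul (by positivity),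
      show α * (1/9) = α / 9 by ring, show (-(3/4):ℝ) * (8/9) = -(2/3) by norm_num]
    have : 0 ≤ P * (‖x‖ ^ (-(2/3) : ℝ) * (‖y - x‖ / ‖x‖) ^ (α / 9)) := by positivity
    linarith
end
section
variable {n : ℕ}
theorem hess_tl (v : EV n → ℝ) (c y : EV n) : hess (fun y => v (y + c)) y = hess v (y + c) := by
  ext i j
  have : fderiv ℝ (fun y => v (y + c)) = fun y => fderiv ℝ v (y + c) := funext fun y => fderiv_comp_add_right c
  rw [hess_apply, hess_apply, this, fderiv_comp_add_right]
theorem cd_tl {v : EV n → ℝ} {c y : EV n} {k : WithTop ℕ∞} (h : ContDiffAt ℝ k v (y + c)) : ContDiffAt ℝ k (fun y => v (y + c)) y :=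
  h.comp y (contDiffAt_id.add contDiffAt_const)
theorem sd_cd' {v : EV n → ℝ} {h : ℝ} {e y : EV n} (h0 : ContDiffAt ℝ 2 v y) (h1 : ContDiffAt ℝ 2 v (y + h • e)) (h2 : ContDiffAt ℝ 2 v (y - h • e)) :
    ContDiffAt ℝ 2 (sd v h e) y ∧ hess (sd v h e) y = (h ^ 2)⁻¹ • (hess v (y + h • e) + hess v (y - h • e) - (2:ℝ) • hess v y) := by
  rw [sub_eq_add_neg] at h2
  have c1 := cd_tl h1
  have c2 := cd_tl h2
  have e1 : sd v h e = fun y => 0 + (h ^ 2)⁻¹ * ((v (y + h • e) + 1 * v (y + -(h • e))) + (-2) * v y) := by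
    ext y; simp only [sd, sub_eq_add_neg]; ring
  have c3 := c1.add ((contDiffAt_const (c := (1:ℝ))).mul c2)
  have c4 := c3.add ((contDiffAt_const (c := (-2:ℝ))).mul h0)
  rw [e1, hess_cs _ _ c4, hess_lin c3 h0, hess_lin c1 c2, hess_tl, hess_tl, ← sub_eq_add_neg]
  exact ⟨contDiffAt_const.add (contDiffAt_const.mul c4), by rw [one_smul, neg_smul, ← sub_eq_add_neg]⟩
theorem hess_bil (B : EV n →L[ℝ] EV n →L[ℝ] ℝ) (ℓ : EV n →L[ℝ] ℝ) (c : ℝ) (x : EV n) : ContDiff ℝ 2 (fun y => B y y + ℓ y + c) ∧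
    ∀ i j, hess (fun y => B y y + ℓ y + c) x i j = B (ee i) (ee j) + B (ee j) (ee i) := by
  have hf : fderiv ℝ (fun y => B y y + ℓ y + c) = fun y => (B + B.flip) y + ℓ := by
    ext y ξ
    have : HasFDerivAt (fun y => B y y + ℓ y + c) (B y + B.flip y + ℓ) y := by
      refine ((HasFDerivAt.clm_apply B.hasFDerivAt (hasFDerivAt_id y)).add ℓ.hasFDerivAt).add_const c |>.congr_fderiv ?_
      ext ξ; simp
    rw [this.fderiv]; rfl
  refine ⟨by fun_prop, fun i j => ?_⟩
  rw [hess_apply, hf, fderiv_add_const, ContinuousLinearMap.fderiv]; simp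
theorem hess_qf (M : Mx n) (ℓ : EV n →L[ℝ] ℝ) (c : ℝ) : ContDiff ℝ 2 (fun y => qf M y + ℓ y + c) ∧
    ∀ x, hess (fun y => qf M y + ℓ y + c) x = M + M.transpose := by
  set B : EV n →L[ℝ] EV n →L[ℝ] ℝ := ∑ i, ∑ j, M i j • (innerSL ℝ (ee i)).smulRight (innerSL ℝ (ee j)) with hB
  have hBa : ∀ y y' : EV n, B y y' = ∑ i, ∑ j, y i * y' j * M i j := fun y y' => by
    simp only [hB, sum_apply, smul_apply, ContinuousLinearMap.smulRight_apply, innerSL_apply_apply, smul_eq_mul]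
    refine Finset.sum_congr rfl fun i _ => Finset.sum_congr rfl fun j _ => ?_
    rw [real_inner_comm, inner_ee, real_inner_comm, inner_ee]; ring
  have e : (fun y => qf M y + ℓ y + c) = fun y => B y y + ℓ y + c := by ext y; rw [hBa]; rfl
  rw [e]
  refine ⟨(hess_bil B ℓ c 0).1, fun x => ?_⟩
  ext i j
  rw [(hess_bil B ℓ c x).2, hBa, hBa]
  simp [ee, Pi.single_apply]
theorem qf_outer (ν y : EV n) : qf (outer ν) y = ⟪ν, y⟫ ^ 2 := by
  simp only [qf, outer, Matrix.of_apply, PiLp.inner_apply, sq, Finset.sum_mul_sum]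
  exact Finset.sum_congr rfl fun i _ => Finset.sum_congr rfl fun j _ => by simp; ring
theorem refl_mx {ν : EV n} (hν : ‖ν‖ = 1) : ∃ T : Mx n, (∀ y, mc T y = y - (2 * ⟪ν, y⟫) • ν) ∧ (∀ y, ‖mc T y‖ = ‖y‖) ∧
    ∀ H : Mx n, (T.transpose * H * T).trace = H.trace := by
  have hm : ∀ y, mc (1 - (2:ℝ) • outer ν) y = y - (2 * ⟪ν, y⟫) • ν := fun y => by
    ext i
    rw [mc_apply]
    simp only [Matrix.sub_apply, sub_mul, Finset.sum_sub_distrib, PiLp.sub_apply, Matrix.smul_apply, outer, Matrix.of_apply, smul_eq_mul, PiLp.smul_apply, PiLp.inner_apply]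
    rw [← mc_apply, mc_one, Finset.mul_sum, Finset.sum_mul]
    congr 1; refine Finset.sum_congr rfl fun j _ => by simp; ring
  refine ⟨1 - (2:ℝ) • outer ν, hm, fun y => ?_, fun H => ?_⟩
  · rw [hm, ← sq_eq_sq₀ (norm_nonneg _) (norm_nonneg _), norm_sub_sq_real, inner_smul_right, norm_smul, hν, real_inner_comm, mul_one, Real.norm_eq_abs, sq_abs]; ring
  · have hT : (1 - (2:ℝ) • outer ν) * (1 - (2:ℝ) • outer ν).transpose = 1 := by
      have h1 : (outer ν).transpose = outer ν := by ext i j; simp [outer, mul_comm]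
      have h2 : outer ν * outer ν = outer ν := by
        ext i j; simp only [outer, Matrix.mul_apply, Matrix.of_apply]
        have : ∑ k, ν i * ν k * (ν k * ν j) = ν i * ν j * ∑ k, ν k ^ 2 := by
          rw [Finset.mul_sum]; exact Finset.sum_congr rfl fun k _ => by ring
        rw [this, ← EuclideanSpace.real_norm_sq_eq, hν]; ring
      rw [Matrix.transpose_sub, Matrix.transpose_smul, h1, Matrix.transpose_one, mul_sub, sub_mul, sub_mul, Matrix.smul_mul, Matrix.smul_mul, Matrix.mul_smul, Matrix.mul_smul, h2]
      simp only [one_mul, mul_one]; module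
    rw [Matrix.trace_mul_comm, ← Matrix.mul_assoc, hT, one_mul]
theorem ell_one : Ell 1 1 (1 : Mx n) := fun P _ => by rw [pr_one]; simp
theorem refl_fn {z : EV n → ℝ} {ν : EV n} {T : Mx n} (hT : (∀ y, mc T y = y - (2 * ⟪ν, y⟫) • ν) ∧ (∀ y, ‖mc T y‖ = ‖y‖) ∧
    ∀ H : Mx n, (T.transpose * H * T).trace = H.trace) {y : EV n} (h1 : ContDiffAt ℝ 2 z y) (h2 : ContDiffAt ℝ 2 z (mc T y)) :
    ContDiffAt ℝ 2 (fun y => z y + (-1) * z (mc T y)) y ∧ pr 1 (hess (fun y => z y + (-1) * z (mc T y)) y) = (hess z y).trace - (hess z (mc T y)).trace := by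
  have h3 : ContDiffAt ℝ 2 (fun y => z (mc T y)) y := h2.comp y (mc T).contDiff.contDiffAt
  refine ⟨h1.add (contDiffAt_const.mul h3), ?_⟩
  rw [hess_lin h1 h3, hess_comp h2, pr_one, Matrix.trace_add, Matrix.trace_smul, hT.2.2]; simp; ring
theorem grad0 {z : EV n → ℝ} {r s M : ℝ} (hr : 0 < r) (hs : 0 ≤ s) (hM : 0 < M) (H : ∀ y : EV n, ‖y‖ ≤ r → ContDiffAt ℝ 2 z y ∧ |z y| ≤ s ∧ |(hess z y).trace| ≤ M)
    {x : EV n} (hx : ‖x‖ ≤ r) : z x - z (-x) ≤ ‖x‖ * ((2 + 2 * n) * s / r + 2 * M * r) := by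
  by_cases hx0 : x = 0
  · simp [hx0]
  have hxp := norm_pos_iff.2 hx0
  set ν : EV n := ‖x‖⁻¹ • x with hνd
  have hν : ‖ν‖ = 1 := by rw [hνd, norm_smul, norm_inv, norm_norm, inv_mul_cancel₀ hxp.ne']
  obtain ⟨T, hT⟩ := refl_mx hν
  set K' := 2 * s * n / r ^ 2 + 2 * M with hK'
  have hK0 : 0 ≤ K' := by positivity
  set ψ : EV n → ℝ := fun y => qf ((2 * s / r ^ 2) • (1 : Mx n) - K' • outer ν) y + ((K' * r) • innerSL ℝ ν) y + 0 with hψ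
  have hψv : ∀ y, ψ y = 2 * s / r ^ 2 * ‖y‖ ^ 2 - K' * ⟪ν, y⟫ ^ 2 + K' * r * ⟪ν, y⟫ := fun y => by
    simp only [hψ, qf_sub, qf_smul, qf_one, qf_outer, smul_apply, innerSL_apply_apply, smul_eq_mul, add_zero]
  have hνx : ⟪ν, x⟫ = ‖x‖ := by rw [hνd, real_inner_smul_left, real_inner_self_eq_norm_sq]; field_simp
  set D : EV n → ℝ := fun y => z y + (-1) * z (mc T y) with hD
  set S : Set (EV n) := {y | ‖y‖ ≤ r ∧ 0 ≤ ⟪ν, y⟫} with hS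
  have hSc : IsCompact S := (isCompact_closedBall (0 : EV n) r).of_isClosed_subset (by
    rw [hS, Set.setOf_and]; exact (isClosed_le continuous_norm continuous_const).inter (isClosed_le continuous_const (by fun_prop))) fun y hy => by simpa using hy.1
  have hDc : ∀ y, ‖y‖ ≤ r → ContDiffAt ℝ 2 D y ∧ pr 1 (hess D y) = (hess z y).trace - (hess z (mc T y)).trace := fun y hy =>
    refl_fn hT (H y hy).1 (H (mc T y) (by rwa [hT.2.1])).1
  have hψh := hess_qf ((2 * s / r ^ 2) • (1 : Mx n) - K' • outer ν) ((K' * r) • innerSL ℝ ν) 0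
  have hin : ∀ y ∈ S, 0 ≤ ⟪ν, y⟫ ∧ ⟪ν, y⟫ ≤ r := fun y hy => ⟨hy.2, by
    have := real_inner_le_norm ν y; rw [hν, one_mul] at this; exact this.trans hy.1⟩
  have key := cmpP (l := 1) (L := 1) zero_le_one hSc (w := ψ) (ψ := D) hψh.1.continuous.continuousOn (fun y hy => (hDc y hy.1).1.continuousAt.continuousWithinAt) (fun y hy => by
    have hq : 0 ≤ K' * (⟪ν, y⟫ * (r - ⟪ν, y⟫)) := mul_nonneg hK0 (mul_nonneg (hin y hy).1 (by have := (hin y hy).2; linarith))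
    have hp : 0 ≤ 2 * s / r ^ 2 * ‖y‖ ^ 2 := by positivity
    rcases hy.2.eq_or_lt with h0 | h0
    · left
      have : mc T y = y := by rw [hT.1, ← h0]; simp
      rw [hψv, hD]; simp only [this]; linarith
    rcases hy.1.eq_or_lt with h1 | h1
    · left
      have b1 := (abs_le.1 (H y hy.1).2.1).2
      have b2 := (abs_le.1 (H (mc T y) (by rw [hT.2.1]; exact hy.1)).2.1).1
      have : 2 * s / r ^ 2 * ‖y‖ ^ 2 = 2 * s := by rw [h1]; field_simp
      rw [hψv, hD]; simp only; linarith
    · right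
      refine ⟨?_, hψh.1.contDiffAt, (hDc y hy.1).1, 1, 0, ell_one, ?_⟩
      · have c : Continuous fun y : EV n => ⟪ν, y⟫ := by fun_prop
        exact (((continuous_norm.tendsto y).eventually (gt_mem_nhds h1)).and ((c.tendsto y).eventually (lt_mem_nhds h0))).mono fun _ h => ⟨h.1.le, h.2.le⟩
      · rw [(hDc y hy.1).2, pr_one, map_zero, map_zero, add_zero, add_zero]
        have b1 := (abs_le.1 (H y hy.1).2.2).1
        have b2 := (abs_le.1 (H (mc T y) (by rw [hT.2.1]; exact hy.1)).2.2).2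
        have e1 : (hess ψ y).trace = 2 * (2 * s / r ^ 2) * n - 2 * K' := by
          rw [hψh.2, Matrix.trace_add, Matrix.trace_transpose, Matrix.trace_sub, Matrix.trace_smul, Matrix.trace_smul, outer_trace, hν, Matrix.trace_one]
          simp; ring
        have : 2 * (2 * s / r ^ 2) * n = 2 * (2 * s * n / r ^ 2) := by ring
        linarith) x ⟨hx, by rw [hνx]; positivity⟩
  have hTx : mc T x = -x := by
    rw [hT.1, hνx, hνd, smul_smul, show 2 * ‖x‖ * ‖x‖⁻¹ = 2 by field_simp]; module
  rw [hψv, hνx] at key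
  simp only [hD, hTx] at key
  have e1 : 2 * s / r ^ 2 * ‖x‖ ^ 2 ≤ ‖x‖ * (2 * s / r) := by
    calc 2 * s / r ^ 2 * ‖x‖ ^ 2 = 2 * s / r ^ 2 * ‖x‖ * ‖x‖ := by ring
      _ ≤ 2 * s / r ^ 2 * ‖x‖ * r := by gcongr
      _ = _ := by field_simp
  have e2 : K' * r * ‖x‖ = ‖x‖ * (2 * n * s / r + 2 * M * r) := by rw [hK']; field_simp
  have e3 : 0 ≤ K' * ‖x‖ ^ 2 := by positivity
  have e4 : ‖x‖ * ((2 + 2 * n) * s / r + 2 * M * r) = ‖x‖ * (2 * s / r) + ‖x‖ * (2 * n * s / r + 2 * M * r) := by ring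
  linarith
theorem grad {z : EV n → ℝ} {r s M : ℝ} (hr : 0 < r) (hM : 0 < M) {x y : EV n}
    (H : ∀ p : EV n, ‖p - (2⁻¹:ℝ) • (x + y)‖ ≤ r → ContDiffAt ℝ 2 z p ∧ |z p - z ((2⁻¹:ℝ) • (x + y))| ≤ s ∧ |(hess z p).trace| ≤ M) (hxy : ‖x - y‖ ≤ r) :
    |z x - z y| ≤ ‖x - y‖ * ((1 + n) * s / r + M * r) := by
  set c := (2⁻¹:ℝ) • (x + y) with hc
  have hs : 0 ≤ s := (abs_nonneg _).trans (H c (by simp; positivity)).2.1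
  have key : ∀ q : EV n, ‖q‖ ≤ r → z (q + c) - z (-q + c) ≤ ‖q‖ * ((2 + 2 * n) * s / r + 2 * M * r) := fun q hq => by
    have := grad0 (z := fun y => (fun y => - z c + 1 * z y) (y + c)) hr hs hM (fun y hy => by
      obtain ⟨h1, h2, h3⟩ := H (y + c) (by rwa [add_sub_cancel_right])
      refine ⟨cd_tl (contDiffAt_const.add (contDiffAt_const.mul h1)), by convert h2 using 2; ring, ?_⟩
      rw [hess_tl (fun y => - z c + 1 * z y), hess_cs _ _ h1, one_smul]; exact h3) hq
    simp only at this; linarith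
  have e1 : (2⁻¹:ℝ) • (x - y) + c = x := by rw [hc]; module
  have e2 : -((2⁻¹:ℝ) • (x - y)) + c = y := by rw [hc]; module
  have hn : ‖(2⁻¹:ℝ) • (x - y)‖ = ‖x - y‖ / 2 := by rw [norm_smul]; norm_num; ring
  have k1 := key ((2⁻¹:ℝ) • (x - y)) (by rw [hn]; have := norm_nonneg (x - y); linarith)
  have k2 := key (-((2⁻¹:ℝ) • (x - y))) (by rw [norm_neg, hn]; have := norm_nonneg (x - y); linarith)
  rw [neg_neg, e1, e2, norm_neg, hn] at k2
  rw [e1, e2, hn] at k1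
  have e3 : ‖x - y‖ / 2 * ((2 + 2 * n) * s / r + 2 * M * r) = ‖x - y‖ * ((1 + n) * s / r + M * r) := by ring
  rw [abs_le]; constructor <;> linarith
end
structure SD {n : ℕ} (w : EV n → ℝ) (a : EV n → Mx n) (g : EV n → ℝ) (M ε α : ℝ) : Prop where
  cd : ∀ y : EV n, ‖y‖ ≤ 1 → ContDiffAt ℝ 2 w y
  eq : ∀ y : EV n, ‖y‖ ≤ 1 → pr (a y) (hess w y) = g y
  wb : ∀ y : EV n, ‖y‖ ≤ 1 → |w y| ≤ M
  ab : ∀ y : EV n, ‖y‖ ≤ 1 → ∀ i j, |a y i j - (1 : Mx n) i j| ≤ ε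
  ah : ∀ y y' : EV n, ‖y‖ ≤ 1 → ‖y'‖ ≤ 1 → ∀ i j, |a y i j - a y' i j| ≤ ε * ‖y - y'‖ ^ α
  gh : ∀ y y' : EV n, ‖y‖ ≤ 1 → ‖y'‖ ≤ 1 → |g y - g y'| ≤ M * ‖y - y'‖ ^ α
def PH {n : ℕ} (w : EV n → ℝ) (α r H : ℝ) : Prop :=
  ∀ x y : EV n, ‖x‖ ≤ r → ‖y‖ ≤ r → ∀ i j, |hess w x i j - hess w y i j| ≤ H * ‖x - y‖ ^ α
section
variable {n : ℕ}
theorem itp_sd {w : EV n → ℝ} {x : EV n} {τ h : ℝ} (hτ : 0 < τ) (H : ∀ p, ‖p - x‖ ≤ τ → ContDiffAt ℝ 2 w p ∧ ∀ i j, |hess w p i j - hess w x i j| ≤ h)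
    {e : EV n} (he : ‖e‖ = 1) : |sd w τ e x - qf (hess w x) e| ≤ n ^ 2 * h := by
  have h1 : ∀ t, |t| ≤ τ → ContDiffAt ℝ 2 w (x + t • e) ∧ |qf (hess w (x + t • e)) e - qf (hess w x) e| ≤ n ^ 2 * h := fun t ht => by
    obtain ⟨c, d⟩ := H (x + t • e) (by rwa [add_sub_cancel_left, norm_smul, he, mul_one])
    refine ⟨c, ?_⟩
    rw [← qf_sub]; exact qf_ent_le d he
  have h2 := sd_le hτ fun t ht => ⟨(h1 t ht).1, (sub_le_iff_le_add.1 (abs_le.1 (h1 t ht).2).2)⟩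
  have h3 := le_sd (M := -(n ^ 2 * h) + qf (hess w x) e) hτ fun t ht => ⟨(h1 t ht).1, by have := (abs_le.1 (h1 t ht).2).1; linarith⟩
  rw [abs_le]; constructor <;> linarith
theorem qf_unit {P : Mx n} {t : ℝ} (h : ∀ e : EV n, ‖e‖ = 1 → |qf P e| ≤ t) (ξ : EV n) : |qf P ξ| ≤ t * ‖ξ‖ ^ 2 := by
  rcases eq_or_ne ξ 0 with rfl | hξ
  · simp [qf]
  have h0 := norm_ne_zero_iff.2 hξ
  have h1 := h (‖ξ‖⁻¹ • ξ) (norm_smul_inv_norm hξ)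
  rw [show qf P ξ = ‖ξ‖ ^ 2 * qf P (‖ξ‖⁻¹ • ξ) by rw [← qf_hom, smul_inv_smul₀ h0], abs_mul, abs_of_nonneg (by positivity), mul_comm]
  gcongr
theorem itp {w : EV n → ℝ} {x : EV n} {τ h M : ℝ} (hτ : 0 < τ) (H : ∀ p, ‖p - x‖ ≤ τ → ContDiffAt ℝ 2 w p ∧ ∀ i j, |hess w p i j - hess w x i j| ≤ h)
    (hw : ∀ p, ‖p - x‖ ≤ τ → |w p| ≤ M) (i j : Fin n) : |hess w x i j| ≤ 2 * (4 * M / τ ^ 2 + n ^ 2 * h) := by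
  have hc := (H x (by simp; positivity)).1
  refine qf_entry (fun i j => hess_symm hc i j) (qf_unit fun e he => ?_) i j
  have h1 := itp_sd hτ H he
  have hn : ‖τ • e‖ = τ := by rw [norm_smul, he, Real.norm_of_nonneg hτ.le, mul_one]
  have b1 := abs_le.1 (hw (x + τ • e) (by rw [add_sub_cancel_left, hn]))
  have b2 := abs_le.1 (hw (x - τ • e) (by rw [sub_sub_cancel_left, norm_neg, hn]))
  have b3 := abs_le.1 (hw x (by simp; positivity))
  have h2 : |sd w τ e x| ≤ 4 * M / τ ^ 2 := by
    rw [sd, abs_mul, abs_of_pos (by positivity), mul_comm, ← div_eq_mul_inv]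
    gcongr
    rw [abs_le]; constructor <;> linarith
  have := abs_sub_abs_le_abs_sub (qf (hess w x) e) (sd w τ e x)
  rw [abs_sub_comm] at this; linarith
theorem lap {w g : EV n → ℝ} {a : EV n → Mx n} {M ε α r H S : ℝ} (hD : SD w a g M ε α) (hr : r ≤ 1) (hH : PH w α r H) (hS : ∀ x : EV n, ‖x‖ ≤ r → ∀ i j, |hess w x i j| ≤ S)
    {x y : EV n} (hx : ‖x‖ ≤ r) (hy : ‖y‖ ≤ r) : |(hess w x).trace - (hess w y).trace| ≤ (M + n ^ 2 * ε * (H + S)) * ‖x - y‖ ^ α := by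
  have ht : ∀ z : EV n, ‖z‖ ≤ 1 → (hess w z).trace = g z - pr (a z - 1) (hess w z) := fun z hz => by
    rw [pr_subl, pr_one, hD.eq z hz]; ring
  have e : (hess w x).trace - (hess w y).trace = (g x - g y) - pr (a x - 1) (hess w x - hess w y) - pr (a x - a y) (hess w y) := by
    rw [ht x (by linarith), ht y (by linarith), pr_sub, pr_subl, pr_subl, pr_subl, pr_subl]; ring
  have h1 := hD.gh x y (by linarith) (by linarith)
  have h2 := pr_ent (c := a x - 1) (hD.ab x (by linarith)) (H := hess w x - hess w y) (hH x y hx hy)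
  have h3 := pr_ent (c := a x - a y) (hD.ah x y (by linarith) (by linarith)) (hS y hy)
  rw [e]
  refine (abs_sub _ _).trans ((add_le_add ((abs_sub _ _).trans (add_le_add h1 h2)) h3).trans (le_of_eq ?_))
  ring
theorem sch_small {w : EV n → ℝ} {α r H G N θ : ℝ} (hα : 0 < α) (hc : ∀ p : EV n, ‖p‖ ≤ r → ContDiffAt ℝ 2 w p) (hH0 : 0 ≤ H) (hG : 0 < G)
    (hH : PH w α r H) (hL : ∀ x y : EV n, ‖x‖ ≤ r → ‖y‖ ≤ r → |(hess w x).trace - (hess w y).trace| ≤ G * ‖x - y‖ ^ α) (hN : 1 ≤ N) (hθ : 0 < θ) (hθ1 : θ ≤ 1)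
    {x y : EV n} (hxy : 0 < ‖x - y‖) {s : ℝ} (hx : ‖x‖ ≤ s) (hy : ‖y‖ ≤ s) (hs : s + 2 * N * ‖x - y‖ ≤ r) {e : EV n} (he : ‖e‖ = 1) :
    |qf (hess w x) e - qf (hess w y) e| ≤ ((n ^ 2 * (3 * (1 + n) * N ^ (α - 1) + 2 * θ ^ α)) * H + 2 * N * θ ^ (α - 2) * G) * ‖x - y‖ ^ α := by
  set ρ := ‖x - y‖ with hρ
  have hτ : 0 < θ * ρ := by positivity
  have hτ1 : θ * ρ ≤ ρ := mul_le_of_le_one_left hxy.le hθ1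
  have hNρ : ρ ≤ N * ρ := le_mul_of_one_le_left hxy.le hN
  have hcn : ‖(2⁻¹:ℝ) • (x + y)‖ ≤ s := by
    rw [norm_smul]; have := norm_add_le x y; norm_num; linarith
  set c := (2⁻¹:ℝ) • (x + y) with hcd
  have hn : ‖(θ * ρ) • e‖ = θ * ρ := by rw [norm_smul, he, Real.norm_of_nonneg hτ.le, mul_one]
  have in1 : ∀ p, ‖p - c‖ ≤ N * ρ → ∀ q, ‖q - p‖ ≤ θ * ρ → ‖q‖ ≤ r := fun p hp q hq => by
    have h1 : ‖q‖ ≤ ‖q - p‖ + ‖p - c‖ + ‖c‖ := by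
      calc ‖q‖ = ‖(q - p) + (p - c) + c‖ := by congr 1; abel
        _ ≤ _ := (norm_add_le _ _).trans (add_le_add_left (norm_add_le _ _) _)
    linarith
  have near : ∀ p, ‖p - c‖ ≤ N * ρ → |sd w (θ * ρ) e p - qf (hess w p) e| ≤ n ^ 2 * (H * (θ * ρ) ^ α) := fun p hp =>
    itp_sd hτ (fun q hq => ⟨hc q (in1 p hp q hq), fun i j => (hH q p (in1 p hp q hq) (in1 p hp p (by simp; positivity)) i j).trans (by gcongr)⟩) he
  have hp0 : 0 ≤ H * (θ * ρ) ^ α := by positivity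
  have hpw : (θ * ρ) ^ α ≤ (N * ρ) ^ α := Real.rpow_le_rpow hτ.le (by linarith) hα.le
  have hG' : 0 < 2 * G * (θ * ρ) ^ (α - 2) := by positivity
  have hc0 : ‖c - c‖ ≤ N * ρ := by simp; positivity
  have G1 := grad (z := sd w (θ * ρ) e) (r := N * ρ) (s := 3 * (n ^ 2 * (H * (N * ρ) ^ α))) (M := 2 * G * (θ * ρ) ^ (α - 2)) (by positivity) hG' (x := x) (y := y) (fun p hp => by
    have q0 := in1 p hp p (by simp; positivity)
    have q1 := in1 p hp (p + (θ * ρ) • e) (by rw [add_sub_cancel_left, hn])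
    have q2 := in1 p hp (p - (θ * ρ) • e) (by rw [sub_sub_cancel_left, norm_neg, hn])
    obtain ⟨s1, s2⟩ := sd_cd' (hc _ q0) (hc _ q1) (hc _ q2)
    refine ⟨s1, ?_, ?_⟩
    · have a1 := abs_le.1 (near p hp)
      have a2 := abs_le.1 (near c hc0)
      have a3 := qf_ent_le (P := hess w p - hess w c) (hH p c q0 (in1 c hc0 c (by simp; positivity))) he
      rw [qf_sub] at a3
      have a4 : (n:ℝ) ^ 2 * (H * ‖p - c‖ ^ α) ≤ n ^ 2 * (H * (N * ρ) ^ α) := by gcongr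
      have a5 : (n:ℝ) ^ 2 * (H * (θ * ρ) ^ α) ≤ n ^ 2 * (H * (N * ρ) ^ α) := by gcongr
      have a6 := abs_le.1 a3
      change |sd w (θ * ρ) e p - sd w (θ * ρ) e c| ≤ _
      rw [abs_le]; constructor <;> linarith
    · rw [s2, Matrix.trace_smul, Matrix.trace_sub, Matrix.trace_add, Matrix.trace_smul, smul_eq_mul, smul_eq_mul, abs_mul, abs_of_pos (by positivity)]
      have b1 := abs_le.1 (hL _ _ q1 q0)
      have b2 := abs_le.1 (hL _ _ q2 q0)
      rw [add_sub_cancel_left, hn] at b1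
      rw [sub_sub_cancel_left, norm_neg, hn] at b2
      have e1 : (θ * ρ) ^ (α - 2) = (((θ * ρ) ^ 2)⁻¹) * (θ * ρ) ^ α := by
        rw [Real.rpow_sub hτ, Real.rpow_two, div_eq_inv_mul]
      rw [e1, mul_left_comm]
      refine mul_le_mul_of_nonneg_left ?_ (by positivity)
      rw [abs_le]; constructor <;> linarith) hNρ
  have xc : ‖x - c‖ ≤ N * ρ := by
    rw [show x - c = (2⁻¹:ℝ) • (x - y) by rw [hcd]; module, norm_smul]; norm_num; linarith
  have yc : ‖y - c‖ ≤ N * ρ := by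
    rw [show y - c = (-2⁻¹:ℝ) • (x - y) by rw [hcd]; module, norm_smul]; norm_num; linarith
  have n1 := abs_le.1 (near x xc)
  have n2 := abs_le.1 (near y yc)
  rw [← hρ] at G1
  have e1 : ρ * ((1 + n) * (3 * (n ^ 2 * (H * (N * ρ) ^ α))) / (N * ρ) + 2 * G * (θ * ρ) ^ (α - 2) * (N * ρ)) + 2 * (n ^ 2 * (H * (θ * ρ) ^ α)) =
      ((n ^ 2 * (3 * (1 + n) * N ^ (α - 1) + 2 * θ ^ α)) * H + 2 * N * θ ^ (α - 2) * G) * ρ ^ α := by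
    rw [Real.mul_rpow (by linarith) hxy.le, Real.mul_rpow hθ.le hxy.le, Real.mul_rpow hθ.le hxy.le, Real.rpow_sub hxy, Real.rpow_two, Real.rpow_sub (by linarith : 0 < N), Real.rpow_one]
    have : N ≠ 0 := by linarith
    field_simp
    ring
  rw [← e1]
  have G2 := abs_le.1 G1
  rw [abs_le]; constructor <;> linarith
end
section
variable {n : ℕ}
theorem rp_small {α c : ℝ} (hα : 0 < α) (hc : 0 < c) : ∃ θ : ℝ, 0 < θ ∧ θ ≤ 1 ∧ θ ^ α ≤ c := by
  have h0 : 0 < min c 1 := lt_min hc one_pos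
  refine ⟨(min c 1) ^ α⁻¹, by positivity, Real.rpow_le_one h0.le (min_le_right _ _) (by positivity), ?_⟩
  rw [← Real.rpow_mul h0.le, inv_mul_cancel₀ hα.ne', Real.rpow_one]; exact min_le_left _ _
theorem PH.mono {w : EV n → ℝ} {α r s H H' : ℝ} (h : PH w α r H) (hs : s ≤ r) (hH : H ≤ H') : PH w α s H' := fun x y hx hy i j =>
  (h x y (hx.trans hs) (hy.trans hs) i j).trans (by gcongr)
theorem sup_PH {w g : EV n → ℝ} {a : EV n → Mx n} {M ε α r H s τ : ℝ} (hα : 0 < α) (hD : SD w a g M ε α) (hr : r ≤ 1) (hH0 : 0 ≤ H) (hH : PH w α r H) (hτ : 0 < τ) (hs : s + τ ≤ r)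
    {x : EV n} (hx : ‖x‖ ≤ s) (i j : Fin n) : |hess w x i j| ≤ 2 * (4 * M / τ ^ 2 + n ^ 2 * (H * τ ^ α)) := by
  have hp : ∀ p, ‖p - x‖ ≤ τ → ‖p‖ ≤ r := fun p hp => by have := norm_le_norm_add_norm_sub' p x; linarith
  refine itp hτ (fun p h => ⟨hD.cd p ((hp p h).trans hr), fun i j => (hH p x (hp p h) (by linarith) i j).trans ?_⟩) (fun p h => hD.wb p ((hp p h).trans hr)) i j
  gcongr
theorem sch_step (n : ℕ) {α : ℝ} (hα : 0 < α) (hα1 : α < 1) : ∃ ε C : ℝ, 0 < ε ∧ 0 < C ∧ ∀ (w g : EV n → ℝ) (a : EV n → Mx n) (M r s H : ℝ), 0 < M → SD w a g M ε α →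
    s < r → r ≤ 1 → 0 ≤ s → 0 ≤ H → PH w α r H → PH w α s (H / 16 + C * M / (r - s) ^ 3) := by
  have hn0 : (0:ℝ) ≤ n := Nat.cast_nonneg n
  obtain ⟨ν, hν, hν1, hν2⟩ := rp_small (sub_pos.2 hα1) (c := 1 / (256 * (n ^ 2 * (3 * (1 + n)) + 1))) (by positivity)
  obtain ⟨θ, hθ, hθ1, hθ2⟩ := rp_small hα (c := 1 / (256 * (n ^ 2 * 2 + 1))) (by positivity)
  obtain ⟨N, hN⟩ : ∃ N, N = ν⁻¹ := ⟨_, rfl⟩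
  have hN1 : 1 ≤ N := by rw [hN]; exact (one_le_inv₀ hν).2 hν1
  have hNa : N ^ (α - 1) = ν ^ (1 - α) := by rw [hN, Real.inv_rpow hν.le, ← Real.rpow_neg hν.le, neg_sub]
  obtain ⟨κ, hκ, hκ1, hκ2⟩ := rp_small hα (c := 1 / (16 * (4 * n ^ 2 * (4 * N) ^ α + 1))) (by positivity)
  obtain ⟨K, hK⟩ : ∃ K, K = 2 * N * θ ^ (α - 2) := ⟨_, rfl⟩
  have hK0 : 0 < K := by rw [hK]; positivity
  obtain ⟨ε, hε⟩ : ∃ ε, ε = 1 / (128 * K * (n ^ 2 * (1 + 2 * n ^ 2) + 1)) := ⟨_, rfl⟩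
  have hε0 : 0 < ε := by rw [hε]; positivity
  have c1 : n ^ 2 * (3 * (1 + n) * N ^ (α - 1) + 2 * θ ^ α) ≤ (1:ℝ) / 128 := by
    rw [hNa]
    rw [le_div_iff₀ (by positivity)] at hν2 hθ2
    have : 0 < ν ^ (1 - α) := by positivity
    have : 0 < θ ^ α := by positivity
    linarith
  have c2 : 4 * n ^ 2 * (4 * N) ^ α * κ ^ α ≤ 1 / 16 := by
    rw [le_div_iff₀ (by positivity)] at hκ2
    have : 0 < κ ^ α := by positivity
    linarith
  have c3 : 2 * K * (n ^ 2 * ε * (1 + 2 * n ^ 2)) ≤ 1 / 64 := by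
    have : ε * (128 * K * (n ^ 2 * (1 + 2 * n ^ 2) + 1)) = 1 := by rw [hε]; field_simp
    have : 0 < ε * K := by positivity
    linarith
  refine ⟨ε, 2 * K * (1 + n ^ 2 * ε * 32) + 16 / κ ^ 2 * (4 * N) ^ α, hε0, by positivity, fun w g a M r s H hM hD hsr hr hs hH0 hH x y hx hy i j => ?_⟩
  obtain ⟨d, hd⟩ : ∃ d, d = r - s := ⟨_, rfl⟩
  rw [← hd]
  have hd0 : 0 < d := by linarith
  have hd1 : d ≤ 1 := by linarith
  have hd3 : M ≤ M / d ^ 3 := le_div_self hM.le (by positivity) (pow_le_one₀ hd0.le hd1)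
  have hd2 : M / d ^ 2 ≤ M / d ^ 3 := by
    have : d ^ 3 ≤ d ^ 2 := pow_le_pow_of_le_one hd0.le hd1 (by norm_num)
    gcongr
  rcases (norm_nonneg (x - y)).eq_or_lt with h0 | hxy
  · rw [sub_eq_zero.1 (norm_eq_zero.1 h0.symm)]; simp; positivity
  have hρ : 0 < ‖x - y‖ ^ α := by positivity
  by_cases hb : 2 * N * ‖x - y‖ ≤ d / 2
  · have hS : ∀ x : EV n, ‖x‖ ≤ s + d / 2 → ∀ i j, |hess w x i j| ≤ 32 * (M / d ^ 2) + 2 * n ^ 2 * H := fun x hx i j => by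
      have h1 := sup_PH hα hD hr hH0 hH (τ := d / 2) (by positivity) (by linarith) hx i j
      have h2 : (d / 2) ^ α ≤ 1 := Real.rpow_le_one (by positivity) (by linarith) hα.le
      have h3 : n ^ 2 * (H * (d / 2) ^ α) ≤ n ^ 2 * (H * 1) := by gcongr
      have h4 : 4 * M / (d / 2) ^ 2 = 16 * (M / d ^ 2) := by field_simp; norm_num
      linarith
    have hH' := hH.mono (s := s + d / 2) (by linarith) le_rfl
    have hG : 0 < M + n ^ 2 * ε * (H + (32 * (M / d ^ 2) + 2 * n ^ 2 * H)) := by positivity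
    have key := qf_entry (P := hess w x - hess w y) (fun i j => by
      rw [Matrix.sub_apply, Matrix.sub_apply, hess_symm (hD.cd x (by linarith)) i j, hess_symm (hD.cd y (by linarith)) i j]) (qf_unit fun e he => by
      rw [qf_sub]
      exact sch_small hα (fun p hp => hD.cd p (by linarith)) hH0 hG hH' (fun x y hx hy => lap hD (by linarith) hH' hS hx hy) hN1 hθ hθ1 hxy hx hy (by linarith) he) i j
    rw [Matrix.sub_apply] at key
    refine key.trans ?_
    rw [← mul_assoc]
    refine mul_le_mul_of_nonneg_right ?_ hρ.le
    rw [← hK, mul_div_assoc]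
    have t1 := mul_le_mul_of_nonneg_right c1 hH0
    have t2 := mul_le_mul_of_nonneg_right c3 hH0
    have t3 : 0 ≤ 16 / κ ^ 2 * (4 * N) ^ α * (M / d ^ 3) := by positivity
    have t4 := mul_le_mul_of_nonneg_left hd3 hK0.le
    have t5 : 2 * K * (n ^ 2 * ε * 32) * (M / d ^ 2) ≤ 2 * K * (n ^ 2 * ε * 32) * (M / d ^ 3) := by gcongr
    linarith
  · rw [not_le] at hb
    have hle : d ≤ 4 * N * ‖x - y‖ := by linarith
    have hS := fun (x : EV n) (hx : ‖x‖ ≤ s) => sup_PH hα hD hr hH0 hH (τ := κ * d) (by positivity) (by have := mul_le_of_le_one_left hd0.le hκ1; linarith) hx i j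
    have h1 := (abs_sub _ _).trans (add_le_add (hS x hx) (hS y hy))
    have h2 : d ^ α ≤ (4 * N) ^ α * ‖x - y‖ ^ α := by
      rw [← Real.mul_rpow (by positivity) hxy.le]; exact Real.rpow_le_rpow hd0.le hle hα.le
    have h3 : d ≤ d ^ α := by
      have := Real.rpow_le_rpow_of_exponent_ge hd0 hd1 hα1.le
      rwa [Real.rpow_one] at this
    refine h1.trans ?_
    rw [Real.mul_rpow hκ.le hd0.le]
    have e1 : 4 * M / (κ * d) ^ 2 = 4 / κ ^ 2 * (M / d ^ 3) * d := by field_simp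
    have t1 : 16 / κ ^ 2 * (M / d ^ 3) * d ≤ 16 / κ ^ 2 * (M / d ^ 3) * ((4 * N) ^ α * ‖x - y‖ ^ α) := by
      refine mul_le_mul_of_nonneg_left (h3.trans h2) (by positivity)
    have t2 : 4 * n ^ 2 * (H * (κ ^ α * d ^ α)) ≤ 4 * n ^ 2 * (H * (κ ^ α * ((4 * N) ^ α * ‖x - y‖ ^ α))) := by gcongr
    have t3 := mul_le_mul_of_nonneg_left c2 (mul_nonneg hH0 hρ.le)
    have t4 : 0 ≤ 2 * K * (1 + n ^ 2 * ε * 32) * (M / d ^ 3) * ‖x - y‖ ^ α := by positivity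
    rw [e1, mul_div_assoc]
    generalize M / d ^ 3 = X at t1 t4 ⊢
    generalize (4 * N) ^ α = Y at t1 t2 t3 ⊢
    generalize ‖x - y‖ ^ α = Z at t1 t2 t3 t4 ⊢
    generalize κ ^ α = κ' at t2 t3 ⊢
    generalize d ^ α = d' at t2 ⊢
    rw [div_eq_mul_inv] at t1 ⊢
    rw [div_eq_mul_inv 16]
    generalize (κ ^ 2)⁻¹ = k2 at t1 ⊢
    linarith
theorem sch (n : ℕ) {α : ℝ} (hα : 0 < α) (hα1 : α < 1) : ∃ ε C : ℝ, 0 < ε ∧ 0 < C ∧ ∀ (w g : EV n → ℝ) (a : EV n → Mx n) (M H : ℝ), 0 < M → SD w a g M ε α →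
    PH w α 1 H → PH w α (1 / 2) (C * M) ∧ ∀ x : EV n, ‖x‖ ≤ 1 / 4 → ∀ i j, |hess w x i j| ≤ C * M := by
  obtain ⟨ε, C, hε, hC, h⟩ := sch_step n hα hα1
  refine ⟨ε, 128 * C + 2 * (64 + n ^ 2 * (128 * C)), hε, by positivity, fun w g a M H hM hD hH => ?_⟩
  have key : ∀ (k : ℕ) (H : ℝ), 0 ≤ H → PH w α (1 - (1 / 2) ^ k / 2) H → PH w α (1 / 2) ((1 / 16) ^ k * H + 128 * C * M * (1 - (1 / 2) ^ k)) := fun k => by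
    induction k with
    | zero => intro H _ hH; refine hH.mono (by norm_num) (by norm_num)
    | succ k ih =>
      intro H hH0 hH
      have hp : (0:ℝ) < (1 / 2) ^ k := by positivity
      have hp1 : ((1:ℝ) / 2) ^ k ≤ 1 := pow_le_one₀ (by norm_num) (by norm_num)
      have := h w g a M _ (1 - (1 / 2) ^ k / 2) H hM hD (by rw [pow_succ]; linarith) (by rw [pow_succ]; linarith) (by linarith) hH0 hH
      refine (ih _ (by rw [pow_succ] at *; have : (0:ℝ) < 1 - (1 / 2) ^ k * (1 / 2) / 2 - (1 - (1 / 2) ^ k / 2) := by linarith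
                       positivity) this).mono le_rfl (le_of_eq ?_)
      have e : (1 - (1 / 2) ^ (k + 1) / 2 - (1 - (1 / 2) ^ k / 2) : ℝ) = (1 / 2) ^ k / 4 := by rw [pow_succ]; ring
      have e2 : ((1:ℝ) / 16) ^ k = (1 / 2) ^ k * ((1 / 2) ^ k) ^ 3 := by rw [← pow_mul, mul_comm k 3, pow_mul, ← mul_pow]; norm_num
      rw [e, pow_succ _ k, pow_succ _ k, e2]
      generalize ((1:ℝ) / 2) ^ k = p at hp ⊢
      field_simp
      ring
  have fin : PH w α (1 / 2) (128 * C * M) := fun x y hx hy i j => by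
    have ht : Tendsto (fun k : ℕ => ((1 / 16:ℝ) ^ k * |H| + 128 * C * M * (1 - (1 / 2) ^ k)) * ‖x - y‖ ^ α) atTop (𝓝 ((0 * |H| + 128 * C * M * (1 - 0)) * ‖x - y‖ ^ α)) :=
      (((tendsto_pow_atTop_nhds_zero_of_lt_one (by norm_num) (by norm_num)).mul_const _).add ((tendsto_const_nhds.sub (tendsto_pow_atTop_nhds_zero_of_lt_one (by norm_num) (by norm_num))).const_mul _)).mul_const _
    rw [zero_mul, zero_add, sub_zero, mul_one] at ht
    have hk : ∀ k : ℕ, (1 - (1 / 2) ^ k / 2 : ℝ) ≤ 1 := fun k => by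
      have : (0:ℝ) < (1 / 2) ^ k := by positivity
      linarith
    exact ge_of_tendsto' ht fun k => key k |H| (abs_nonneg _) (hH.mono (hk k) (le_abs_self H)) x y hx hy i j
  refine ⟨fin.mono le_rfl ?_, fun x hx i j => ?_⟩
  · have : 0 ≤ 2 * (64 + n ^ 2 * (128 * C)) * M := by positivity
    linarith
  · have h1 := sup_PH hα hD (by norm_num) (by positivity) fin (s := 1 / 4) (τ := 1 / 4) (by norm_num) (by norm_num) hx i j
    have h2 : ((1:ℝ) / 4) ^ α ≤ 1 := Real.rpow_le_one (by norm_num) (by norm_num) hα.le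
    have h3 : n ^ 2 * (128 * C * M * (1 / 4) ^ α) ≤ n ^ 2 * (128 * C * M * 1) := by gcongr
    have : 0 ≤ 128 * C * M := by positivity
    norm_num at h1 h3 ⊢
    linarith
end
section
variable {n : ℕ}
theorem ent_norm {B : EV n →L[ℝ] EV n →L[ℝ] ℝ} {t : ℝ} (ht : 0 ≤ t) (h : ∀ i j, |B (ee i) (ee j)| ≤ t) : ‖B‖ ≤ n ^ 2 * t := by
  refine ContinuousLinearMap.opNorm_le_bound₂ B (by positivity) fun x y => ?_
  rw [bil_sum B x y, Real.norm_eq_abs]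
  refine (Finset.abs_sum_le_sum_abs _ _).trans ((Finset.sum_le_card_nsmul _ _ (n * (t * ‖x‖ * ‖y‖)) fun i _ => (Finset.abs_sum_le_sum_abs _ _).trans ((Finset.sum_le_card_nsmul _ _ (t * ‖x‖ * ‖y‖) fun j _ => ?_).trans ?_)).trans ?_)
  · rw [abs_mul, abs_mul, mul_comm, ← mul_assoc]
    gcongr
    · exact h i j
    · exact PiLp.norm_apply_le x i
    · exact PiLp.norm_apply_le y j
  · simp
  · simp; exact le_of_eq (by ring)
theorem c2_of {w : EV n → ℝ} {T : EV n → EV n →L[ℝ] EV n →L[ℝ] ℝ} {r : ℝ} (h1 : ∀ y : EV n, ‖y‖ < r → DifferentiableAt ℝ w y ∧ HasFDerivAt (fderiv ℝ w) (T y) y)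
    {q : EV n → EV n → ℝ} (h3 : ∀ x y : EV n, ‖x‖ < r → ‖y‖ < r → ‖T x - T y‖ ≤ q x y) (h4 : ∀ x, Tendsto (fun y => q y x) (𝓝 x) (𝓝 0)) {y : EV n} (hy : ‖y‖ < r) : ContDiffAt ℝ 2 w y := by
  have h2 : ContinuousOn T {y | ‖y‖ < r} := fun x hx => by
    refine ContinuousAt.continuousWithinAt (tendsto_iff_norm_sub_tendsto_zero (E := EV n →L[ℝ] EV n →L[ℝ] ℝ).2 ?_)
    refine squeeze_zero' (Eventually.of_forall fun y => norm_nonneg (T y - T x)) ?_ (h4 x)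
    filter_upwards [(isOpen_lt continuous_norm continuous_const).mem_nhds hx] with y hy using h3 y x hy hx
  have ho : IsOpen {y : EV n | ‖y‖ < r} := isOpen_lt continuous_norm continuous_const
  refine ContDiffOn.contDiffAt (s := {y : EV n | ‖y‖ < r}) ?_ (ho.mem_nhds hy)
  rw [show (2 : WithTop ℕ∞) = 1 + 1 by norm_num, contDiffOn_succ_iff_fderiv_of_isOpen ho]
  refine ⟨fun y hy => (h1 y hy).1.differentiableWithinAt, by simp, ?_⟩
  rw [show (1 : WithTop ℕ∞) = 0 + 1 by norm_num, contDiffOn_succ_iff_fderiv_of_isOpen ho]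
  refine ⟨fun y hy => (h1 y hy).2.differentiableAt.differentiableWithinAt, by simp, contDiffOn_zero.2 (h2.congr fun y hy => (h1 y hy).2.fderiv)⟩
theorem sch_lim (n : ℕ) {α : ℝ} (hα : 0 < α) (hα1 : α < 1) : ∃ ε C : ℝ, 0 < ε ∧ 0 < C ∧ ∀ {ι : Type} (F : Filter ι) [NeBot F] (w g : ι → EV n → ℝ) (a : ι → EV n → Mx n)
    (w0 g0 : EV n → ℝ) (a0 : EV n → Mx n) (M : ℝ), 0 < M → (∀ h, SD (w h) (a h) (g h) M ε α ∧ ∃ H, PH (w h) α 1 H) →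
    (∀ y : EV n, ‖y‖ ≤ 1 → DifferentiableAt ℝ w0 y ∧ (∀ v, Tendsto (fun h => fderiv ℝ (w h) y v) F (𝓝 (fderiv ℝ w0 y v))) ∧ (∀ i j, Tendsto (fun h => a h y i j) F (𝓝 (a0 y i j))) ∧
      Tendsto (fun h => g h y) F (𝓝 (g0 y))) →
    PH w0 α (1 / 8) (C * M) ∧ ∀ y : EV n, ‖y‖ ≤ 1 / 8 → ContDiffAt ℝ 2 w0 y ∧ pr (a0 y) (hess w0 y) = g0 y ∧ ∀ i j, |hess w0 y i j| ≤ C * M := by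
  obtain ⟨ε, C, hε, hC, hs⟩ := sch n hα hα1
  refine ⟨ε, C, hε, hC, fun {ι} F _ w g a w0 g0 a0 M hM hD hl => ?_⟩
  have hS : ∀ h, PH (w h) α (1 / 2) (C * M) ∧ ∀ x : EV n, ‖x‖ ≤ 1 / 4 → ∀ i j, |hess (w h) x i j| ≤ C * M := fun h => hs _ _ _ M _ hM (hD h).1 (hD h).2.choose_spec
  let U := Ultrafilter.of F
  have hU : (U : Filter ι) ≤ F := Ultrafilter.of_le F
  have hCM : 0 < C * M := by positivity
  haveI : ProperSpace (EV n →L[ℝ] EV n →L[ℝ] ℝ) := FiniteDimensional.proper ℝ (EV n →L[ℝ] EV n →L[ℝ] ℝ)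
  have hT : ∀ y : EV n, ∃ T : EV n →L[ℝ] EV n →L[ℝ] ℝ, ‖y‖ ≤ 1 / 4 → Tendsto (fun h => fderiv ℝ (fderiv ℝ (w h)) y) U (𝓝 T) := fun y => by
    by_cases hy : ‖y‖ ≤ 1 / 4
    · obtain ⟨T, -, hT⟩ := (isCompact_closedBall (0 : EV n →L[ℝ] EV n →L[ℝ] ℝ) (n ^ 2 * (C * M))).ultrafilter_le_nhds (U.map fun h => fderiv ℝ (fderiv ℝ (w h)) y) (by
        rw [le_principal_iff, Ultrafilter.mem_coe, Ultrafilter.mem_map]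
        refine univ_mem' fun h => ?_
        have hb : ‖fderiv ℝ (fderiv ℝ (w h)) y‖ ≤ n ^ 2 * (C * M) := ent_norm hCM.le fun i j => by rw [← hess_apply]; exact (hS h).2 y hy i j
        exact (mem_closedBall_zero_iff (E := EV n →L[ℝ] EV n →L[ℝ] ℝ)).2 hb)
      exact ⟨T, fun _ => hT⟩
    · exact ⟨0, fun h => absurd h hy⟩
  choose T hT using hT
  have hTv : ∀ y : EV n, ‖y‖ ≤ 1 / 4 → ∀ v v', Tendsto (fun h => fderiv ℝ (fderiv ℝ (w h)) y v v') U (𝓝 (T y v v')) := fun y hy v v' =>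
    ((((ContinuousLinearMap.apply ℝ ℝ v').continuous.comp (ContinuousLinearMap.apply ℝ (EV n →L[ℝ] ℝ) v).continuous).tendsto (T y)).comp (hT y hy) :)
  have hTe : ∀ y : EV n, ‖y‖ ≤ 1 / 4 → ∀ i j, Tendsto (fun h => hess (w h) y i j) U (𝓝 (T y (ee i) (ee j))) := fun y hy i j => by
    simp only [hess_apply]
    exact hTv y hy _ _
  have hTh : ∀ x y : EV n, ‖x‖ ≤ 1 / 4 → ‖y‖ ≤ 1 / 4 → ‖T x - T y‖ ≤ n ^ 2 * (C * M * ‖x - y‖ ^ α) := fun x y hx hy => ent_norm (by positivity) fun i j =>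
    le_of_tendsto' ((hTe x hx i j).sub (hTe y hy i j)).abs fun h => (hS h).1 x y (by linarith) (by linarith) i j
  have hlin : ∀ x y : EV n, ‖x‖ < 1 / 4 → ‖y‖ < 1 / 4 → ‖fderiv ℝ w0 y - fderiv ℝ w0 x - T x (y - x)‖ ≤ n ^ 2 * (C * M * ‖y - x‖ ^ α) * ‖y - x‖ := fun x y hx hy => by
    refine ContinuousLinearMap.opNorm_le_bound _ (by positivity) fun v => ?_
    have t1 := ((((hl y (by linarith)).2.1 v).mono_left hU).sub (((hl x (by linarith)).2.1 v).mono_left hU)).sub (hTv x hx.le (y - x) v)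
    refine le_of_tendsto' t1.norm fun h => ?_
    have conv : Convex ℝ (Metric.closedBall x ‖y - x‖ ∩ Metric.ball (0 : EV n) (1 / 4)) := (convex_closedBall _ _).inter (convex_ball _ _)
    have := conv.norm_image_sub_le_of_norm_hasFDerivWithin_le (f := fun p => fderiv ℝ (w h) p - fderiv ℝ (fderiv ℝ (w h)) x p) (f' := fun p => fderiv ℝ (fderiv ℝ (w h)) p - fderiv ℝ (fderiv ℝ (w h)) x)
      (C := n ^ 2 * (C * M * ‖y - x‖ ^ α)) (x := x) (y := y) (fun p hp => by
        have hp2 : ‖p‖ < 1 / 4 := by simpa using hp.2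
        exact ((((((hD h).1.cd p (by linarith)).fderiv_right (m := 1) (by norm_num)).differentiableAt (by norm_num)).hasFDerivAt).sub (ContinuousLinearMap.hasFDerivAt _)).hasFDerivWithinAt) (fun p hp => by
        have hp2 : ‖p‖ < 1 / 4 := by simpa using hp.2
        have hp1 : ‖p - x‖ ≤ ‖y - x‖ := by simpa [dist_eq_norm] using hp.1
        refine ent_norm (by positivity) fun i j => ?_
        have := (hS h).1 p x (by linarith) (by linarith) i j
        rw [hess_apply, hess_apply] at this
        refine this.trans ?_
        gcongr) ⟨by simp, by simpa using hx⟩ ⟨by simp [dist_eq_norm], by simpa using hy⟩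
    have e : fderiv ℝ (w h) y v - fderiv ℝ (w h) x v - fderiv ℝ (fderiv ℝ (w h)) x (y - x) v = ((fderiv ℝ (w h) y - fderiv ℝ (fderiv ℝ (w h)) x y) - (fderiv ℝ (w h) x - fderiv ℝ (fderiv ℝ (w h)) x x)) v := by
      simp only [ContinuousLinearMap.sub_apply, map_sub]; ring
    rw [e]
    exact (ContinuousLinearMap.le_opNorm _ _).trans (mul_le_mul_of_nonneg_right this (norm_nonneg _))
  have z1 : ∀ x : EV n, Tendsto (fun y => n ^ 2 * (C * M * ‖y - x‖ ^ α)) (𝓝 x) (𝓝 0) := fun x => by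
    have : Continuous fun y => n ^ 2 * (C * M * ‖y - x‖ ^ α) := by
      exact (((Real.continuous_rpow_const hα.le).comp (continuous_id.sub continuous_const).norm).const_mul _).const_mul _
    simpa [hα.ne'] using this.tendsto x
  have nb : ∀ x : EV n, ‖x‖ < 1 / 4 → ∀ᶠ y in 𝓝 x, ‖y‖ < 1 / 4 := fun x hx => (isOpen_lt continuous_norm continuous_const).mem_nhds hx
  have hder : ∀ x : EV n, ‖x‖ < 1 / 4 → DifferentiableAt ℝ w0 x ∧ HasFDerivAt (fderiv ℝ w0) (T x) x := fun x hx => by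
    refine ⟨(hl x (by linarith)).1, ?_⟩
    rw [hasFDerivAt_iff_isLittleO, Asymptotics.isLittleO_iff]
    intro c hc
    filter_upwards [nb x hx, (z1 x).eventually_le_const hc] with y hy hy2
    exact (hlin x y hx hy).trans (by gcongr)
  have hh : ∀ y : EV n, ‖y‖ ≤ 1 / 8 → ∀ i j, hess w0 y i j = T y (ee i) (ee j) := fun y hy i j => by rw [hess_apply, (hder y (by linarith)).2.fderiv]
  refine ⟨fun x y hx hy i j => ?_, fun y hy => ⟨c2_of hder (fun x y hx hy => hTh x y hx.le hy.le) z1 (by linarith), ?_, fun i j => ?_⟩⟩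
  · rw [hh x hx, hh y hy]
    exact le_of_tendsto' ((hTe x (by linarith) i j).sub (hTe y (by linarith) i j)).abs fun h => (hS h).1 x y (by linarith) (by linarith) i j
  · refine tendsto_nhds_unique ?_ ((hl y (by linarith)).2.2.2.mono_left hU)
    have : Tendsto (fun h => pr (a h y) (hess (w h) y)) U (𝓝 (pr (a0 y) (hess w0 y))) := by
      refine tendsto_finset_sum _ fun i _ => tendsto_finset_sum _ fun j _ => (((hl y (by linarith)).2.2.1 i j).mono_left hU).mul ?_
      rw [hh y hy]; exact hTe y (by linarith) i j
    exact this.congr fun h => (hD h).1.eq y (by linarith)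
  · rw [hh y hy]; exact le_of_tendsto' (hTe y (by linarith) i j).abs fun h => (hS h).2 y (by linarith) i j
end
def DW (W : ℝ → ℝ) : Prop := ∃ D, 0 < D ∧ ∀ᶠ r in atTop, 0 < W r ∧ ∀ t, r / 2 ≤ t → t ≤ 2 * r → W t ≤ D * W r
def HF {n : ℕ} {ι : Type} (α : ℝ) (W : ℝ → ℝ) (w : ι → EV n → ℝ) : Prop :=
  ∃ C, 0 < C ∧ ∀ᶠ x in nf n, ∀ i, |w i x| ≤ C * W ‖x‖ ∧ ∀ y, ‖y - x‖ ≤ ‖x‖ / 4 → |w i y - w i x| ≤ C * W ‖x‖ * (‖y - x‖ / ‖x‖) ^ α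
abbrev HU {n : ℕ} (α : ℝ) (W : ℝ → ℝ) (w : EV n → ℝ) : Prop := HF α W fun _ : Unit => w
section
variable {n : ℕ} {ι : Type} {α : ℝ} {V W : ℝ → ℝ}
theorem ev_near {p : EV n → Prop} (h : ∀ᶠ x in nf n, p x) : ∀ᶠ x in nf n, ∀ y, ‖y - x‖ ≤ ‖x‖ / 2 → p y := by
  obtain ⟨R, hR⟩ := evi.1 h
  refine evi.2 ⟨2 * R, fun x hx y hy => hR y ?_⟩
  have := norm_le_norm_add_norm_sub y x
  linarith
theorem near_n {x y : EV n} (h : ‖y - x‖ ≤ ‖x‖ / 2) : ‖x‖ / 2 ≤ ‖y‖ ∧ ‖y‖ ≤ 2 * ‖x‖ := by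
  have := norm_le_norm_add_norm_sub y x
  have := norm_le_norm_add_norm_sub' y x
  constructor <;> linarith [norm_nonneg x]
theorem DW.nf (h : DW W) (n : ℕ) : ∃ D, 0 < D ∧ ∀ᶠ x in nf n, 0 < W ‖x‖ ∧ ∀ y, ‖y - x‖ ≤ ‖x‖ / 2 → W ‖y‖ ≤ D * W ‖x‖ := by
  obtain ⟨D, hD, h⟩ := h
  refine ⟨D, hD, ?_⟩
  filter_upwards [nf_norm.eventually h] with x hx
  exact ⟨hx.1, fun y hy => hx.2 _ (near_n hy).1 (near_n hy).2⟩
theorem hf_of {w : ι → EV n → ℝ} {c : ℝ} (hc : 1 ≤ c) (hα : 0 < α) (hW : DW W) (h : ∃ C, 0 < C ∧ ∀ᶠ x in nf n, ∀ i, |w i x| ≤ C * W ‖x‖ ∧ ∀ y, ‖y - x‖ ≤ ‖x‖ / c → |w i y - w i x| ≤ C * W ‖x‖ * (‖y - x‖ / ‖x‖) ^ α) :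
    HF α W w := by
  obtain ⟨C, hC, h⟩ := h
  obtain ⟨D, hD, hD'⟩ := hW.nf n
  refine ⟨C + C * (D + 1) * c ^ α, by positivity, ?_⟩
  filter_upwards [h, ev_near h, hD', ev_ge 1] with x h1 h2 h3 hx i
  have hW := h3.1
  have e : 0 ≤ C * (D + 1) * c ^ α * W ‖x‖ := by positivity
  refine ⟨by have := (h1 i).1; linarith, fun y hy => ?_⟩
  have hr : 0 ≤ (‖y - x‖ / ‖x‖) ^ α := by positivity
  rw [add_mul, add_mul]
  by_cases hyc : ‖y - x‖ ≤ ‖x‖ / c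
  · have := (h1 i).2 y hyc
    have := mul_nonneg e hr
    linarith
  · have hx0 : 0 < ‖x‖ := by linarith
    have h5 : 1 ≤ (c * (‖y - x‖ / ‖x‖)) ^ α := by
      refine Real.one_le_rpow ?_ hα.le
      rw [not_le, div_lt_iff₀ (by linarith)] at hyc
      rw [mul_div_assoc', le_div_iff₀ hx0]; linarith
    rw [Real.mul_rpow (by linarith) (by positivity)] at h5
    have h6 := (h2 y (by linarith) i).1
    have h7 := mul_le_mul_of_nonneg_left (h3.2 y (by linarith)) hC.le
    have h8 : C * (D + 1) * W ‖x‖ * 1 ≤ C * (D + 1) * W ‖x‖ * (c ^ α * (‖y - x‖ / ‖x‖) ^ α) := by gcongr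
    have h9 : 0 ≤ C * W ‖x‖ * (‖y - x‖ / ‖x‖) ^ α := by positivity
    have := (h1 i).1
    have := abs_sub (w i y) (w i x)
    linarith
theorem HF.uni {w : EV n → ℝ} (h : HU α W w) (κ : Type) : HF α W fun _ : κ => w := by
  obtain ⟨C, hC, h⟩ := h
  exact ⟨C, hC, h.mono fun x hx _ => hx ()⟩
theorem Hd.hu {w : EV n → ℝ} (hW : DW W) (h : Hd α W w) : HU α W w := by
  obtain ⟨C, h⟩ := h
  obtain ⟨D, hD, hD'⟩ := hW.nf n
  refine ⟨|C| + 1, by positivity, ?_⟩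
  filter_upwards [h, hD'] with x h1 h2 _
  have h3 : C * W ‖x‖ ≤ (|C| + 1) * W ‖x‖ := mul_le_mul_of_nonneg_right (by linarith [le_abs_self C]) h2.1.le
  exact ⟨h1.1.trans h3, fun y hy => (h1.2 y hy).trans (by gcongr)⟩
theorem HF.mono {w : ι → EV n → ℝ} (h : HF α W w) {K : ℝ} (hK : 0 < K) (hV : ∀ᶠ r in atTop, W r ≤ K * V r) : HF α V w := by
  obtain ⟨C, hC, h⟩ := h
  refine ⟨C * K, by positivity, ?_⟩
  filter_upwards [h, nf_norm.eventually hV] with x h1 h2 i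
  have h3 : C * W ‖x‖ ≤ C * K * V ‖x‖ := by rw [mul_assoc]; gcongr
  exact ⟨(h1 i).1.trans h3, fun y hy => ((h1 i).2 y hy).trans (by gcongr)⟩
theorem HF.add {w z : ι → EV n → ℝ} (h : HF α W w) (h' : HF α W z) : HF α W fun i x => w i x + z i x := by
  obtain ⟨C, hC, h⟩ := h
  obtain ⟨C', hC', h'⟩ := h'
  refine ⟨C + C', by positivity, ?_⟩
  filter_upwards [h, h'] with x h1 h2 i
  refine ⟨(abs_add_le _ _).trans (by linarith [(h1 i).1, (h2 i).1]), fun y hy => ?_⟩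
  rw [add_sub_add_comm]
  exact (abs_add_le _ _).trans (by linarith [(h1 i).2 y hy, (h2 i).2 y hy])
theorem HF.mul {w z : ι → EV n → ℝ} (hα : 0 < α) (h : HF α W w) (h' : HF α V z) : HF α (fun r => W r * V r) fun i x => w i x * z i x := by
  obtain ⟨C, hC, h⟩ := h
  obtain ⟨C', hC', h'⟩ := h'
  refine ⟨3 * (C * C'), by positivity, ?_⟩
  filter_upwards [h, h', ev_ge 1] with x h1 h2 hx i
  have p1 : 0 ≤ C * W ‖x‖ := (abs_nonneg _).trans (h1 i).1
  have p2 : 0 ≤ C' * V ‖x‖ := (abs_nonneg _).trans (h2 i).1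
  have p3 := mul_le_mul (h1 i).1 (h2 i).1 (abs_nonneg _) p1
  rw [← abs_mul] at p3
  refine ⟨p3.trans (by linarith [mul_nonneg p1 p2]), fun y hy => ?_⟩
  have hr : 0 ≤ (‖y - x‖ / ‖x‖) ^ α := by positivity
  have hr1 : (‖y - x‖ / ‖x‖) ^ α ≤ 1 := Real.rpow_le_one (by positivity) (by rw [div_le_one (by linarith)]; linarith) hα.le
  have q1 := (h1 i).2 y hy
  have q2 := (h2 i).2 y hy
  have q3 : |z i y| ≤ 2 * (C' * V ‖x‖) := by
    have e1 := mul_le_mul_of_nonneg_left hr1 p2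
    have e2 := abs_sub_abs_le_abs_sub (z i y) (z i x)
    linarith [(h2 i).1]
  have e : w i y * z i y - w i x * z i x = (w i y - w i x) * z i y + w i x * (z i y - z i x) := by ring
  have t1 := mul_le_mul q1 q3 (abs_nonneg _) (by positivity)
  have t2 := mul_le_mul (h1 i).1 q2 (abs_nonneg _) p1
  rw [e]
  refine (abs_add_le _ _).trans ?_
  rw [abs_mul, abs_mul]
  linarith
theorem HF.cmul {w : ι → EV n → ℝ} (h : HF α W w) (c : ℝ) : HF α W fun i x => c * w i x := by
  obtain ⟨C, hC, h⟩ := h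
  refine ⟨(|c| + 1) * C, by positivity, ?_⟩
  filter_upwards [h] with x h1 i
  have p1 : 0 ≤ C * W ‖x‖ := (abs_nonneg _).trans (h1 i).1
  refine ⟨?_, fun y hy => ?_⟩
  · rw [abs_mul]
    have := mul_le_mul_of_nonneg_left (h1 i).1 (abs_nonneg c)
    linarith
  · rw [← mul_sub, abs_mul]
    have := mul_le_mul_of_nonneg_left ((h1 i).2 y hy) (abs_nonneg c)
    have : 0 ≤ C * W ‖x‖ * (‖y - x‖ / ‖x‖) ^ α := by positivity
    linarith
theorem HF.sub {w z : ι → EV n → ℝ} (h : HF α W w) (h' : HF α W z) : HF α W fun i x => w i x - z i x := by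
  simpa [sub_eq_add_neg] using h.add (h'.cmul (-1))
theorem HF.const (c : ℝ) : HF α (fun _ => 1) fun (_ : ι) (_ : EV n) => c :=
  ⟨|c| + 1, by positivity, Eventually.of_forall fun x i => ⟨by simp, fun y _ => by simp; positivity⟩⟩
theorem HF.sum {β : Type} {w : β → ι → EV n → ℝ} {s : Finset β} (hW : DW W) (h : ∀ b ∈ s, HF α W (w b)) : HF α W fun i x => ∑ b ∈ s, w b i x := by
  classical
  induction s using Finset.induction_on with
  | empty =>
    obtain ⟨D, -, hD⟩ := hW.nf n
    exact ⟨1, one_pos, hD.mono fun x hx i => ⟨by simpa using hx.1.le, fun y _ => by have := hx.1; simp; positivity⟩⟩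
  | insert b s hb ih =>
    simp only [Finset.sum_insert hb]
    exact (h b (Finset.mem_insert_self b s)).add (ih fun b' hb' => h b' (Finset.mem_insert_of_mem hb'))
theorem HF.shift {w : EV n → ℝ} (hα : 0 < α) (hW : DW W) (h : HU α W w) (e : ι → EV n) (he : ∀ i, ‖e i‖ ≤ 1) : HF α W fun i x => w (x + e i) := by
  refine hf_of (c := 8) (by norm_num) hα hW ?_
  obtain ⟨C, hC, h⟩ := h
  obtain ⟨D, hD, hD'⟩ := hW.nf n
  refine ⟨C * D * (2 ^ α + 1), by positivity, ?_⟩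
  filter_upwards [ev_near h, hD', ev_ge 2] with x h1 h2 hx i
  have hi : ‖x + e i - x‖ ≤ ‖x‖ / 2 := by rw [add_sub_cancel_left]; linarith [he i]
  have h3 := h1 _ hi ()
  have h4 : C * W ‖x + e i‖ ≤ C * D * W ‖x‖ := by rw [mul_assoc]; exact mul_le_mul_of_nonneg_left (h2.2 _ hi) hC.le
  have h5 := (near_n hi).1
  have h0 := h2.1
  have p0 : 0 ≤ C * D * W ‖x‖ := by positivity
  have p1 : 0 ≤ C * D * W ‖x‖ * 2 ^ α := by positivity
  refine ⟨by linarith [h3.1], fun y hy => ?_⟩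
  have h6 := h3.2 (y + e i) (by rw [add_sub_add_right_eq_sub]; linarith)
  rw [add_sub_add_right_eq_sub] at h6
  refine h6.trans ?_
  have h7 : (‖y - x‖ / ‖x + e i‖) ^ α ≤ (2 * (‖y - x‖ / ‖x‖)) ^ α := by
    refine Real.rpow_le_rpow (by positivity) ?_ hα.le
    rw [show 2 * (‖y - x‖ / ‖x‖) = ‖y - x‖ / (‖x‖ / 2) by field_simp]
    gcongr
  rw [Real.mul_rpow (by norm_num) (by positivity)] at h7
  have h8 := mul_le_mul h4 h7 (by positivity) p0
  have h9 : 0 ≤ C * D * W ‖x‖ * (‖y - x‖ / ‖x‖) ^ α := by positivity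
  linarith
end
section
variable {n : ℕ} {ι : Type} {α : ℝ}
theorem scl {w : EV n → ℝ} {z y : EV n} (r c : ℝ) (hw : ContDiffAt ℝ 2 w (z + r • y)) : ContDiffAt ℝ 2 (fun y => c + 1 * w (z + r • y)) y ∧
    (∀ i j, hess (fun y => c + 1 * w (z + r • y)) y i j = r ^ 2 * hess w (z + r • y) i j) := by
  have h1 : ContDiffAt ℝ 2 (fun y => w (z + r • y)) y := hw.comp y (contDiffAt_const.add (contDiffAt_id.const_smul r))
  refine ⟨contDiffAt_const.add (contDiffAt_const.mul h1), fun i j => ?_⟩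
  rw [hess_cs _ _ h1, one_smul]
  have := d2_comp (w := fun y => w (y + z)) (B := r • ContinuousLinearMap.id ℝ (EV n)) (x := y) (cd_tl (by simpa [add_comm] using hw)) (ee i) (ee j)
  simp only [smul_apply, ContinuousLinearMap.id_apply, map_smul, smul_eq_mul] at this
  have h2 := congrFun (congrFun (hess_tl w z (r • y)) i) j
  rw [hess_apply] at h2
  rw [hess_apply, add_comm z, ← h2, sq, mul_assoc, ← this]
  simp only [add_comm z]
theorem scl_d {w : EV n → ℝ} {z y : EV n} (r c : ℝ) (hw : DifferentiableAt ℝ w (z + r • y)) : DifferentiableAt ℝ (fun y => c + 1 * w (z + r • y)) y ∧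
    ∀ v, fderiv ℝ (fun y => c + 1 * w (z + r • y)) y v = r * fderiv ℝ w (z + r • y) v := by
  have h : HasFDerivAt (fun y => c + 1 * w (z + r • y)) ((1:ℝ) • (fderiv ℝ w (z + r • y)).comp (r • ContinuousLinearMap.id ℝ (EV n))) y :=
    (((hw.hasFDerivAt).comp y (((hasFDerivAt_id y).const_smul r).const_add z)).const_mul 1).const_add c
  refine ⟨h.differentiableAt, fun v => ?_⟩
  rw [h.fderiv]; simp
theorem two {W : ℝ → ℝ} (hα : 0 < α) (hW : DW W) {w : ι → EV n → ℝ} (h : HF α W w) : ∃ C, 0 < C ∧ ∀ᶠ x in nf n, ∀ i, ∀ y : EV n, ‖y‖ ≤ 1 →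
    |w i (x + (‖x‖ / 10) • y)| ≤ C * W ‖x‖ ∧ ∀ y' : EV n, ‖y'‖ ≤ 1 → |w i (x + (‖x‖ / 10) • y) - w i (x + (‖x‖ / 10) • y')| ≤ C * W ‖x‖ * ‖y - y'‖ ^ α := by
  obtain ⟨C, hC, h⟩ := h
  obtain ⟨D, hD, hD'⟩ := hW.nf n
  refine ⟨C * D, by positivity, ?_⟩
  filter_upwards [ev_near h, hD', ev_ge 1] with x h1 h2 hx i y hy
  have hb : ∀ y : EV n, ‖y‖ ≤ 1 → ‖x + (‖x‖ / 10) • y - x‖ ≤ ‖x‖ / 10 := fun y hy => by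
    rw [add_sub_cancel_left, norm_smul, Real.norm_of_nonneg (by positivity)]; exact mul_le_of_le_one_right (by positivity) hy
  have hW : ∀ y : EV n, ‖y‖ ≤ 1 → C * W ‖x + (‖x‖ / 10) • y‖ ≤ C * D * W ‖x‖ := fun y hy => by
    rw [mul_assoc]; exact mul_le_mul_of_nonneg_left (h2.2 _ (by linarith [hb y hy])) hC.le
  refine ⟨(h1 _ (by linarith [hb y hy]) i).1.trans (hW y hy), fun y' hy' => ?_⟩
  have b' := hb y' hy'
  have h3 := norm_le_norm_add_norm_sub (x + (‖x‖ / 10) • y') x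
  have e : x + (‖x‖ / 10) • y - (x + (‖x‖ / 10) • y') = (‖x‖ / 10) • (y - y') := by module
  have en : ‖(‖x‖ / 10) • (y - y')‖ = ‖x‖ / 10 * ‖y - y'‖ := by rw [norm_smul, Real.norm_of_nonneg (by positivity)]
  have hyy : ‖y - y'‖ ≤ 2 := by linarith [norm_sub_le y y']
  have h4 := (h1 (x + (‖x‖ / 10) • y') (by linarith) i).2 (x + (‖x‖ / 10) • y) (by
    rw [e, en]
    have := mul_le_mul_of_nonneg_left hyy (by positivity : 0 ≤ ‖x‖ / 10)
    linarith)
  refine h4.trans (mul_le_mul (hW y' hy') ?_ (by positivity) (by have := h2.1; positivity))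
  refine Real.rpow_le_rpow (by positivity) ?_ hα.le
  rw [e, en, div_le_iff₀ (by linarith), mul_comm]
  gcongr
  linarith
theorem T0 (hα : 0 < α) (hα1 : α < 1) {V V' A1 : ℝ → ℝ} (hV : DW V) (hV' : DW V') (hA : DW A1) (hA0 : Tendsto A1 atTop (𝓝 0)) (F : Filter ι) [NeBot F] {s : ι → ℝ} (hs : ∀ h, s h ≠ 0)
    {w G : ι → EV n → ℝ} {a : ι → EV n → Mx n} {w0 G0 : EV n → ℝ} {a0 : EV n → Mx n} (ha : ∀ i j, HF α A1 fun h x => a h x i j - (1 : Mx n) i j) (hG : HF α V G)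
    (ho : ∃ C, 0 < C ∧ ∀ᶠ x in nf n, ∀ h y, ‖y - x‖ ≤ ‖x‖ / 4 → |w h y - w h x| ≤ C * (V ‖x‖ * ‖x‖ ^ 2))
    (hE : ∀ᶠ x in nf n, ∀ h, ContDiffAt ℝ 2 (w h) x ∧ pr (a h x) (hess (w h) x) = G h x)
    (hP : ∀ i j, HF α V' fun h x => s h * hess (w h) x i j)
    (hl : ∀ᶠ x in nf n, DifferentiableAt ℝ w0 x ∧ (∀ v, Tendsto (fun h => fderiv ℝ (w h) x v) F (𝓝 (fderiv ℝ w0 x v))) ∧ (∀ i j, Tendsto (fun h => a h x i j) F (𝓝 (a0 x i j))) ∧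
      Tendsto (fun h => G h x) F (𝓝 (G0 x))) :
    (∀ᶠ x in nf n, ContDiffAt ℝ 2 w0 x ∧ pr (a0 x) (hess w0 x) = G0 x) ∧ ∀ i j, HU α V fun x => hess w0 x i j := by
  obtain ⟨ε, C, hε, hC, hS⟩ := sch_lim n hα hα1
  obtain ⟨Cg, hCg, hG⟩ := two hα hV hG
  obtain ⟨Co, hCo, ho⟩ := ho
  have ha : ∀ᶠ x in nf n, ∀ i j h, ∀ y : EV n, ‖y‖ ≤ 1 → |a h (x + (‖x‖ / 10) • y) i j - (1 : Mx n) i j| ≤ ε ∧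
      ∀ y' : EV n, ‖y'‖ ≤ 1 → |a h (x + (‖x‖ / 10) • y) i j - a h (x + (‖x‖ / 10) • y') i j| ≤ ε * ‖y - y'‖ ^ α := by
    rw [eventually_all]; intro i; rw [eventually_all]; intro j
    obtain ⟨Ca, hCa, h⟩ := two hα hA (ha i j)
    have : Tendsto (fun x : EV n => Ca * A1 ‖x‖) (nf n) (𝓝 0) := by simpa using (hA0.comp nf_norm).const_mul Ca
    filter_upwards [h, this.eventually_le_const hε] with x h1 h2 k y hy
    refine ⟨(h1 k y hy).1.trans h2, fun y' hy' => ?_⟩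
    have := (h1 k y hy).2 y' hy'
    rw [sub_sub_sub_cancel_right] at this
    exact this.trans (by gcongr)
  have hP' : ∀ᶠ x in nf n, ∀ h, ∃ K, ∀ i j, ∀ y : EV n, ‖y‖ ≤ 1 → ∀ y' : EV n, ‖y'‖ ≤ 1 → |hess (w h) (x + (‖x‖ / 10) • y) i j - hess (w h) (x + (‖x‖ / 10) • y') i j| ≤ K * ‖y - y'‖ ^ α := by
    choose Cp hCp hp using fun i j => two hα hV' (hP i j)
    obtain ⟨D, -, hD'⟩ := hV'.nf n
    filter_upwards [eventually_all.2 fun i => eventually_all.2 fun j => hp i j, hD'] with x h1 h2 h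
    refine ⟨|s h|⁻¹ * ((∑ i, ∑ j, Cp i j) * V' ‖x‖), fun i j y hy y' hy' => ?_⟩
    have h3 := (h1 i j h y hy).2 y' hy'
    rw [← mul_sub, abs_mul] at h3
    have h4 : Cp i j ≤ ∑ i, ∑ j, Cp i j := (Finset.single_le_sum (f := fun j => Cp i j) (fun j _ => (hCp i j).le) (Finset.mem_univ j)).trans
      (Finset.single_le_sum (f := fun i => ∑ j, Cp i j) (fun i _ => Finset.sum_nonneg fun j _ => (hCp i j).le) (Finset.mem_univ i))
    have hs0 : 0 < |s h| := abs_pos.2 (hs h)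
    rw [mul_assoc, ← div_eq_inv_mul, le_div_iff₀ hs0, mul_comm]
    refine h3.trans ?_
    have := h2.1
    gcongr
  have hnear : ∀ {x y : EV n}, ‖y‖ ≤ 1 → ‖x + (‖x‖ / 10) • y - x‖ ≤ ‖x‖ / 10 := fun {x y} hy => by
    rw [add_sub_cancel_left, norm_smul, Real.norm_of_nonneg (by positivity)]; exact mul_le_of_le_one_right (by positivity) hy
  obtain ⟨D, hD, hD'⟩ := hV.nf n
  have main : ∀ᶠ x in nf n, ∀ y : EV n, ‖y - x‖ ≤ ‖x‖ / 80 → (ContDiffAt ℝ 2 w0 y ∧ pr (a0 y) (hess w0 y) = G0 y) ∧ ∀ i j, |hess w0 y i j| ≤ C * (Cg + Co) * 100 * V ‖x‖ ∧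
      |hess w0 y i j - hess w0 x i j| ≤ C * (Cg + Co) * 100 * V ‖x‖ * (10 * (‖y - x‖ / ‖x‖)) ^ α := by
    filter_upwards [hG, ho, ha, hP', ev_near hE, ev_near hl, hD', ev_ge 1] with x g1 o1 a1 p1 e1 l1 d1 hx
    have hx0 : 0 < ‖x‖ := by linarith
    have hV0 := d1.1
    obtain ⟨ρ, hρ⟩ : ∃ ρ, ρ = ‖x‖ / 10 := ⟨_, rfl⟩
    have hρ0 : 0 < ρ := by rw [hρ]; positivity
    have hnr : ∀ {y : EV n}, ‖y‖ ≤ 1 → ‖x + ρ • y - x‖ ≤ ‖x‖ / 10 := fun hy => by rw [hρ]; exact hnear hy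
    rw [← hρ] at g1 a1 p1
    have hM : 0 < (Cg + Co) * (V ‖x‖ * ‖x‖ ^ 2) := by positivity
    have hρx : ρ ^ 2 ≤ ‖x‖ ^ 2 := by gcongr; linarith
    obtain ⟨k1, k2⟩ := hS F (fun h y => -w h x + 1 * w h (x + ρ • y)) (fun h y => ρ ^ 2 * G h (x + ρ • y)) (fun h y => a h (x + ρ • y)) (fun y => 0 + 1 * w0 (x + ρ • y))
      (fun y => ρ ^ 2 * G0 (x + ρ • y)) (fun y => a0 (x + ρ • y)) _ hM (fun h => by
        have hc := fun (y : EV n) (hy : ‖y‖ ≤ 1) => e1 (x + ρ • y) (by linarith [hnr hy]) h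
        refine ⟨⟨fun y hy => (scl ρ _ (hc y hy).1).1, fun y hy => ?_, fun y hy => ?_, fun y hy i j => (a1 i j h y hy).1, fun y y' hy hy' i j => (a1 i j h y hy).2 y' hy', fun y y' hy hy' => ?_⟩, ?_⟩
        · rw [← (hc y hy).2]
          simp only [pr, (scl ρ _ (hc y hy).1).2, Finset.mul_sum]
          exact Finset.sum_congr rfl fun i _ => Finset.sum_congr rfl fun j _ => by ring
        · rw [one_mul, neg_add_eq_sub]
          refine (o1 h (x + ρ • y) (by linarith [hnr hy])).trans ?_
          gcongr; linarith
        · rw [← mul_sub, abs_mul, abs_of_pos (by positivity)]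
          have t1 := mul_le_mul hρx ((g1 h y hy).2 y' hy') (abs_nonneg _) (by positivity)
          have t2 : 0 ≤ Co * (V ‖x‖ * ‖x‖ ^ 2) * ‖y - y'‖ ^ α := by positivity
          linarith
        · obtain ⟨K, hK⟩ := p1 h
          refine ⟨ρ ^ 2 * K, fun y y' hy hy' i j => ?_⟩
          rw [(scl ρ _ (hc y hy).1).2, (scl ρ _ (hc y' hy').1).2, ← mul_sub, abs_mul, abs_of_pos (by positivity), mul_assoc]
          exact mul_le_mul_of_nonneg_left (hK i j y hy y' hy') (by positivity)) (fun y hy => by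
        obtain ⟨l2, l3, l4, l5⟩ := l1 (x + ρ • y) (by linarith [hnr hy])
        refine ⟨(scl_d ρ 0 l2).1, fun v => ?_, l4, l5.const_mul _⟩
        rw [(scl_d ρ 0 l2).2 v]
        refine ((l3 v).const_mul ρ).congr fun h => ?_
        exact ((scl_d ρ _ ((e1 (x + ρ • y) (by linarith [hnr hy]) h).1.differentiableAt (by norm_num))).2 v).symm)
    have unsc : ∀ y : EV n, ‖y - x‖ ≤ ‖x‖ / 80 → ‖ρ⁻¹ • (y - x)‖ ≤ 1 / 8 ∧ x + ρ • ρ⁻¹ • (y - x) = y := fun y hy => by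
      refine ⟨?_, by rw [smul_inv_smul₀ hρ0.ne']; abel⟩
      rw [norm_smul, norm_inv, Real.norm_of_nonneg hρ0.le, inv_mul_le_iff₀ hρ0]; linarith
    have hcd : ∀ y : EV n, ‖y - x‖ ≤ ‖x‖ / 80 → ContDiffAt ℝ 2 w0 y ∧ ∀ i j, hess (fun y => 0 + 1 * w0 (x + ρ • y)) (ρ⁻¹ • (y - x)) i j = ρ ^ 2 * hess w0 y i j := fun y hy => by
      have c1 := (k2 _ (unsc y hy).1).1
      have c2 : ContDiffAt ℝ 2 w0 y := by
        have := ContDiffAt.comp y (f := fun y => ρ⁻¹ • (y - x)) c1 ((contDiffAt_id.sub contDiffAt_const).const_smul _)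
        refine this.congr_of_eventuallyEq (Eventually.of_forall fun z => ?_)
        simp only [Function.comp, smul_inv_smul₀ hρ0.ne']; simp
      refine ⟨c2, fun i j => ?_⟩
      rw [(scl ρ 0 (by rwa [(unsc y hy).2])).2, (unsc y hy).2]
    have eC : C * ((Cg + Co) * (V ‖x‖ * ‖x‖ ^ 2)) = ρ ^ 2 * (C * (Cg + Co) * 100 * V ‖x‖) := by rw [hρ]; ring
    have hxx : ‖x - x‖ ≤ ‖x‖ / 80 := by simp; positivity
    rw [eC] at k1 k2
    intro y hy
    obtain ⟨-, q1, q2⟩ := k2 _ (unsc y hy).1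
    refine ⟨⟨(hcd y hy).1, ?_⟩, fun i j => ⟨?_, ?_⟩⟩
    · rw [(unsc y hy).2] at q1
      refine mul_left_cancel₀ (pow_ne_zero 2 hρ0.ne') (q1 ▸ ?_)
      simp only [pr, (hcd y hy).2, Finset.mul_sum]
      exact Finset.sum_congr rfl fun i _ => Finset.sum_congr rfl fun j _ => by ring
    · have := q2 i j
      rw [(hcd y hy).2, abs_mul, abs_of_pos (by positivity)] at this
      exact le_of_mul_le_mul_left this (by positivity)
    · have := k1 _ _ (unsc y hy).1 (unsc x hxx).1 i j
      rw [(hcd y hy).2, (hcd x hxx).2, ← mul_sub, abs_mul, abs_of_pos (by positivity), mul_assoc] at this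
      refine (le_of_mul_le_mul_left this (by positivity)).trans (le_of_eq ?_)
      rw [sub_self, smul_zero, sub_zero, norm_smul, norm_inv, Real.norm_of_nonneg hρ0.le, hρ]
      congr 2; field_simp
  refine ⟨main.mono fun x hx => (hx x (by simp; positivity)).1, fun i j => hf_of (c := 80) (by norm_num) hα hV ⟨C * (Cg + Co) * 100 * 10 ^ α + C * (Cg + Co) * 100, by positivity, ?_⟩⟩
  filter_upwards [main, hD'] with x h1 h2 _
  have := h2.1
  refine ⟨((h1 x (by simp; positivity)).2 i j).1.trans ?_, fun y hy => ((h1 y hy).2 i j).2.trans ?_⟩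
  · have : 0 ≤ C * (Cg + Co) * 100 * 10 ^ α * V ‖x‖ := by positivity
    linarith
  · rw [Real.mul_rpow (by norm_num) (by positivity)]
    have : 0 ≤ C * (Cg + Co) * 100 * V ‖x‖ * (‖y - x‖ / ‖x‖) ^ α := by positivity
    linarith
end
abbrev Hs := {h : ℝ // h ≠ 0 ∧ |h| ≤ 1}
def FH : Filter Hs := comap Subtype.val (𝓝[≠] 0)
instance : NeBot FH := by
  refine NeBot.comap_of_range_mem inferInstance ?_
  rw [Subtype.range_coe_subtype]
  exact inter_mem self_mem_nhdsWithin (mem_nhdsWithin_of_mem_nhds ((continuous_abs.tendsto (0:ℝ)).eventually (ge_mem_nhds (by simp))))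
section
variable {n : ℕ} {ι : Type} {α : ℝ} {V W : ℝ → ℝ}
theorem DW.pow (s : ℝ) : DW fun r => r ^ s := by
  refine ⟨2 ^ |s|, by positivity, ?_⟩
  filter_upwards [eventually_gt_atTop 0] with r hr
  refine ⟨by positivity, fun t h1 h2 => ?_⟩
  have ht : 0 < t := by linarith
  rw [← div_le_iff₀ (by positivity), ← Real.div_rpow ht.le hr.le]
  rcases le_total 0 s with hs | hs
  · rw [abs_of_nonneg hs]
    exact Real.rpow_le_rpow (by positivity) (by rw [div_le_iff₀ hr]; linarith) hs
  · rw [abs_of_nonpos hs, Real.rpow_neg (by norm_num), ← Real.inv_rpow (by norm_num)]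
    exact Real.rpow_le_rpow_of_nonpos (by norm_num) (by rw [le_div_iff₀ hr]; linarith) hs
theorem DW.log : DW Real.log := by
  refine ⟨2, by norm_num, ?_⟩
  filter_upwards [eventually_gt_atTop 2] with r hr
  have := Real.log_pos (by linarith : 1 < r)
  refine ⟨this, fun t h1 h2 => ?_⟩
  have h3 := Real.log_le_log (by linarith) h2
  rw [Real.log_mul (by norm_num) (by linarith)] at h3
  linarith [Real.log_le_log (by norm_num) hr.le]
theorem DW.mul (hV : DW V) (hW : DW W) : DW fun r => V r * W r := by
  obtain ⟨D, hD, h⟩ := hV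
  obtain ⟨D', hD', h'⟩ := hW
  refine ⟨D * D', by positivity, ?_⟩
  have e : ∀ᶠ r : ℝ in atTop, ∀ t, r / 2 ≤ t → 0 < V t := by
    obtain ⟨b, hb⟩ := eventually_atTop.1 h
    filter_upwards [eventually_ge_atTop (2 * b)] with r hr t ht
    exact (hb t (by linarith)).1
  filter_upwards [h, h', e] with r h1 h2 h3
  refine ⟨mul_pos h1.1 h2.1, fun t a b => ?_⟩
  have := mul_le_mul_of_nonneg_left (h2.2 t a b) (h3 t a).le
  have := mul_le_mul_of_nonneg_right (h1.2 t a b) (mul_pos hD' h2.1).le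
  linarith
theorem DW.div (hV : DW V) : DW fun r => V r / r := by
  simpa [div_eq_mul_inv, Real.rpow_neg_one] using hV.mul (DW.pow (-1))
theorem DW.id : DW fun r => r := by simpa using DW.pow 1
theorem DW.one : DW fun _ => 1 := by simpa using DW.pow 0
theorem fd_le {L : EV n →L[ℝ] ℝ} {t : ℝ} (ht : 0 ≤ t) (h : ∀ i, |L (ee i)| ≤ t) : ‖L‖ ≤ n * t := by
  refine L.opNorm_le_bound (by positivity) fun ξ => ?_
  conv_lhs => rw [sum_ee ξ, map_sum]
  refine (norm_sum_le _ _).trans ((Finset.sum_le_card_nsmul _ _ (t * ‖ξ‖) fun i _ => ?_).trans_eq (by simp; ring))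
  rw [map_smul, norm_smul, mul_comm]
  exact mul_le_mul (h i) (PiLp.norm_apply_le ξ i) (norm_nonneg _) ht
theorem oscg (hW : DW W) {w : ι → EV n → ℝ} (h : ∃ C, 0 < C ∧ ∀ᶠ x in nf n, ∀ i, DifferentiableAt ℝ (w i) x ∧ ‖fderiv ℝ (w i) x‖ ≤ C * W ‖x‖) :
    ∃ C, 0 < C ∧ ∀ᶠ x in nf n, ∀ i y, ‖y - x‖ ≤ ‖x‖ / 2 → |w i y - w i x| ≤ C * W ‖x‖ * ‖y - x‖ := by
  obtain ⟨C, hC, h⟩ := h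
  obtain ⟨D, hD, hD'⟩ := hW.nf n
  refine ⟨C * D, by positivity, ?_⟩
  filter_upwards [ev_near h, hD'] with x h1 h2 i y hy
  refine (convex_closedBall x (‖x‖ / 2)).norm_image_sub_le_of_norm_fderiv_le (𝕜 := ℝ) (f := w i) (fun z hz => ?_) (fun z hz => ?_) (Metric.mem_closedBall_self (by positivity)) (mem_closedBall_iff_norm.2 hy)
  · exact (h1 z (mem_closedBall_iff_norm.1 hz) i).1
  · have hz := mem_closedBall_iff_norm.1 hz
    refine (h1 z hz i).2.trans ?_
    rw [mul_assoc]; exact mul_le_mul_of_nonneg_left (h2.2 z hz) hC.le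
theorem hu_g (hα : 0 < α) (hα1 : α < 1) (hW : DW W) {w : EV n → ℝ} (h0 : ∃ C, ∀ᶠ x in nf n, |w x| ≤ C * W ‖x‖)
    (h : ∃ C, 0 < C ∧ ∀ᶠ x in nf n, DifferentiableAt ℝ w x ∧ ‖fderiv ℝ w x‖ ≤ C * (W ‖x‖ / ‖x‖)) : HU α W w := by
  obtain ⟨C0, h0⟩ := h0
  obtain ⟨C1, hC1, h1⟩ := h
  obtain ⟨C, hC, h⟩ := oscg hW.div (w := fun _ : Unit => w) ⟨C1, hC1, h1.mono fun x hx _ => hx⟩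
  obtain ⟨D, hD, hD'⟩ := hW.nf n
  refine ⟨|C0| + C, by positivity, ?_⟩
  filter_upwards [h0, h, ev_ge 1, hD'] with x a1 a2 hx d _
  have hw := d.1
  have e1 := mul_le_mul_of_nonneg_right (le_abs_self C0) hw.le
  have e2 : 0 ≤ C * W ‖x‖ := by positivity
  refine ⟨by linarith, fun y hy => ?_⟩
  have hx0 : 0 < ‖x‖ := by linarith
  have e3 : ‖y - x‖ / ‖x‖ ≤ (‖y - x‖ / ‖x‖) ^ α := by
    have := Real.rpow_le_rpow_of_exponent_ge' (x := ‖y - x‖ / ‖x‖) (by positivity) (by rw [div_le_one hx0]; linarith) hα.le hα1.le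
    rwa [Real.rpow_one] at this
  have e4 := a2 () y (by linarith)
  have e5 := mul_le_mul_of_nonneg_left e3 e2
  have e6 : 0 ≤ |C0| * W ‖x‖ * (‖y - x‖ / ‖x‖) ^ α := by positivity
  have e7 : C * (W ‖x‖ / ‖x‖) * ‖y - x‖ = C * W ‖x‖ * (‖y - x‖ / ‖x‖) := by ring
  linarith
theorem mv1 {φ φ' : ℝ → ℝ} {C : ℝ} (h : ∀ t, |t| ≤ 1 → HasDerivAt φ (φ' t) t ∧ |φ' t| ≤ C) {t : ℝ} (ht : |t| ≤ 1) : |φ t - φ 0| ≤ C * |t| := by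
  have := (convex_Icc (-1:ℝ) 1).norm_image_sub_le_of_norm_hasDerivWithin_le (f := φ) (f' := φ') (x := 0) (y := t) (C := C) (fun s hs => (h s (abs_le.2 hs)).1.hasDerivWithinAt)
    (fun s hs => (h s (abs_le.2 hs)).2) (by constructor <;> norm_num) (abs_le.1 ht)
  simpa using this
theorem ee_n (l : Fin n) : ‖(ee l : EV n)‖ = 1 := by simp [ee]
theorem lin_d {g : EV n → ℝ} {y e : EV n} {t : ℝ} (h : DifferentiableAt ℝ g (y + t • e)) : HasDerivAt (fun t : ℝ => g (y + t • e)) (fderiv ℝ g (y + t • e) e) t := by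
  have h1 : HasDerivAt (fun t : ℝ => y + t • e) e t := by simpa using ((hasDerivAt_id t).smul_const e).const_add y
  exact h.hasFDerivAt.comp_hasDerivAt t h1
theorem dq_hf (hα : 0 < α) (hW : DW W) {g : EV n → ℝ} {l : Fin n} (hd : ∀ᶠ x in nf n, DifferentiableAt ℝ g x) (hg : HU α W fun x => fderiv ℝ g x (ee l)) :
    HF α W fun (h : Hs) x => (g (x + h.1 • ee l) - g x) / h.1 := by
  obtain ⟨C, hC, hs⟩ := HF.shift hα hW hg (fun t : {t : ℝ // |t| ≤ 1} => t.1 • ee l) (fun t => by rw [norm_smul, ee_n, mul_one]; exact t.2)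
  refine ⟨C, hC, ?_⟩
  filter_upwards [hs, ev_near hd, ev_ge 4] with x h1 h2 hx h
  have hq : 0 < |h.1| := abs_pos.2 h.2.1
  have hn : ∀ y : EV n, ‖y - x‖ ≤ ‖x‖ / 4 → ∀ t : ℝ, |t| ≤ 1 → ‖y + t • ee l - x‖ ≤ ‖x‖ / 2 := fun y hy t ht => by
    rw [add_sub_right_comm]
    refine (norm_add_le _ _).trans ?_
    rw [norm_smul, ee_n, mul_one, Real.norm_eq_abs]; linarith
  have hxx : ‖x - x‖ ≤ ‖x‖ / 4 := by simp; positivity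
  refine ⟨?_, fun y hy => ?_⟩
  · rw [abs_div, div_le_iff₀ hq]
    have := mv1 (φ := fun t => g (x + t • ee l)) (fun t ht => ⟨lin_d (h2 _ (hn x hxx t ht)), (h1 ⟨t, ht⟩).1⟩) h.2.2
    simpa using this
  · rw [← sub_div, abs_div, div_le_iff₀ hq, sub_sub_sub_comm]
    have := mv1 (φ := fun t => g (y + t • ee l) - g (x + t • ee l)) (fun t ht => ⟨(lin_d (h2 _ (hn y hy t ht))).sub (lin_d (h2 _ (hn x hxx t ht))), (h1 ⟨t, ht⟩).2 y hy⟩) h.2.2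
    simpa using this
theorem dq_lim {g : EV n → ℝ} {x e : EV n} (h : DifferentiableAt ℝ g x) : Tendsto (fun h : Hs => (g (x + h.1 • e) - g x) / h.1) FH (𝓝 (fderiv ℝ g x e)) := by
  have h1 := hasDerivAt_iff_tendsto_slope_zero.1 (lin_d (t := 0) (e := e) (y := x) (by simpa using h))
  simp only [zero_add, zero_smul, add_zero, smul_eq_mul] at h1
  refine (h1.comp tendsto_comap).congr fun h => ?_
  simp only [Function.comp]; ring
theorem tend_sh {w : EV n → ℝ} {x e : EV n} (h : ContinuousAt w x) : Tendsto (fun h : Hs => w (x + h.1 • e)) FH (𝓝 (w x)) := by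
  have h1 : Tendsto (fun t : ℝ => x + t • e) (𝓝[≠] 0) (𝓝 x) := by
    have : Continuous fun t : ℝ => x + t • e := by fun_prop
    simpa using (this.tendsto 0).mono_left nhdsWithin_le_nhds
  exact h.tendsto.comp (h1.comp tendsto_comap)
theorem fd_i {w : EV n → ℝ} {x : EV n} (h : ContDiffAt ℝ 2 w x) : ∀ v, DifferentiableAt ℝ (fun x => fderiv ℝ w x v) x ∧ (∀ v', fderiv ℝ (fun x => fderiv ℝ w x v) x v' = fderiv ℝ (fderiv ℝ w) x v' v) := fun v => by
  have h1 : DifferentiableAt ℝ (fderiv ℝ w) x := (h.fderiv_right (m := 1) (by norm_num)).differentiableAt (by norm_num)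
  refine ⟨h1.clm_apply (differentiableAt_const v), fun v' => ?_⟩
  rw [fderiv_clm_apply h1 (differentiableAt_const v)]; simp
theorem D1 (hα : 0 < α) (hα1 : α < 1) {A1 : ℝ → ℝ} (hV : DW V) (hA : DW A1) (hA0 : Tendsto A1 atTop (𝓝 0)) {w : EV n → ℝ} {l : Fin n} (hc : ∀ᶠ x in nf n, ContDiffAt ℝ 2 w x)
    (hH : ∀ i j, HU α (fun r => V r * r) fun x => hess w x i j) {G : Hs → EV n → ℝ} {a : Hs → EV n → Mx n} {G0 : EV n → ℝ} {a0 : EV n → Mx n}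
    (ha : ∀ i j, HF α A1 fun h x => a h x i j - (1 : Mx n) i j) (hG : HF α V G)
    (hE : ∀ᶠ x in nf n, ∀ h, pr (a h x) (hess w (x + h.1 • ee l) - hess w x) = h.1 * G h x)
    (hl : ∀ᶠ x in nf n, (∀ i j, Tendsto (fun h => a h x i j) FH (𝓝 (a0 x i j))) ∧ Tendsto (fun h => G h x) FH (𝓝 (G0 x))) :
    (∀ᶠ x in nf n, ContDiffAt ℝ 2 (fun x => fderiv ℝ w x (ee l)) x ∧ pr (a0 x) (hess (fun x => fderiv ℝ w x (ee l)) x) = G0 x) ∧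
      ∀ i j, HU α V fun x => hess (fun x => fderiv ℝ w x (ee l)) x i j := by
  have hVr := hV.mul DW.id
  have he : ∀ h : Hs, ‖h.1 • (ee l : EV n)‖ ≤ 1 := fun h => by rw [norm_smul, ee_n, mul_one]; exact h.2.2
  have hcs : ∀ᶠ x in nf n, ∀ h : Hs, ContDiffAt ℝ 2 w (x + h.1 • ee l) := by
    filter_upwards [ev_near hc, ev_ge 2] with x h1 hx h
    exact h1 _ (by rw [add_sub_cancel_left]; linarith [he h])
  have key : ∀ᶠ x in nf n, ∀ h : Hs, ContDiffAt ℝ 2 (fun x => 0 + h.1⁻¹ * w (x + h.1 • ee l) + -h.1⁻¹ * w x) x ∧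
      (∀ v, fderiv ℝ (fun x => 0 + h.1⁻¹ * w (x + h.1 • ee l) + -h.1⁻¹ * w x) x v = (fderiv ℝ w (x + h.1 • ee l) v - fderiv ℝ w x v) / h.1) ∧
      hess (fun x => 0 + h.1⁻¹ * w (x + h.1 • ee l) + -h.1⁻¹ * w x) x = h.1⁻¹ • (hess w (x + h.1 • ee l) - hess w x) := by
    filter_upwards [hc, hcs] with x h1 h2 h
    have c1 := cd_tl (h2 h)
    have c2 : ContDiffAt ℝ 2 (fun x => 0 + h.1⁻¹ * w (x + h.1 • ee l)) x := contDiffAt_const.add (contDiffAt_const.mul c1)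
    refine ⟨c2.add (contDiffAt_const.mul h1), fun v => ?_, ?_⟩
    · have d1 := (((hasFDerivAt_comp_add_right (h.1 • ee l)).2 ((h2 h).differentiableAt (by norm_num)).hasFDerivAt).const_mul h.1⁻¹).const_add 0
      rw [(d1.fun_add ((h1.differentiableAt (by norm_num)).hasFDerivAt.const_mul (-h.1⁻¹))).fderiv]
      simp only [add_apply, smul_apply, smul_eq_mul]; ring
    · rw [hess_lin c2 h1, hess_cs _ _ c1, hess_tl w, smul_sub, neg_smul, sub_eq_add_neg]
  refine T0 hα hα1 hV hVr hA hA0 FH (s := fun h => h.1) (fun h => h.2.1) (w := fun h x => 0 + h.1⁻¹ * w (x + h.1 • ee l) + -h.1⁻¹ * w x) ha hG ?_ ?_ (fun i j => ?_) ?_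
  · have hq : ∀ i, HF α (fun r => V r * r) fun (h : Hs) x => (fderiv ℝ w (x + h.1 • ee l) (ee i) - fderiv ℝ w x (ee i)) / h.1 := fun i => by
      refine dq_hf (g := fun x => fderiv ℝ w x (ee i)) hα hVr (hc.mono fun x hx => (fd_i hx _).1) ?_
      obtain ⟨C, hC, h⟩ := hH l i
      refine ⟨C, hC, ?_⟩
      filter_upwards [h, ev_near hc] with x h1 h2 _
      have e : ∀ y, ‖y - x‖ ≤ ‖x‖ / 2 → fderiv ℝ (fun x => fderiv ℝ w x (ee i)) y (ee l) = hess w y l i := fun y hy => by rw [(fd_i (h2 y hy) _).2, hess_apply]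
      have ex := e x (by simp; positivity)
      rw [ex]
      refine ⟨(h1 ()).1, fun y hy => ?_⟩
      rw [e y (by linarith [norm_nonneg x])]; exact (h1 ()).2 y hy
    choose C hC hq using hq
    obtain ⟨D, -, hD⟩ := hVr.nf n
    obtain ⟨C', hC', h⟩ := oscg hVr (w := fun (h : Hs) x => 0 + h.1⁻¹ * w (x + h.1 • ee l) + -h.1⁻¹ * w x) ⟨n * (∑ i, C i) + 1, by have := Finset.sum_nonneg (s := Finset.univ) fun i _ => (hC i).le; positivity, by
      filter_upwards [key, eventually_all.2 hq, hD] with x k1 k2 k3 h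
      refine ⟨(k1 h).1.differentiableAt (by norm_num), (fd_le (t := (∑ i, C i) * (V ‖x‖ * ‖x‖)) (mul_nonneg (Finset.sum_nonneg fun i _ => (hC i).le) k3.1.le) fun i => ?_).trans (by linarith [k3.1])⟩
      rw [(k1 h).2.1]
      exact (k2 i h).1.trans (mul_le_mul_of_nonneg_right (Finset.single_le_sum (fun i _ => (hC i).le) (Finset.mem_univ i)) k3.1.le)⟩
    refine ⟨C', hC', ?_⟩
    filter_upwards [h, hD] with x h1 h2 h y hy
    have := norm_nonneg x
    refine (h1 h y (by linarith)).trans ?_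
    rw [mul_assoc, sq, ← mul_assoc (V ‖x‖)]
    have := h2.1
    exact mul_le_mul_of_nonneg_left (mul_le_mul_of_nonneg_left (by linarith) this.le) hC'.le
  · filter_upwards [key, hE] with x k1 k2 h
    refine ⟨(k1 h).1, ?_⟩
    rw [(k1 h).2.2, pr_smul, k2 h, inv_mul_cancel_left₀ h.2.1]
  · obtain ⟨C, hC, hF⟩ := (HF.shift hα hVr (hH i j) _ he).sub ((hH i j).uni Hs)
    refine ⟨C, hC, ?_⟩
    filter_upwards [hF, ev_near key] with x h1 k1 h
    have e : ∀ y, ‖y - x‖ ≤ ‖x‖ / 2 → h.1 * hess (fun x => 0 + h.1⁻¹ * w (x + h.1 • ee l) + -h.1⁻¹ * w x) y i j = hess w (y + h.1 • ee l) i j - hess w y i j := fun y hy => by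
      rw [(k1 y hy h).2.2, Matrix.smul_apply, smul_eq_mul, mul_inv_cancel_left₀ h.2.1, Matrix.sub_apply]
    have ex := e x (by simp; positivity)
    simp only [ex]
    refine ⟨(h1 h).1, fun y hy => ?_⟩
    rw [e y (by linarith [norm_nonneg x])]; exact (h1 h).2 y hy
  · filter_upwards [hl, hc, key] with x l1 h1 k1
    refine ⟨(fd_i h1 _).1, fun v => ?_, l1⟩
    rw [(fd_i h1 _).2, h1.isSymmSndFDerivAt (by simp) v (ee l), ← (fd_i h1 v).2]
    exact (dq_lim (fd_i h1 v).1).congr fun h => ((k1 h).2.1 v).symm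
end
def HB {n : ℕ} (α : ℝ) : ℕ → (ℝ → ℝ) → (EV n → ℝ) → Prop
  | 0, W, w => HU α W w
  | k + 1, W, w => HU α W w ∧ (∀ᶠ x in nf n, DifferentiableAt ℝ w x) ∧ ∀ i, HB α k (fun r => W r / r) fun x => fderiv ℝ w x (ee i)
def mix {n : ℕ} (X Y : Mx n) (m : ℕ) : Mx n := fun k j => if k.1 < m then X k j else Y k j
noncomputable def cof {n : ℕ} (X Y : Mx n) : Mx n := fun i j => ((mix X Y i.1).updateRow i (Pi.single j 1)).det
section
variable {n : ℕ} {ι : Type} {α : ℝ} {V W : ℝ → ℝ}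
theorem cof_pr (X Y : Mx n) : pr (cof X Y) (X - Y) = X.det - Y.det := by
  have row : ∀ (B : Mx n) (i : Fin n) (b : Fin n → ℝ), ∑ j, (B.updateRow i (Pi.single j 1)).det * b j = (B.updateRow i b).det := fun B i b => by
    rw [Matrix.det_eq_sum_mul_adjugate_row _ i]
    refine Finset.sum_congr rfl fun j _ => ?_
    rw [Matrix.adjugate_apply, Matrix.updateRow_idem, Matrix.updateRow_self, mul_comm]
  have h1 : ∀ i : Fin n, ∑ j, cof X Y i j * (X - Y) i j = (mix X Y (i.1 + 1)).det - (mix X Y i.1).det := fun i => by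
    have e1 : (mix X Y i.1).updateRow i (X i) = mix X Y (i.1 + 1) := by
      ext k j
      by_cases hk : k = i
      · subst hk; simp [mix]
      · have : (k.1 < i.1 + 1) ↔ k.1 < i.1 := ⟨fun h => lt_of_le_of_ne (Nat.lt_succ_iff.1 h) fun h => hk (Fin.ext h), fun h => by omega⟩
        simp [mix, Matrix.updateRow_ne hk, this]
    have e2 : (mix X Y i.1).updateRow i (Y i) = mix X Y i.1 := by
      ext k j
      by_cases hk : k = i
      · subst hk; simp [mix]
      · simp [Matrix.updateRow_ne hk]
    simp only [Matrix.sub_apply, mul_sub, Finset.sum_sub_distrib, cof]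
    rw [row _ i (X i), row _ i (Y i), e1, e2]
  simp only [pr, h1]
  rw [Fin.sum_univ_eq_sum_range (fun i => (mix X Y (i + 1)).det - (mix X Y i).det) n, Finset.sum_range_sub fun i => (mix X Y i).det]
  congr 2 <;> ext k j <;> simp [mix]
theorem cof_self (X : Mx n) (i j : Fin n) : cof X X i j = X.adjugate j i := by
  rw [Matrix.adjugate_apply, cof]
  congr 2; ext k j; simp [mix]
theorem det_cl {T : Type} {Q : (T → ℝ) → ℝ → Prop} (hc : ∀ c, Q (fun _ => c) c) (ha : ∀ {f g c d}, Q f c → Q g d → Q (fun t => f t + g t) (c + d))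
    (hm : ∀ {f g c d}, Q f c → Q g d → Q (fun t => f t * g t) (c * d)) {X : T → Mx n} {M : Mx n} (hX : ∀ i j, Q (fun t => X t i j) (M i j)) : Q (fun t => (X t).det) M.det := by
  classical
  simp only [Matrix.det_apply']
  have hp : ∀ (s : Finset (Fin n)) (σ : Equiv.Perm (Fin n)), Q (fun t => ∏ i ∈ s, X t (σ i) i) (∏ i ∈ s, M (σ i) i) := fun s σ => by
    induction s using Finset.induction_on with
    | empty => simpa using hc 1
    | insert b s hb ih => simp only [Finset.prod_insert hb]; exact hm (hX _ _) ih
  have hs : ∀ s : Finset (Equiv.Perm (Fin n)), Q (fun t => ∑ σ ∈ s, ((Equiv.Perm.sign σ : ℤ) : ℝ) * ∏ i, X t (σ i) i) (∑ σ ∈ s, ((Equiv.Perm.sign σ : ℤ) : ℝ) * ∏ i, M (σ i) i) := fun s => by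
    induction s using Finset.induction_on with
    | empty => simpa using hc 0
    | insert b s hb ih => simp only [Finset.sum_insert hb]; exact ha (hm (hc _) (hp _ _)) ih
  exact hs _
theorem cof_cl {T : Type} {Q : (T → ℝ) → ℝ → Prop} (hc : ∀ c, Q (fun _ => c) c) (ha : ∀ {f g c d}, Q f c → Q g d → Q (fun t => f t + g t) (c + d))
    (hm : ∀ {f g c d}, Q f c → Q g d → Q (fun t => f t * g t) (c * d)) {X Y : T → Mx n} {M N : Mx n} (hX : ∀ i j, Q (fun t => X t i j) (M i j)) (hY : ∀ i j, Q (fun t => Y t i j) (N i j))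
    (i j : Fin n) : Q (fun t => cof (X t) (Y t) i j) (cof M N i j) := by
  refine det_cl hc ha hm fun k l => ?_
  by_cases hk : k = i
  · subst hk; simpa using hc _
  · simp only [Matrix.updateRow_ne hk, mix]
    split_ifs
    exacts [hX k l, hY k l]
theorem evn {p : EV n → Prop} (h : ∀ᶠ x in nf n, p x) : ∀ᶠ x in nf n, ∀ᶠ y in 𝓝 x, p y := by
  filter_upwards [ev_near h, ev_ge 1] with x hx h1
  filter_upwards [Metric.closedBall_mem_nhds x (by linarith : 0 < ‖x‖ / 2)] with y hy
  exact hx y (mem_closedBall_iff_norm.1 hy)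
theorem HF.congr {w z : ι → EV n → ℝ} (h : HF α W w) (e : ∀ᶠ x in nf n, ∀ i, w i x = z i x) : HF α W z := by
  obtain ⟨C, hC, h⟩ := h
  refine ⟨C, hC, ?_⟩
  filter_upwards [h, ev_near e] with x h1 h2 i
  rw [← h2 x (by simp; positivity) i]
  refine ⟨(h1 i).1, fun y hy => ?_⟩
  rw [← h2 y (by linarith [norm_nonneg x]) i]
  exact (h1 i).2 y hy
theorem fd_congr {w z : EV n → ℝ} (e : ∀ᶠ x in nf n, w x = z x) : ∀ᶠ x in nf n, (DifferentiableAt ℝ w x → DifferentiableAt ℝ z x) ∧ ∀ v, fderiv ℝ w x v = fderiv ℝ z x v := by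
  filter_upwards [evn e] with x hx
  exact ⟨fun h => h.congr_of_eventuallyEq (hx.mono fun y h => h.symm), fun v => by rw [EventuallyEq.fderiv_eq hx]⟩
theorem HB.congr {w z : EV n → ℝ} {k : ℕ} (h : HB α k W w) (e : ∀ᶠ x in nf n, w x = z x) : HB α k W z := by
  induction k generalizing W w z with
  | zero => exact HF.congr h (e.mono fun x hx _ => hx)
  | succ k ih =>
    have := fd_congr e
    exact ⟨HF.congr h.1 (e.mono fun x hx _ => hx), (h.2.1.and this).mono fun x hx => hx.2.1 hx.1, fun i => ih (h.2.2 i) (this.mono fun x hx => hx.2 _)⟩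
theorem HB.mono {w : EV n → ℝ} {k : ℕ} (h : HB α k W w) {K : ℝ} (hK : 0 < K) (hV : ∀ᶠ r in atTop, W r ≤ K * V r) : HB α k V w := by
  induction k generalizing W V w with
  | zero => exact HF.mono h hK hV
  | succ k ih =>
    refine ⟨h.1.mono hK hV, h.2.1, fun i => ih (h.2.2 i) ?_⟩
    filter_upwards [hV, eventually_gt_atTop 0] with r h1 h2
    rw [← mul_div_assoc]; gcongr
theorem HB.hu {w : EV n → ℝ} {k : ℕ} (h : HB α k W w) : HU α W w := by
  cases k with
  | zero => exact h
  | succ k => exact h.1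
theorem HB.le {w : EV n → ℝ} {k : ℕ} (h : HB α (k + 1) W w) : HB α k W w := by
  induction k generalizing W w with
  | zero => exact h.1
  | succ k ih => exact ⟨h.1, h.2.1, fun i => ih (h.2.2 i)⟩
theorem HB.add {w z : EV n → ℝ} {k : ℕ} (h : HB α k W w) (h' : HB α k W z) : HB α k W fun x => w x + z x := by
  induction k generalizing W w z with
  | zero => exact HF.add h h'
  | succ k ih =>
    have e := h.2.1.and h'.2.1
    exact ⟨h.1.add h'.1, e.mono fun x hx => hx.1.add hx.2, fun i => (ih (h.2.2 i) (h'.2.2 i)).congr (e.mono fun x hx => by rw [fderiv_fun_add hx.1 hx.2]; simp)⟩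
theorem HB.mul (hα : 0 < α) {w z : EV n → ℝ} {k : ℕ} (h : HB α k W w) (h' : HB α k V z) : HB α k (fun r => W r * V r) fun x => w x * z x := by
  induction k generalizing W V w z with
  | zero => exact HF.mul hα h h'
  | succ k ih =>
    have e := h.2.1.and h'.2.1
    refine ⟨h.1.mul hα h'.1, e.mono fun x hx => hx.1.mul hx.2, fun i => ?_⟩
    have h1 := ih h.le (h'.2.2 i)
    have h2 := ih (h.2.2 i) h'.le
    rw [show (fun r => W r * (V r / r)) = fun r => W r * V r / r by funext r; ring] at h1
    rw [show (fun r => W r / r * V r) = fun r => W r * V r / r by funext r; ring] at h2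
    exact (h1.add h2).congr (e.mono fun x hx => by rw [fderiv_fun_mul hx.1 hx.2]; simp [mul_comm])
theorem HB.zero (hW : DW W) (k : ℕ) : HB α k W fun _ : EV n => 0 := by
  induction k generalizing W with
  | zero => simpa [HB] using HF.sum (s := (∅ : Finset Unit)) (w := fun _ _ _ => 0) (α := α) (n := n) (ι := Unit) hW (by simp)
  | succ k ih => exact ⟨(ih hW).hu, by simp, fun i => by simpa using ih hW.div⟩
theorem HB.const (c : ℝ) (k : ℕ) : HB α k (fun _ => 1) fun _ : EV n => c := by
  cases k with
  | zero => exact HF.const c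
  | succ k => exact ⟨HF.const c, by simp, fun i => by simpa using HB.zero DW.one.div k⟩
theorem HB.cmul (hα : 0 < α) {w : EV n → ℝ} {k : ℕ} (h : HB α k W w) (c : ℝ) : HB α k W fun x => c * w x := by
  simpa using (HB.const c k).mul hα h
theorem HB.sum {β : Type} {w : β → EV n → ℝ} {s : Finset β} {k : ℕ} (hW : DW W) (h : ∀ b, HB α k W (w b)) : HB α k W fun x => ∑ b ∈ s, w b x := by
  classical
  induction s using Finset.induction_on with
  | empty => simpa using HB.zero hW k
  | insert b s hb ih => simp only [Finset.sum_insert hb]; exact (h b).add ih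
theorem osc_d (hV : DW V) {w : EV n → ℝ} (hc : ∀ᶠ x in nf n, DifferentiableAt ℝ w x) (h : ∀ i, ∃ C, 0 < C ∧ ∀ᶠ x in nf n, |fderiv ℝ w x (ee i)| ≤ C * V ‖x‖) :
    ∃ C, 0 < C ∧ ∀ᶠ x in nf n, DifferentiableAt ℝ w x ∧ ‖fderiv ℝ w x‖ ≤ C * V ‖x‖ := by
  choose C hC h using h
  obtain ⟨D, -, hD⟩ := hV.nf n
  refine ⟨n * (∑ i, C i) + 1, by have := Finset.sum_nonneg (s := Finset.univ) fun i _ => (hC i).le; positivity, ?_⟩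
  filter_upwards [hc, eventually_all.2 h, hD] with x k1 k2 k3
  refine ⟨k1, (fd_le (t := (∑ i, C i) * V ‖x‖) (mul_nonneg (Finset.sum_nonneg fun i _ => (hC i).le) k3.1.le) fun i => ?_).trans (by linarith [k3.1])⟩
  exact (k2 i).trans (mul_le_mul_of_nonneg_right (Finset.single_le_sum (fun i _ => (hC i).le) (Finset.mem_univ i)) k3.1.le)
theorem osc_t (hV : DW V) {w : EV n → ℝ} (h : ∃ C, 0 < C ∧ ∀ᶠ x in nf n, DifferentiableAt ℝ w x ∧ ‖fderiv ℝ w x‖ ≤ C * (V ‖x‖ * ‖x‖)) :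
    ∃ C, 0 < C ∧ ∀ᶠ x in nf n, ∀ _ : Unit, ∀ y, ‖y - x‖ ≤ ‖x‖ / 4 → |w y - w x| ≤ C * (V ‖x‖ * ‖x‖ ^ 2) := by
  obtain ⟨C, hC, h⟩ := oscg (hV.mul DW.id) (w := fun _ : Unit => w) (by obtain ⟨C, hC, h⟩ := h; exact ⟨C, hC, h.mono fun x hx _ => hx⟩)
  obtain ⟨D, -, hD⟩ := hV.nf n
  refine ⟨C, hC, ?_⟩
  filter_upwards [h, hD, ev_ge 1] with x h1 h2 hx _ y hy
  refine (h1 () y (by linarith)).trans ?_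
  have := h2.1
  rw [mul_assoc, sq, ← mul_assoc (V ‖x‖)]
  exact mul_le_mul_of_nonneg_left (mul_le_mul_of_nonneg_left (by linarith) (by positivity)) hC.le
theorem hess_fd {w : EV n → ℝ} {x : EV n} (h : ContDiffAt ℝ 2 w x) (i j : Fin n) : hess w x i j = fderiv ℝ (fun x => fderiv ℝ w x (ee j)) x (ee i) := by
  rw [(fd_i h _).2, hess_apply]
theorem T1 (hα : 0 < α) (hα1 : α < 1) {V' A1 : ℝ → ℝ} (hV : DW V) (hV' : DW V') (hA : DW A1) (hA0 : Tendsto A1 atTop (𝓝 0))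
    {w G : EV n → ℝ} {a : EV n → Mx n} (hE : ∀ᶠ x in nf n, ContDiffAt ℝ 2 w x ∧ pr (a x) (hess w x) = G x) (ha : ∀ i j, HU α A1 fun x => a x i j - (1 : Mx n) i j) (hG : HU α V G)
    (ho : ∃ C, 0 < C ∧ ∀ᶠ x in nf n, ∀ _ : Unit, ∀ y, ‖y - x‖ ≤ ‖x‖ / 4 → |w y - w x| ≤ C * (V ‖x‖ * ‖x‖ ^ 2)) (hP : ∀ i j, HU α V' fun x => hess w x i j) : ∀ i j, HU α V fun x => hess w x i j :=
  (T0 hα hα1 hV hV' hA hA0 (⊤ : Filter Unit) (s := fun _ => 1) (by simp) (w := fun _ => w) (G := fun _ => G) (a := fun _ => a) (w0 := w) (G0 := G) (a0 := a) ha hG ho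
    (hE.mono fun x hx _ => hx) (by simpa using hP) (hE.mono fun x hx => ⟨hx.1.differentiableAt (by norm_num), fun v => tendsto_const_nhds, fun i j => tendsto_const_nhds, tendsto_const_nhds⟩)).2
theorem TL (hα : 0 < α) (hα1 : α < 1) (k : ℕ) {V V' A1 : ℝ → ℝ} (hV : DW V) (hV' : DW V') (hA : DW A1) (hA0 : Tendsto A1 atTop (𝓝 0)) {w G : EV n → ℝ} {a : EV n → Mx n}
    (hE : ∀ᶠ x in nf n, ContDiffAt ℝ 2 w x ∧ pr (a x) (hess w x) = G x) (ha : ∀ i j, HU α A1 fun x => a x i j - (1 : Mx n) i j) (ha' : ∀ i j, HB α k (fun _ => 1) fun x => a x i j) (hG : HB α k V G)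
    (ho : ∃ C, 0 < C ∧ ∀ᶠ x in nf n, ∀ _ : Unit, ∀ y, ‖y - x‖ ≤ ‖x‖ / 4 → |w y - w x| ≤ C * (V ‖x‖ * ‖x‖ ^ 2)) (hP : ∀ i j, HU α V' fun x => hess w x i j) :
    ∀ i j, HB α k V fun x => hess w x i j := by
  have h0 := T1 hα hα1 hV hV' hA hA0 hE ha hG.hu ho hP
  induction k generalizing V V' w G with
  | zero => exact h0
  | succ k ih =>
    have ihw := ih hV hV' hE (fun i j => (ha' i j).le) hG.le ho hP h0
    have hc := hE.mono fun x hx => hx.1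
    have h0' : ∀ i j, HU α (fun r => V r / r * r) fun x => hess w x i j := fun i j => (h0 i j).mono one_pos (by
      filter_upwards [eventually_gt_atTop 0] with r hr
      rw [div_mul_cancel₀ _ hr.ne', one_mul])
    have wt : (fun r : ℝ => 1 / r * V r) = fun r => V r / r := by funext r; ring
    have st : ∀ l, (∀ᶠ x in nf n, ContDiffAt ℝ 2 (fun x => fderiv ℝ w x (ee l)) x) ∧ ∀ i j, HB α k (fun r => V r / r) fun x => hess (fun x => fderiv ℝ w x (ee l)) x i j := fun l => by
      have he : ∀ h : Hs, ‖h.1 • (ee l : EV n)‖ ≤ 1 := fun h => by rw [norm_smul, ee_n, mul_one]; exact h.2.2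
      obtain ⟨d1, d2⟩ := D1 (l := l) hα hα1 hV.div hA hA0 hc h0' (a := fun h x => a (x + h.1 • ee l)) (a0 := a)
        (G := fun h x => (G (x + h.1 • ee l) - G x) / h.1 - ∑ i, ∑ j, (a (x + h.1 • ee l) i j - a x i j) / h.1 * hess w x i j)
        (G0 := fun x => fderiv ℝ G x (ee l) - ∑ i, ∑ j, fderiv ℝ (fun x => a x i j) x (ee l) * hess w x i j)
        (fun i j => HF.shift hα hA (ha i j) _ he)
        ((dq_hf hα hV.div hG.2.1 (hG.2.2 l).hu).sub (HF.sum hV.div fun i _ => HF.sum hV.div fun j _ => by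
          have := (dq_hf hα DW.one.div (ha' i j).2.1 ((ha' i j).2.2 l).hu).mul hα ((h0 i j).uni Hs)
          rwa [wt] at this))
        (by
          filter_upwards [ev_near hE, ev_ge 2] with x h1 hx h
          have e1 := (h1 (x + h.1 • ee l) (by rw [add_sub_cancel_left]; linarith [he h])).2
          have e2 := (h1 x (by simp; positivity)).2
          have e3 : ∑ i, ∑ j, (a (x + h.1 • ee l) i j - a x i j) / h.1 * hess w x i j = (pr (a (x + h.1 • ee l)) (hess w x) - G x) / h.1 := by
            rw [← e2]
            simp only [pr, ← Finset.sum_sub_distrib, Finset.sum_div]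
            exact Finset.sum_congr rfl fun i _ => Finset.sum_congr rfl fun j _ => by ring
          rw [pr_sub, e1, e3, mul_sub, mul_div_cancel₀ _ h.2.1, mul_div_cancel₀ _ h.2.1]; ring)
        (by
          filter_upwards [eventually_all.2 fun i => eventually_all.2 fun j => (ha' i j).2.1, hG.2.1] with x h1 h2
          exact ⟨fun i j => tend_sh (h1 i j).continuousAt, (dq_lim h2).sub (tendsto_finsetSum _ fun i _ => tendsto_finsetSum _ fun j _ => (dq_lim (h1 i j)).mul_const _)⟩)
      refine ⟨d1.mono fun x hx => hx.1, ih hV.div hV.div d1 (fun i j => (ha' i j).le) ?_ ?_ d2 d2⟩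
      · have hs : HB α k (fun r => V r / r) fun x => ∑ i, ∑ j, fderiv ℝ (fun x => a x i j) x (ee l) * hess w x i j := HB.sum hV.div fun i => HB.sum hV.div fun j => by
          have := ((ha' i j).2.2 l).mul hα (ihw i j)
          rwa [wt] at this
        refine ((hG.2.2 l).add (hs.cmul hα (-1))).congr (Eventually.of_forall fun x => by ring)
      · refine osc_t hV.div ?_
        refine osc_d (hV.div.mul DW.id) (d1.mono fun x hx => hx.1.differentiableAt (by norm_num)) fun i => ?_
        obtain ⟨C, hC, h⟩ := h0' i l
        refine ⟨C, hC, ?_⟩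
        filter_upwards [h, hc] with x h1 h2
        rw [← hess_fd h2]; exact (h1 ()).1
    intro i j
    have e : ∀ᶠ x in nf n, fderiv ℝ (fun x => fderiv ℝ w x (ee j)) x (ee i) = hess w x i j := hc.mono fun x hx => (hess_fd hx i j).symm
    refine ⟨h0 i j, ?_, fun l => ?_⟩
    · filter_upwards [(st j).1, fd_congr e] with x h1 h2
      exact h2.1 (fd_i h1 _).1
    · refine ((st j).2 l i).congr ?_
      filter_upwards [(st j).1, fd_congr e] with x h1 h2
      rw [hess_fd h1, h2.2]
end
noncomputable def cA {n : ℕ} (M1 M2 X Y : Mx n) (g : ℝ) : Mx n := fun i j => M1.det⁻¹ * (cof (X + M1) (Y + M1) i j + -1 * (g * cof (X + M2) (Y + M2) i j))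
structure NE {n : ℕ} (M1 M2 : Mx n) (c : ℝ) (E g : EV n → ℝ) : Prop where
  nd : M1.det ≠ 0
  ci : M1.det = c * M2.det
  nz : cA M1 M2 0 0 c = 1
  cd : ∀ᶠ x in nf n, ContDiffAt ℝ 2 E x
  eq : ∀ᶠ x in nf n, (hess E x + M1).det = g x * (hess E x + M2).det
section
variable {n : ℕ} {ι : Type} {α c : ℝ} {V W A1 : ℝ → ℝ} {M1 M2 : Mx n} {E g : EV n → ℝ}
theorem cA_pr (X Y : Mx n) (g : ℝ) : pr (cA M1 M2 X Y g) (X - Y) = M1.det⁻¹ * ((X + M1).det - (Y + M1).det - g * ((X + M2).det - (Y + M2).det)) := by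
  rw [← cof_pr, ← cof_pr, add_sub_add_right_eq_sub, add_sub_add_right_eq_sub]
  simp only [pr, Finset.mul_sum, ← Finset.sum_sub_distrib, cA]
  exact Finset.sum_congr rfl fun i _ => Finset.sum_congr rfl fun j _ => by ring
theorem cA_cl {T : Type} {Q : (T → ℝ) → ℝ → Prop} (hc : ∀ c, Q (fun _ => c) c) (ha : ∀ {f g c d}, Q f c → Q g d → Q (fun t => f t + g t) (c + d))
    (hm : ∀ {f g c d}, Q f c → Q g d → Q (fun t => f t * g t) (c * d)) {X Y : T → Mx n} {g : T → ℝ} {M N : Mx n} {c : ℝ} (hX : ∀ i j, Q (fun t => X t i j) (M i j)) (hY : ∀ i j, Q (fun t => Y t i j) (N i j))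
    (hg : Q g c) (i j : Fin n) : Q (fun t => cA M1 M2 (X t) (Y t) (g t) i j) (cA M1 M2 M N c i j) :=
  hm (hc _) (ha (cof_cl hc ha hm (fun i j => ha (hX i j) (hc _)) (fun i j => ha (hY i j) (hc _)) i j)
    (hm (hc (-1)) (hm hg (cof_cl hc ha hm (fun i j => ha (hX i j) (hc _)) (fun i j => ha (hY i j) (hc _)) i j))))
theorem cA_hf (hα : 0 < α) (hA : DW A1) (hA0 : Tendsto A1 atTop (𝓝 0)) (h : NE M1 M2 c E g) {X Y : ι → EV n → Mx n} {q : ι → EV n → ℝ} (hX : ∀ i j, HF α A1 fun h x => X h x i j) (hY : ∀ i j, HF α A1 fun h x => Y h x i j)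
    (hq : HF α A1 fun h x => q h x - c) (i j : Fin n) : HF α A1 fun k x => cA M1 M2 (X k x) (Y k x) (q k x) i j - (1 : Mx n) i j := by
  have key := cA_cl (M1 := M1) (M2 := M2) (T := ι × EV n) (Q := fun f c => HF α A1 fun h x => f (h, x) - c) (X := fun t => X t.1 t.2) (Y := fun t => Y t.1 t.2) (g := fun t => q t.1 t.2) (M := 0) (N := 0) (c := c)
    (fun c => by simpa using HF.sum (s := (∅ : Finset Unit)) (w := fun _ _ _ => 0) (α := α) (n := n) (ι := ι) hA (by simp))
    (fun {f g c d} h1 h2 => (h1.add h2).congr (Eventually.of_forall fun x i => by ring))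
    (fun {f g c d} h1 h2 => by
      have h3 := (h1.mul hα h2).mono (V := A1) one_pos (by
        obtain ⟨D, -, hD⟩ := hA
        filter_upwards [hA0.eventually_le_const one_pos, hD] with r h1 h2
        rw [one_mul]; exact mul_le_of_le_one_left h2.1.le h1)
      exact ((h3.add (h2.cmul c)).add (h1.cmul d)).congr (Eventually.of_forall fun x i => by ring))
    (by simpa using hX) (by simpa using hY) hq i j
  rwa [h.nz] at key
theorem cA_hb (hα : 0 < α) {k : ℕ} {X : EV n → Mx n} (hX : ∀ i j, HB α k (fun _ => 1) fun x => X x i j) (hg : HB α k (fun _ => 1) g) :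
    (∀ i j, HB α k (fun _ => 1) fun x => cA M1 M2 (X x) (X x) (g x) i j) ∧ HB α k (fun _ => 1) fun x => (X x + M2).det := by
  have hm : ∀ {f g : EV n → ℝ} {c d : ℝ}, HB α k (fun _ => 1) f → HB α k (fun _ => 1) g → HB α k (fun _ => 1) fun t => f t * g t := fun h1 h2 => by simpa using h1.mul hα h2
  exact ⟨cA_cl (Q := fun f _ => HB α k (fun _ => 1) f) (M := 0) (N := 0) (c := 0) (fun c => HB.const c k) (fun h1 h2 => h1.add h2) (fun {_ _ c d} => hm (c := c) (d := d)) hX hX hg,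
    det_cl (Q := fun f _ => HB α k (fun _ => 1) f) (M := 0) (fun c => HB.const c k) (fun h1 h2 => h1.add h2) (fun {_ _ c d} => hm (c := c) (d := d)) fun i j => (hX i j).add (HB.const _ k)⟩
theorem NE.lin (h : NE M1 M2 c E g) : ∀ᶠ x in nf n, pr (cA M1 M2 (hess E x) 0 (g x)) (hess E x) = M1.det⁻¹ * M2.det * (g x - c) := by
  filter_upwards [h.eq] with x hx
  have := cA_pr (M1 := M1) (M2 := M2) (hess E x) 0 (g x)
  rw [sub_zero, hx, zero_add, zero_add] at this
  rw [this, h.ci]; ring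
theorem hess_ct {x : EV n} (h : ContDiffAt ℝ 2 E x) (i j : Fin n) : ContinuousAt (fun x => hess E x i j) x := by
  have h1 : ContinuousAt (fderiv ℝ (fderiv ℝ E)) x := ((h.fderiv_right (m := 1) (by norm_num)).fderiv_right (m := 0) (by norm_num)).continuousAt
  simp only [hess_apply]
  exact (h1.clm_apply continuousAt_const).clm_apply continuousAt_const
theorem NE.der (hα : 0 < α) (hα1 : α < 1) (hV : DW V) (hA : DW A1) (hA0 : Tendsto A1 atTop (𝓝 0)) (h : NE M1 M2 c E g) (hP : ∀ i j, HU α A1 fun x => hess E x i j)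
    (hP' : ∀ i j, HU α (fun r => V r * r) fun x => hess E x i j) (hg : HU α A1 fun x => g x - c) (hd : ∀ᶠ x in nf n, DifferentiableAt ℝ g x) (l : Fin n) (hgl : HU α V fun x => fderiv ℝ g x (ee l)) :
    (∀ᶠ x in nf n, ContDiffAt ℝ 2 (fun x => fderiv ℝ E x (ee l)) x ∧ pr (cA M1 M2 (hess E x) (hess E x) (g x)) (hess (fun x => fderiv ℝ E x (ee l)) x) = M1.det⁻¹ * (fderiv ℝ g x (ee l) * (hess E x + M2).det)) ∧
      ∀ i j, HU α V fun x => hess (fun x => fderiv ℝ E x (ee l)) x i j := by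
  have he : ∀ h : Hs, ‖h.1 • (ee l : EV n)‖ ≤ 1 := fun h => by rw [norm_smul, ee_n, mul_one]; exact h.2.2
  have hA1 : ∀ᶠ r in atTop, A1 r ≤ 1 * 1 := by simpa using hA0.eventually_le_const one_pos
  have hdet := (cA_hb (M1 := M1) (M2 := M2) (k := 0) (X := hess E) hα (fun i j => (hP i j).mono one_pos hA1) ((HF.add (hg.mono one_pos hA1) (HF.const c)).congr (z := fun _ => g) (by simp))).2
  refine D1 (a := fun h x => cA M1 M2 (hess E (x + h.1 • ee l)) (hess E x) (g (x + h.1 • ee l))) (G := fun h x => M1.det⁻¹ * ((g (x + h.1 • ee l) - g x) / h.1 * (hess E x + M2).det))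
    hα hα1 hV hA hA0 h.cd hP' (cA_hf hα hA hA0 h (fun i j => HF.shift hα hA (hP i j) _ he) (fun i j => (hP i j).uni Hs) (HF.shift hα hA hg _ he)) ?_ ?_ ?_
  · have := (dq_hf hα hV hd hgl).mul hα (HF.uni (HB.hu hdet) Hs)
    simp only [mul_one] at this
    exact this.cmul _
  · filter_upwards [ev_near h.eq, ev_ge 2] with x h1 hx h
    rw [cA_pr, h1 (x + h.1 • ee l) (by rw [add_sub_cancel_left]; linarith [he h]), h1 x (by simp; positivity)]
    have := h.2.1
    field_simp; ring
  · filter_upwards [h.cd, hd] with x h1 h2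
    exact ⟨cA_cl (Q := fun f c => Tendsto f FH (𝓝 c)) (fun c => tendsto_const_nhds) (fun h1 h2 => h1.add h2) (fun h1 h2 => h1.mul h2) (fun i j => tend_sh (hess_ct h1 i j)) (fun i j => tendsto_const_nhds) (tend_sh h2.continuousAt),
      ((dq_lim h2).mul_const _).const_mul _⟩
end
def IT {n : ℕ} (W : ℝ → ℝ) (k : ℕ) (w : EV n → ℝ) : Prop := ∃ C, 0 < C ∧ ∀ᶠ x in nf n, ContDiffAt ℝ k w x ∧ ‖iteratedFDeriv ℝ k w x‖ ≤ C * (W ‖x‖ / ‖x‖ ^ k)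
section
variable {n : ℕ} {α : ℝ} {W : ℝ → ℝ} {w : EV n → ℝ}
theorem DW.far (h : DW W) (j : ℕ) : ∃ D, 0 < D ∧ ∀ᶠ r in atTop, ∀ t, r / 2 ^ j ≤ t → t ≤ 2 ^ j * r → W t ≤ D * W r := by
  induction j with
  | zero => exact ⟨1, one_pos, Eventually.of_forall fun r t h1 h2 => by rw [show t = r by simp at h1 h2; linarith]; simp⟩
  | succ j ih =>
    obtain ⟨D0, hD0, h⟩ := h
    obtain ⟨D, hD, ih⟩ := ih
    obtain ⟨R, hR⟩ := eventually_atTop.1 h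
    refine ⟨D + D0 * D, by positivity, ?_⟩
    filter_upwards [ih, eventually_ge_atTop (2 ^ j * |R|), eventually_ge_atTop R, eventually_gt_atTop 0] with r ih h1 h0 hr t h2 h3
    have hW := (hR r h0).1
    have e1 : r / 2 ^ j ≤ 2 ^ j * r := by
      rw [div_le_iff₀ (by positivity)]
      have : (1:ℝ) ≤ 2 ^ j := one_le_pow₀ (by norm_num)
      nlinarith [mul_le_mul this this (by norm_num) (by positivity)]
    have key : ∀ s, R ≤ s → r / 2 ^ j ≤ s → s ≤ 2 ^ j * r → s / 2 ≤ t → t ≤ 2 * s → W t ≤ (D + D0 * D) * W r := fun s hs a1 a2 a3 a4 => by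
      have b1 := (hR s hs).2 t a3 a4
      have b2 := mul_le_mul_of_nonneg_left (ih s a1 a2) hD0.le
      have : 0 < D * W r := by positivity
      linarith
    have e2 : R ≤ r / 2 ^ j := by rw [le_div_iff₀ (by positivity), mul_comm]; exact (mul_le_mul_of_nonneg_left (le_abs_self R) (by positivity)).trans h1
    rw [pow_succ] at h2 h3
    rw [← div_div] at h2
    rcases le_total t (r / 2 ^ j) with h4 | h4
    · exact key _ e2 le_rfl e1 h2 (by linarith [e1, div_pos hr (pow_pos two_pos j : (0:ℝ) < 2 ^ j)])
    · rcases le_total t (2 ^ j * r) with h5 | h5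
      · have := ih t h4 h5
        have : 0 < D0 * D * W r := by positivity
        linarith
      · exact key _ (e2.trans e1) e1 le_rfl (by linarith [mul_pos (pow_pos two_pos j : (0:ℝ) < 2 ^ j) hr]) (by linarith)
theorem IT.comp (hW : DW W) {k : ℕ} (h : IT W k w) (L : EV n ≃L[ℝ] EV n) : IT W k fun x => w (L x) := by
  obtain ⟨C, hC, h⟩ := h
  obtain ⟨K, hK⟩ : ∃ K, K = ‖(L : EV n →L[ℝ] EV n)‖ + ‖(L.symm : EV n →L[ℝ] EV n)‖ := ⟨_, rfl⟩
  have n1 := norm_nonneg (L : EV n →L[ℝ] EV n)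
  have n2 := norm_nonneg (L.symm : EV n →L[ℝ] EV n)
  obtain ⟨j, hj⟩ := pow_unbounded_of_one_lt K (one_lt_two)
  obtain ⟨D, hD, hD'⟩ := hW.far j
  have a1 : ∀ x, ‖L x‖ ≤ 2 ^ j * ‖x‖ := fun x => ((L : EV n →L[ℝ] EV n).le_opNorm x).trans (mul_le_mul_of_nonneg_right (by linarith) (norm_nonneg x))
  have a2 : ∀ x, ‖x‖ / 2 ^ j ≤ ‖L x‖ := fun x => by
    rw [div_le_iff₀ (by positivity), mul_comm]
    have := (L.symm : EV n →L[ℝ] EV n).le_opNorm (L x)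
    simp only [ContinuousLinearEquiv.coe_coe, L.symm_apply_apply] at this
    exact this.trans (mul_le_mul_of_nonneg_right (by linarith) (norm_nonneg _))
  obtain ⟨R, hR⟩ := evi.1 h
  have hK0 : 0 < K + 1 := by linarith
  refine ⟨C * D * (2 ^ j) ^ k * (K + 1) ^ k, by positivity, ?_⟩
  filter_upwards [nf_norm.eventually hD', ev_ge (2 ^ j * R), ev_ge 1] with x h1 h2 h3
  obtain ⟨h4, h5⟩ := hR (L x) ((by rw [le_div_iff₀ (by positivity)]; linarith : R ≤ ‖x‖ / 2 ^ j).trans (a2 x))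
  refine ⟨h4.comp x L.contDiff.contDiffAt, ?_⟩
  have e := L.iteratedFDerivWithin_comp_right w uniqueDiffOn_univ (Set.mem_univ (L x)) k
  rw [Set.preimage_univ, iteratedFDerivWithin_univ, iteratedFDerivWithin_univ] at e
  change ‖iteratedFDeriv ℝ k (w ∘ L) x‖ ≤ _
  rw [e]
  refine (ContinuousMultilinearMap.norm_compContinuousLinearMap_le _ _).trans ?_
  rw [Finset.prod_const, Finset.card_univ, Fintype.card_fin]
  have p1 : 0 < ‖x‖ / 2 ^ j := by positivity
  have b1 : W ‖L x‖ / ‖L x‖ ^ k ≤ D * W ‖x‖ / (‖x‖ / 2 ^ j) ^ k := by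
    have w1 := h1 _ (a2 x) (a1 x)
    have w2 : 0 ≤ W ‖L x‖ := by
      have p2 : 0 < C * (1 / ‖L x‖ ^ k) := by have := p1.trans_le (a2 x); positivity
      refine le_of_mul_le_mul_left ?_ p2
      rw [mul_zero]
      refine (norm_nonneg _).trans (h5.trans_eq (by ring))
    exact div_le_div₀ (w2.trans w1) w1 (by positivity) (pow_le_pow_left₀ p1.le (a2 x) k)
  have b2 : ‖(L : EV n →L[ℝ] EV n)‖ ^ k ≤ (K + 1) ^ k := pow_le_pow_left₀ n1 (by linarith) k
  refine (mul_le_mul (h5.trans (mul_le_mul_of_nonneg_left b1 hC.le)) b2 (by positivity) ?_).trans_eq (by rw [div_pow]; field_simp)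
  exact (norm_nonneg _).trans (h5.trans (mul_le_mul_of_nonneg_left b1 hC.le))
theorem IT.fd {k : ℕ} (h : IT W (k + 1) w) (v : EV n) : IT (fun r => W r / r) k fun x => fderiv ℝ w x v := by
  obtain ⟨C, hC, h⟩ := h
  refine ⟨(‖v‖ + 1) * C, by positivity, ?_⟩
  filter_upwards [h, ev_ge 1] with x h1 h2
  have h3 : ContDiffAt ℝ k (fderiv ℝ w) x := h1.1.fderiv_right (by norm_cast)
  refine ⟨h3.clm_apply contDiffAt_const, (norm_iteratedFDeriv_clm_apply_const h3 le_rfl).trans ?_⟩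
  rw [norm_iteratedFDeriv_fderiv, mul_assoc, div_div, ← pow_succ']
  exact mul_le_mul (by linarith) h1.2 (norm_nonneg _) (by positivity)
theorem IT.hu (hα : 0 < α) (hα1 : α < 1) (hW : DW W) (h0 : IT W 0 w) (h1 : IT W 1 w) : HU α W w := by
  obtain ⟨C, hC, h⟩ := h1
  obtain ⟨C', -, h'⟩ := h0
  exact hu_g hα hα1 hW ⟨C', h'.mono fun x hx => by simpa using hx.2⟩ ⟨C, hC, h.mono fun x hx => ⟨hx.1.differentiableAt (by norm_num), by simpa [norm_iteratedFDeriv_one] using hx.2⟩⟩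
theorem IT.hb (hα : 0 < α) (hα1 : α < 1) (hW : DW W) {k : ℕ} (h : ∀ j ≤ k + 1, IT W j w) : HB α k W w := by
  induction k generalizing W w with
  | zero => exact (h 0 (by omega)).hu hα hα1 hW (h 1 le_rfl)
  | succ k ih =>
    refine ⟨(h 0 (by omega)).hu hα hα1 hW (h 1 (by omega)), ?_, fun i => ih hW.div fun j hj => IT.fd (h (j + 1) (by omega)) _⟩
    obtain ⟨C, hC, h⟩ := h 1 (by omega)
    exact h.mono fun x hx => hx.1.differentiableAt (by norm_num)
theorem HB.it (hα : 0 < α) {k : ℕ} (h : HB α k W w) : IT W k w := by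
  induction k generalizing W w with
  | zero =>
    obtain ⟨C, hC, h⟩ := h
    have hc : ∀ᶠ x in nf n, ContinuousAt w x := by
      filter_upwards [h, ev_ge 1] with x hx h1
      have t : Tendsto (fun y => C * W ‖x‖ * (‖y - x‖ / ‖x‖) ^ α) (𝓝 x) (𝓝 0) := by
        have : ContinuousAt (fun y : EV n => C * W ‖x‖ * (‖y - x‖ / ‖x‖) ^ α) x := by
          refine continuousAt_const.mul (ContinuousAt.rpow_const (by fun_prop) (Or.inr hα.le))
        simpa [ContinuousAt, Real.zero_rpow hα.ne'] using this
      rw [ContinuousAt, tendsto_iff_norm_sub_tendsto_zero]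
      refine squeeze_zero' (Eventually.of_forall fun y => norm_nonneg _) ?_ t
      filter_upwards [Metric.closedBall_mem_nhds x (by linarith : 0 < ‖x‖ / 4)] with y hy
      exact (hx ()).2 y (mem_closedBall_iff_norm.1 hy)
    refine ⟨C, hC, ?_⟩
    filter_upwards [h, evn hc] with x h1 h2
    exact ⟨contDiffAt_zero.2 ⟨_, h2, fun y hy => ContinuousAt.continuousWithinAt hy⟩, by simpa using (h1 ()).1⟩
  | succ k ih =>
    choose C hC h3 using fun i => ih (h.2.2 i)
    refine ⟨∑ i, ‖(EuclideanSpace.proj i : EV n →L[ℝ] ℝ)‖ * C i + 1, add_pos_of_nonneg_of_pos (Finset.sum_nonneg fun i _ => mul_nonneg (norm_nonneg _) (hC i).le) one_pos, ?_⟩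
    obtain ⟨C0, hC0, hw⟩ := h.hu
    filter_upwards [eventually_all.2 h3, evn h.2.1, ev_ge 1, hw] with x h3 h4 h5 hw
    have e : fderiv ℝ w = fun y => ∑ i, (ContinuousLinearMap.toSpanSingleton ℝ (EuclideanSpace.proj i : EV n →L[ℝ] ℝ)) (fderiv ℝ w y (ee i)) := by
      funext y; ext ξ
      conv_lhs => rw [sum_ee ξ, map_sum]
      simp [ContinuousLinearMap.sum_apply, mul_comm]
    have hk : ∀ i, ContDiffAt ℝ k (fun y => (ContinuousLinearMap.toSpanSingleton ℝ (EuclideanSpace.proj i : EV n →L[ℝ] ℝ)) (fderiv ℝ w y (ee i))) x := fun i =>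
      (ContinuousLinearMap.contDiff _).contDiffAt.comp x (h3 i).1
    have hc : ContDiffAt ℝ k (fderiv ℝ w) x := by
      rw [e]; exact ContDiffAt.sum fun i _ => hk i
    refine ⟨contDiffAt_succ_iff_hasFDerivAt.2 ⟨fderiv ℝ w, ⟨_, h4, fun y hy => DifferentiableAt.hasFDerivAt hy⟩, hc⟩, ?_⟩
    rw [← norm_iteratedFDeriv_fderiv, e, iteratedFDeriv_fun_sum_apply fun i _ => hk i]
    have hW0 : 0 ≤ W ‖x‖ := nonneg_of_mul_nonneg_right ((abs_nonneg _).trans (hw ()).1) hC0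
    have : 0 ≤ W ‖x‖ / ‖x‖ ^ (k + 1) := by positivity
    refine (norm_sum_le _ _).trans ?_
    rw [add_mul, Finset.sum_mul]
    refine (Finset.sum_le_sum fun i _ => ?_).trans (le_add_of_nonneg_right (by linarith))
    refine ((ContinuousLinearMap.toSpanSingleton ℝ (EuclideanSpace.proj i : EV n →L[ℝ] ℝ)).norm_iteratedFDeriv_comp_left (h3 i).1 le_rfl).trans ?_
    rw [ContinuousLinearMap.norm_toSpanSingleton, mul_assoc, pow_succ', ← div_div]
    exact mul_le_mul_of_nonneg_left (h3 i).2 (norm_nonneg _)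
end
section
variable {n : ℕ} {α : ℝ} {V : ℝ → ℝ} {φ : EV n → ℝ}
theorem exp_d : ∀ᶠ x in nf n, DifferentiableAt ℝ φ x → DifferentiableAt ℝ (fun x => rexp (φ x)) x ∧ ∀ v, fderiv ℝ (fun x => rexp (φ x)) x v = rexp (φ x) * fderiv ℝ φ x v :=
  Eventually.of_forall fun x h => ⟨h.exp, fun v => by rw [fderiv_exp h]; simp⟩
theorem exp_hu (hα : 0 < α) (hα1 : α < 1) (hV : DW V) (h0 : Tendsto V atTop (𝓝 0)) {k : ℕ} (h : HB α (k + 1) V φ) : HU α V fun x => rexp (φ x) - 1 := by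
  obtain ⟨C, hC, h1⟩ := h.1
  obtain ⟨C', hC', h2⟩ := osc_d hV.div h.2.1 fun i => by
    obtain ⟨C, hC, h⟩ := (h.2.2 i).hu
    exact ⟨C, hC, h.mono fun x hx => (hx ()).1⟩
  have hs : ∀ᶠ x in nf n, |φ x| ≤ 1 := by
    filter_upwards [h1, nf_norm.eventually (h0.eventually_le_const (by positivity : 0 < 1 / C))] with x h1 h2
    exact (h1 ()).1.trans ((mul_le_mul_of_nonneg_left h2 hC.le).trans_eq (by field_simp))
  refine hu_g hα hα1 hV ⟨2 * C, ?_⟩ ⟨rexp 1 * C', by positivity, ?_⟩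
  · filter_upwards [h1, hs] with x h1 h2
    have := Real.abs_exp_sub_one_le h2
    linarith [(h1 ()).1]
  · filter_upwards [h2, hs] with x h2 h3
    refine ⟨h2.1.exp.sub_const 1, ?_⟩
    rw [fderiv_sub_const, fderiv_exp h2.1, norm_smul, Real.norm_eq_abs, Real.abs_exp, mul_assoc]
    exact mul_le_mul (Real.exp_le_exp.2 ((le_abs_self _).trans h3)) h2.2 (norm_nonneg _) (by positivity)
theorem exp_hb (hα : 0 < α) (hα1 : α < 1) (hV : DW V) (h0 : Tendsto V atTop (𝓝 0)) {k : ℕ} (h : HB α (k + 1) V φ) :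
    HB α k (fun _ => 1) (fun x => rexp (φ x)) ∧ ∀ i, HB α k (fun r => V r / r) fun x => fderiv ℝ (fun x => rexp (φ x)) x (ee i) := by
  have hV1 : ∀ᶠ r in atTop, V r ≤ 1 * 1 := by simpa using h0.eventually_le_const one_pos
  have hu : HU α (fun _ => 1) fun x => rexp (φ x) := (((exp_hu hα hα1 hV h0 h).mono one_pos hV1).add (HF.const 1)).congr (by simp)
  have hd : ∀ i, HB α k (fun _ => 1) (fun x => rexp (φ x)) → HB α k (fun r => V r / r) fun x => fderiv ℝ (fun x => rexp (φ x)) x (ee i) := fun i h1 => by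
    have := (h1.mul hα (h.2.2 i)).congr (z := fun x => fderiv ℝ (fun x => rexp (φ x)) x (ee i)) (by
      filter_upwards [exp_d (φ := φ), h.2.1] with x h1 h2
      exact ((h1 h2).2 _).symm)
    simpa using this
  refine ⟨?_, fun i => hd i ?_⟩ <;> clear hd
  all_goals
    induction k with
    | zero => exact hu
    | succ k ih =>
      have h1 := ih h.le
      refine ⟨hu, by filter_upwards [exp_d (φ := φ), h.2.1] with x h1 h2 using (h1 h2).1, fun i => ?_⟩
      have := ((h1.mul hα (h.2.2 i).le).congr (z := fun x => fderiv ℝ (fun x => rexp (φ x)) x (ee i)) (by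
        filter_upwards [exp_d (φ := φ), h.2.1] with x h1 h2
        exact ((h1 h2).2 _).symm))
      refine this.mono one_pos ?_
      filter_upwards [hV1, eventually_gt_atTop 0] with r hr h0
      rw [one_mul, one_mul]; gcongr; linarith
theorem gside (hα : 0 < α) (hα1 : α < 1) {f : EV n → ℝ} {finf ζ C R : ℝ} {m : ℕ} (hf : FP f finf ζ C R (m + 2)) (hζ : 0 < ζ) (L : EV n ≃L[ℝ] EV n) (K : ℝ) {g : EV n → ℝ} (hg : g = fun x => rexp (K * f (L x))) :
    HB α m (fun _ => 1) g ∧ (HU α (fun r => r ^ (-ζ)) fun x => g x - rexp (K * finf)) ∧ (∀ᶠ x in nf n, DifferentiableAt ℝ g x) ∧ ∀ l, HB α m (fun r => r ^ (-ζ) / r) fun x => fderiv ℝ g x (ee l) := by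
  have h1 : ∀ j ≤ m + 2, IT (fun r => r ^ (-ζ)) j fun x => f x - finf := fun j hj => by
    refine ⟨C, by linarith [hf.C1], ?_⟩
    filter_upwards [ev_ge R, ev_ge 1] with x hx h1
    refine ⟨((hf.cd x hx).of_le (by exact_mod_cast hj)).sub contDiffAt_const, ?_⟩
    rw [← Real.rpow_sub_natCast (by positivity)]
    exact hf.itd x hx j hj
  have h2 : HB α (m + 1) (fun r => r ^ (-ζ)) fun x => K * (f (L x) - finf) := (IT.hb hα hα1 (DW.pow _) fun j hj => (h1 j hj).comp (DW.pow _) L).cmul hα K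
  have h0 := tendsto_rpow_neg_atTop hζ
  have e : g = fun x => rexp (K * finf) * rexp (K * (f (L x) - finf)) := by
    rw [hg]; funext x; rw [← Real.exp_add]; congr 1; ring
  obtain ⟨h3, h4⟩ := exp_hb hα hα1 (DW.pow _) h0 h2
  have h5 : ∀ᶠ x in nf n, DifferentiableAt ℝ (fun x => rexp (K * (f (L x) - finf))) x := by
    filter_upwards [exp_d, h2.2.1] with x h1 h2 using (h1 h2).1
  rw [e]
  refine ⟨h3.cmul hα _, ((exp_hu hα hα1 (DW.pow _) h0 h2).cmul (rexp (K * finf))).congr (Eventually.of_forall fun x _ => by ring), h5.mono fun x hx => hx.const_mul _, fun l => ((h4 l).cmul hα (rexp (K * finf))).congr ?_⟩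
  filter_upwards [h5] with x hx
  rw [fderiv_const_mul hx]; rfl
end
section
variable {n : ℕ} {w : EV n → ℝ} {s R C : ℝ}
theorem lapb (hn : 3 ≤ n) (hs : 0 < s) (hs1 : s < 1) {x : EV n} (hx : x ≠ 0) : pr 1 (hess (fun y : EV n => (‖y - 0‖ ^ 2) ^ (-s / 2)) x) ≤ -(s * (1 - s)) * ‖x‖ ^ (-s - 2) := by
  refine ((rbar hs hx).2.2.2 1 0 (by simp)).trans ?_
  have h3 : (3:ℝ) ≤ n := by exact_mod_cast hn
  refine mul_le_mul_of_nonneg_right ?_ (by positivity)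
  have := mul_le_mul_of_nonneg_left (by linarith : 1 - s ≤ n - 2 - s) hs.le
  linarith
theorem liou_c (hn : 3 ≤ n) (hs : 0 < s) (hs1 : s < 1) (hR : 1 ≤ R) (hw : ∀ x, R ≤ ‖x‖ → ContDiffAt ℝ 2 w x ∧ |(hess w x).trace| ≤ C * ‖x‖ ^ (-s - 2))
    (hS : ∀ x y, R ≤ ‖x‖ → ‖x‖ = ‖y‖ → w x - w y ≤ C * ‖x‖ ^ (-s)) : ∃ N, ∀ x y, 2 * R ≤ ‖x‖ → ‖x‖ ≤ ‖y‖ → w y - w x ≤ N * ‖x‖ ^ (-s) := by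
  have h1s : 0 < s * (1 - s) := mul_pos hs (by linarith)
  obtain ⟨N0, hN0⟩ : ∃ N0, N0 = |C| + |C| / (s * (1 - s)) + 1 := ⟨_, rfl⟩
  have hC := le_abs_self C
  have q0 : 0 ≤ |C| / (s * (1 - s)) := by positivity
  have core : ∀ N y, N0 ≤ N → (∀ z, ‖z‖ = R → w y + (-N) * ‖z‖ ^ (-s) ≤ w z) → ∀ x, R ≤ ‖x‖ → ‖x‖ ≤ ‖y‖ → w y + (-N) * ‖x‖ ^ (-s) ≤ w x := fun N y hN hz x h1 h2 => by
    have hnz : ∀ z : EV n, R ≤ ‖z‖ → z ≠ 0 := fun z hz => norm_pos_iff.1 (by linarith)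
    have := cmpP zero_le_one (ann_c R ‖y‖) (w := w) (ψ := fun z => w y + (-N) * (‖z - 0‖ ^ 2) ^ (-s / 2)) (L := 1)
      (fun z hz => (hw z hz.1).1.continuousAt.continuousWithinAt) (fun z hz => (continuousAt_const.add (continuousAt_const.mul (rbar hs (hnz z hz.1)).1.continuousAt)).continuousWithinAt) (fun z h => by
        have hb := rbar hs (hnz z h.1)
        rcases eq_or_lt_of_le h.1 with h3 | h3
        · left; simpa only [hb.2.1] using hz z h3.symm
        rcases eq_or_lt_of_le h.2 with h4 | h4
        · left; simp only [hb.2.1]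
          have := hS y z (by linarith) h4.symm
          rw [← h4] at this
          have := mul_le_mul_of_nonneg_right (by linarith : C ≤ N) (by positivity : 0 ≤ ‖z‖ ^ (-s))
          linarith
        right
        refine ⟨ann_n h3 h4, (hw z h.1).1, contDiffAt_const.add (contDiffAt_const.mul hb.1), 1, 0, ell_one, ?_⟩
        rw [map_zero, map_zero, hess_cs _ _ hb.1, pr_smul, pr_one]
        have e1 := lapb hn hs hs1 (hnz z h.1)
        have e2 := (abs_le.1 (hw z h.1).2).2
        have p : 0 < ‖z‖ ^ (-s - 2) := Real.rpow_pos_of_pos (by linarith) _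
        have e3 := mul_le_mul_of_nonneg_left e1 (by linarith [abs_nonneg C] : 0 ≤ N)
        have e4 : C < N * (s * (1 - s)) := by
          have : |C| / (s * (1 - s)) < N := by linarith [abs_nonneg C]
          rw [div_lt_iff₀ h1s] at this
          linarith
        have e5 := mul_lt_mul_of_pos_right e4 p
        linarith) x ⟨h1, h2⟩
    simpa only [(rbar hs (hnz x h1)).2.1] using this
  obtain ⟨p, hp⟩ : ∃ p : EV n, ‖p‖ = R := ⟨R • ee ⟨0, by omega⟩, by rw [norm_smul, ee_n]; simp; linarith⟩
  have hRs : 0 < R ^ (-s) := by positivity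
  obtain ⟨θ, hθ⟩ : ∃ θ, θ = (2:ℝ) ^ (-s) := ⟨_, rfl⟩
  have hθ1 : θ < 1 := hθ ▸ Real.rpow_lt_one_of_one_lt_of_neg (by norm_num) (by linarith)
  have hB : ∃ B, ∀ y, 2 * R ≤ ‖y‖ → w y ≤ B := by
    refine ⟨|w p| + N0 * R ^ (-s) + |(w ((2:ℝ) • p) - θ * w p + θ * (C * R ^ (-s))) / (1 - θ)|, fun y hy => ?_⟩
    have a1 := le_abs_self (w p)
    have a2 := le_abs_self ((w ((2:ℝ) • p) - θ * w p + θ * (C * R ^ (-s))) / (1 - θ))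
    have a3 : 0 ≤ N0 * R ^ (-s) := mul_nonneg (by linarith [abs_nonneg C]) hRs.le
    rcases le_total ((w y - w p + C * R ^ (-s)) / R ^ (-s)) N0 with h | h
    · rw [div_le_iff₀ hRs] at h
      have := hS p p (by linarith) rfl
      rw [hp] at this
      linarith [abs_nonneg ((w ((2:ℝ) • p) - θ * w p + θ * (C * R ^ (-s))) / (1 - θ))]
    · have := core _ y h (fun z hz => by
        rw [hz, neg_mul, div_mul_cancel₀ _ hRs.ne']
        have := hS p z (by linarith) (by linarith)
        rw [hp] at this
        linarith) ((2:ℝ) • p) (by rw [norm_smul, hp]; simp; linarith) (by rw [norm_smul, hp]; simpa using hy)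
      rw [norm_smul, hp, Real.norm_eq_abs, abs_two, Real.mul_rpow (by norm_num) (by linarith), ← hθ] at this
      have e : (w y - w p + C * R ^ (-s)) / R ^ (-s) * (θ * R ^ (-s)) = θ * (w y - w p + C * R ^ (-s)) := by field_simp
      rw [neg_mul, e] at this
      have : w y ≤ (w ((2:ℝ) • p) - θ * w p + θ * (C * R ^ (-s))) / (1 - θ) := by rw [le_div_iff₀ (by linarith)]; linarith
      linarith [abs_nonneg (w p)]
  obtain ⟨B, hB⟩ := hB
  refine ⟨max N0 ((B - w p + C * R ^ (-s)) / R ^ (-s)), fun x y h1 h2 => ?_⟩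
  have := core _ y (le_max_left N0 ((B - w p + C * R ^ (-s)) / R ^ (-s))) (fun z hz => by
    have e1 := mul_le_mul_of_nonneg_right (le_max_right N0 ((B - w p + C * R ^ (-s)) / R ^ (-s))) hRs.le
    rw [div_mul_cancel₀ _ hRs.ne'] at e1
    have := hS p z (by linarith) (by linarith)
    rw [hp] at this
    rw [hz]
    linarith [hB y (by linarith)]) x (by linarith) h2
  linarith
theorem liou_s (hn : 3 ≤ n) (hs : 0 < s) (hs1 : s < 1) (hw : ∃ C, ∀ᶠ x in nf n, ContDiffAt ℝ 2 w x ∧ |(hess w x).trace| ≤ C * ‖x‖ ^ (-s - 2)) (hd : Tendsto (fderiv ℝ w) (nf n) (𝓝 0)) :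
    ∃ C R, 1 ≤ R ∧ (∀ x, R ≤ ‖x‖ → ContDiffAt ℝ 2 w x ∧ |(hess w x).trace| ≤ C * ‖x‖ ^ (-s - 2)) ∧ ∀ x y, R ≤ ‖x‖ → ‖x‖ = ‖y‖ → w x - w y ≤ C * ‖x‖ ^ (-s) := by
  obtain ⟨C, hw⟩ := hw
  obtain ⟨R0, hR0⟩ := evi.1 (hw.and (ev_ge 1))
  obtain ⟨R, hR⟩ : ∃ R, R = max R0 1 := ⟨_, rfl⟩
  have hR1 : 1 ≤ R := hR ▸ le_max_right _ _
  have hc : ∀ x, R ≤ ‖x‖ → ContDiffAt ℝ 2 w x ∧ |(hess w x).trace| ≤ C * ‖x‖ ^ (-s - 2) := fun x hx => (hR0 x ((hR ▸ le_max_left _ _ : R0 ≤ R).trans hx)).1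
  have h1s : 0 < s * (1 - s) := mul_pos hs (by linarith)
  have hb : ∀ r, R ≤ r → ∃ M, 0 ≤ M ∧ ∀ x : EV n, ‖x‖ = r → |w x| ≤ M := fun r hr => by
    obtain ⟨M, hM⟩ := (ann_c r r).exists_bound_of_continuousOn (f := w) fun x hx => (hc x (hr.trans hx.1)).1.continuousAt.continuousWithinAt
    exact ⟨|M|, abs_nonneg M, fun x hx => (hM x ⟨hx.ge, hx.le⟩).trans (le_abs_self M)⟩
  have hg : ∀ ε > 0, ∃ r, R ≤ r ∧ ∀ x, r ≤ ‖x‖ → ‖fderiv ℝ w x‖ ≤ ε := fun ε hε => by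
    obtain ⟨r, hr⟩ := evi.1 (hd.norm.eventually_le_const (by simpa using hε))
    exact ⟨max r R, le_max_right _ _, fun x hx => hr x ((le_max_left _ _).trans hx)⟩
  have mv : ∀ {ε r}, R ≤ r → (∀ x, r ≤ ‖x‖ → ‖fderiv ℝ w x‖ ≤ ε) → ∀ {S : Set (EV n)}, Convex ℝ S → (∀ x ∈ S, r ≤ ‖x‖) → ∀ {x y}, x ∈ S → y ∈ S → |w x - w y| ≤ ε * ‖x - y‖ := fun hr h S hS h' x y hx hy =>
    hS.norm_image_sub_le_of_norm_fderiv_le (fun z hz => (hc z (hr.trans (h' z hz))).1.differentiableAt (by simp)) (fun z hz => h z (h' z hz)) hy hx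
  have sub : ∀ ε > 0, ∃ r, R ≤ r ∧ ∀ x, r ≤ ‖x‖ → |w x| ≤ ε * ‖x‖ := fun ε hε => by
    obtain ⟨r, hr, h⟩ := hg (ε / 2) (by positivity)
    obtain ⟨M, hM, hM'⟩ := hb r hr
    refine ⟨max r (2 * M / ε), hr.trans (le_max_left _ _), fun x hx => ?_⟩
    have h1 : r ≤ ‖x‖ := (le_max_left _ _).trans hx
    have h2 : 2 * M ≤ ‖x‖ * ε := by rw [← div_le_iff₀ hε]; exact (le_max_right _ _).trans hx
    have h0 : 0 < ‖x‖ := by linarith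
    have e : ∀ t : ℝ, 0 < t → ‖(t / ‖x‖) • x‖ = t := fun t ht => by rw [norm_smul, Real.norm_eq_abs, abs_of_pos (by positivity)]; field_simp
    have h3 := mv hr h (S := (fun t : ℝ => t • x) '' Set.Icc (r / ‖x‖) 1) ((convex_Icc _ _).linear_image (LinearMap.toSpanSingleton ℝ _ x)) (by
      rintro _ ⟨t, ht, rfl⟩
      have ht0 : 0 < t := lt_of_lt_of_le (div_pos (by linarith) h0) ht.1
      have := (div_le_iff₀ h0).1 ht.1
      simpa [norm_smul, abs_of_pos ht0] using this) (x := x) (y := (r / ‖x‖) • x) ⟨1, ⟨by rw [div_le_one h0]; exact h1, le_rfl⟩, by simp⟩ ⟨_, ⟨le_rfl, by rw [div_le_one h0]; exact h1⟩, rfl⟩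
    have h4 := hM' _ (e r (by linarith))
    have h5 : ‖x - (r / ‖x‖) • x‖ ≤ ‖x‖ := by
      have : x - (r / ‖x‖) • x = (1 - r / ‖x‖) • x := by rw [sub_smul, one_smul]
      rw [this, norm_smul, Real.norm_eq_abs, abs_of_nonneg (by rw [sub_nonneg, div_le_one h0]; exact h1)]
      exact mul_le_of_le_one_left h0.le (by linarith [div_pos (by linarith : 0 < r) h0])
    have h6 := mul_le_mul_of_nonneg_left h5 (by positivity : 0 ≤ ε / 2)
    have h7 := abs_sub_abs_le_abs_sub (w x) (w ((r / ‖x‖) • x))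
    linarith
  obtain ⟨M, hM, hM'⟩ := hb R le_rfl
  have hRs : 0 < R ^ (-s) := by positivity
  obtain ⟨C1, hC1⟩ : ∃ C1, C1 = |C| + 2 * |C| / (s * (1 - s)) + 1 + 2 * M / R ^ (-s) := ⟨_, rfl⟩
  have q0 : 0 ≤ 2 * |C| / (s * (1 - s)) := by positivity
  have q1 : 0 ≤ 2 * M / R ^ (-s) := by positivity
  have q2 := abs_nonneg C
  have hnz : ∀ z : EV n, R ≤ ‖z‖ → z ≠ 0 := fun z hz => norm_pos_iff.1 (by linarith)
  have key : ∀ ν : EV n, ‖ν‖ = 1 → ∀ y, R ≤ ‖y‖ → 0 ≤ ⟪ν, y⟫ → w y - w (y - (2 * ⟪ν, y⟫) • ν) ≤ C1 * ‖y‖ ^ (-s) := fun ν hν y hy h0 => by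
    obtain ⟨T, hT⟩ := refl_mx hν
    rw [← hT.1]
    refine le_of_forall_pos_le_add fun δ hδ => ?_
    obtain ⟨ε, hε, hεδ⟩ : ∃ ε, 0 < ε ∧ ε * ⟪ν, y⟫ ≤ δ := ⟨δ / (⟪ν, y⟫ + 1), by positivity, by rw [div_mul_eq_mul_div, div_le_iff₀ (by positivity)]; linarith⟩
    obtain ⟨r1, hr1, h1⟩ := hg (ε / 2) (by positivity)
    obtain ⟨r2, hr2, h2⟩ := sub (ε / 8) (by positivity)
    obtain ⟨ρ, hρ⟩ : ∃ ρ, ρ = 2 * r1 + r2 + ‖y‖ := ⟨_, rfl⟩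
    have far : ∀ z, ‖z‖ = ρ → 0 ≤ ⟪ν, z⟫ → w z + (-1) * w (mc T z) ≤ ε * ⟪ν, z⟫ := fun z hz ht => by
      rcases le_total (4 * ⟪ν, z⟫) ‖z‖ with h | h
      · have e1 : ‖z - (z - ⟪ν, z⟫ • ν)‖ = ⟪ν, z⟫ := by rw [sub_sub_cancel, norm_smul, hν, mul_one, Real.norm_eq_abs, abs_of_nonneg ht]
        have e2 : ‖mc T z - (z - ⟪ν, z⟫ • ν)‖ = ⟪ν, z⟫ := by
          rw [hT.1, show z - (2 * ⟪ν, z⟫) • ν - (z - ⟪ν, z⟫ • ν) = -(⟪ν, z⟫ • ν) by module, norm_neg, norm_smul, hν, mul_one, Real.norm_eq_abs, abs_of_nonneg ht]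
        have := mv hr1 h1 (convex_closedBall (z - ⟪ν, z⟫ • ν) ⟪ν, z⟫) (fun p hp => by
          rw [mem_closedBall_iff_norm] at hp
          have f1 := norm_sub_norm_le z p
          have f2 := norm_sub_le_norm_sub_add_norm_sub z (z - ⟪ν, z⟫ • ν) p
          rw [norm_sub_rev (z - ⟪ν, z⟫ • ν) p] at f2
          linarith) (mem_closedBall_iff_norm.2 e1.le) (mem_closedBall_iff_norm.2 e2.le)
        have e3 : ‖z - mc T z‖ = 2 * ⟪ν, z⟫ := by rw [hT.1, sub_sub_cancel, norm_smul, hν, mul_one, Real.norm_eq_abs, abs_of_nonneg (by linarith)]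
        rw [e3] at this
        linarith [(abs_le.1 this).2]
      · have f1 := h2 z (by linarith [norm_nonneg y])
        have f2 := h2 (mc T z) (by rw [hT.2.1]; linarith [norm_nonneg y])
        rw [hT.2.1] at f2
        have := mul_le_mul_of_nonneg_left h hε.le
        linarith [(abs_le.1 f1).2, (abs_le.1 f2).1]
    have hin : Continuous fun z : EV n => ⟪ν, z⟫ := by fun_prop
    have cin : ContDiff ℝ 2 fun z : EV n => ε * ⟪ν, z⟫ := contDiff_const.mul (innerSL ℝ ν).contDiff
    have hin0 : ∀ x, hess (fun z : EV n => ε * ⟪ν, z⟫) x = 0 := fun x => by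
      have e : fderiv ℝ (fun z : EV n => ε * ⟪ν, z⟫) = fun _ => ε • innerSL ℝ ν := funext fun z => ((innerSL ℝ ν).hasFDerivAt.const_mul ε).fderiv
      ext i j; rw [hess_apply, e]; simp
    have hcT : ∀ z, R ≤ ‖z‖ → R ≤ ‖mc T z‖ := fun z hz => by rwa [hT.2.1]
    have := cmpP zero_le_one (L := 1) (K := {x : EV n | R ≤ ‖x‖ ∧ ‖x‖ ≤ ρ} ∩ {z | 0 ≤ ⟪ν, z⟫}) ((ann_c R ρ).inter_right (isClosed_le continuous_const hin)) (w := fun z => ε * ⟪ν, z⟫ + C1 * (‖z - 0‖ ^ 2) ^ (-s / 2))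
      (ψ := fun z => w z + (-1) * w (mc T z)) (fun z hz => (cin.contDiffAt.add (contDiffAt_const.mul (rbar hs (hnz z hz.1.1)).1)).continuousAt.continuousWithinAt)
      (fun z hz => (refl_fn hT (hc z hz.1.1).1 (hc _ (hcT z hz.1.1)).1).1.continuousAt.continuousWithinAt) (fun z h => by
        have hb := rbar hs (hnz z h.1.1)
        have p0 : 0 ≤ ‖z‖ ^ (-s) := by positivity
        have p1 := mul_nonneg (by linarith : 0 ≤ C1) p0
        have p2 := mul_nonneg hε.le h.2
        rcases eq_or_lt_of_le h.1.1 with h3 | h3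
        · left; simp only [hb.2.1]
          have f1 := hM' z h3.symm
          have f2 := hM' (mc T z) (by rw [hT.2.1, h3])
          have : 2 * M ≤ C1 * ‖z‖ ^ (-s) := by
            rw [← h3, ← div_le_iff₀ hRs]; linarith
          linarith [(abs_le.1 f1).2, (abs_le.1 f2).1]
        rcases eq_or_lt_of_le h.1.2 with h4 | h4
        · left; simp only [hb.2.1]; linarith [far z h4 h.2]
        rcases eq_or_lt_of_le (show 0 ≤ ⟪ν, z⟫ from h.2) with h5 | h5
        · left; simp only [hb.2.1]; rw [hT.1, ← h5]; simp; linarith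
        right
        have hr := refl_fn hT (hc z h.1.1).1 (hc _ (hcT z h.1.1)).1
        refine ⟨inter_mem (ann_n h3 h4) ((hin.tendsto z).eventually (lt_mem_nhds h5) |>.mono fun _ h => le_of_lt h), cin.contDiffAt.add (contDiffAt_const.mul hb.1), hr.1, 1, 0, ell_one, ?_⟩
        rw [map_zero, map_zero, hess_lin cin.contDiffAt hb.1, hin0, zero_add, pr_smul, hr.2]
        have e1 := lapb hn hs hs1 (hnz z h.1.1)
        have e2 := (hc z h.1.1).2
        have e3 := (hc _ (hcT z h.1.1)).2
        rw [hT.2.1] at e3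
        have p : 0 < ‖z‖ ^ (-s - 2) := Real.rpow_pos_of_pos (by linarith) _
        have e4 := mul_le_mul_of_nonneg_left e1 (by linarith : 0 ≤ C1)
        have e5 : 2 * C < C1 * (s * (1 - s)) := by
          have : 2 * |C| / (s * (1 - s)) < C1 := by linarith
          rw [div_lt_iff₀ h1s] at this
          linarith [le_abs_self C]
        have e6 := mul_lt_mul_of_pos_right e5 p
        linarith [(abs_le.1 e2).1, (abs_le.1 e3).2]) y ⟨⟨hy, by linarith⟩, h0⟩
    simp only [(rbar hs (hnz y hy)).2.1] at this
    linarith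
  refine ⟨C1, R, hR1, fun x hx => ⟨(hc x hx).1, (hc x hx).2.trans (mul_le_mul_of_nonneg_right (by linarith [le_abs_self C]) (by positivity))⟩, fun x y hx hxy => ?_⟩
  rcases eq_or_ne x y with rfl | hne
  · rw [sub_self]; exact mul_nonneg (by linarith) (by positivity)
  have hp : 0 < ‖x - y‖ := norm_pos_iff.2 (sub_ne_zero.2 hne)
  have e1 : 2 * ⟪x - y, x⟫ = ‖x - y‖ ^ 2 := by
    rw [inner_sub_left, real_inner_self_eq_norm_sq, norm_sub_sq_real, hxy, real_inner_comm]; ring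
  have e2 : ⟪‖x - y‖⁻¹ • (x - y), x⟫ = ‖x - y‖ / 2 := by
    rw [inner_smul_left, show ⟪x - y, x⟫ = ‖x - y‖ ^ 2 / 2 by linarith]; simp; field_simp
  have := key (‖x - y‖⁻¹ • (x - y)) (by rw [norm_smul, norm_inv, norm_norm, inv_mul_cancel₀ hp.ne']) x hx (by rw [e2]; positivity)
  rwa [e2, smul_smul, show 2 * (‖x - y‖ / 2) * ‖x - y‖⁻¹ = 1 by field_simp, one_smul, sub_sub_cancel] at this
theorem liou (hn : 3 ≤ n) (hs : 0 < s) (hs1 : s < 1) (hw : ∃ C, ∀ᶠ x in nf n, ContDiffAt ℝ 2 w x ∧ |(hess w x).trace| ≤ C * ‖x‖ ^ (-s - 2)) (hd : Tendsto (fderiv ℝ w) (nf n) (𝓝 0)) :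
    ∃ c C, 0 < C ∧ ∀ᶠ x in nf n, |w x - c| ≤ C * ‖x‖ ^ (-s) := by
  obtain ⟨C, R, hR, hc, hS⟩ := liou_s hn hs hs1 hw hd
  obtain ⟨N, hN⟩ := liou_c hn hs hs1 hR hc hS
  obtain ⟨N', hN'⟩ := liou_c (w := fun x => -1 * w x) hn hs hs1 hR (fun x hx => ⟨contDiffAt_const.mul (hc x hx).1, by rw [hess_cmul (hc x hx).1]; simpa using (hc x hx).2⟩) (fun x y hx hxy => by
    have := hS y x (hxy ▸ hx) hxy.symm
    rw [← hxy] at this; linarith)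
  have hK : ∀ x y, 2 * R ≤ ‖x‖ → ‖x‖ ≤ ‖y‖ → |w y - w x| ≤ (|N| + |N'| + 1) * ‖x‖ ^ (-s) := fun x y h1 h2 => by
    have a1 := hN x y h1 h2
    have a2 := hN' x y h1 h2
    have p : 0 ≤ ‖x‖ ^ (-s) := by positivity
    have b1 := mul_le_mul_of_nonneg_right (by linarith [le_abs_self N, abs_nonneg N'] : N ≤ |N| + |N'| + 1) p
    have b2 := mul_le_mul_of_nonneg_right (by linarith [le_abs_self N', abs_nonneg N] : N' ≤ |N| + |N'| + 1) p
    rw [abs_le]; constructor <;> linarith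
  obtain ⟨e, he⟩ : ∃ e : EV n, ‖e‖ = 1 := ⟨ee ⟨0, by omega⟩, ee_n _⟩
  have hne : ∀ k : ℕ, ‖((k:ℝ) + 2 * R) • e‖ = k + 2 * R := fun k => by rw [norm_smul, he, mul_one, Real.norm_eq_abs, abs_of_nonneg (by positivity)]
  have t0 : Tendsto (fun k : ℕ => (k:ℝ) + 2 * R) atTop atTop := tendsto_atTop_add_const_right _ _ tendsto_natCast_atTop_atTop
  have hcs : CauchySeq fun k : ℕ => w (((k:ℝ) + 2 * R) • e) := by
    refine cauchySeq_of_le_tendsto_0' (fun k : ℕ => (|N| + |N'| + 1) * ((k:ℝ) + 2 * R) ^ (-s)) (fun k l hkl => ?_) ?_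
    · have hkl' : (k:ℝ) ≤ l := by exact_mod_cast hkl
      have := hK (((k:ℝ) + 2 * R) • e) (((l:ℝ) + 2 * R) • e) (by rw [hne]; simp) (by rw [hne, hne]; linarith)
      rw [hne] at this
      rwa [dist_comm, Real.dist_eq]
    · simpa using ((tendsto_rpow_neg_atTop hs).comp t0).const_mul (|N| + |N'| + 1)
  obtain ⟨c, hcl⟩ := cauchySeq_tendsto_of_complete hcs
  refine ⟨c, |N| + |N'| + 1, by positivity, ?_⟩
  filter_upwards [ev_ge (2 * R)] with x hx
  rw [abs_sub_comm]
  refine le_of_tendsto ((hcl.sub_const _).abs) ?_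
  filter_upwards [t0.eventually_ge_atTop ‖x‖] with k hk
  exact hK x _ hx (by rwa [hne])
end
section
variable {n : ℕ} {α c ζ : ℝ} {V W A1 : ℝ → ℝ} {M1 M2 : Mx n} {E g : EV n → ℝ}
theorem pw {s t : ℝ} (h : s ≤ t) : ∀ᶠ r : ℝ in atTop, r ^ s ≤ 1 * r ^ t := by
  filter_upwards [eventually_ge_atTop 1] with r hr
  rw [one_mul]; exact Real.rpow_le_rpow_of_exponent_le hr h
theorem pwm (s t u : ℝ) (h : s + t ≤ u) : ∀ᶠ r : ℝ in atTop, r ^ s * r ^ t ≤ 1 * r ^ u := by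
  filter_upwards [pw h, eventually_gt_atTop 0] with r hr h0
  rwa [← Real.rpow_add h0]
theorem pw0 {s : ℝ} (h : s < 0) : Tendsto (fun r : ℝ => r ^ s) atTop (𝓝 0) := by
  simpa using tendsto_rpow_neg_atTop (neg_pos.2 h)
theorem HF.bd {w : EV n → ℝ} (h : HU α W w) : ∃ C, 0 < C ∧ ∀ᶠ x in nf n, |w x| ≤ C * W ‖x‖ := by
  obtain ⟨C, hC, h⟩ := h
  exact ⟨C, hC, h.mono fun x hx => (hx ()).1⟩
theorem mx_bd {X : EV n → Mx n} (hV : DW V) (h : ∀ i j, HU α V fun x => X x i j) : ∃ C, 0 < C ∧ ∀ᶠ x in nf n, ∀ i j, |X x i j| ≤ C * V ‖x‖ := by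
  choose C hC hb using fun i j => (h i j).bd
  obtain ⟨D, -, hD⟩ := hV.nf n
  refine ⟨∑ i, ∑ j, C i j + 1, add_pos_of_nonneg_of_pos (Finset.sum_nonneg fun i _ => Finset.sum_nonneg fun j _ => (hC i j).le) one_pos, ?_⟩
  filter_upwards [eventually_all.2 fun i => eventually_all.2 (hb i), hD] with x h1 h2 i j
  refine (h1 i j).trans (mul_le_mul_of_nonneg_right ?_ h2.1.le)
  have a1 := Finset.single_le_sum (fun j _ => (hC i j).le) (Finset.mem_univ j)
  have a2 := Finset.single_le_sum (f := fun i => ∑ j, C i j) (fun i _ => Finset.sum_nonneg fun j _ => (hC i j).le) (Finset.mem_univ i)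
  linarith
theorem tr_le {a H : EV n → Mx n} {G : EV n → ℝ} (hA : DW A1) (hV : DW V) (ha : ∀ i j, HU α A1 fun x => a x i j - (1 : Mx n) i j) (hH : ∀ i j, HU α V fun x => H x i j)
    (he : ∀ᶠ x in nf n, pr (a x) (H x) = G x) (hG : ∃ C, ∀ᶠ x in nf n, |G x| ≤ C * W ‖x‖) (hW : ∀ᶠ r in atTop, A1 r * V r ≤ 1 * W r) : ∃ C, ∀ᶠ x in nf n, |(H x).trace| ≤ C * W ‖x‖ := by
  obtain ⟨C1, hC1, h1⟩ := mx_bd (X := fun x => a x - 1) hA ha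
  obtain ⟨C2, hC2, h2⟩ := mx_bd hV hH
  obtain ⟨C, hG⟩ := hG
  refine ⟨C + n ^ 2 * (C1 * C2), ?_⟩
  filter_upwards [h1, h2, he, hG, nf_norm.eventually hW] with x h1 h2 h3 h4 h5
  have e : (H x).trace = G x - pr (a x - 1) (H x) := by rw [pr_subl, h3, pr_one]; ring
  have := pr_ent h1 h2
  rw [e]
  refine (abs_sub _ _).trans ?_
  have h6 := mul_le_mul_of_nonneg_left h5 (by positivity : 0 ≤ n ^ 2 * (C1 * C2))
  rw [one_mul] at h6
  linarith
theorem NE.aff (h : NE M1 M2 c E g) (ℓ : EV n →L[ℝ] ℝ) (d : ℝ) : NE M1 M2 c (fun x => E x + -1 * (ℓ x + d)) g ∧ ∀ᶠ x in nf n, hess E x = hess (fun x => E x + -1 * (ℓ x + d)) x := by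
  obtain ⟨q1, q2⟩ := hess_qf (0 : Mx n) ℓ d
  have e : (fun y : EV n => qf 0 y + ℓ y + d) = fun y => ℓ y + d := by funext y; simp [qf]
  rw [e] at q1 q2
  have hh : ∀ᶠ x in nf n, hess E x = hess (fun x => E x + -1 * (ℓ x + d)) x := by
    filter_upwards [h.cd] with x hx
    rw [hess_lin hx q1.contDiffAt, q2]; simp
  refine ⟨⟨h.nd, h.ci, h.nz, h.cd.mono fun x hx => hx.add (contDiffAt_const.mul q1.contDiffAt), ?_⟩, hh⟩
  filter_upwards [h.eq, hh] with x h1 h2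
  rwa [← h2]
theorem NE.hu (hα : 0 < α) (h : NE M1 M2 c E g) (hA : DW A1) (hA0 : Tendsto A1 atTop (𝓝 0)) (hP : ∀ i j, HU α A1 fun x => hess E x i j) (hg : HU α A1 fun x => g x - c) (i j : Fin n) :
    (HU α A1 fun x => cA M1 M2 (hess E x) 0 (g x) i j - (1 : Mx n) i j) ∧ HU α A1 fun x => cA M1 M2 (hess E x) (hess E x) (g x) i j - (1 : Mx n) i j :=
  ⟨cA_hf hα hA hA0 h (X := fun _ => hess E) (Y := fun _ _ => 0) (q := fun _ => g) hP (fun _ _ => HB.zero hA 0) hg i j, cA_hf hα hA hA0 h (X := fun _ => hess E) (Y := fun _ => hess E) (q := fun _ => g) hP hP hg i j⟩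
theorem tnd {F : Type} [NormedAddCommGroup F] {w : EV n → F} {C s : ℝ} (hs : s < 0) (h : ∀ᶠ x in nf n, ‖w x‖ ≤ C * ‖x‖ ^ s) : Tendsto w (nf n) (𝓝 0) :=
  squeeze_zero_norm' h (by simpa using ((pw0 hs).comp nf_norm).const_mul C)
theorem fl1 (hn : 3 ≤ n) (hα : 0 < α) (hα1 : α < 1) (hζ : 2 < ζ) (h : NE M1 M2 c E g) (hP : ∀ i j, HU α (fun r => r ^ (-(2/3):ℝ)) fun x => hess E x i j) (hg : HU α (fun r => r ^ (-ζ)) fun x => g x - c)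
    (hd : ∀ᶠ x in nf n, DifferentiableAt ℝ g x) (hgl : ∀ l, HU α (fun r => r ^ (-ζ) / r) fun x => fderiv ℝ g x (ee l)) :
    ∃ ℓ : EV n →L[ℝ] ℝ, ∃ C, 0 < C ∧ ∀ᶠ x in nf n, DifferentiableAt ℝ E x ∧ ‖fderiv ℝ E x - ℓ‖ ≤ C * ‖x‖ ^ (-(3/10):ℝ) := by
  have hg' := hg.mono (V := fun r => r ^ (-(2/3):ℝ)) one_pos (pw (by linarith))
  have hlim : Tendsto (fun r : ℝ => r ^ (-(2/3):ℝ)) atTop (𝓝 0) := pw0 (by norm_num)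
  have st : ∀ l, ∃ b C, 0 < C ∧ ∀ᶠ x in nf n, |fderiv ℝ E x (ee l) - b| ≤ C * ‖x‖ ^ (-(3/10):ℝ) := fun l => by
    obtain ⟨d1, d2⟩ := NE.der hα hα1 (DW.pow (-(5/3))) (DW.pow _) hlim h hP (fun i j => (hP i j).mono one_pos (by
      filter_upwards [eventually_gt_atTop 0] with r hr
      rw [← Real.rpow_add_one hr.ne']; norm_num)) hg' hd l ((hgl l).mono one_pos (by
        filter_upwards [pw (by linarith : -ζ - 1 ≤ -(5/3)), eventually_gt_atTop 0] with r h1 hr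
        rwa [Real.rpow_sub_one hr.ne'] at h1))
    refine liou hn (by norm_num) (by norm_num) ?_ ?_
    · have hm := (HF.mul hα (hgl l) ((cA_hb (M1 := M1) (M2 := M2) (k := 0) (X := hess E) hα (fun i j => HF.mono (V := fun _ => 1) (hP i j) one_pos (by simpa using pw (by norm_num : (-(2/3):ℝ) ≤ 0))) ((HF.add (hg.mono (V := fun _ => 1) one_pos (by simpa using pw (by linarith : -ζ ≤ 0))) (HF.const c)).congr (z := fun _ => g) (by simp))).2.hu)).cmul M1.det⁻¹
      obtain ⟨C, -, hC⟩ := (hm.mono (V := fun r => r ^ (-(3/10) - 2 : ℝ)) one_pos (by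
        filter_upwards [pw (by linarith : -ζ - 1 ≤ -(3/10) - 2), eventually_gt_atTop 0] with r h1 hr
        rwa [mul_one, ← Real.rpow_sub_one hr.ne'])).bd
      obtain ⟨C, hC⟩ := tr_le (W := fun r => r ^ (-(3/10) - 2 : ℝ)) (DW.pow _) (DW.pow _) (fun i j => (h.hu hα (DW.pow _) hlim hP hg' i j).2) d2 (d1.mono fun x hx => hx.2) ⟨C, hC⟩ (pwm _ _ _ (by norm_num))
      exact ⟨C, (d1.and hC).mono fun x hx => ⟨hx.1.1, hx.2⟩⟩
    · obtain ⟨C, hC, hb⟩ := osc_d (DW.pow (-(2/3))) (d1.mono fun x hx => hx.1.differentiableAt (by norm_num)) fun i => by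
        obtain ⟨C, hC, hb⟩ := (hP i l).bd
        refine ⟨C, hC, ?_⟩
        filter_upwards [hb, h.cd] with x h1 h2
        rwa [← hess_fd h2]
      exact tnd (by norm_num) (hb.mono fun x hx => hx.2)
  choose b C hC hb using st
  have he : ∀ i, (∑ l, b l • innerSL ℝ (ee l : EV n)) (ee i) = b i := fun i => by
    simp [sum_apply, smul_apply, ee, EuclideanSpace.inner_single_left, Finset.sum_ite_eq]
  refine ⟨∑ l, b l • innerSL ℝ (ee l), n * ∑ l, C l + 1, by have := Finset.sum_nonneg (s := Finset.univ) fun i _ => (hC i).le; positivity, ?_⟩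
  filter_upwards [h.cd, eventually_all.2 hb, ev_ge 1] with x h1 h2 h3
  have p : 0 < ‖x‖ ^ (-(3/10):ℝ) := by positivity
  refine ⟨h1.differentiableAt (by norm_num), (fd_le (t := (∑ l, C l) * ‖x‖ ^ (-(3/10):ℝ)) (mul_nonneg (Finset.sum_nonneg fun i _ => (hC i).le) p.le) fun i => ?_).trans (by linarith)⟩
  rw [sub_apply, he]
  exact (h2 i).trans (mul_le_mul_of_nonneg_right (Finset.single_le_sum (fun i _ => (hC i).le) (Finset.mem_univ i)) p.le)
theorem fl2 (hn : 3 ≤ n) (hα : 0 < α) (hα1 : α < 1) (hζ : 2 < ζ) (h : NE M1 M2 c E g) (hP : ∀ i j, HU α (fun r => r ^ (-(2/3):ℝ)) fun x => hess E x i j) (hg : HU α (fun r => r ^ (-ζ)) fun x => g x - c)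
    (hd : ∀ᶠ x in nf n, DifferentiableAt ℝ g x) (hgl : ∀ l, HU α (fun r => r ^ (-ζ) / r) fun x => fderiv ℝ g x (ee l)) :
    ∃ (ℓ : EV n →L[ℝ] ℝ) (d : ℝ) (w : EV n → ℝ), w = (fun x => E x + -1 * (ℓ x + d)) ∧ NE M1 M2 c w g ∧ (∀ i j, HU α (fun r => r ^ (-(13/10):ℝ)) fun x => hess w x i j) ∧ Tendsto w (nf n) (𝓝 0) := by
  obtain ⟨ℓ, C, hC, hb⟩ := fl1 hn hα hα1 hζ h hP hg hd hgl
  obtain ⟨w, hw⟩ : ∃ w, w = fun x => E x + -1 * (ℓ x + 0) := ⟨_, rfl⟩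
  obtain ⟨a1, a2⟩ := h.aff ℓ 0
  rw [← hw] at a1 a2
  have hP1 : ∀ i j, HU α (fun r => r ^ (-(2/3):ℝ)) fun x => hess w x i j := fun i j => (hP i j).congr (a2.mono fun x hx _ => by rw [hx])
  have hlim : Tendsto (fun r : ℝ => r ^ (-(2/3):ℝ)) atTop (𝓝 0) := pw0 (by norm_num)
  have hdw : ∀ᶠ x in nf n, DifferentiableAt ℝ w x ∧ ‖fderiv ℝ w x‖ ≤ C * ‖x‖ ^ (-(3/10):ℝ) := by
    filter_upwards [hb] with x hx
    have := hx.1.hasFDerivAt.fun_add ((ℓ.hasFDerivAt (x := x)).add_const 0 |>.const_mul (-1))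
    rw [hw]
    refine ⟨this.differentiableAt, ?_⟩
    rw [this.fderiv, neg_one_smul, ← sub_eq_add_neg]; exact hx.2
  have hP2 := T1 (V := fun r => r ^ (-(13/10):ℝ)) hα hα1 (DW.pow _) (DW.pow _) (DW.pow _) hlim (a1.cd.and a1.lin) (fun i j => (a1.hu hα (DW.pow _) hlim hP1 (hg.mono one_pos (pw (by linarith))) i j).1)
    ((hg.mono one_pos (pw (by linarith))).cmul _) (osc_t (DW.pow _) ⟨C, hC, by
      filter_upwards [hdw, ev_ge 1] with x hx h1
      rw [← Real.rpow_add_one (by positivity)]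
      norm_num at hx ⊢; exact hx⟩) hP1
  have hlim' : Tendsto (fun r : ℝ => r ^ (-(13/10):ℝ)) atTop (𝓝 0) := pw0 (by norm_num)
  obtain ⟨s, h0, h1, h2⟩ : ∃ s : ℝ, 0 < s ∧ s ≤ 3 / 10 ∧ s ≤ ζ - 2 := ⟨min (3/10) (ζ - 2), lt_min (by norm_num) (by linarith), min_le_left _ _, min_le_right _ _⟩
  obtain ⟨C2, hC2⟩ := tr_le (W := fun r => r ^ (-s - 2)) (DW.pow _) (DW.pow _) (fun i j => (a1.hu hα (DW.pow _) hlim' hP2 (hg.mono one_pos (pw (by linarith))) i j).1) hP2 a1.lin (by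
    obtain ⟨C, -, hC⟩ := ((hg.mono (V := fun r => r ^ (-s - 2)) one_pos (pw (by linarith))).cmul (M1.det⁻¹ * M2.det)).bd
    exact ⟨C, hC⟩) (pwm _ _ _ (by linarith))
  obtain ⟨d, C3, -, hd⟩ := liou hn h0 (by linarith) ⟨C2, a1.cd.and hC2⟩ (tnd (by norm_num) (hdw.mono fun x hx => hx.2))
  obtain ⟨b1, b2⟩ := h.aff ℓ d
  refine ⟨ℓ, d, _, rfl, b1, fun i j => (hP2 i j).congr (a2.mp (b2.mono fun x hx h' _ => by rw [← hx, ← h'])), tnd (neg_lt_zero.2 h0) (C := C3) (hd.mono fun x hx => ?_)⟩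
  rw [hw] at hx
  rw [Real.norm_eq_abs]
  ring_nf at hx ⊢; exact hx
end
section
variable {n : ℕ}
theorem ell_near {a : Mx n} {ε : ℝ} (h : ∀ i j, |a i j - (1 : Mx n) i j| ≤ ε) (hε : n ^ 2 * ε ≤ 1 / 4) : Ell (1 / 2) 2 a := fun P hP => by
  have h0 : ∀ i j, P i j = P j i := fun i j => congrFun₂ (sym_t hP.1) j i
  have h1 : ∀ i j, |P i j| ≤ 2 * P.trace := qf_entry h0 fun ξ => by
    rw [abs_of_nonneg (qf_psd hP ξ)]; exact quad_le_trace hP ξ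
  have h2 := pr_ent (c := a - 1) h h1
  rw [pr_subl, pr_one] at h2
  have h3 := mul_le_mul_of_nonneg_right hε hP.trace_nonneg
  have h4 := abs_le.1 h2
  constructor <;> linarith
theorem barr (hn : 3 ≤ n) {w Q : EV n → ℝ} {a : EV n → Mx n} {G g1 g2 : ℝ → ℝ} {z κ K : ℝ} (hcd : ∀ᶠ x in nf n, ContDiffAt ℝ 2 w x ∧ pr (a x) (hess w x) = Q x)
    (ha : ∃ C, 0 < C ∧ ∀ᶠ x in nf n, ∀ i j, |a x i j - (1 : Mx n) i j| ≤ C * ‖x‖ ^ (-(13/10):ℝ)) (hQ : ∃ C, 0 < C ∧ ∀ᶠ x in nf n, |Q x| ≤ C * (‖x‖ ^ 2) ^ z) (hw : Tendsto w (nf n) (𝓝 0))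
    (hκ : 0 < κ) (hK : 0 < K) (hG : ∀ t, 1 < t → ContDiffAt ℝ 2 G t ∧ HasDerivAt G (g1 t) t ∧ HasDerivAt g1 (g2 t) t ∧ 2 * n * g1 t + 4 * g2 t * t ≤ -κ * t ^ z)
    (hb : ∀ᶠ t in atTop, 0 < G t ∧ |g1 t| ≤ K * t ^ (z + 3/5) ∧ |g2 t| * t ≤ K * t ^ (z + 3/5)) : ∃ C, 0 < C ∧ ∀ᶠ x in nf n, |w x| ≤ C * G (‖x‖ ^ 2) := by
  obtain ⟨Ca, hCa, ha⟩ := ha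
  obtain ⟨Cq, hCq, hQ⟩ := hQ
  have t2 : Tendsto (fun x : EV n => ‖x‖ ^ 2) (nf n) atTop := (tendsto_pow_atTop two_ne_zero).comp nf_norm
  have k0 : ∀ᶠ x in nf n, n ^ 2 * (Ca * ‖x‖ ^ (-(13/10):ℝ)) ≤ 1 / 4 := by
    have : Tendsto (fun x : EV n => n ^ 2 * (Ca * ‖x‖ ^ (-(13/10):ℝ))) (nf n) (𝓝 (n ^ 2 * (Ca * 0))) := (((pw0 (by norm_num)).comp nf_norm).const_mul Ca).const_mul _
    rw [mul_zero, mul_zero] at this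
    exact this.eventually_le_const (by norm_num)
  have k1 : ∀ᶠ x in nf n, n ^ 2 * (Ca * 6 * K) * ‖x‖ ^ (-(1/10):ℝ) ≤ κ / 2 := by
    have : Tendsto (fun x : EV n => n ^ 2 * (Ca * 6 * K) * ‖x‖ ^ (-(1/10):ℝ)) (nf n) (𝓝 (n ^ 2 * (Ca * 6 * K) * 0)) := ((pw0 (by norm_num)).comp nf_norm).const_mul _
    rw [mul_zero] at this
    exact this.eventually_le_const (by positivity)
  have k2 : ∀ᶠ x in nf n, |w x| ≤ 1 := by
    have := hw.abs; rw [abs_zero] at this; exact this.eventually_le_const one_pos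
  obtain ⟨R, hR⟩ := evi.1 ((((((hcd.and ha).and hQ).and k0).and k1).and k2).and ((t2.eventually hb).and (ev_ge 2)))
  obtain ⟨R1, hR1⟩ : ∃ R1, R1 = max R 2 := ⟨_, rfl⟩
  have hR2 : 2 ≤ R1 := hR1 ▸ le_max_right _ _
  have hR : ∀ x : EV n, R1 ≤ ‖x‖ → _ := fun x hx => hR x ((hR1 ▸ le_max_left R 2).trans hx)
  have h1 : ∀ x : EV n, R1 ≤ ‖x‖ → 1 < ‖x - 0‖ ^ 2 := fun x hx => by
    rw [sub_zero]; exact one_lt_pow₀ (by linarith) two_ne_zero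
  have hψ : ∀ x : EV n, R1 ≤ ‖x‖ → ContDiffAt ℝ 2 (fun y : EV n => G (‖y - 0‖ ^ 2)) x ∧ pr (a x) (hess (fun y : EV n => G (‖y - 0‖ ^ 2)) x) ≤ -(κ / 2) * (‖x‖ ^ 2) ^ z := fun x hx => by
    obtain ⟨⟨⟨⟨⟨⟨-, f1⟩, -⟩, -⟩, f2⟩, -⟩, ⟨-, f3, f4⟩, -⟩ := hR x hx
    have q := hG _ (h1 x hx)
    have d1 : deriv G =ᶠ[𝓝 (‖x - 0‖ ^ 2)] g1 := by
      filter_upwards [lt_mem_nhds (h1 x hx)] with t ht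
      exact (hG t ht).2.1.deriv
    refine ⟨contDiffAt_rad q.1, (rad_pr q.1 f1 q.2.1.deriv (d1.deriv_eq.trans q.2.2.1.deriv)).trans ?_⟩
    have q3 := q.2.2.2
    rw [sub_zero] at q3 ⊢
    have hx0 : 0 < ‖x‖ := by linarith
    have p1 : (‖x‖ ^ 2) ^ (z + 3/5) = ‖x‖ ^ (6/5 : ℝ) * (‖x‖ ^ 2) ^ z := by
      rw [Real.rpow_add (by positivity), mul_comm, ← Real.rpow_natCast ‖x‖ 2, ← Real.rpow_mul hx0.le _ (3/5)]; norm_num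
    have p2 : ‖x‖ ^ (-(13/10):ℝ) * ‖x‖ ^ (6/5 : ℝ) = ‖x‖ ^ (-(1/10):ℝ) := by rw [← Real.rpow_add hx0]; norm_num
    have p3 : n ^ 2 * (Ca * ‖x‖ ^ (-(13/10):ℝ) * (2 * |g1 (‖x‖ ^ 2)| + 4 * |g2 (‖x‖ ^ 2)| * ‖x‖ ^ 2)) ≤ n ^ 2 * (Ca * ‖x‖ ^ (-(13/10):ℝ) * (6 * (K * (‖x‖ ^ 2) ^ (z + 3/5)))) := by
      gcongr; linarith
    have p4 := mul_le_mul_of_nonneg_right f2 (by positivity : 0 ≤ (‖x‖ ^ 2) ^ z)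
    rw [p1] at p3
    have p5 : n ^ 2 * (Ca * ‖x‖ ^ (-(13/10):ℝ) * (6 * (K * (‖x‖ ^ (6/5 : ℝ) * (‖x‖ ^ 2) ^ z)))) = n ^ 2 * (Ca * 6 * K) * ‖x‖ ^ (-(1/10):ℝ) * (‖x‖ ^ 2) ^ z := by rw [← p2]; ring
    linarith
  obtain ⟨x0, hx0⟩ : ∃ x : EV n, ‖x‖ = R1 := ⟨R1 • ee ⟨0, by omega⟩, by rw [norm_smul, ee_n, mul_one, Real.norm_eq_abs, abs_of_nonneg (by linarith)]⟩
  have hG0 : 0 < G (R1 ^ 2) := by rw [← hx0]; exact (hR x0 hx0.ge).2.1.1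
  obtain ⟨N, hN⟩ : ∃ N, N = 1 / G (R1 ^ 2) + (2 * Cq / κ + 1) := ⟨_, rfl⟩
  have v1 : 0 < 1 / G (R1 ^ 2) := by positivity
  have v2 : 0 < 2 * Cq / κ := by positivity
  have hN0 : 0 < N := by linarith
  have hN1 : 1 ≤ N * G (R1 ^ 2) := by rw [← div_le_iff₀ hG0]; linarith
  have hN2 : Cq < N * (κ / 2) := by rw [← div_lt_iff₀ (by positivity), show Cq / (κ / 2) = 2 * Cq / κ by field_simp]; linarith
  have key : ∀ σ : ℝ, |σ| = 1 → ∀ x : EV n, R1 ≤ ‖x‖ → σ * w x ≤ N * G (‖x - 0‖ ^ 2) := fun σ hσ =>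
    ext_cmp (l := 1 / 2) (L := 2) (by norm_num) (fun x hx => ⟨contDiffAt_const.mul (hR x hx).1.1.1.1.1.1.1, contDiffAt_const.mul (hψ x hx).1⟩) (fun x hx => by
      rw [sub_zero, hx]
      refine le_trans ((le_abs_self _).trans ?_) hN1
      rw [abs_mul, hσ, one_mul]; exact (hR x hx.ge).1.2) (fun ε hε => by
        have : Tendsto (fun x => σ * w x) (nf n) (𝓝 (σ * 0)) := hw.const_mul σ
        rw [mul_zero] at this
        filter_upwards [this.eventually_le_const hε, ev_ge R1] with x f1 f2
        have := mul_pos hN0 (hR x f2).2.1.1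
        rw [sub_zero]; linarith) fun x hx => by
      obtain ⟨⟨⟨⟨⟨⟨f0, f1⟩, f5⟩, f2⟩, -⟩, -⟩, -⟩ := hR x hx.le
      refine ⟨a x, 0, ell_near f1 f2, ?_⟩
      rw [map_zero, map_zero, hess_cmul (hψ x hx.le).1, hess_cmul f0.1, pr_smul, pr_smul, f0.2, add_zero, add_zero]
      have p : 0 < (‖x‖ ^ 2) ^ z := by have : 0 < ‖x‖ := by linarith
                                       positivity
      have w1 := mul_le_mul_of_nonneg_left (hψ x hx.le).2 hN0.le
      have w2 := mul_lt_mul_of_pos_right hN2 p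
      have w3 : |σ * Q x| ≤ Cq * (‖x‖ ^ 2) ^ z := by rwa [abs_mul, hσ, one_mul]
      have := (abs_le.1 w3).1
      linarith
  refine ⟨N, hN0, ?_⟩
  filter_upwards [ev_ge R1] with x hx
  have := key 1 (by simp) x hx
  have := key (-1) (by simp) x hx
  rw [sub_zero] at *
  rw [abs_le]; constructor <;> linarith
theorem pw_d (s t : ℝ) (ht : 0 < t) : HasDerivAt (fun t : ℝ => t ^ s) (s * t ^ (s - 1)) t := Real.hasDerivAt_rpow_const (Or.inl ht.ne')
theorem bar1 {ζ : ℝ} (hζ : 2 < ζ) (hn : ζ < n) : ∃ κ K : ℝ, 0 < κ ∧ 0 < K ∧ ∃ g1 g2 : ℝ → ℝ, (∀ t : ℝ, 1 < t → ContDiffAt ℝ 2 (fun t : ℝ => t ^ (1 - ζ / 2)) t ∧ HasDerivAt (fun t : ℝ => t ^ (1 - ζ / 2)) (g1 t) t ∧ HasDerivAt g1 (g2 t) t ∧ 2 * n * g1 t + 4 * g2 t * t ≤ -κ * t ^ (-ζ / 2)) ∧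
    ∀ᶠ t : ℝ in atTop, 0 < t ^ (1 - ζ / 2) ∧ |g1 t| ≤ K * t ^ (-ζ / 2 + 3/5) ∧ |g2 t| * t ≤ K * t ^ (-ζ / 2 + 3/5) := by
  have m0 : 0 < (ζ - 2) * (n - ζ) := mul_pos (by linarith) (by linarith)
  refine ⟨(ζ - 2) * (n - ζ), ζ ^ 2, m0, by positivity, fun t => (1 - ζ / 2) * t ^ (1 - ζ / 2 - 1), fun t => (1 - ζ / 2) * ((1 - ζ / 2 - 1) * t ^ (1 - ζ / 2 - 1 - 1)), fun t ht => ⟨(deriv_rpow2 _ (by linarith)).1, pw_d _ t (by linarith), (pw_d _ t (by linarith)).const_mul _, ?_⟩, ?_⟩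
  · have e := Real.rpow_sub_one (by linarith : t ≠ 0) (1 - ζ / 2 - 1)
    have e2 : t ^ (1 - ζ / 2 - 1 - 1) * t = t ^ (1 - ζ / 2 - 1) := by rw [e]; field_simp
    rw [show -ζ / 2 = 1 - ζ / 2 - 1 by ring]
    refine le_of_eq ?_
    linear_combination 4 * (1 - ζ / 2) * (1 - ζ / 2 - 1) * e2
  · filter_upwards [eventually_ge_atTop 1] with t ht
    have e := Real.rpow_sub_one (by linarith : t ≠ 0) (1 - ζ / 2 - 1)
    have e2 : t ^ (1 - ζ / 2 - 1 - 1) * t = t ^ (1 - ζ / 2 - 1) := by rw [e]; field_simp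
    have e3 : t ^ (1 - ζ / 2 - 1) ≤ t ^ (-ζ / 2 + 3/5) := Real.rpow_le_rpow_of_exponent_le ht (by linarith)
    have p : 0 < t ^ (1 - ζ / 2 - 1) := by positivity
    refine ⟨by positivity, ?_, ?_⟩
    · rw [abs_mul, abs_of_pos p, abs_of_neg (by linarith)]
      exact mul_le_mul (by nlinarith) e3 p.le (by positivity)
    · rw [show 1 - ζ / 2 - 1 = -(ζ/2) by ring] at *
      rw [abs_of_pos (mul_pos_of_neg_of_neg (by linarith) (mul_neg_of_neg_of_pos (by linarith) (by positivity))), ← mul_assoc, mul_assoc, e2]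
      exact mul_le_mul (by nlinarith) e3 p.le (by positivity)
theorem bar2 (hn : 3 ≤ n) {e : ℝ} (he : 0 < e) (he1 : e ≤ 1) : ∃ κ K : ℝ, 0 < κ ∧ 0 < K ∧ ∃ g1 g2 : ℝ → ℝ, (∀ t : ℝ, 1 < t → ContDiffAt ℝ 2 (fun t : ℝ => t ^ (1 - (n:ℝ) / 2) - t ^ (1 - n / 2 - e / 2)) t ∧
    HasDerivAt (fun t : ℝ => t ^ (1 - (n:ℝ) / 2) - t ^ (1 - n / 2 - e / 2)) (g1 t) t ∧ HasDerivAt g1 (g2 t) t ∧ 2 * n * g1 t + 4 * g2 t * t ≤ -κ * t ^ (-(n + e) / 2)) ∧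
    ∀ᶠ t : ℝ in atTop, 0 < t ^ (1 - (n:ℝ) / 2) - t ^ (1 - n / 2 - e / 2) ∧ |g1 t| ≤ K * t ^ (-(n + e) / 2 + 3/5) ∧ |g2 t| * t ≤ K * t ^ (-(n + e) / 2 + 3/5) := by
  have hn' : (3:ℝ) ≤ n := by exact_mod_cast hn
  obtain ⟨s, hs⟩ : ∃ s, s = 1 - (n:ℝ) / 2 := ⟨_, rfl⟩
  obtain ⟨q, hq⟩ : ∃ q, q = s - e / 2 := ⟨_, rfl⟩
  rw [← hs, ← hq, show -(n + e) / 2 = q - 1 by rw [hq, hs]; ring]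
  have em : ∀ t : ℝ, 1 < t → ∀ s : ℝ, t ^ (s - 1 - 1) * t = t ^ (s - 1) := fun t ht s => by
    have : t ≠ 0 := by linarith
    rw [Real.rpow_sub_one this]; field_simp
  refine ⟨-2 * q * e, |s| + |q| + |s * (s - 1)| + |q * (q - 1)| + 1, by have := mul_pos (neg_pos.2 (by linarith : q < 0)) he; linarith, by positivity, fun t => s * t ^ (s - 1) - q * t ^ (q - 1),
    fun t => s * ((s - 1) * t ^ (s - 1 - 1)) - q * ((q - 1) * t ^ (q - 1 - 1)), fun t ht => ⟨(deriv_rpow2 _ (by linarith)).1.sub (deriv_rpow2 _ (by linarith)).1, (pw_d _ t (by linarith)).sub (pw_d _ t (by linarith)),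
      ((pw_d _ t (by linarith)).const_mul _).sub ((pw_d _ t (by linarith)).const_mul _), ?_⟩, ?_⟩
  · refine le_of_eq ?_
    beta_reduce
    have e1 := em t ht s
    have e2 := em t ht q
    generalize t ^ (s - 1 - 1) = A at *
    generalize t ^ (q - 1 - 1) = B at *
    have h1 : (n:ℝ) = 2 - 2 * s := by linarith
    have h2 : e = 2 * (s - q) := by linarith
    rw [h1, h2, ← e1, ← e2]; ring
  · filter_upwards [eventually_gt_atTop 1] with t ht
    have a1 : t ^ (s - 1) ≤ t ^ (q - 1 + 3/5) := Real.rpow_le_rpow_of_exponent_le ht.le (by linarith)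
    have a2 : t ^ (q - 1) ≤ t ^ (q - 1 + 3/5) := Real.rpow_le_rpow_of_exponent_le ht.le (by linarith)
    have p1 : 0 < t ^ (s - 1) := by positivity
    have p2 : 0 < t ^ (q - 1) := by positivity
    have fin : ∀ A B : ℝ, |A| + |B| ≤ |s| + |q| + |s * (s - 1)| + |q * (q - 1)| + 1 → |A * t ^ (s - 1) - B * t ^ (q - 1)| ≤ (|s| + |q| + |s * (s - 1)| + |q * (q - 1)| + 1) * t ^ (q - 1 + 3/5) := fun A B hAB => by
      refine (abs_sub _ _).trans ?_
      rw [abs_mul, abs_mul, abs_of_pos p1, abs_of_pos p2]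
      have b1 := mul_le_mul_of_nonneg_left a1 (abs_nonneg A)
      have b2 := mul_le_mul_of_nonneg_left a2 (abs_nonneg B)
      have b3 := mul_le_mul_of_nonneg_right hAB (p2.le.trans a2)
      linarith
    refine ⟨sub_pos.2 (Real.rpow_lt_rpow_of_exponent_lt ht (by linarith)), fin s q (by linarith [abs_nonneg (s * (s - 1)), abs_nonneg (q * (q - 1))]), ?_⟩
    have := fin (s * (s - 1)) (q * (q - 1)) (by linarith [abs_nonneg s, abs_nonneg q])
    rw [← em t ht s, ← em t ht q] at this
    refine le_trans (le_of_eq ?_) this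
    conv_lhs => rw [← abs_of_pos (by linarith : 0 < t), ← abs_mul, abs_of_pos (by linarith : 0 < t)]
    congr 1; ring
theorem bar3 (hn : 3 ≤ n) : ∃ κ K : ℝ, 0 < κ ∧ 0 < K ∧ ∃ g1 g2 : ℝ → ℝ, (∀ t : ℝ, 1 < t → ContDiffAt ℝ 2 (fun t : ℝ => t ^ (1 - (n:ℝ) / 2) * Real.log t) t ∧
    HasDerivAt (fun t : ℝ => t ^ (1 - (n:ℝ) / 2) * Real.log t) (g1 t) t ∧ HasDerivAt g1 (g2 t) t ∧ 2 * n * g1 t + 4 * g2 t * t ≤ -κ * t ^ (-(n:ℝ) / 2)) ∧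
    ∀ᶠ t : ℝ in atTop, 0 < t ^ (1 - (n:ℝ) / 2) * Real.log t ∧ |g1 t| ≤ K * t ^ (-(n:ℝ) / 2 + 3/5) ∧ |g2 t| * t ≤ K * t ^ (-(n:ℝ) / 2 + 3/5) := by
  have hn' : (3:ℝ) ≤ n := by exact_mod_cast hn
  obtain ⟨s, hs⟩ : ∃ s, s = 1 - (n:ℝ) / 2 := ⟨_, rfl⟩
  rw [← hs, show -(n:ℝ) / 2 = s - 1 by rw [hs]; ring]
  have em : ∀ t : ℝ, 1 < t → ∀ s : ℝ, t ^ (s - 1) * t = t ^ s := fun t ht s => by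
    have : t ≠ 0 := by linarith
    rw [Real.rpow_sub_one this]; field_simp
  have dl : ∀ t : ℝ, 1 < t → HasDerivAt (fun t => s * Real.log t + 1) (s * t⁻¹) t := fun t ht => ((Real.hasDerivAt_log (by linarith)).const_mul s).add_const 1
  refine ⟨2 * n - 4, |s| * 2 + |s * (s - 1)| * 2 + |2 * s - 1| + 1, by linarith, by positivity, fun t => t ^ (s - 1) * (s * Real.log t + 1),
    fun t => (s - 1) * t ^ (s - 1 - 1) * (s * Real.log t + 1) + t ^ (s - 1) * (s * t⁻¹), fun t ht => ⟨(deriv_rpow2 _ (by linarith)).1.mul (Real.contDiffAt_log.2 (by linarith)), ?_, (pw_d _ t (by linarith)).mul (dl t ht), ?_⟩, ?_⟩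
  · refine ((pw_d s t (by linarith)).mul (Real.hasDerivAt_log (by linarith))).congr_deriv ?_
    have : t ≠ 0 := by linarith
    rw [← em t ht s]; field_simp
  · refine le_of_eq ?_
    have e1 := em t ht (s - 1)
    have t1 : t⁻¹ * t = 1 := inv_mul_cancel₀ (by linarith)
    beta_reduce
    generalize t ^ (s - 1 - 1) = A at *
    have h1 : (n:ℝ) = 2 - 2 * s := by linarith
    rw [h1, ← e1]; linear_combination 4 * A * t * s * t1
  · filter_upwards [eventually_gt_atTop 1] with t ht
    have t0 : t ≠ 0 := by linarith
    have p1 : 0 < t ^ (s - 1) := by positivity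
    have hl := Real.log_pos ht
    have l1 : Real.log t ≤ 2 * t ^ (3/5:ℝ) := by
      have := Real.log_le_rpow_div (by linarith : 0 ≤ t) (by norm_num : (0:ℝ) < 3/5)
      have : 0 < t ^ (3/5:ℝ) := by positivity
      linarith
    have l2 : 1 ≤ t ^ (3/5:ℝ) := Real.one_le_rpow ht.le (by norm_num)
    have fin : ∀ A B : ℝ, |A| * 2 + |B| ≤ |s| * 2 + |s * (s - 1)| * 2 + |2 * s - 1| + 1 → |t ^ (s - 1) * (A * Real.log t + B)| ≤ (|s| * 2 + |s * (s - 1)| * 2 + |2 * s - 1| + 1) * t ^ (s - 1 + 3/5) := fun A B hAB => by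
      rw [abs_mul, abs_of_pos p1, Real.rpow_add (by linarith), mul_left_comm]
      refine mul_le_mul_of_nonneg_left ((abs_add_le _ _).trans ?_) p1.le
      rw [abs_mul, abs_of_pos hl]
      have b1 := mul_le_mul_of_nonneg_left l1 (abs_nonneg A)
      have b2 := mul_le_mul_of_nonneg_left l2 (abs_nonneg B)
      have b3 := mul_le_mul_of_nonneg_right hAB (by linarith : 0 ≤ t ^ (3/5:ℝ))
      linarith
    refine ⟨by positivity, fin s 1 (by rw [abs_one]; linarith [abs_nonneg (s * (s - 1)), abs_nonneg (2 * s - 1)]), ?_⟩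
    refine le_trans (le_of_eq ?_) (fin (s * (s - 1)) (2 * s - 1) (by linarith [abs_nonneg s]))
    conv_lhs => rw [← abs_of_pos (by linarith : 0 < t), ← abs_mul, abs_of_pos (by linarith : 0 < t)]
    rw [← em t ht (s - 1)]
    congr 1; field_simp; ring
end
section
variable {n : ℕ} {α c ζ : ℝ} {V W A1 : ℝ → ℝ} {M1 M2 : Mx n} {w g : EV n → ℝ}
theorem HB.le' {k m : ℕ} (hk : k ≤ m) (h : HB α m W w) : HB α k W w := by
  induction m, hk using Nat.le_induction with
  | base => exact h
  | succ m _ ih => exact ih h.le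
theorem gr_h (hV : DW V) (hc : ∀ᶠ x in nf n, ContDiffAt ℝ 2 w x) (h : ∀ i j, HU α V fun x => hess w x i j) (l : Fin n) :
    ∃ C, 0 < C ∧ ∀ᶠ x in nf n, DifferentiableAt ℝ (fun x => fderiv ℝ w x (ee l)) x ∧ ‖fderiv ℝ (fun x => fderiv ℝ w x (ee l)) x‖ ≤ C * V ‖x‖ :=
  osc_d hV (hc.mono fun x hx => (fd_i hx _).1) fun i => by
    obtain ⟨C, hC, hb⟩ := (h i l).bd
    refine ⟨C, hC, ?_⟩
    filter_upwards [hb, hc] with x h1 h2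
    rwa [← hess_fd h2]
theorem gr_w (hW : DW W) (hc : ∀ᶠ x in nf n, ContDiffAt ℝ 2 w x) (hb : ∃ C, 0 < C ∧ ∀ᶠ x in nf n, |w x| ≤ C * W ‖x‖) (h : ∀ i j, HU α (fun r => W r / r / r) fun x => hess w x i j) (l : Fin n) :
    ∃ C, 0 < C ∧ ∀ᶠ x in nf n, |fderiv ℝ w x (ee l)| ≤ C * (W ‖x‖ / ‖x‖) := by
  obtain ⟨C, hC, h1⟩ := gr_h hW.div.div hc h l
  obtain ⟨C, hC, h1⟩ := oscg hW.div.div (w := fun _ : Unit => fun x => fderiv ℝ w x (ee l)) ⟨C, hC, h1.mono fun x hx _ => hx⟩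
  obtain ⟨C0, hC0, hb⟩ := hb
  obtain ⟨D, hD, hD'⟩ := hW.nf n
  refine ⟨C + 4 * (C0 * D + C0), by positivity, ?_⟩
  filter_upwards [h1, ev_near (hc.and hb), hD', ev_ge 1] with x h1 h2 h3 h4
  have q : ∀ t : ℝ, |t| ≤ 1 → ‖x + t • ((‖x‖ / 4) • ee l) - x‖ ≤ ‖x‖ / 4 := fun t ht => by
    rw [add_sub_cancel_left, norm_smul, norm_smul, ee_n, mul_one, Real.norm_eq_abs, Real.norm_eq_abs, abs_of_nonneg (by positivity : 0 ≤ ‖x‖ / 4)]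
    exact mul_le_of_le_one_left (by positivity) ht
  obtain ⟨A, hA⟩ : ∃ A, A = fderiv ℝ w x (ee l) := ⟨_, rfl⟩
  have k1 := mv1 (φ := fun t => w (x + t • ((‖x‖ / 4) • ee l)) - t * (‖x‖ / 4 * A)) (φ' := fun t => fderiv ℝ w (x + t • ((‖x‖ / 4) • ee l)) ((‖x‖ / 4) • ee l) - 1 * (‖x‖ / 4 * A)) (C := ‖x‖ / 4 * (C * (W ‖x‖ / ‖x‖))) (fun t ht => by
    have q := q t ht
    refine ⟨(lin_d ((h2 _ (q.trans (by linarith))).1.differentiableAt (by norm_num))).sub ((hasDerivAt_id t).mul_const _), ?_⟩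
    have := (h1 () _ (q.trans (by linarith)))
    rw [map_smul, smul_eq_mul, one_mul, ← mul_sub, abs_mul, abs_of_nonneg (by positivity : 0 ≤ ‖x‖ / 4)]
    refine mul_le_mul_of_nonneg_left ?_ (by positivity)
    rw [← hA] at this
    refine this.trans ?_
    rw [mul_assoc]
    refine mul_le_mul_of_nonneg_left ?_ hC.le
    have w0 := h3.1
    refine (mul_le_mul_of_nonneg_left (q.trans (by linarith : ‖x‖ / 4 ≤ ‖x‖)) (by positivity)).trans_eq ?_
    field_simp) (t := 1) (by simp)
  have q1 := q 1 (by simp)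
  have k2 := (h2 _ (q1.trans (by linarith))).2
  have k3 := (h2 x (by simp; positivity)).2
  have k4 := mul_le_mul_of_nonneg_left (h3.2 _ (q1.trans (by linarith))) hC0.le
  simp only [one_smul, zero_smul, add_zero, one_mul, zero_mul, abs_one, mul_one, sub_zero] at k1 k2 k4
  rw [← hA]
  have e : W ‖x‖ = ‖x‖ * (W ‖x‖ / ‖x‖) := by field_simp
  have k5 : |‖x‖ / 4 * A| ≤ ‖x‖ / 4 * ((C + 4 * (C0 * D + C0)) * (W ‖x‖ / ‖x‖)) := by
    rw [e] at k3 k4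
    generalize W ‖x‖ / ‖x‖ = z at *
    generalize w (x + (‖x‖ / 4) • ee l) = u at *
    generalize w x = v at *
    have := abs_le.1 k1; have := abs_le.1 k2; have := abs_le.1 k3
    rw [abs_le]; constructor <;> linarith
  rw [abs_mul, abs_of_nonneg (by positivity : 0 ≤ ‖x‖ / 4)] at k5
  exact le_of_mul_le_mul_left k5 (by positivity)
theorem fl4 (hα : 0 < α) (hα1 : α < 1) (hζ : 2 < ζ) (hW : DW W) (h : NE M1 M2 c w g) (hP : ∀ i j, HU α (fun r => r ^ (-(13/10):ℝ)) fun x => hess w x i j) (hg : HU α (fun r => r ^ (-ζ)) fun x => g x - c)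
    (hd : ∀ᶠ x in nf n, DifferentiableAt ℝ g x) {m : ℕ} (hgm : HB α m (fun _ => 1) g) (hgl : ∀ l, HB α m (fun r => r ^ (-ζ) / r) fun x => fderiv ℝ g x (ee l))
    (hW1 : ∀ᶠ r in atTop, r ^ (-ζ) ≤ 1 * (W r / r / r)) (hW2 : ∀ᶠ r in atTop, W r / r / r ≤ 1 * 1) (hb : ∃ C, 0 < C ∧ ∀ᶠ x in nf n, |w x| ≤ C * W ‖x‖) : HB α (m + 3) W w := by
  have hA0 : Tendsto (fun r : ℝ => r ^ (-(13/10):ℝ)) atTop (𝓝 0) := pw0 (by norm_num)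
  have hA := DW.pow (-(13/10))
  have hV := hW.div.div
  have hg1 := hg.mono (V := fun r => r ^ (-(13/10):ℝ)) one_pos (pw (by linarith))
  have h0 := T1 (V := fun r => W r / r / r) hα hα1 hV hA hA hA0 (h.cd.and h.lin) (fun i j => (h.hu hα hA hA0 hP hg1 i j).1) ((hg.mono one_pos hW1).cmul _) (by
    obtain ⟨C, hC, hb⟩ := hb
    obtain ⟨D, hD, hD'⟩ := hW.nf n
    refine ⟨C * D + C, by positivity, ?_⟩
    filter_upwards [ev_near hb, hD', ev_ge 1] with x h1 h2 h3 _ y hy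
    have := h1 y (by linarith)
    have := h1 x (by simp; positivity)
    have := mul_le_mul_of_nonneg_left (h2.2 y (by linarith)) hC.le
    rw [show W ‖x‖ / ‖x‖ / ‖x‖ * ‖x‖ ^ 2 = W ‖x‖ by field_simp]
    refine (abs_sub _ _).trans ?_
    linarith) hP
  have hr : ∀ᶠ r : ℝ in atTop, W r / r / r ≤ 1 * (W r / r / r / r * r) := by
    filter_upwards [eventually_gt_atTop 0] with r hr
    rw [div_mul_cancel₀ _ hr.ne', one_mul]
  have key : ∀ k ≤ m + 1, ∀ i j, HB α k (fun r => W r / r / r) fun x => hess w x i j := fun k => by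
    induction k with
    | zero => exact fun _ => h0
    | succ k ih =>
      intro hk
      have ih := ih (by omega)
      have hkm : k ≤ m := by omega
      have st : ∀ l, (∀ᶠ x in nf n, ContDiffAt ℝ 2 (fun x => fderiv ℝ w x (ee l)) x) ∧ ∀ i j, HB α k (fun r => W r / r / r / r) fun x => hess (fun x => fderiv ℝ w x (ee l)) x i j := fun l => by
        have hg3 := ((hgl l).le' hkm).mono (V := fun r => W r / r / r / r) one_pos (by
          filter_upwards [hW1, eventually_gt_atTop 0] with r h1 h2
          rw [one_mul] at h1 ⊢; gcongr)
        obtain ⟨d1, d2⟩ := NE.der hα hα1 hV.div hA hA0 h hP (fun i j => (h0 i j).mono one_pos hr) hg1 hd l hg3.hu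
        obtain ⟨c1, c2⟩ := cA_hb (M1 := M1) (M2 := M2) hα (fun i j => (ih i j).mono one_pos hW2) (hgm.le' hkm)
        refine ⟨d1.mono fun x hx => hx.1, TL hα hα1 k hV.div hV.div hA hA0 d1 (fun i j => (h.hu hα hA hA0 hP hg1 i j).2) c1 ?_ (osc_t hV.div ?_) d2⟩
        · simpa using (hg3.mul hα c2).cmul hα M1.det⁻¹
        · obtain ⟨C, hC, hb⟩ := gr_h hV h.cd h0 l
          refine ⟨C, hC, ?_⟩
          filter_upwards [hb, ev_ge 1] with x h1 h2
          rwa [div_mul_cancel₀ _ (by positivity)]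
      intro i j
      have e : ∀ᶠ x in nf n, fderiv ℝ (fun x => fderiv ℝ w x (ee j)) x (ee i) = hess w x i j := h.cd.mono fun x hx => (hess_fd hx i j).symm
      refine ⟨h0 i j, ?_, fun l => ?_⟩
      · filter_upwards [(st j).1, fd_congr e] with x h1 h2
        exact h2.1 (fd_i h1 _).1
      · refine ((st j).2 l i).congr ?_
        filter_upwards [(st j).1, fd_congr e] with x h1 h2
        rw [hess_fd h1, h2.2]
  have gb := gr_w hW h.cd hb h0
  refine ⟨hu_g hα hα1 hW (by obtain ⟨C, -, hb⟩ := hb; exact ⟨C, hb⟩) (osc_d hW.div (h.cd.mono fun x hx => hx.differentiableAt (by norm_num)) gb), h.cd.mono fun x hx => hx.differentiableAt (by norm_num), fun i => ⟨?_, h.cd.mono fun x hx => (fd_i hx _).1, fun j => ?_⟩⟩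
  · refine hu_g hα hα1 hW.div (by obtain ⟨C, -, hb⟩ := gb i; exact ⟨C, hb⟩) (gr_h hV h.cd h0 i)
  · exact (key (m + 1) le_rfl j i).congr (h.cd.mono fun x hx => hess_fd hx j i)
theorem fl3 (hn : 3 ≤ n) (hα : 0 < α) (hζ : 2 < ζ) (h : NE M1 M2 c w g) (hP : ∀ i j, HU α (fun r => r ^ (-(13/10):ℝ)) fun x => hess w x i j) (hg : HU α (fun r => r ^ (-ζ)) fun x => g x - c) (hw : Tendsto w (nf n) (𝓝 0)) :
    (ζ ≠ n → ∃ C, 0 < C ∧ ∀ᶠ x in nf n, |w x| ≤ C * ‖x‖ ^ ((2:ℝ) - min (n:ℝ) ζ)) ∧ (ζ = n → ∃ C, 0 < C ∧ ∀ᶠ x in nf n, |w x| ≤ C * (‖x‖ ^ (2 - (n:ℝ)) * Real.log ‖x‖)) := by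
  have hA0 : Tendsto (fun r : ℝ => r ^ (-(13/10):ℝ)) atTop (𝓝 0) := pw0 (by norm_num)
  have hA := DW.pow (-(13/10))
  have ha := mx_bd (X := fun x => cA M1 M2 (hess w x) 0 (g x) - 1) hA fun i j => (h.hu hα hA hA0 hP (hg.mono one_pos (pw (by linarith))) i j).1
  have e : ∀ s x : ℝ, 0 ≤ x → (x ^ 2) ^ s = x ^ (2 * s) := fun s x hx => by
    rw [← Real.rpow_natCast, ← Real.rpow_mul hx]; norm_num
  have hQ : ∀ z : ℝ, -ζ ≤ 2 * z → ∃ C, 0 < C ∧ ∀ᶠ x in nf n, |M1.det⁻¹ * M2.det * (g x - c)| ≤ C * (‖x‖ ^ 2) ^ z := fun z hz => by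
    obtain ⟨C, hC, hb⟩ := ((hg.mono (V := fun r => r ^ (2 * z)) one_pos (pw hz)).cmul (M1.det⁻¹ * M2.det)).bd
    exact ⟨C, hC, hb.mono fun x hx => by rwa [e _ _ (norm_nonneg x)]⟩
  have hE := h.cd.and h.lin
  refine ⟨fun hne => ?_, fun heq => ?_⟩
  · rcases lt_or_gt_of_ne hne with hl | hl
    · obtain ⟨κ, K, hκ, hK, g1, g2, hG, hb⟩ := bar1 hζ hl
      obtain ⟨C, hC, hb⟩ := barr hn hE ha (hQ _ (by linarith)) hw hκ hK hG hb
      rw [min_eq_right hl.le]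
      refine ⟨C, hC, hb.mono fun x hx => ?_⟩
      rwa [e _ _ (norm_nonneg x), show 2 * (1 - ζ / 2) = 2 - ζ by ring] at hx
    · obtain ⟨d, d0, d1, d2⟩ : ∃ d : ℝ, 0 < d ∧ d ≤ 1 ∧ d ≤ ζ - n := ⟨min 1 (ζ - n), lt_min one_pos (sub_pos.2 hl), min_le_left _ _, min_le_right _ _⟩
      obtain ⟨κ, K, hκ, hK, g1, g2, hG, hb⟩ := bar2 hn d0 d1
      obtain ⟨C, hC, hb⟩ := barr hn hE ha (hQ _ (by linarith)) hw hκ hK hG hb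
      rw [min_eq_left hl.le]
      refine ⟨C, hC, hb.mono fun x hx => hx.trans (mul_le_mul_of_nonneg_left ?_ hC.le)⟩
      rw [e _ _ (norm_nonneg x), show 2 * (1 - (n:ℝ) / 2) = 2 - n by ring]
      exact sub_le_self _ (by positivity)
  · obtain ⟨κ, K, hκ, hK, g1, g2, hG, hb⟩ := bar3 hn
    obtain ⟨C, hC, hb⟩ := barr hn hE ha (hQ _ (by linarith)) hw hκ hK hG hb
    refine ⟨C * 2, by positivity, hb.mono fun x hx => ?_⟩
    rw [e _ _ (norm_nonneg x), show 2 * (1 - (n:ℝ) / 2) = 2 - n by ring, Real.log_pow] at hx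
    push_cast at hx
    linarith
end
section
variable {n : ℕ} {α : ℝ} {W : ℝ → ℝ}
theorem HF.lc {w : EV n → ℝ} (hα : 0 < α) (hW : DW W) (h : HU α W w) (L : EV n ≃L[ℝ] EV n) : HU α W fun x => w (L x) := by
  obtain ⟨C, hC, h⟩ := h
  obtain ⟨j, hj⟩ := pow_unbounded_of_one_lt (‖(L : EV n →L[ℝ] EV n)‖ + ‖(L.symm : EV n →L[ℝ] EV n)‖) (one_lt_two)
  have n1 := norm_nonneg (L : EV n →L[ℝ] EV n)
  have n2 := norm_nonneg (L.symm : EV n →L[ℝ] EV n)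
  obtain ⟨D, hD, hD'⟩ := hW.far j
  have a1 : ∀ x, ‖L x‖ ≤ 2 ^ j * ‖x‖ := fun x => ((L : EV n →L[ℝ] EV n).le_opNorm x).trans (mul_le_mul_of_nonneg_right (by linarith) (norm_nonneg x))
  have a2 : ∀ x, ‖x‖ ≤ 2 ^ j * ‖L x‖ := fun x => by
    have := (L.symm : EV n →L[ℝ] EV n).le_opNorm (L x)
    simp only [ContinuousLinearEquiv.coe_coe, L.symm_apply_apply] at this
    exact this.trans (mul_le_mul_of_nonneg_right (by linarith) (norm_nonneg _))
  obtain ⟨T, hT⟩ : ∃ T : ℝ, T = 2 ^ j := ⟨_, rfl⟩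
  have hT1 : 1 ≤ T := hT ▸ one_le_pow₀ one_le_two
  rw [← hT] at a1 a2 hD'
  obtain ⟨R, hR⟩ := evi.1 h
  refine hf_of (c := 4 * T ^ 2) (by nlinarith) hα hW ⟨C * D * ((T ^ 2) ^ α + 1), by positivity, ?_⟩
  obtain ⟨D2, -, hD2⟩ := hW.nf n
  filter_upwards [nf_norm.eventually hD', ev_ge (T * R), ev_ge 1, hD2] with x h1 h2 h3 h7 _
  have hW0 := h7.1
  obtain ⟨h4, h5⟩ := hR (L x) (le_of_mul_le_mul_left (h2.trans (a2 x)) (by linarith)) ()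
  have h6 := mul_le_mul_of_nonneg_left (h1 ‖L x‖ (by rw [div_le_iff₀ (by linarith)]; linarith [a2 x]) (a1 x)) hC.le
  have pT : 0 ≤ (T ^ 2) ^ α := by positivity
  have p0 : 0 ≤ C * (D * W ‖x‖) := by positivity
  refine ⟨(h4.trans h6).trans ?_, fun y hy => ?_⟩
  · have := mul_nonneg p0 pT
    linarith
  · have hx0 : 0 < ‖L x‖ := pos_of_mul_pos_right ((by linarith : 0 < ‖x‖).trans_le (a2 x)) (by linarith)
    have e1 : ‖L y - L x‖ ≤ T * ‖y - x‖ := by rw [← map_sub]; exact a1 _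
    rw [le_div_iff₀ (by positivity)] at hy
    refine (h5 (L y) ?_).trans ?_
    · have : T * (4 * ‖L y - L x‖) ≤ T * ‖L x‖ := by
        have := mul_le_mul_of_nonneg_left e1 (by linarith : 0 ≤ 4 * T)
        linarith [a2 x]
      linarith [le_of_mul_le_mul_left this (by linarith)]
    · have e2 : ‖L y - L x‖ / ‖L x‖ ≤ T ^ 2 * (‖y - x‖ / ‖x‖) := by
        rw [div_le_iff₀ hx0, mul_div_assoc', div_mul_eq_mul_div, le_div_iff₀ (by linarith)]
        have := mul_le_mul e1 (a2 x) (by positivity) (by positivity)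
        linarith
      have e3 := Real.rpow_le_rpow (by positivity) e2 hα.le
      rw [Real.mul_rpow (by positivity) (by positivity)] at e3
      have q : 0 ≤ (‖y - x‖ / ‖x‖) ^ α := by positivity
      have e4 := mul_le_mul h6 e3 (by positivity) p0
      have := mul_nonneg p0 q
      linarith
theorem a_pd (hn : 3 ≤ n) {a b K finf : ℝ} (hb : 0 < b) {f u : EV n → ℝ} (hf : Tendsto f (nf n) (𝓝 finf)) (hpd : ∀ x, (hess u x + (a - b) • (1 : Mx n)).PosDef)
    (heq : ∀ x, (hess u x + (a - b) • (1 : Mx n)).det = rexp (K * f x) * (hess u x + (a + b) • (1 : Mx n)).det)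
    {A : Mx n} (hs : ∀ i j, A i j = A j i) (hA : Tendsto (hess u) (nf n) (𝓝 A)) (hd : (A + (a + b) • (1 : Mx n)).det ≠ 0) :
    (A + (a - b) • (1 : Mx n)).PosDef ∧ (A + (a - b) • (1 : Mx n)).det = rexp (K * finf) * (A + (a + b) • (1 : Mx n)).det := by
  have := nf_ne hn
  have ht : ∀ t : ℝ, Tendsto (fun x => (hess u x + t • (1 : Mx n)).det) (nf n) (𝓝 (A + t • (1 : Mx n)).det) := fun t => ((Continuous.matrix_det continuous_id).tendsto _).comp (hA.add_const _)
  have e := tendsto_nhds_unique (ht (a - b)) (by simp only [heq]; exact ((Real.continuous_exp.tendsto _).comp (hf.const_mul K)).mul (ht (a + b)))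
  have hs' : ∀ i j, (A + (a - b) • (1 : Mx n)) i j = (A + (a - b) • (1 : Mx n)) j i := fun i j => by
    simp [hs i j, Matrix.one_apply, eq_comm]
  have p : (A + (a - b) • (1 : Mx n)).PosSemidef := psd_of_quad hs' fun ξ => by
    have : Tendsto (fun x => ∑ i, ∑ j, ξ i * ξ j * (hess u x + (a - b) • (1 : Mx n)) i j) (nf n) (𝓝 (∑ i, ∑ j, ξ i * ξ j * (A + (a - b) • (1 : Mx n)) i j)) :=
      tendsto_finsetSum _ fun i _ => tendsto_finsetSum _ fun j _ => (tendsto_pi_nhds.1 (tendsto_pi_nhds.1 (hA.add_const _) i) j).const_mul _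
    exact ge_of_tendsto' this fun x => qf_psd (hpd x).posSemidef ξ
  refine ⟨p.posDef_iff_isUnit.2 ?_, e⟩
  rw [Matrix.isUnit_iff_isUnit_det, isUnit_iff_ne_zero, e]
  exact mul_ne_zero (Real.exp_ne_zero _) hd
theorem nrmz {P Q : Mx n} {b c : ℝ} (hb : 0 < b) (hP : P.PosDef) (hQ : Q.PosDef) (hPQ : Q = P + b • 1) (hc : P.det = c * Q.det) :
    ∃ S : Mx n, S.transpose = S ∧ IsUnit S.det ∧ (S * P * S).det ≠ 0 ∧ (S * P * S).det = c * (S * Q * S).det ∧ cA (S * P * S) (S * Q * S) 0 0 c = 1 := by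
  have uP := hP.det_pos.ne'.isUnit
  have uQ := hQ.det_pos.ne'.isUnit
  have hB : (b • (Q * P)⁻¹).PosDef := by
    refine (Matrix.PosDef.inv ?_).smul hb
    rw [hPQ, add_mul, smul_mul_assoc, one_mul]
    refine Matrix.PosDef.add ?_ (hP.smul hb)
    have := Matrix.PosDef.conjTranspose_mul_self P (Matrix.mulVec_injective_iff_isUnit.2 ((Matrix.isUnit_iff_isUnit_det _).2 uP))
    rwa [hP.1.eq] at this
  obtain ⟨S, hS, e⟩ := pd_sqrt hB
  have uS := hS.det_pos.ne'.isUnit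
  have e2 : P⁻¹ - Q⁻¹ = S * S := by
    rw [← e, Matrix.mul_inv_rev]
    have : P⁻¹ * (Q - P) * Q⁻¹ = P⁻¹ - Q⁻¹ := by
      rw [mul_sub, sub_mul, Matrix.nonsing_inv_mul _ uP, Matrix.mul_assoc, Matrix.mul_nonsing_inv _ uQ]; simp
    rw [← this, hPQ]; simp
  have d1 : (S * P * S).det = c * (S * Q * S).det := by simp only [Matrix.det_mul, hc]; ring
  have u1 : IsUnit (S * P * S).det := by rw [Matrix.det_mul, Matrix.det_mul]; exact (uS.mul uP).mul uS
  have u2 : IsUnit (S * Q * S).det := by rw [Matrix.det_mul, Matrix.det_mul]; exact (uS.mul uQ).mul uS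
  refine ⟨S, sym_t hS.1, uS, u1.ne_zero, d1, ?_⟩
  have e3 : (S * P * S)⁻¹ - (S * Q * S)⁻¹ = 1 := by
    simp only [Matrix.mul_inv_rev]
    rw [← mul_sub, ← sub_mul, e2, Matrix.mul_assoc S S, Matrix.mul_nonsing_inv _ uS, mul_one, Matrix.nonsing_inv_mul _ uS]
  have e4 : ∀ M : Mx n, IsUnit M.det → M.adjugate = M.det • M⁻¹ := fun M h => by
    rw [Matrix.inv_def, smul_smul, Ring.mul_inverse_cancel _ h, one_smul]
  ext i j
  have e5 := congrFun₂ e3 j i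
  simp only [cA, zero_add, cof_self, e4 _ u1, e4 _ u2, Matrix.smul_apply, smul_eq_mul]
  rw [Matrix.sub_apply] at e5
  have e6 : (1 : Mx n) j i = (1 : Mx n) i j := by simp [Matrix.one_apply, eq_comm]
  rw [← e6, ← e5]
  have h0 := u1.ne_zero
  have e7 : ∀ y, c * ((S * Q * S).det * y) = (S * P * S).det * y := fun y => by rw [← mul_assoc, ← d1]
  generalize (S * P * S)⁻¹ j i = p at *
  generalize (S * Q * S)⁻¹ j i = q at *
  rw [e7]
  generalize (S * P * S).det = d at *
  field_simp; ring
end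
section
variable {n : ℕ}
theorem DW.plog (s : ℝ) : DW fun r => r ^ s * Real.log r := by
  obtain ⟨D, hD, h⟩ := DW.pow s
  refine ⟨D * 2, by positivity, ?_⟩
  filter_upwards [h, eventually_ge_atTop 4] with r ⟨h1, h2⟩ hr
  have hl : 0 < Real.log r := Real.log_pos (by linarith)
  refine ⟨by positivity, fun t h3 h4 => ?_⟩
  have h5 : Real.log t ≤ 2 * Real.log r := by
    have := Real.log_le_log (by linarith) (h4.trans (by nlinarith : 2 * r ≤ r * r))
    rw [Real.log_mul (by linarith) (by linarith)] at this
    linarith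
  have := mul_le_mul (h2 t h3 h4) h5 (Real.log_nonneg (by linarith)) (by positivity)
  linarith
theorem core (hn : 3 ≤ n) {m : ℕ} {a b ζ K finf C R : ℝ} (hb : 0 < b) (hab : 0 < a + b) (hK : 0 < K) (hζ : 2 < ζ) {f u : EV n → ℝ}
    (hf : FP f finf ζ C R (m + 2)) (hfc : Continuous f) (hfl : Tendsto f (nf n) (𝓝 finf)) (hu : ContDiff ℝ 2 u)
    (hpd : ∀ x, (hess u x - (-a + b) • (1 : Mx n)).PosDef)
    (heq : ∀ x, Real.log (hess u x + (a - b) • (1 : Mx n)).det - Real.log (hess u x + (a + b) • (1 : Mx n)).det = K * f x)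
    (hg : ∃ C : ℝ, ∀ x : EV n, u x ≤ C * (1 + ‖x‖ ^ 2)) :
    ∃ (A : Mx n) (ℓ : EV n →L[ℝ] ℝ) (d : ℝ), (∀ i j, A i j = A j i) ∧ (A + (a - b) • (1 : Mx n)).PosDef ∧ (A + (a - b) • (1 : Mx n)).det = rexp (K * finf) * (A + (a + b) • (1 : Mx n)).det ∧
      (ζ ≠ n → ∀ k ≤ m + 3, IT (fun r => r ^ ((2:ℝ) - min (n:ℝ) ζ)) k fun y => u y - (1 / 2 * qf A y + ℓ y + d)) ∧
      (ζ = n → ∀ k ≤ m + 3, IT (fun r => r ^ (2 - (n:ℝ)) * Real.log r) k fun y => u y - (1 / 2 * qf A y + ℓ y + d)) := by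
  obtain ⟨A, hs, hA, hd, α, hα, hα1, hH⟩ := xfer hn hb hab hK hζ hf hfc hu hpd heq hg
  have e0 : ∀ M : Mx n, M - (-a + b) • (1 : Mx n) = M + (a - b) • 1 := fun M => by
    rw [sub_eq_add_neg, ← neg_smul]; congr 2; ring
  have e1 : ∀ M : Mx n, M + (a + b) • (1 : Mx n) = M + (a - b) • 1 + (2 * b) • 1 := fun M => by
    rw [add_assoc, ← add_smul]; congr 2; ring
  have pQ : ∀ M : Mx n, (M + (a - b) • (1 : Mx n)).PosDef → (M + (a + b) • (1 : Mx n)).PosDef := fun M h => by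
    rw [e1]; exact h.add (Matrix.PosDef.one.smul (by positivity))
  simp only [e0] at hpd
  have heq' : ∀ x, (hess u x + (a - b) • (1 : Mx n)).det = rexp (K * f x) * (hess u x + (a + b) • (1 : Mx n)).det := fun x => by
    have h1 := (hpd x).det_pos
    have h2 := (pQ _ (hpd x)).det_pos
    rw [← heq x, Real.exp_sub, Real.exp_log h1, Real.exp_log h2, div_mul_cancel₀ _ h2.ne']
  obtain ⟨hAp, hAd⟩ := a_pd hn hb hfl hpd heq' hs hA hd
  obtain ⟨S, hS, uS, n1, n2, n3⟩ := nrmz (b := 2 * b) (by positivity) hAp (pQ _ hAp) (e1 A) hAd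
  obtain ⟨L, hL⟩ : ∃ L : EV n ≃L[ℝ] EV n, L = ContinuousLinearEquiv.equivOfInverse (mc S) (mc S⁻¹) (fun x => by rw [mc_mul, Matrix.nonsing_inv_mul _ uS, mc_one]) (fun x => by rw [mc_mul, Matrix.mul_nonsing_inv _ uS, mc_one]) := ⟨_, rfl⟩
  have hLx : ∀ x, L x = mc S x := fun x => by rw [hL]; rfl
  obtain ⟨q1, q2⟩ := hess_qf A 0 0
  obtain ⟨v, hv⟩ : ∃ v : EV n → ℝ, v = fun y => u y + (-(1/2)) * (qf A y + (0 : EV n →L[ℝ] ℝ) y + 0) := ⟨_, rfl⟩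
  have cv : ContDiff ℝ 2 v := hv ▸ hu.add (contDiff_const.mul q1)
  have hvh : ∀ x, hess v x = hess u x - A := fun x => by
    have hAt : A.transpose = A := by ext i j; exact hs j i
    rw [hv, hess_lin hu.contDiffAt q1.contDiffAt, q2, hAt]
    ext i j
    simp only [Matrix.add_apply, Matrix.sub_apply, Matrix.smul_apply, smul_eq_mul]; ring
  obtain ⟨E, hE⟩ : ∃ E : EV n → ℝ, E = fun x => v (mc S x) := ⟨_, rfl⟩
  have hEh : ∀ x, hess E x = S * (hess u (mc S x) - A) * S := fun x => by
    rw [hE, hess_comp cv.contDiffAt, hvh, hS]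
  obtain ⟨g, hgd⟩ : ∃ g : EV n → ℝ, g = fun x => rexp (K * f (L x)) := ⟨_, rfl⟩
  have N : NE (S * (A + (a - b) • (1 : Mx n)) * S) (S * (A + (a + b) • (1 : Mx n)) * S) (rexp (K * finf)) E g := by
    refine ⟨n1, n2, n3, Eventually.of_forall fun x => ?_, Eventually.of_forall fun x => ?_⟩
    · rw [hE]; exact (cv.comp (mc S).contDiff).contDiffAt
    · have : ∀ t : ℝ, hess E x + S * (A + t • (1 : Mx n)) * S = S * (hess u (mc S x) + t • (1 : Mx n)) * S := fun t => by
        rw [hEh, ← add_mul, ← mul_add, ← add_assoc, sub_add_cancel]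
      rw [this, this]
      simp only [Matrix.det_mul, heq', hgd, hLx]; ring
  have hP : ∀ i j, HU α (fun r => r ^ (-(2/3):ℝ)) fun x => hess E x i j := fun i j => by
    have : (fun x => hess E x i j) = fun x => ∑ k, S k j * ∑ l, S i l * (hess u (L x) l k - A l k) := by
      funext x
      simp only [hEh, hLx, Matrix.mul_apply, Matrix.sub_apply]
      exact Finset.sum_congr rfl fun k _ => mul_comm _ _
    rw [this]
    exact HF.sum (DW.pow _) fun k _ => (HF.sum (DW.pow _) fun l _ => (HF.lc hα (DW.pow _) ((hH l k).hu (DW.pow _)) L).cmul _).cmul _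
  obtain ⟨g1, g2, g3, g4⟩ := gside hα hα1 hf (by linarith) L K hgd
  obtain ⟨ℓ, d, w, hw, W1, W2, W3⟩ := fl2 hn hα hα1 hζ N hP g2 g3 fun l => HB.le' (Nat.zero_le _) (g4 l)
  obtain ⟨b1, b2⟩ := fl3 hn hα hζ W1 W2 g2 W3
  refine ⟨A, ℓ.comp (L.symm : EV n →L[ℝ] EV n), d, hs, hAp, hAd, ?_⟩
  have fin : ∀ W, DW W → (∀ᶠ r in atTop, r ^ (-ζ) ≤ 1 * (W r / r / r)) → (∀ᶠ r in atTop, W r / r / r ≤ 1 * 1) → (∃ C, 0 < C ∧ ∀ᶠ x in nf n, |w x| ≤ C * W ‖x‖) →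
      ∀ k ≤ m + 3, IT W k fun y => u y - (1 / 2 * qf A y + ℓ.comp (L.symm : EV n →L[ℝ] EV n) y + d) := fun W h1 h2 h3 h4 k hk => by
    have := IT.comp h1 (HB.it hα (HB.le' hk (fl4 hα hα1 hζ h1 W1 W2 g2 g3 g1 g4 h2 h3 h4))) L.symm
    convert this using 2 with y
    simp only [hw, hE, hv, ← hLx, L.apply_symm_apply, ContinuousLinearMap.comp_apply, ContinuousLinearEquiv.coe_coe, zero_apply]
    ring
  have e2 : ∀ s r : ℝ, 0 < r → r ^ (2 - s) / r / r = r ^ (-s) := fun s r hr => by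
    rw [div_div, ← sq, ← Real.rpow_sub_natCast hr.ne']; congr 1; push_cast; ring
  have n3' : (3:ℝ) ≤ n := by exact_mod_cast hn
  refine ⟨fun h => fin _ (DW.pow _) ?_ ?_ (b1 h), fun h => fin _ (DW.plog _) ?_ ?_ (b2 h)⟩
  · filter_upwards [pw (neg_le_neg (min_le_right (n:ℝ) ζ)), eventually_gt_atTop 0] with r hr h0
    rwa [e2 _ _ h0]
  · filter_upwards [pw (neg_nonpos.2 (le_min (by linarith) (by linarith) : 0 ≤ min (n:ℝ) ζ)), eventually_gt_atTop 0] with r hr h0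
    rw [Real.rpow_zero] at hr
    rwa [e2 _ _ h0]
  · filter_upwards [eventually_ge_atTop (rexp 1)] with r hr
    have h0 := (Real.exp_pos 1).trans_le hr
    rw [mul_div_right_comm, mul_div_right_comm, e2 _ _ h0, h, one_mul]
    exact le_mul_of_one_le_right (by positivity) ((Real.le_log_iff_exp_le h0).2 hr)
  · filter_upwards [eventually_ge_atTop 1, pw (by linarith : -(n:ℝ) ≤ -1)] with r hr h1
    have h0 : 0 < r := by linarith
    rw [mul_div_right_comm, mul_div_right_comm, e2 _ _ h0]
    refine (mul_le_mul h1 ((Real.log_le_sub_one_of_pos h0).trans (by linarith : r - 1 ≤ r)) (Real.log_nonneg hr) (by positivity)).trans ?_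
    rw [Real.rpow_neg_one, one_mul, inv_mul_cancel₀ h0.ne']; norm_num
end
end
/-- **Theorem 1.1, case τ ∈ (0, π/4)**: with `a = cot τ`, `b = √(a²-1)`, if `u ∈ C²(ℝⁿ)`
solves `(√(a²+1)/(2b)) Σᵢ ln((λᵢ(D²u)+a-b)/(λᵢ(D²u)+a+b)) = f` with `u ≤ C(1+|x|²)`,
`D²u > (-a+b)I`, `n ≥ 3`, and `f` is `C^m` outside a compact set with
`|x|^{ζ+k}|D^k(f - f(∞))|` bounded at infinity for all `k ≤ m`, `ζ > 2`, `m ≥ 2`, then `u`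
is asymptotic to a quadratic polynomial `½xᵀAx + β·x + c` with `A > (-a+b)I` and
`F_τ(λ(A)) = f(∞)`, with error `O_{m+1}(|x|^{2-min{n,ζ}})` (`O_{m+1}(|x|^{2-n}ln|x|)` if
`ζ = n`). -/
theorem asymptotic_expansion_tau_between_zero_pi_div_four
    (n m : ℕ) (hn : 3 ≤ n) (hm : 2 ≤ m) (ζ : ℝ) (hζ : 2 < ζ)
    (τ : ℝ) (hτ₀ : 0 < τ) (hτ₁ : τ < Real.pi / 4)
    (a b : ℝ) (ha : a = Real.cos τ / Real.sin τ) (hb : b = Real.sqrt (a ^ 2 - 1))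
    (f : EuclideanSpace ℝ (Fin n) → ℝ) (finf : ℝ)
    (hf_cont : Continuous f)
    (hf_Cm : ∃ K : Set (EuclideanSpace ℝ (Fin n)), IsCompact K ∧ ContDiffOn ℝ m f Kᶜ)
    (hf_lim : Tendsto f (cocompact _) (nhds finf))
    (hf_decay : ∀ k : ℕ, k ≤ m → ∃ C R : ℝ, 0 < C ∧ 0 < R ∧
      ∀ x : EuclideanSpace ℝ (Fin n), R ≤ ‖x‖ →
        ‖x‖ ^ (ζ + k) * ‖iteratedFDeriv ℝ k (fun y => f y - finf) x‖ ≤ C)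
    (u : EuclideanSpace ℝ (Fin n) → ℝ) (hu : ContDiff ℝ 2 u)
    (hsym : ∀ x, (hess u x).IsHermitian)
    (heq : ∀ x, (Real.sqrt (a ^ 2 + 1) / (2 * b)) *
      ∑ i, Real.log (((hsym x).eigenvalues i + a - b) / ((hsym x).eigenvalues i + a + b))
        = f x)
    (hgrow : ∃ C : ℝ, ∀ x : EuclideanSpace ℝ (Fin n), u x ≤ C * (1 + ‖x‖ ^ 2))
    (hsemiconv : ∀ x, (hess u x - (-a + b) • (1 : Matrix (Fin n) (Fin n) ℝ)).PosDef) :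
    ∃ (c : ℝ) (β : Fin n → ℝ) (A : Matrix (Fin n) (Fin n) ℝ) (hA : A.IsHermitian),
      (A - (-a + b) • (1 : Matrix (Fin n) (Fin n) ℝ)).PosDef ∧
      ((Real.sqrt (a ^ 2 + 1) / (2 * b)) *
        ∑ i, Real.log ((hA.eigenvalues i + a - b) / (hA.eigenvalues i + a + b)) = finf) ∧
      ((ζ ≠ n → ∀ k : ℕ, k ≤ m + 1 → ∃ C R : ℝ, 0 < C ∧ 1 < R ∧
        ∀ x : EuclideanSpace ℝ (Fin n), R ≤ ‖x‖ →
          ‖iteratedFDeriv ℝ k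
              (fun y => u y - ((1/2) * ∑ i, ∑ j, A i j * y i * y j + ∑ i, β i * y i + c)) x‖
            ≤ C * ‖x‖ ^ ((2 : ℝ) - min (n : ℝ) ζ - k)) ∧
      (ζ = n → ∀ k : ℕ, k ≤ m + 1 → ∃ C R : ℝ, 0 < C ∧ 1 < R ∧
        ∀ x : EuclideanSpace ℝ (Fin n), R ≤ ‖x‖ →
          ‖iteratedFDeriv ℝ k
              (fun y => u y - ((1/2) * ∑ i, ∑ j, A i j * y i * y j + ∑ i, β i * y i + c)) x‖
            ≤ C * ‖x‖ ^ ((2 : ℝ) - n - k) * Real.log ‖x‖)) := by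
  obtain ⟨m, rfl⟩ := Nat.exists_eq_add_of_le' hm
  have ha1 := aux_a_gt_one hτ₀ hτ₁ ha
  have hb0 := aux_b_pos ha1 hb
  obtain ⟨C, R, hF⟩ := fpack hm hζ hf_cont hf_Cm hf_lim hf_decay
  have hq : 0 < Real.sqrt (a ^ 2 + 1) := Real.sqrt_pos.2 (by positivity)
  have hfl : Tendsto f (nf n) (nhds finf) := by
    have : nf n = cocompact _ := by rw [nf, comap_norm_atTop, Metric.cobounded_eq_cocompact]
    rwa [this]
  generalize Real.sqrt (a ^ 2 + 1) = q at *
  obtain ⟨A, ℓ, d, hs, hp, hd, h1, h2⟩ := core (K := 2 * b / q) hn hb0 (by linarith) (by positivity) hζ hF hf_cont hfl hu hsemiconv (fun x => by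
    rw [← aux_logdet (hsym x) hb0 (hsemiconv x), ← heq x]; field_simp) hgrow
  have e0 : A - (-a + b) • (1 : Matrix (Fin n) (Fin n) ℝ) = A + (a - b) • 1 := by
    rw [sub_eq_add_neg, ← neg_smul]; congr 2; ring
  rw [← e0] at hp
  have hA : A.IsHermitian := by ext i j; simpa using hs j i
  refine ⟨d, fun i => ℓ (ee i), A, hA, hp, ?_, ?_⟩
  · have h3 : (A + (a + b) • (1 : Matrix (Fin n) (Fin n) ℝ)).det ≠ 0 := fun h => by
      rw [h, mul_zero, ← e0] at hd; exact hp.det_pos.ne' hd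
    rw [aux_logdet hA hb0 hp, hd, Real.log_mul (Real.exp_ne_zero _) h3, Real.log_exp]
    field_simp; ring
  have e1 : (fun y => u y - ((1/2) * ∑ i, ∑ j, A i j * y i * y j + ∑ i, ℓ (ee i) * y i + d)) = fun y => u y - (1 / 2 * qf A y + ℓ y + d) := by
    funext y
    have h4 : ℓ y = ∑ i, ℓ (ee i) * y i := by
      conv_lhs => rw [sum_ee y, map_sum]
      exact Finset.sum_congr rfl fun i _ => by rw [map_smul, smul_eq_mul, mul_comm]
    have h5 : qf A y = ∑ i, ∑ j, A i j * y i * y j := Finset.sum_congr rfl fun i _ => Finset.sum_congr rfl fun j _ => by ring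
    rw [h4, h5]
  simp only [e1]
  refine ⟨fun h k hk => ?_, fun h k hk => ?_⟩
  · obtain ⟨C, hC, hT⟩ := h1 h k (by omega)
    obtain ⟨R, hR⟩ := evi.1 hT
    refine ⟨C, max R 2, hC, by simp, fun x hx => ?_⟩
    have hx0 : 0 < ‖x‖ := by linarith [le_max_right R 2]
    refine (hR x ((le_max_left _ _).trans hx)).2.trans_eq ?_
    rw [Real.rpow_sub_natCast hx0.ne']
  · obtain ⟨C, hC, hT⟩ := h2 h k (by omega)
    obtain ⟨R, hR⟩ := evi.1 hT
    refine ⟨C, max R 2, hC, by simp, fun x hx => ?_⟩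
    have hx0 : 0 < ‖x‖ := by linarith [le_max_right R 2]
    refine (hR x ((le_max_left _ _).trans hx)).2.trans_eq ?_
    rw [Real.rpow_sub_natCast hx0.ne']; ring
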